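/- Let ω be a nonempty open subset of B_R and set T* = (inf_{x ∈ ω} ‖x‖²)/(2d). Then for every T > T* there exists a constant K > 0 such that every solution y of the Baouendi–Grushin equation on [0,T] satisfies ∫_{B_R × Ω̃} |y(T,·)|² ≤ K² ∫₀^T ∫_{ω × Ω̃} |y(t,x,x̃)|² dx dx̃ dt. -/

import Mathlib

open MeasureTheory Metric Set Filter

/-- The Euclidean Laplacian of `f : ℝ^n → ℝ` at `x`, as the sum of second partial
derivatives in the coordinate directions. -/
noncomputable def lapl {n : ℕ} (f : EuclideanSpace ℝ (Fin n) → ℝ)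
    (x : EuclideanSpace ℝ (Fin n)) : ℝ :=
  ∑ i, fderiv ℝ (fun z => fderiv ℝ f z (EuclideanSpace.single i 1)) x (EuclideanSpace.single i 1)

/-- `y` is a solution of the Baouendi–Grushin equation
`∂ₜ y − Δₓ y − ‖x‖² Δ_{x̃} y = 0` on `(0,T) × B_R × Ω̃`: it is continuous on
`[0,T] × closure (B_R × Ω̃)`, smooth on `(0,T) × B_R × Ω̃`, solves the equation there and
vanishes on `(0,T) × ∂(B_R × Ω̃)`. -/
structure IsGrushinSolution (d dt : ℕ) (R T : ℝ) (Ωt : Set (EuclideanSpace ℝ (Fin dt)))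
    (y : ℝ → EuclideanSpace ℝ (Fin d) → EuclideanSpace ℝ (Fin dt) → ℝ) : Prop where
  continuousOn : ContinuousOn
    (fun p : ℝ × (EuclideanSpace ℝ (Fin d) × EuclideanSpace ℝ (Fin dt)) => y p.1 p.2.1 p.2.2)
    (Icc 0 T ×ˢ closure (ball (0 : EuclideanSpace ℝ (Fin d)) R ×ˢ Ωt))
  smoothOn : ContDiffOn ℝ (⊤ : ℕ∞)
    (fun p : ℝ × (EuclideanSpace ℝ (Fin d) × EuclideanSpace ℝ (Fin dt)) => y p.1 p.2.1 p.2.2)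
    (Ioo 0 T ×ˢ (ball (0 : EuclideanSpace ℝ (Fin d)) R ×ˢ Ωt))
  eqn : ∀ t ∈ Ioo (0:ℝ) T, ∀ x ∈ ball (0 : EuclideanSpace ℝ (Fin d)) R, ∀ z ∈ Ωt,
    deriv (fun s => y s x z) t - lapl (fun x' => y t x' z) x
      - ‖x‖ ^ 2 * lapl (fun z' => y t x z') z = 0
  boundary : ∀ t ∈ Ioo (0:ℝ) T,
    ∀ p ∈ frontier (ball (0 : EuclideanSpace ℝ (Fin d)) R ×ˢ Ωt), y t p.1 p.2 = 0

namespace Grushin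

section L2

open Topology ENNReal

variable {α : Type*} [MeasurableSpace α] {μ : Measure α}
  {V : Type*} [NormedAddCommGroup V] [InnerProductSpace ℝ V]

theorem inner_toLp {f g : α → V} (hf : MemLp f 2 μ) (hg : MemLp g 2 μ) :
    inner ℝ (hf.toLp f) (hg.toLp g) = ∫ x, inner ℝ (f x) (g x) ∂μ := by
  rw [L2.inner_def]
  apply integral_congr_ae
  filter_upwards [hf.coeFn_toLp, hg.coeFn_toLp] with x h1 h2
  rw [h1, h2]

theorem integrable_inner_of_memLp {f g : α → V} (hf : MemLp f 2 μ) (hg : MemLp g 2 μ) :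
    Integrable (fun x => (inner ℝ (f x) (g x) : ℝ)) μ := by
  refine (L2.integrable_inner (𝕜 := ℝ) (hf.toLp f) (hg.toLp g)).congr ?_
  filter_upwards [hf.coeFn_toLp, hg.coeFn_toLp] with x h1 h2
  rw [h1, h2]

theorem integrable_mul_of_memLp {f g : α → ℝ} (hf : MemLp f 2 μ) (hg : MemLp g 2 μ) :
    Integrable (fun x => f x * g x) μ := by
  refine (integrable_inner_of_memLp hg hf).congr ?_
  exact Eventually.of_forall fun x => by simp

theorem tendsto_integral_inner {f g : α → V} {fs gs : ℕ → α → V}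
    (hf : MemLp f 2 μ) (hg : MemLp g 2 μ) (hfs : ∀ k, MemLp (fs k) 2 μ)
    (hgs : ∀ k, MemLp (gs k) 2 μ)
    (h1 : Tendsto (fun k => eLpNorm (fs k - f) 2 μ) atTop (𝓝 0))
    (h2 : Tendsto (fun k => eLpNorm (gs k - g) 2 μ) atTop (𝓝 0)) :
    Tendsto (fun k => ∫ x, (inner ℝ (fs k x) (gs k x) : ℝ) ∂μ) atTop
      (𝓝 (∫ x, (inner ℝ (f x) (g x) : ℝ) ∂μ)) := by
  have e1 := (Lp.tendsto_Lp_iff_tendsto_eLpNorm'' fs hfs f hf).2 h1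
  have e2 := (Lp.tendsto_Lp_iff_tendsto_eLpNorm'' gs hgs g hg).2 h2
  have := e1.inner (𝕜 := ℝ) e2
  simpa only [inner_toLp] using this

theorem tendsto_integral_mul {f g : α → ℝ} {fs gs : ℕ → α → ℝ}
    (hf : MemLp f 2 μ) (hg : MemLp g 2 μ) (hfs : ∀ k, MemLp (fs k) 2 μ)
    (hgs : ∀ k, MemLp (gs k) 2 μ)
    (h1 : Tendsto (fun k => eLpNorm (fs k - f) 2 μ) atTop (𝓝 0))
    (h2 : Tendsto (fun k => eLpNorm (gs k - g) 2 μ) atTop (𝓝 0)) :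
    Tendsto (fun k => ∫ x, fs k x * gs k x ∂μ) atTop (𝓝 (∫ x, f x * g x ∂μ)) := by
  have := tendsto_integral_inner hg hf hgs hfs h2 h1
  simpa using this

theorem tendsto_eLpNorm_const_sub {V : Type*} [NormedAddCommGroup V] (f : α → V) :
    Tendsto (fun _ : ℕ => eLpNorm (f - f) 2 μ) atTop (𝓝 0) := by
  simp

/-- L² convergence is preserved by pointwise operations bounded by a multiple. -/
theorem tendsto_eLpNorm_of_le_mul {V W : Type*} [NormedAddCommGroup V] [NormedAddCommGroup W]
    {fs : ℕ → α → V} {gs : ℕ → α → W} {C : ℝ}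
    (h : Tendsto (fun k => eLpNorm (fs k) 2 μ) atTop (𝓝 0))
    (hle : ∀ k, ∀ᵐ x ∂μ, ‖gs k x‖ ≤ C * ‖fs k x‖) :
    Tendsto (fun k => eLpNorm (gs k) 2 μ) atTop (𝓝 0) := by
  have h0 : Tendsto (fun k => ENNReal.ofReal C * eLpNorm (fs k) 2 μ) atTop (𝓝 0) := by
    have := ENNReal.Tendsto.const_mul (a := ENNReal.ofReal C) h (Or.inr ENNReal.ofReal_ne_top)
    simpa using this
  exact tendsto_of_tendsto_of_tendsto_of_le_of_le tendsto_const_nhds h0 (fun _ => zero_le)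
    (fun k => eLpNorm_le_mul_eLpNorm_of_ae_le_mul (hle k) 2)

theorem tendsto_eLpNorm_add {W : Type*} [NormedAddCommGroup W] {fs gs : ℕ → α → W}
    (hfs : ∀ k, AEStronglyMeasurable (fs k) μ) (hgs : ∀ k, AEStronglyMeasurable (gs k) μ)
    (h : Tendsto (fun k => eLpNorm (fs k) 2 μ) atTop (𝓝 0))
    (h' : Tendsto (fun k => eLpNorm (gs k) 2 μ) atTop (𝓝 0)) :
    Tendsto (fun k => eLpNorm (fs k + gs k) 2 μ) atTop (𝓝 0) := by
  have := h.add h'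
  rw [add_zero] at this
  exact tendsto_of_tendsto_of_tendsto_of_le_of_le tendsto_const_nhds this (fun _ => zero_le)
    (fun k => eLpNorm_add_le (hfs k) (hgs k) (by norm_num))

/-- Cauchy–Schwarz. -/
theorem sq_integral_mul_le {f g : α → ℝ} (hf : MemLp f 2 μ) (hg : MemLp g 2 μ) :
    (∫ x, f x * g x ∂μ) ^ 2 ≤ (∫ x, f x ^ 2 ∂μ) * ∫ x, g x ^ 2 ∂μ := by
  have h := real_inner_mul_inner_self_le (hf.toLp f) (hg.toLp g)
  rw [inner_toLp, inner_toLp, inner_toLp] at h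
  have e : ∀ a b : α → ℝ, ∫ x, (inner ℝ (a x) (b x) : ℝ) ∂μ = ∫ x, a x * b x ∂μ := fun a b => by
    congr 1; ext x; simp [mul_comm]
  rw [e, e, e] at h
  simp only [sq]
  simpa using h

end L2

/-- Euclidean space of dimension `d`. -/
abbrev Eu (d : ℕ) := EuclideanSpace ℝ (Fin d)

variable {d : ℕ}

/-- Smooth functions compactly supported in `U`. -/
structure IsTest (U : Set (Eu d)) (h : Eu d → ℝ) : Prop where
  smooth : ContDiff ℝ (⊤ : ℕ∞) h
  compact : HasCompactSupport h
  supp : tsupport h ⊆ U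

/-- `f` lies in `H¹₀(U)` and `F` is its weak gradient, both extended by zero. -/
structure H10 (U : Set (Eu d)) (f : Eu d → ℝ) (F : Eu d → Eu d) : Prop where
  memf : MemLp f 2 volume
  memF : MemLp F 2 volume
  zerof : ∀ x ∉ U, f x = 0
  zeroF : ∀ x ∉ U, F x = 0
  approx : ∃ h : ℕ → Eu d → ℝ, (∀ k, IsTest U (h k)) ∧
    Tendsto (fun k => eLpNorm (h k - f) 2 volume) atTop (nhds 0) ∧
    Tendsto (fun k => eLpNorm (gradient (h k) - F) 2 volume) atTop (nhds 0)

theorem gradient_apply_inner (f : Eu d → ℝ) (x v : Eu d) :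
    inner ℝ (gradient f x) v = fderiv ℝ f x v := inner_gradient_left ..

theorem gradient_eq_of_inner {f : Eu d → ℝ} {x w : Eu d}
    (h : ∀ v, fderiv ℝ f x v = inner ℝ w v) : gradient f x = w := by
  refine ext_inner_right ℝ fun v => ?_
  rw [gradient_apply_inner, h]

theorem continuous_gradient {f : Eu d → ℝ} (h : ContDiff ℝ (⊤ : ℕ∞) f) :
    Continuous (gradient f) := by
  have : Continuous (fderiv ℝ f) := h.continuous_fderiv (by simp)
  exact (InnerProductSpace.toDual ℝ (Eu d)).symm.continuous.comp this

theorem tsupport_gradient_subset (f : Eu d → ℝ) : tsupport (gradient f) ⊆ tsupport f := by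
  refine closure_minimal (fun x hx => ?_) (isClosed_tsupport f)
  refine support_fderiv_subset ℝ (f := f) ?_
  intro h0
  apply hx
  refine gradient_eq_of_inner fun v => ?_
  simp [h0]

theorem gradient_mul {f g : Eu d → ℝ} {x : Eu d} (hf : DifferentiableAt ℝ f x)
    (hg : DifferentiableAt ℝ g x) :
    gradient (fun x => f x * g x) x = f x • gradient g x + g x • gradient f x := by
  refine gradient_eq_of_inner fun v => ?_
  rw [fderiv_fun_mul hf hg, inner_add_left, inner_smul_left, inner_smul_left]
  simp

theorem gradient_fun_add {f g : Eu d → ℝ} {x : Eu d} (hf : DifferentiableAt ℝ f x)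
    (hg : DifferentiableAt ℝ g x) :
    gradient (fun x => f x + g x) x = gradient f x + gradient g x := by
  refine gradient_eq_of_inner fun v => ?_
  rw [fderiv_fun_add hf hg, inner_add_left]
  simp

namespace IsTest

variable {U : Set (Eu d)} {h k : Eu d → ℝ}

theorem cont (hh : IsTest U h) : Continuous h := hh.smooth.continuous

theorem diff (hh : IsTest U h) : Differentiable ℝ h := hh.smooth.differentiable (by simp)

theorem compact_gradient (hh : IsTest U h) : HasCompactSupport (gradient h) :=
  hh.compact.of_isClosed_subset (isClosed_tsupport _) (tsupport_gradient_subset h)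

theorem cont_gradient (hh : IsTest U h) : Continuous (gradient h) := continuous_gradient hh.smooth

theorem memLp (hh : IsTest U h) : MemLp h 2 volume :=
  hh.cont.memLp_of_hasCompactSupport hh.compact

theorem memLp_gradient (hh : IsTest U h) : MemLp (gradient h) 2 volume :=
  hh.cont_gradient.memLp_of_hasCompactSupport hh.compact_gradient

theorem zero_of_notMem (hh : IsTest U h) {x : Eu d} (hx : x ∉ U) : h x = 0 :=
  image_eq_zero_of_notMem_tsupport fun h' => hx (hh.supp h')

theorem gradient_zero_of_notMem (hh : IsTest U h) {x : Eu d} (hx : x ∉ U) : gradient h x = 0 :=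
  image_eq_zero_of_notMem_tsupport fun h' => hx (hh.supp (tsupport_gradient_subset _ h'))

theorem mul_left (hh : IsTest U h) {m : Eu d → ℝ} (hm : ContDiff ℝ (⊤ : ℕ∞) m) :
    IsTest U (fun x => m x * h x) where
  smooth := hm.mul hh.smooth
  compact := hh.compact.mul_left
  supp := (tsupport_mul_subset_right (f := m) (g := h)).trans hh.supp

theorem add (hh : IsTest U h) (hk : IsTest U k) : IsTest U (fun x => h x + k x) where
  smooth := hh.smooth.add hk.smooth
  compact := hh.compact.add hk.compact
  supp := (tsupport_add h k).trans (union_subset hh.supp hk.supp)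

theorem zero : IsTest U (fun _ : Eu d => (0 : ℝ)) where
  smooth := contDiff_const
  compact := HasCompactSupport.zero
  supp := by
    have : tsupport (fun _ : Eu d => (0 : ℝ)) = ∅ := tsupport_eq_empty_iff.2 rfl
    simp [this]

theorem h10 (hh : IsTest U h) : H10 U h (gradient h) where
  memf := hh.memLp
  memF := hh.memLp_gradient
  zerof _ hx := hh.zero_of_notMem hx
  zeroF _ hx := hh.gradient_zero_of_notMem hx
  approx := ⟨fun _ => h, fun _ => hh, tendsto_eLpNorm_const_sub _, tendsto_eLpNorm_const_sub _⟩

end IsTest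

theorem exists_bound_on {U : Set (Eu d)} (hU : Bornology.IsBounded U) {V : Type*}
    [NormedAddCommGroup V] {m : Eu d → V} (hm : Continuous m) :
    ∃ C : ℝ, 0 ≤ C ∧ ∀ x ∈ U, ‖m x‖ ≤ C := by
  have hc : IsCompact (closure U) := hU.isCompact_closure
  obtain ⟨C, hC⟩ := hc.exists_bound_of_continuousOn hm.continuousOn
  exact ⟨max C 0, le_max_right _ _, fun x hx => (hC x (subset_closure hx)).trans (le_max_left _ _)⟩

section Multiply

variable {U : Set (Eu d)} {f : Eu d → ℝ} {F : Eu d → Eu d}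

theorem memLp_mul_cont (hU : Bornology.IsBounded U) (hf : MemLp f 2 volume)
    (h0 : ∀ x ∉ U, f x = 0) {m : Eu d → ℝ} (hm : Continuous m) :
    MemLp (fun x => m x * f x) 2 volume := by
  obtain ⟨C, hC0, hC⟩ := exists_bound_on hU hm
  refine hf.of_le_mul (c := C) (hm.aestronglyMeasurable.mul hf.1) (Eventually.of_forall fun x => ?_)
  rw [norm_mul]
  by_cases hx : x ∈ U
  · gcongr; exact hC x hx
  · simp [h0 x hx]

theorem memLp_smul_cont (hU : Bornology.IsBounded U) (hF : MemLp F 2 volume)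
    (h0 : ∀ x ∉ U, F x = 0) {m : Eu d → ℝ} (hm : Continuous m) :
    MemLp (fun x => m x • F x) 2 volume := by
  obtain ⟨C, hC0, hC⟩ := exists_bound_on hU hm
  refine hF.of_le_mul (c := C) (hm.aestronglyMeasurable.smul hF.1)
    (Eventually.of_forall fun x => ?_)
  rw [norm_smul]
  by_cases hx : x ∈ U
  · gcongr; exact hC x hx
  · simp [h0 x hx]

theorem memLp_smul_vec (hU : Bornology.IsBounded U) (hf : MemLp f 2 volume)
    (h0 : ∀ x ∉ U, f x = 0) {m : Eu d → Eu d} (hm : Continuous m) :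
    MemLp (fun x => f x • m x) 2 volume := by
  obtain ⟨C, hC0, hC⟩ := exists_bound_on hU hm
  refine hf.of_le_mul (c := C) (hf.1.smul hm.aestronglyMeasurable) (Eventually.of_forall fun x => ?_)
  rw [norm_smul, mul_comm]
  by_cases hx : x ∈ U
  · gcongr; exact hC x hx
  · simp [h0 x hx]

theorem memLp_inner_vec (hU : Bornology.IsBounded U) (hF : MemLp F 2 volume)
    (h0 : ∀ x ∉ U, F x = 0) {m : Eu d → Eu d} (hm : Continuous m) :
    MemLp (fun x => (inner ℝ (F x) (m x) : ℝ)) 2 volume := by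
  obtain ⟨C, hC0, hC⟩ := exists_bound_on hU hm
  refine hF.of_le_mul (c := C) (hF.1.inner hm.aestronglyMeasurable)
    (Eventually.of_forall fun x => ?_)
  refine (norm_inner_le_norm _ _).trans ?_
  rw [mul_comm]
  by_cases hx : x ∈ U
  · gcongr; exact hC x hx
  · simp [h0 x hx]

end Multiply

namespace H10

variable {U : Set (Eu d)} {f g : Eu d → ℝ} {F G : Eu d → Eu d}

theorem zero : H10 U (fun _ : Eu d => (0 : ℝ)) (fun _ => (0 : Eu d)) := by
  have := (IsTest.zero (U := U)).h10
  have e : gradient (fun _ : Eu d => (0 : ℝ)) = fun _ => (0 : Eu d) := by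
    ext1 x
    exact gradient_eq_of_inner fun v => by simp
  rwa [e] at this

theorem add (hf : H10 U f F) (hg : H10 U g G) :
    H10 U (fun x => f x + g x) (fun x => F x + G x) := by
  obtain ⟨h, ht, h1, h2⟩ := hf.approx
  obtain ⟨k, kt, k1, k2⟩ := hg.approx
  refine ⟨hf.memf.add hg.memf, hf.memF.add hg.memF, fun x hx => ?_, fun x hx => ?_,
    fun j x => h j x + k j x, fun j => (ht j).add (kt j), ?_, ?_⟩
  · rw [hf.zerof x hx, hg.zerof x hx, add_zero]
  · rw [hf.zeroF x hx, hg.zeroF x hx, add_zero]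
  · refine (tendsto_eLpNorm_add (fun j => ((ht j).memLp.sub hf.memf).1)
      (fun j => ((kt j).memLp.sub hg.memf).1) h1 k1).congr fun j => ?_
    congr 1; ext x; simp; ring
  · refine (tendsto_eLpNorm_add (fun j => ((ht j).memLp_gradient.sub hf.memF).1)
      (fun j => ((kt j).memLp_gradient.sub hg.memF).1) h2 k2).congr fun j => ?_
    congr 1; ext1 x
    simp only [Pi.add_apply, Pi.sub_apply]
    rw [gradient_fun_add ((ht j).diff x) ((kt j).diff x)]
    abel

/-- Multiplication by a smooth function. -/
theorem mul_smooth (hU : Bornology.IsBounded U) (hf : H10 U f F) {m : Eu d → ℝ}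
    (hm : ContDiff ℝ (⊤ : ℕ∞) m) :
    H10 U (fun x => m x * f x) (fun x => m x • F x + f x • gradient m x) := by
  obtain ⟨h, ht, h1, h2⟩ := hf.approx
  obtain ⟨C, hC0, hC⟩ := exists_bound_on hU hm.continuous
  obtain ⟨D, hD0, hD⟩ := exists_bound_on hU (continuous_gradient hm)
  refine ⟨memLp_mul_cont hU hf.memf hf.zerof hm.continuous,
    (memLp_smul_cont hU hf.memF hf.zeroF hm.continuous).add
      (memLp_smul_vec hU hf.memf hf.zerof (continuous_gradient hm)),
    fun x hx => ?_, fun x hx => ?_,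
    fun j x => m x * h j x, fun j => (ht j).mul_left hm, ?_, ?_⟩
  · rw [hf.zerof x hx, mul_zero]
  · rw [hf.zerof x hx, hf.zeroF x hx]; simp
  · refine tendsto_eLpNorm_of_le_mul (C := C) h1 fun k => Eventually.of_forall fun x => ?_
    simp only [Pi.sub_apply]
    rw [← mul_sub, norm_mul]
    by_cases hx : x ∈ U
    · gcongr; exact hC x hx
    · simp [hf.zerof x hx, (ht k).zero_of_notMem hx]
  · have e1 := tendsto_eLpNorm_of_le_mul (C := C) (gs := fun j x => m x • (gradient (h j) x - F x))
      h2 fun k => Eventually.of_forall fun x => by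
        rw [norm_smul]
        by_cases hx : x ∈ U
        · simp only [Pi.sub_apply]; gcongr; exact hC x hx
        · simp [hf.zeroF x hx, (ht k).gradient_zero_of_notMem hx]
    have e2 := tendsto_eLpNorm_of_le_mul (C := D) (gs := fun j x => (h j x - f x) • gradient m x)
      h1 fun k => Eventually.of_forall fun x => by
        rw [norm_smul, mul_comm]
        by_cases hx : x ∈ U
        · simp only [Pi.sub_apply]; gcongr; exact hD x hx
        · simp [hf.zerof x hx, (ht k).zero_of_notMem hx]
    refine (tendsto_eLpNorm_add (fun j => ?_) (fun j => ?_) e1 e2).congr fun j => ?_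
    · exact hm.continuous.aestronglyMeasurable.smul ((ht j).memLp_gradient.sub hf.memF).1
    · exact ((ht j).memLp.sub hf.memf).1.smul (continuous_gradient hm).aestronglyMeasurable
    · congr 1; ext1 x
      simp only [Pi.add_apply, Pi.sub_apply]
      rw [gradient_mul (hm.differentiable (by simp) x) ((ht j).diff x)]
      module

theorem const_smul (hf : H10 U f F) (c : ℝ) : H10 U (fun x => c * f x) (fun x => c • F x) := by
  obtain ⟨h, ht, h1, h2⟩ := hf.approx
  refine ⟨hf.memf.const_mul c, hf.memF.const_smul c, fun x hx => ?_, fun x hx => ?_,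
    fun j x => c * h j x, fun j => (ht j).mul_left contDiff_const, ?_, ?_⟩
  · rw [hf.zerof x hx, mul_zero]
  · rw [hf.zeroF x hx, smul_zero]
  · refine tendsto_eLpNorm_of_le_mul (C := ‖c‖) h1 fun k => Eventually.of_forall fun x => ?_
    simp only [Pi.sub_apply]
    rw [← mul_sub, norm_mul]
  · refine tendsto_eLpNorm_of_le_mul (C := ‖c‖) h2 fun k => Eventually.of_forall fun x => ?_
    simp only [Pi.sub_apply]
    rw [gradient_mul (by fun_prop) ((ht k).diff x), ← norm_smul, smul_sub]
    have : gradient (fun _ : Eu d => c) x = 0 := gradient_eq_of_inner fun v => by simp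
    simp [this]

theorem sum {ι : Type*} (s : Finset ι) {f : ι → Eu d → ℝ} {F : ι → Eu d → Eu d} (c : ι → ℝ)
    (hf : ∀ i ∈ s, H10 U (f i) (F i)) :
    H10 U (fun x => ∑ i ∈ s, c i * f i x) (fun x => ∑ i ∈ s, c i • F i x) := by
  classical
  induction s using Finset.induction_on with
  | empty => simpa using zero
  | insert a s ha ih =>
    simp only [Finset.sum_insert ha]
    exact ((hf a (by simp)).const_smul (c a)).add (ih fun i hi => hf i (by simp [hi]))

theorem sub (hf : H10 U f F) (hg : H10 U g G) :
    H10 U (fun x => f x - g x) (fun x => F x - G x) := by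
  have := hf.add (hg.const_smul (-1))
  convert this using 2 <;> simp [sub_eq_add_neg]

end H10

end Grushin

namespace Grushin

variable {d : ℕ}

section Dilation

open Topology

/-- The affine map `x ↦ r x + b`. -/
def dil (r : ℝ) (b x : Eu d) : Eu d := r • x + b

theorem continuous_dil (r : ℝ) (b : Eu d) : Continuous (dil r b) := by
  unfold dil; fun_prop

theorem contDiff_dil (r : ℝ) (b : Eu d) : ContDiff ℝ (⊤ : ℕ∞) (dil r b) := by
  unfold dil; fun_prop

theorem map_dil {r : ℝ} (hr : 0 < r) (b : Eu d) :
    Measure.map (dil r b) (volume : Measure (Eu d)) = ENNReal.ofReal ((r ^ d)⁻¹) • volume := by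
  have h1 : (dil r b) = (fun x => x + b) ∘ (fun x : Eu d => r • x) := rfl
  rw [h1, ← Measure.map_map (by fun_prop) (by fun_prop),
    Measure.map_addHaar_smul _ hr.ne', Measure.map_smul, map_add_right_eq_self]
  congr 2
  rw [finrank_euclideanSpace_fin, abs_of_pos (by positivity)]

/-- The affine map as a homeomorphism. -/
noncomputable def dilHomeo {r : ℝ} (hr : 0 < r) (b : Eu d) : Eu d ≃ₜ Eu d :=
  (Homeomorph.smulOfNeZero r hr.ne').trans (Homeomorph.addRight b)

theorem measurableEmbedding_dil {r : ℝ} (hr : 0 < r) (b : Eu d) : MeasurableEmbedding (dil r b) :=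
  (dilHomeo hr b).measurableEmbedding

theorem integral_comp_dil {V : Type*} [NormedAddCommGroup V] [NormedSpace ℝ V] {r : ℝ} (hr : 0 < r)
    (b : Eu d) (g : Eu d → V) : ∫ x, g (dil r b x) = (r ^ d)⁻¹ • ∫ x, g x := by
  rw [← (measurableEmbedding_dil hr b).integral_map, map_dil hr, integral_smul_measure,
    ENNReal.toReal_ofReal (by positivity)]

theorem eLpNorm_comp_dil {V : Type*} [NormedAddCommGroup V] {r : ℝ} (hr : 0 < r)
    (b : Eu d) (g : Eu d → V) :
    eLpNorm (fun x => g (dil r b x)) 2 volume =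
      ENNReal.ofReal ((r ^ d)⁻¹) ^ (1 / (2 : ENNReal)).toReal • eLpNorm g 2 volume := by
  have := (measurableEmbedding_dil hr b).eLpNorm_map_measure (g := g) (μ := volume) (p := 2)
  rw [map_dil hr, eLpNorm_smul_measure_of_ne_top (by norm_num)] at this
  exact this.symm

theorem memLp_comp_dil {V : Type*} [NormedAddCommGroup V] {r : ℝ} (hr : 0 < r)
    (b : Eu d) {g : Eu d → V} (hg : MemLp g 2 volume) :
    MemLp (fun x => g (dil r b x)) 2 volume := by
  have h := hg.smul_measure (c := ENNReal.ofReal ((r ^ d)⁻¹)) ENNReal.ofReal_ne_top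
  rw [← map_dil hr b] at h
  exact ((measurableEmbedding_dil hr b).memLp_map_measure_iff).1 h

theorem tendsto_eLpNorm_comp_dil {V : Type*} [NormedAddCommGroup V] {r : ℝ} (hr : 0 < r)
    (b : Eu d) {g : ℕ → Eu d → V} (h : Tendsto (fun k => eLpNorm (g k) 2 volume) atTop (𝓝 0)) :
    Tendsto (fun k => eLpNorm (fun x => g k (dil r b x)) 2 volume) atTop (𝓝 0) := by
  simp only [eLpNorm_comp_dil hr, smul_eq_mul]
  have := ENNReal.Tendsto.const_mul
    (a := ENNReal.ofReal ((r ^ d)⁻¹) ^ (1 / (2 : ENNReal)).toReal) h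
    (Or.inr (ENNReal.rpow_ne_top_of_nonneg (by simp) ENNReal.ofReal_ne_top))
  simpa using this

theorem gradient_comp_dil {r : ℝ} {b : Eu d} {h : Eu d → ℝ} {x : Eu d}
    (hh : DifferentiableAt ℝ h (dil r b x)) :
    gradient (fun x => h (dil r b x)) x = r • gradient h (dil r b x) := by
  refine gradient_eq_of_inner fun v => ?_
  have h1 : HasFDerivAt (dil r b) (r • ContinuousLinearMap.id ℝ (Eu d)) x := by
    unfold dil
    exact ((hasFDerivAt_id x).const_smul r).add_const b
  have h2 := hh.hasFDerivAt.comp x h1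
  have h3 : fderiv ℝ (fun x => h (dil r b x)) x = _ := h2.fderiv
  rw [h3, inner_smul_left, gradient_apply_inner]
  simp

theorem IsTest.comp_dil {U : Set (Eu d)} {h : Eu d → ℝ} (hh : IsTest U h) {r : ℝ} (hr : 0 < r)
    {b : Eu d} (hb : ∀ x, dil r b x ∈ U → x ∈ U) : IsTest U (fun x => h (dil r b x)) where
  smooth := hh.smooth.comp (contDiff_dil r b)
  compact := hh.compact.comp_homeomorph (dilHomeo hr b)
  supp := by
    intro x hx
    apply hb
    apply hh.supp
    have := tsupport_comp_subset_preimage h (f := dil r b) (continuous_dil r b) hx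
    exact this

theorem H10.comp_dil {U : Set (Eu d)} {f : Eu d → ℝ} {F : Eu d → Eu d} (hf : H10 U f F) {r : ℝ}
    (hr : 0 < r) {b : Eu d} (hb : ∀ x, dil r b x ∈ U → x ∈ U) :
    H10 U (fun x => f (dil r b x)) (fun x => r • F (dil r b x)) := by
  obtain ⟨h, ht, h1, h2⟩ := hf.approx
  refine ⟨memLp_comp_dil hr b hf.memf, (memLp_comp_dil hr b hf.memF).const_smul r,
    fun x hx => ?_, fun x hx => ?_,
    fun j x => h j (dil r b x), fun j => (ht j).comp_dil hr hb, ?_, ?_⟩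
  · exact hf.zerof (dil r b x) (mt (hb x) hx)
  · simp only [hf.zeroF (dil r b x) (mt (hb x) hx), smul_zero]
  · refine (tendsto_eLpNorm_comp_dil hr b h1).congr fun k => ?_
    congr 1
  · have := tendsto_eLpNorm_comp_dil hr b h2
    refine tendsto_eLpNorm_of_le_mul (C := r) this fun k => Eventually.of_forall fun x => ?_
    simp only [Pi.sub_apply]
    rw [gradient_comp_dil ((ht k).diff _), ← smul_sub, norm_smul, Real.norm_of_nonneg hr.le]

end Dilation

section IntegrationByParts

theorem IsTest.integral_inner_gradient {U : Set (Eu d)} {h : Eu d → ℝ} (hh : IsTest U h)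
    (p : Eu d) : ∫ x, (inner ℝ (gradient h x) (x - p) : ℝ) = -(d * ∫ x, h x) := by
  have hc : ∀ i : Fin d, Continuous fun x : Eu d => (x - p) i := fun i => by fun_prop
  have hdc : ∀ i : Fin d, Continuous fun x : Eu d => fderiv ℝ h x (EuclideanSpace.single i 1) :=
    fun i => (hh.smooth.continuous_fderiv (by simp)).clm_apply continuous_const
  have hcs : ∀ i : Fin d, HasCompactSupport
      fun x : Eu d => fderiv ℝ h x (EuclideanSpace.single i 1) := fun i =>
    hh.compact.fderiv_apply ℝ _
  have h_int : ∀ i : Fin d, Integrable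
      fun x : Eu d => (x - p) i * fderiv ℝ h x (EuclideanSpace.single i 1) := fun i =>
    ((hc i).mul (hdc i)).integrable_of_hasCompactSupport ((hcs i).mul_left)
  have hfd : ∀ (i : Fin d) (x : Eu d),
      HasFDerivAt (fun x : Eu d => (x - p) i) (EuclideanSpace.proj (𝕜 := ℝ) i) x := fun i x => by
    have := (EuclideanSpace.proj (𝕜 := ℝ) i : Eu d →L[ℝ] ℝ).hasFDerivAt (x := x)
    exact (this.sub_const (p i))
  have e1 : ∀ x, (inner ℝ (gradient h x) (x - p) : ℝ) =
      ∑ i, (x - p) i * fderiv ℝ h x (EuclideanSpace.single i 1) := fun x => by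
    rw [gradient_apply_inner]
    conv_lhs => rw [← (EuclideanSpace.basisFun (Fin d) ℝ).sum_repr (x - p)]
    rw [map_sum]
    simp
  simp_rw [e1]
  rw [integral_finsetSum _ fun i _ => h_int i]
  have e2 : ∀ i : Fin d, ∫ x, (x - p) i * fderiv ℝ h x (EuclideanSpace.single i 1) =
      - ∫ x, h x := fun i => by
    rw [integral_mul_fderiv_eq_neg_fderiv_mul_of_integrable]
    · congr 2; ext x; rw [(hfd i x).fderiv]; simp
    · refine (hh.cont.integrable_of_hasCompactSupport hh.compact).congr ?_
      exact Eventually.of_forall fun x => by simp only [(hfd i x).fderiv]; simp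
    · exact h_int i
    · exact ((hc i).mul hh.cont).integrable_of_hasCompactSupport (hh.compact.mul_left)
    · exact fun x _ => (hfd i x).differentiableAt
    · exact fun x _ => hh.diff x
  rw [Finset.sum_congr rfl fun i _ => e2 i]
  simp

theorem tendsto_inner_vec {U : Set (Eu d)} (hU : Bornology.IsBounded U) {f : Eu d → Eu d}
    {fs : ℕ → Eu d → Eu d} (h0 : ∀ x ∉ U, f x = 0) (hs0 : ∀ k, ∀ x ∉ U, fs k x = 0)
    {m : Eu d → Eu d} (hm : Continuous m)
    (h : Tendsto (fun k => eLpNorm (fs k - f) 2 volume) atTop (nhds 0)) :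
    Tendsto (fun k => eLpNorm ((fun x => (inner ℝ (fs k x) (m x) : ℝ)) -
      fun x => inner ℝ (f x) (m x)) 2 volume) atTop (nhds 0) := by
  obtain ⟨C, hC0, hC⟩ := exists_bound_on hU hm
  refine tendsto_eLpNorm_of_le_mul (C := C) h fun k => Eventually.of_forall fun x => ?_
  simp only [Pi.sub_apply]
  rw [← inner_sub_left]
  refine (norm_inner_le_norm _ _).trans ?_
  rw [mul_comm]
  by_cases hx : x ∈ U
  · gcongr; exact hC x hx
  · simp [h0 x hx, hs0 k x hx]

variable {U : Set (Eu d)} {f k : Eu d → ℝ} {F K : Eu d → Eu d}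

/-- Integration by parts against the Euler field. -/
theorem H10.euler (hU : Bornology.IsBounded U) (hf : H10 U f F) (hk : H10 U k K) (p : Eu d) :
    (∫ x, f x * inner ℝ (K x) (x - p)) + (∫ x, k x * inner ℝ (F x) (x - p))
      = -(d * ∫ x, f x * k x) := by
  obtain ⟨a, at', a1, a2⟩ := hf.approx
  obtain ⟨b, bt, b1, b2⟩ := hk.approx
  have hz : Continuous fun x : Eu d => x - p := by fun_prop
  have c1 := tendsto_inner_vec hU hf.zeroF (fun k x => (at' k).gradient_zero_of_notMem) hz a2
  have c2 := tendsto_inner_vec hU hk.zeroF (fun k x => (bt k).gradient_zero_of_notMem) hz b2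
  have m1 := memLp_inner_vec hU hf.memF hf.zeroF hz
  have m2 := memLp_inner_vec hU hk.memF hk.zeroF hz
  have m3 := fun j => memLp_inner_vec hU (at' j).memLp_gradient
    (fun x => (at' j).gradient_zero_of_notMem) hz
  have m4 := fun j => memLp_inner_vec hU (bt j).memLp_gradient
    (fun x => (bt j).gradient_zero_of_notMem) hz
  have t1 := tendsto_integral_mul hf.memf m2 (fun j => (at' j).memLp) m4 a1 c2
  have t2 := tendsto_integral_mul hk.memf m1 (fun j => (bt j).memLp) m3 b1 c1
  have t3 := tendsto_integral_mul hf.memf hk.memf (fun j => (at' j).memLp)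
    (fun j => (bt j).memLp) a1 b1
  refine tendsto_nhds_unique (t1.add t2) (((t3.const_mul (d : ℝ)).neg).congr fun j => ?_)
  have hp : IsTest U (fun x => a j x * b j x) := (bt j).mul_left (at' j).smooth
  rw [← hp.integral_inner_gradient p, ← integral_add]
  · congr 1; ext x
    rw [gradient_mul ((at' j).diff x) ((bt j).diff x), inner_add_left, inner_smul_left,
      inner_smul_left]
    simp
  · exact integrable_mul_of_memLp (at' j).memLp (m4 j)
  · exact integrable_mul_of_memLp (bt j).memLp (m3 j)

/-- Weighted version of integration by parts against the Euler field. -/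
theorem H10.euler_weight (hU : Bornology.IsBounded U) (hf : H10 U f F) (p : Eu d) {m : Eu d → ℝ}
    (hm : ContDiff ℝ (⊤ : ℕ∞) m) :
    2 * (∫ x, m x * f x * inner ℝ (F x) (x - p)) + d * (∫ x, m x * f x ^ 2)
      = -∫ x, inner ℝ (gradient m x) (x - p) * f x ^ 2 := by
  have hz : Continuous fun x : Eu d => x - p := by fun_prop
  have hmf := hf.mul_smooth hU hm
  have h := hf.euler hU hmf p
  have i1 : Integrable fun x => m x * f x * inner ℝ (F x) (x - p) :=
    integrable_mul_of_memLp hmf.memf (memLp_inner_vec hU hf.memF hf.zeroF hz)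
  have i2 : Integrable fun x => inner ℝ (gradient m x) (x - p) * f x ^ 2 := by
    refine (integrable_mul_of_memLp (memLp_mul_cont hU hf.memf hf.zerof
      (((continuous_gradient hm).inner hz) : Continuous fun x =>
        (inner ℝ (gradient m x) (x - p) : ℝ))) hf.memf).congr ?_
    exact Eventually.of_forall fun x => by simp only; ring
  have e1 : ∫ x, f x * inner ℝ (m x • F x + f x • gradient m x) (x - p) =
      (∫ x, m x * f x * inner ℝ (F x) (x - p)) + ∫ x, inner ℝ (gradient m x) (x - p) * f x ^ 2 := by
    rw [← integral_add i1 i2]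
    congr 1; ext x
    rw [inner_add_left, inner_smul_left, inner_smul_left]
    simp; ring
  have e2 : ∫ x, f x * (m x * f x) = ∫ x, m x * f x ^ 2 := by
    congr 1; ext x; ring
  rw [e1, e2] at h
  linarith

end IntegrationByParts

section Difference

theorem IsTest.hasDerivAt_line {U : Set (Eu d)} {h : Eu d → ℝ} (hh : IsTest U h) (x w : Eu d)
    (s : ℝ) : HasDerivAt (fun s : ℝ => h (x + s • w)) (inner ℝ (gradient h (x + s • w)) w) s := by
  have h1 : HasDerivAt (fun s : ℝ => x + s • w) w s := by
    simpa using ((hasDerivAt_id s).smul_const w).const_add x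
  rw [gradient_apply_inner]
  exact (hh.diff _).hasFDerivAt.comp_hasDerivAt s h1

theorem IsTest.sq_diff_le {U : Set (Eu d)} {h : Eu d → ℝ} (hh : IsTest U h) (x w : Eu d) {M : ℝ}
    (hM : ∀ s ∈ Icc (0:ℝ) 1, x + s • w ∈ U → ‖w‖ ≤ M) :
    (h (x + w) - h x) ^ 2 ≤ M ^ 2 * ∫ s in Ioc (0:ℝ) 1, ‖gradient h (x + s • w)‖ ^ 2 := by
  have hcl : Continuous fun s : ℝ => x + s • w := by fun_prop
  have hcg : Continuous fun s : ℝ => gradient h (x + s • w) := hh.cont_gradient.comp hcl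
  have hci : Continuous fun s : ℝ => (inner ℝ (gradient h (x + s • w)) w : ℝ) :=
    hcg.inner continuous_const
  have e1 : ∫ s in (0:ℝ)..1, (inner ℝ (gradient h (x + s • w)) w : ℝ) = h (x + w) - h x := by
    have := intervalIntegral.integral_eq_sub_of_hasDerivAt
      (fun s _ => hh.hasDerivAt_line x w s) (hci.intervalIntegrable 0 1)
    simpa using this
  rw [intervalIntegral.integral_of_le zero_le_one] at e1
  have hmem : ∀ g : ℝ → ℝ, Continuous g → MemLp g 2 (volume.restrict (Ioc (0:ℝ) 1)) := fun g hg => by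
    obtain ⟨C, hC⟩ := isCompact_Icc.exists_bound_of_continuousOn (s := Icc (0:ℝ) 1) hg.continuousOn
    refine MemLp.of_bound hg.aestronglyMeasurable C ?_
    filter_upwards [ae_restrict_mem measurableSet_Ioc] with s hs
    exact hC s ⟨hs.1.le, hs.2⟩
  have cs := sq_integral_mul_le (hmem _ hci) (hmem (fun _ => 1) continuous_const)
  simp only [mul_one, one_pow] at cs
  rw [e1] at cs
  have h1 : ∫ _ in Ioc (0:ℝ) 1, (1:ℝ) = 1 := by simp
  rw [h1, mul_one] at cs
  refine cs.trans ?_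
  rw [← integral_const_mul]
  refine setIntegral_mono_on (hmem _ hci).integrable_sq
    (((hmem _ hcg.norm).integrable_sq).const_mul _) measurableSet_Ioc fun s hs => ?_
  by_cases hx : x + s • w ∈ U
  · have h2 : |inner ℝ (gradient h (x + s • w)) w| ≤ ‖gradient h (x + s • w)‖ * M :=
      (abs_real_inner_le_norm _ _).trans (by gcongr; exact hM s ⟨hs.1.le, hs.2⟩ hx)
    rw [← sq_abs]
    calc |inner ℝ (gradient h (x + s • w)) w| ^ 2 ≤ (‖gradient h (x + s • w)‖ * M) ^ 2 := by gcongr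
      _ = _ := by ring
  · simp [hh.gradient_zero_of_notMem hx]

/-- Difference quotient estimate for the affine displacement `x ↦ ε x + b`. -/
theorem IsTest.integral_sq_diff_le {U : Set (Eu d)} {h : Eu d → ℝ} (hh : IsTest U h) {ε : ℝ}
    (hε : 0 ≤ ε) (b : Eu d) {M : ℝ}
    (hM : ∀ x, ∀ s ∈ Icc (0:ℝ) 1, x + s • (ε • x + b) ∈ U → ‖ε • x + b‖ ≤ M) :
    ∫ x, (h (x + (ε • x + b)) - h x) ^ 2 ≤ M ^ 2 * ∫ x, ‖gradient h x‖ ^ 2 := by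
  have hdil : ∀ s : ℝ, ∀ x : Eu d, x + s • (ε • x + b) = dil (1 + s * ε) (s • b) x := fun s x => by
    unfold dil; module
  have hpos : ∀ s ∈ Icc (0:ℝ) 1, 0 < 1 + s * ε := fun s hs => by
    have := mul_nonneg hs.1 hε; linarith
  have hgint : Integrable fun x => ‖gradient h x‖ ^ 2 := hh.memLp_gradient.norm.integrable_sq
  have hG0 : 0 ≤ ∫ x, ‖gradient h x‖ ^ 2 := integral_nonneg fun x => by positivity
  have hcont : Continuous fun q : Eu d × ℝ => ‖gradient h (q.1 + q.2 • (ε • q.1 + b))‖ ^ 2 :=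
    (hh.cont_gradient.comp (by fun_prop)).norm.pow 2
  have hslice : ∀ s ∈ Icc (0:ℝ) 1,
      Integrable (fun x => ‖gradient h (x + s • (ε • x + b))‖ ^ 2) ∧
      ∫ x, ‖gradient h (x + s • (ε • x + b))‖ ^ 2 ≤ ∫ x, ‖gradient h x‖ ^ 2 := fun s hs => by
    simp only [hdil]
    refine ⟨(memLp_comp_dil (hpos s hs) _ hh.memLp_gradient).norm.integrable_sq, ?_⟩
    rw [integral_comp_dil (hpos s hs) (s • b) (fun x => ‖gradient h x‖ ^ 2), smul_eq_mul]
    refine mul_le_of_le_one_left hG0 (inv_le_one_of_one_le₀ (one_le_pow₀ ?_))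
    have := mul_nonneg hs.1 hε; linarith
  have hprod : Integrable (fun q : Eu d × ℝ => ‖gradient h (q.1 + q.2 • (ε • q.1 + b))‖ ^ 2)
      (volume.prod (volume.restrict (Ioc (0:ℝ) 1))) := by
    rw [integrable_prod_iff' hcont.aestronglyMeasurable]
    constructor
    · filter_upwards [ae_restrict_mem measurableSet_Ioc] with s hs
      exact (hslice s ⟨hs.1.le, hs.2⟩).1
    · refine Integrable.mono' (integrable_const (∫ x, ‖gradient h x‖ ^ 2)) ?_ ?_
      · exact (hcont.norm.stronglyMeasurable.integral_prod_left (μ := volume)).aestronglyMeasurable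
      · filter_upwards [ae_restrict_mem measurableSet_Ioc] with s hs
        have := (hslice s ⟨hs.1.le, hs.2⟩).2
        simp only [norm_pow, norm_norm]
        rw [Real.norm_of_nonneg (integral_nonneg fun x => by positivity)]
        exact this
  have hsw := integral_integral_swap (f := fun (x : Eu d) (s : ℝ) =>
    ‖gradient h (x + s • (ε • x + b))‖ ^ 2) hprod
  have hle : ∫ s in Ioc (0:ℝ) 1, ∫ x, ‖gradient h (x + s • (ε • x + b))‖ ^ 2
      ≤ ∫ x, ‖gradient h x‖ ^ 2 := by
    calc _ ≤ ∫ s in Ioc (0:ℝ) 1, ∫ x, ‖gradient h x‖ ^ 2 := by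
          refine setIntegral_mono_on hprod.integral_prod_right (integrable_const _)
            measurableSet_Ioc fun s hs => (hslice s ⟨hs.1.le, hs.2⟩).2
      _ = _ := by simp
  have h1 : ∀ x : Eu d, x + (ε • x + b) = dil (1 + ε) b x := fun x => by unfold dil; module
  calc ∫ x, (h (x + (ε • x + b)) - h x) ^ 2
      ≤ ∫ x, M ^ 2 * ∫ s in Ioc (0:ℝ) 1, ‖gradient h (x + s • (ε • x + b))‖ ^ 2 := by
        refine integral_mono ?_ (hprod.integral_prod_left.const_mul _) fun x =>
          hh.sq_diff_le x _ (hM x)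
        simp only [h1]
        exact ((memLp_comp_dil (by linarith) b hh.memLp).sub hh.memLp).integrable_sq
    _ = M ^ 2 * ∫ s in Ioc (0:ℝ) 1, ∫ x, ‖gradient h (x + s • (ε • x + b))‖ ^ 2 := by
        rw [integral_const_mul, hsw]
    _ ≤ _ := by gcongr

theorem tendsto_integral_norm_sq {V : Type*} [NormedAddCommGroup V] [InnerProductSpace ℝ V]
    {f : Eu d → V} {fs : ℕ → Eu d → V}
    (hf : MemLp f 2 volume) (hfs : ∀ k, MemLp (fs k) 2 volume)
    (h1 : Tendsto (fun k => eLpNorm (fs k - f) 2 volume) atTop (nhds 0)) :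
    Tendsto (fun k => ∫ x, ‖fs k x‖ ^ 2) atTop (nhds (∫ x, ‖f x‖ ^ 2)) := by
  have := tendsto_integral_inner hf hf hfs hfs h1 h1
  simpa only [real_inner_self_eq_norm_sq] using this

theorem H10.integral_sq_diff_le {U : Set (Eu d)} {f : Eu d → ℝ} {F : Eu d → Eu d}
    (hf : H10 U f F) {ε : ℝ}
    (hε : 0 ≤ ε) (b : Eu d) {M : ℝ}
    (hM : ∀ x, ∀ s ∈ Icc (0:ℝ) 1, x + s • (ε • x + b) ∈ U → ‖ε • x + b‖ ≤ M) :
    ∫ x, (f (x + (ε • x + b)) - f x) ^ 2 ≤ M ^ 2 * ∫ x, ‖F x‖ ^ 2 := by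
  obtain ⟨h, ht, h1, h2⟩ := hf.approx
  have e : ∀ x : Eu d, x + (ε • x + b) = dil (1 + ε) b x := fun x => by unfold dil; module
  have hp : 0 < 1 + ε := by linarith
  have t2 := (tendsto_integral_norm_sq hf.memF (fun j => (ht j).memLp_gradient) h2).const_mul
    (M ^ 2)
  have t1 := tendsto_integral_norm_sq (f := fun x => f (dil (1 + ε) b x) - f x)
    (fs := fun j x => h j (dil (1 + ε) b x) - h j x)
    ((memLp_comp_dil hp b hf.memf).sub hf.memf)
    (fun j => (memLp_comp_dil hp b (ht j).memLp).sub (ht j).memLp) (by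
      have a1 := tendsto_eLpNorm_comp_dil hp b h1
      have a2 : Tendsto (fun k => eLpNorm (f - h k) 2 volume) atTop (nhds 0) := by
        refine h1.congr fun k => ?_
        rw [← eLpNorm_neg, neg_sub]
      refine (tendsto_eLpNorm_add (fun j => ?_) (fun j => ?_) a1 a2).congr fun j => ?_
      · exact (memLp_comp_dil hp b ((ht j).memLp.sub hf.memf)).1
      · exact (hf.memf.sub (ht j).memLp).1
      · congr 1; ext x; simp; ring)
  simp only [Real.norm_eq_abs, sq_abs] at t1
  simp only [e]
  refine le_of_tendsto_of_tendsto' t1 t2 fun j => ?_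
  have := (ht j).integral_sq_diff_le hε b hM
  simpa only [e] using this

end Difference

end Grushin

namespace Grushin

variable {d : ℕ}

section Pohozaev

open Topology

theorem abs_integral_mul_le {α : Type*} [MeasurableSpace α] {μ : Measure α} {f g : α → ℝ}
    (hf : MemLp f 2 μ) (hg : MemLp g 2 μ) {A : ℝ} (hA : ∫ x, g x ^ 2 ∂μ ≤ A) :
    |∫ x, f x * g x ∂μ| ≤ Real.sqrt ((∫ x, f x ^ 2 ∂μ) * A) := by
  rw [← Real.sqrt_sq_eq_abs]
  refine Real.sqrt_le_sqrt ((sq_integral_mul_le hf hg).trans ?_)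
  gcongr

variable {R : ℝ} {p : Eu d}

theorem mem_ball_of_dil_mem (hp : ‖p‖ ≤ R) {ε : ℝ} (hε : 0 ≤ ε) (x : Eu d)
    (hx : dil (1 + ε) (-(ε • p)) x ∈ ball (0 : Eu d) R) : x ∈ ball (0 : Eu d) R := by
  rw [mem_ball_zero_iff] at hx ⊢
  have h1 : (1 + ε) • x = dil (1 + ε) (-(ε • p)) x + ε • p := by unfold dil; module
  have h2 : (1 + ε) * ‖x‖ ≤ ‖dil (1 + ε) (-(ε • p)) x‖ + ε * ‖p‖ := by
    calc (1 + ε) * ‖x‖ = ‖(1 + ε) • x‖ := by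
          rw [norm_smul, Real.norm_of_nonneg (by linarith)]
      _ ≤ _ := by
          rw [h1]
          refine (norm_add_le _ _).trans ?_
          rw [norm_smul, Real.norm_of_nonneg hε]
  nlinarith [mul_le_mul_of_nonneg_left hp hε]

theorem norm_displacement_le (hp : ‖p‖ ≤ R) {ε : ℝ} (hε : 0 ≤ ε) (x : Eu d) {s : ℝ} (hs : 0 ≤ s)
    (hx : x + s • (ε • x + -(ε • p)) ∈ ball (0 : Eu d) R) :
    ‖ε • x + -(ε • p)‖ ≤ 2 * R * ε := by
  rw [mem_ball_zero_iff] at hx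
  have h1 : x + s • (ε • x + -(ε • p)) - p = (1 + s * ε) • (x - p) := by module
  have h2 : ‖x + s • (ε • x + -(ε • p)) - p‖ ≤ 2 * R := by
    refine (norm_sub_le _ _).trans (by linarith)
  have hse := mul_nonneg hs hε
  rw [h1, norm_smul, Real.norm_of_nonneg (by linarith)] at h2
  have h3 : ε • x + -(ε • p) = ε • (x - p) := by module
  rw [h3, norm_smul, Real.norm_of_nonneg hε]
  have : ‖x - p‖ ≤ 2 * R := by nlinarith [norm_nonneg (x - p)]
  nlinarith

theorem IsTest.tendsto_quotient {k : Eu d → ℝ} (hk : IsTest (ball (0 : Eu d) R) k) (hp : ‖p‖ ≤ R)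
    {h : Eu d → ℝ} (hh : MemLp h 2 volume) :
    Tendsto (fun ε : ℝ => ε⁻¹ * ∫ x, h x * (k (x + (ε • x + -(ε • p))) - k x)) (𝓝[>] 0)
      (𝓝 (∫ x, h x * inner ℝ (gradient k x) (x - p))) := by
  obtain ⟨C, hC⟩ := hk.cont_gradient.bounded_above_of_compact_support hk.compact_gradient
  have hC0 : 0 ≤ C := (norm_nonneg _).trans (hC 0)
  have hfd : ∀ x, ‖fderiv ℝ k x‖ ≤ C := fun x => by
    rw [← toDual_gradient, LinearIsometryEquiv.norm_map]; exact hC x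
  have hR0 : 0 ≤ R := (norm_nonneg _).trans hp
  simp only [← integral_const_mul]
  refine tendsto_integral_filter_of_dominated_convergence
    (fun x => ‖h x‖ * (ball (0 : Eu d) R).indicator (fun _ => C * (2 * R)) x) ?_ ?_ ?_ ?_
  · filter_upwards [self_mem_nhdsWithin] with ε hε
    refine (hh.1.mul (Continuous.aestronglyMeasurable ?_)).const_mul _
    have := hk.cont
    fun_prop
  · filter_upwards [self_mem_nhdsWithin] with ε hε
    refine Eventually.of_forall fun x => ?_
    have hε0 : 0 < ε := hε
    by_cases hx : x ∈ ball (0 : Eu d) R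
    · rw [indicator_of_mem hx]
      have h1 : ‖k (x + (ε • x + -(ε • p))) - k x‖ ≤ C * (2 * R * ε) := by
        have := Convex.norm_image_sub_le_of_norm_fderiv_le (𝕜 := ℝ) (f := k) (s := univ) (C := C)
          (fun x _ => hk.diff x) (fun x _ => hfd x) convex_univ (mem_univ x)
          (mem_univ (x + (ε • x + -(ε • p))))
        refine this.trans ?_
        gcongr
        rw [add_sub_cancel_left]
        exact norm_displacement_le hp hε0.le x le_rfl (by simpa using hx)
      calc ‖ε⁻¹ * (h x * (k (x + (ε • x + -(ε • p))) - k x))‖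
          = ε⁻¹ * (‖h x‖ * ‖k (x + (ε • x + -(ε • p))) - k x‖) := by
            rw [norm_mul, norm_mul, Real.norm_of_nonneg (inv_nonneg.2 hε0.le)]
        _ ≤ ε⁻¹ * (‖h x‖ * (C * (2 * R * ε))) := by gcongr
        _ = _ := by field_simp
    · have h1 : k (x + (ε • x + -(ε • p))) = 0 := by
        refine hk.zero_of_notMem fun h' => hx (mem_ball_of_dil_mem hp hε0.le x ?_)
        have : x + (ε • x + -(ε • p)) = dil (1 + ε) (-(ε • p)) x := by unfold dil; module
        rwa [← this]
      rw [h1, hk.zero_of_notMem hx, indicator_of_notMem hx]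
      simp
  · refine integrable_mul_of_memLp hh.norm ?_
    exact memLp_indicator_const _ measurableSet_ball _ (Or.inr measure_ball_lt_top.ne)
  · refine Eventually.of_forall fun x => ?_
    have h1 := (hk.hasDerivAt_line x (x - p) 0).tendsto_slope_zero_right
    simp only [zero_add, zero_smul, add_zero, smul_eq_mul] at h1
    refine (h1.const_mul (h x)).congr fun ε => ?_
    rw [show ε • x + -(ε • p) = ε • (x - p) by module]
    ring

/-- Pohozaev-type inequality in a ball, for a centre `p` in the closed ball. -/
theorem pohozaev (hd : 2 ≤ d) (hp : ‖p‖ ≤ R) {f : Eu d → ℝ} {F : Eu d → Eu d}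
    (hf : H10 (ball (0 : Eu d) R) f F) {h : Eu d → ℝ} (hh : MemLp h 2 volume)
    (weak : ∀ w W, H10 (ball (0 : Eu d) R) w W → ∫ x, h x * w x = -∫ x, inner ℝ (F x) (W x)) :
    (d - 2 : ℝ) / 2 * ∫ x, ‖F x‖ ^ 2 ≤ ∫ x, h x * inner ℝ (F x) (x - p) := by
  have hU : Bornology.IsBounded (ball (0 : Eu d) R) := isBounded_ball
  obtain ⟨k, kt, k1, k2⟩ := hf.approx
  set A := ∫ x, ‖F x‖ ^ 2 with hA
  have hA0 : 0 ≤ A := integral_nonneg fun x => by positivity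
  set e : ℕ → ℝ := fun j => Real.sqrt ((∫ x, h x ^ 2) *
    ((2 * R) ^ 2 * ∫ x, ‖F x - gradient (k j) x‖ ^ 2)) with he
  have dile : ∀ (ε : ℝ) (x : Eu d), x + (ε • x + -(ε • p)) = dil (1 + ε) (-(ε • p)) x :=
    fun ε x => by unfold dil; module
  -- the energy comparison
  have step1 : ∀ ε : ℝ, 0 < ε →
      (d - 2 : ℝ) / (1 + (d - 2) * ε) / 2 * A
        ≤ ε⁻¹ * ∫ x, h x * (f (x + (ε • x + -(ε • p))) - f x) := by
    intro ε hε
    have hp1 : 0 < 1 + ε := by linarith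
    have hfe := hf.comp_dil hp1 (b := -(ε • p)) (mem_ball_of_dil_mem hp hε.le)
    have h1 := weak _ _ (hfe.sub hf)
    simp only [dile]
    rw [h1]
    set Fe : Eu d → Eu d := fun x => (1 + ε) • F (dil (1 + ε) (-(ε • p)) x) with hFe
    have iFe : Integrable fun x => ‖Fe x‖ ^ 2 := hfe.memF.norm.integrable_sq
    have iF : Integrable fun x => ‖F x‖ ^ 2 := hf.memF.norm.integrable_sq
    have h2 : ∫ x, ‖Fe x‖ ^ 2 = (1 + ε) ^ 2 * (((1 + ε) ^ d)⁻¹ * A) := by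
      have := integral_comp_dil hp1 (-(ε • p)) (fun x => ‖F x‖ ^ 2)
      rw [smul_eq_mul] at this
      rw [← this, ← integral_const_mul]
      congr 1; ext x
      rw [hFe, norm_smul, mul_pow, Real.norm_eq_abs, sq_abs]
    have h3 : (1 / 2) * (A - ∫ x, ‖Fe x‖ ^ 2) ≤ -∫ x, inner ℝ (F x) (Fe x - F x) := by
      rw [hA, ← integral_sub iF iFe, ← integral_const_mul, ← integral_neg]
      refine integral_mono ((iF.sub iFe).const_mul _)
        (integrable_inner_of_memLp hf.memF (hfe.memF.sub hf.memF)).neg fun x => ?_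
      simp only
      rw [inner_sub_right, real_inner_self_eq_norm_sq]
      have := norm_sub_sq_real (F x) (Fe x)
      nlinarith [sq_nonneg ‖F x - Fe x‖]
    obtain ⟨m, rfl⟩ := Nat.exists_eq_add_of_le hd
    have h4 : ((2 + m : ℕ) : ℝ) - 2 = m := by push_cast; ring
    rw [h4]
    have h5 : 1 + m * ε ≤ (1 + ε) ^ m := one_add_mul_le_pow (by linarith) m
    have hmε : 0 < 1 + m * ε := by positivity
    have h6 : (1 + ε) ^ 2 * (((1 + ε) ^ (2 + m))⁻¹ * A) = ((1 + ε) ^ m)⁻¹ * A := by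
      rw [pow_add]; field_simp
    rw [h2, h6] at h3
    have h7 : ((1 + ε) ^ m)⁻¹ ≤ (1 + m * ε)⁻¹ := inv_anti₀ hmε h5
    calc (m : ℝ) / (1 + m * ε) / 2 * A = ε⁻¹ * (1 / 2 * (A - (1 + m * ε)⁻¹ * A)) := by
          field_simp; ring
      _ ≤ ε⁻¹ * (1 / 2 * (A - ((1 + ε) ^ m)⁻¹ * A)) := by gcongr
      _ ≤ _ := by gcongr
  have step2 : ∀ j, ∀ ε : ℝ, 0 < ε → ε⁻¹ * ∫ x, h x * (f (x + (ε • x + -(ε • p))) - f x) ≤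
      ε⁻¹ * (∫ x, h x * (k j (x + (ε • x + -(ε • p))) - k j x)) + e j := by
    intro j ε hε
    have hp1 : 0 < 1 + ε := by linarith
    have hsub := hf.sub (kt j).h10
    have h1 := hsub.integral_sq_diff_le hε.le (-(ε • p)) (M := 2 * R * ε) fun x s hs hx =>
      norm_displacement_le hp hε.le x hs.1 hx
    have m1 : MemLp (fun x => f (x + (ε • x + -(ε • p))) - f x) 2 volume := by
      simp only [dile]
      exact (memLp_comp_dil hp1 _ hf.memf).sub hf.memf
    have m2 : MemLp (fun x => k j (x + (ε • x + -(ε • p))) - k j x) 2 volume := by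
      simp only [dile]
      exact (memLp_comp_dil hp1 _ (kt j).memLp).sub (kt j).memLp
    have m3 := m1.sub m2
    have h2 : ∫ x, ((fun x => f (x + (ε • x + -(ε • p))) - f x) -
        (fun x => k j (x + (ε • x + -(ε • p))) - k j x)) x ^ 2 ≤
        (2 * R * ε) ^ 2 * ∫ x, ‖F x - gradient (k j) x‖ ^ 2 := by
      refine le_trans (le_of_eq ?_) h1
      congr 1; ext x; simp only [Pi.sub_apply]; ring
    have h3 := abs_integral_mul_le hh m3 h2
    have h4 : Real.sqrt ((∫ x, h x ^ 2) * ((2 * R * ε) ^ 2 *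
        ∫ x, ‖F x - gradient (k j) x‖ ^ 2)) = ε * e j := by
      rw [he]
      rw [show (∫ x, h x ^ 2) * ((2 * R * ε) ^ 2 * ∫ x, ‖F x - gradient (k j) x‖ ^ 2) =
        ε ^ 2 * ((∫ x, h x ^ 2) * ((2 * R) ^ 2 * ∫ x, ‖F x - gradient (k j) x‖ ^ 2)) by ring,
        Real.sqrt_mul (sq_nonneg _), Real.sqrt_sq hε.le]
    rw [h4] at h3
    have h5 : ∫ x, h x * ((fun x => f (x + (ε • x + -(ε • p))) - f x) -
        (fun x => k j (x + (ε • x + -(ε • p))) - k j x)) x =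
        (∫ x, h x * (f (x + (ε • x + -(ε • p))) - f x)) -
        ∫ x, h x * (k j (x + (ε • x + -(ε • p))) - k j x) := by
      rw [← integral_sub (integrable_mul_of_memLp hh m1) (integrable_mul_of_memLp hh m2)]
      congr 1; ext x; simp only [Pi.sub_apply]; ring
    rw [h5] at h3
    have h6 := (le_abs_self _).trans h3
    calc _ ≤ ε⁻¹ * ((∫ x, h x * (k j (x + (ε • x + -(ε • p))) - k j x)) + ε * e j) := by
          gcongr; linarith
      _ = _ := by field_simp
  have hz : Continuous fun x : Eu d => x - p := by fun_prop
  have step3 : ∀ j, (d - 2 : ℝ) / 2 * A ≤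
      (∫ x, h x * inner ℝ (gradient (k j) x) (x - p)) + e j := by
    intro j
    have t1 : Tendsto (fun ε : ℝ => (d - 2 : ℝ) / (1 + (d - 2) * ε) / 2 * A) (𝓝[>] 0)
        (𝓝 ((d - 2 : ℝ) / 2 * A)) := by
      have : ContinuousAt (fun ε : ℝ => (d - 2 : ℝ) / (1 + (d - 2) * ε) / 2 * A) 0 := by
        fun_prop (disch := simp)
      have h := this.tendsto.mono_left (nhdsWithin_le_nhds (s := Ioi (0:ℝ)))
      simpa using h
    refine le_of_tendsto_of_tendsto t1 (((kt j).tendsto_quotient hp hh).add_const (e j)) ?_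
    filter_upwards [self_mem_nhdsWithin] with ε hε
    exact (step1 ε hε).trans (step2 j ε hε)
  have t1 := tendsto_integral_mul hh (memLp_inner_vec hU hf.memF hf.zeroF hz) (fun _ => hh)
    (fun j => memLp_inner_vec hU (kt j).memLp_gradient
      (fun x => (kt j).gradient_zero_of_notMem) hz) (tendsto_eLpNorm_const_sub h)
    (tendsto_inner_vec hU hf.zeroF (fun j x => (kt j).gradient_zero_of_notMem) hz k2)
  have t2 : Tendsto e atTop (𝓝 0) := by
    have h1 := tendsto_integral_norm_sq (f := fun _ : Eu d => (0 : Eu d))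
      (fs := fun j x => F x - gradient (k j) x) MemLp.zero
      (fun j => hf.memF.sub (kt j).memLp_gradient) (by
        refine k2.congr fun j => ?_
        rw [← eLpNorm_neg]
        congr 1; ext1 x; simp)
    simp only [norm_zero, ne_eq, OfNat.ofNat_ne_zero, not_false_eq_true, zero_pow,
      integral_zero] at h1
    have h2 := (Real.continuous_sqrt.tendsto _).comp
      ((h1.const_mul ((2 * R) ^ 2)).const_mul (∫ x, h x ^ 2))
    simpa [he, Function.comp_def] using h2
  have t3 := t1.add t2
  rw [add_zero] at t3
  exact ge_of_tendsto' t3 step3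

end Pohozaev

end Grushin

namespace Grushin

variable {d : ℕ}

section InnerProduct

/-- The `L²` pairing. -/
noncomputable def ip (a b : Eu d → ℝ) : ℝ := ∫ x, a x * b x

variable {a b c : Eu d → ℝ}

theorem ip_comm (a b : Eu d → ℝ) : ip a b = ip b a := by
  unfold ip; congr 1; ext x; ring

theorem ip_add_left (ha : MemLp a 2 volume) (hb : MemLp b 2 volume) (hc : MemLp c 2 volume) :
    ip (fun x => a x + b x) c = ip a c + ip b c := by
  unfold ip
  rw [← integral_add (integrable_mul_of_memLp ha hc) (integrable_mul_of_memLp hb hc)]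
  congr 1; ext x; ring

theorem ip_sub_left (ha : MemLp a 2 volume) (hb : MemLp b 2 volume) (hc : MemLp c 2 volume) :
    ip (fun x => a x - b x) c = ip a c - ip b c := by
  unfold ip
  rw [← integral_sub (integrable_mul_of_memLp ha hc) (integrable_mul_of_memLp hb hc)]
  congr 1; ext x; ring

theorem ip_add_right (ha : MemLp a 2 volume) (hb : MemLp b 2 volume) (hc : MemLp c 2 volume) :
    ip c (fun x => a x + b x) = ip c a + ip c b := by
  rw [ip_comm, ip_add_left ha hb hc, ip_comm a, ip_comm b]

theorem ip_sub_right (ha : MemLp a 2 volume) (hb : MemLp b 2 volume) (hc : MemLp c 2 volume) :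
    ip c (fun x => a x - b x) = ip c a - ip c b := by
  rw [ip_comm, ip_sub_left ha hb hc, ip_comm a, ip_comm b]

theorem ip_const_mul_left (r : ℝ) (a c : Eu d → ℝ) : ip (fun x => r * a x) c = r * ip a c := by
  unfold ip
  rw [← integral_const_mul]
  congr 1; ext x; ring

theorem ip_const_mul_right (r : ℝ) (a c : Eu d → ℝ) : ip c (fun x => r * a x) = r * ip c a := by
  rw [ip_comm, ip_const_mul_left, ip_comm]

theorem ip_self_nonneg (a : Eu d → ℝ) : 0 ≤ ip a a := integral_nonneg fun _ => mul_self_nonneg _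

theorem ip_sq_le (ha : MemLp a 2 volume) (hb : MemLp b 2 volume) :
    ip a b ^ 2 ≤ ip a a * ip b b := by
  have := sq_integral_mul_le ha hb
  simpa only [ip, sq] using this

end InnerProduct

/-- `v = Δu − ν‖x‖² u` weakly in `U`. -/
def WeakEq (U : Set (Eu d)) (ν : ℝ) (u : Eu d → ℝ) (G : Eu d → Eu d) (v : Eu d → ℝ) : Prop :=
  ∀ w W, H10 U w W → ∫ x, v x * w x =
    -(∫ x, (inner ℝ (G x) (W x) : ℝ)) - ν * ∫ x, ‖x‖ ^ 2 * u x * w x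

/-- The Gaussian weight `exp(c - α‖x-p‖²/2)`. -/
noncomputable def wt (α c : ℝ) (p x : Eu d) : ℝ := Real.exp (c - α * ‖x - p‖ ^ 2 / 2)

theorem contDiff_wt (α c : ℝ) (p : Eu d) : ContDiff ℝ (⊤ : ℕ∞) (wt α c p) := by
  unfold wt
  refine ContDiff.exp ?_
  have : ContDiff ℝ (⊤ : ℕ∞) fun x : Eu d => ‖x - p‖ ^ 2 :=
    (contDiff_id.sub contDiff_const).norm_sq ℝ
  fun_prop

theorem wt_pos (α c : ℝ) (p x : Eu d) : 0 < wt α c p x := Real.exp_pos _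

theorem hasFDerivAt_norm_sub_sq (p x : Eu d) :
    HasFDerivAt (fun x : Eu d => ‖x - p‖ ^ 2) (2 • innerSL ℝ (x - p)) x := by
  have := ((hasFDerivAt_id x).sub_const p).norm_sq
  simpa using this

theorem gradient_wt (α c : ℝ) (p x : Eu d) :
    gradient (wt α c p) x = (-(α * wt α c p x)) • (x - p) := by
  refine gradient_eq_of_inner fun v => ?_
  have h1 := ((((hasFDerivAt_norm_sub_sq p x).const_mul (α / 2)).const_sub c).exp)
  have h2 : (fun y : Eu d => Real.exp (c - α / 2 * ‖y - p‖ ^ 2)) = wt α c p := by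
    ext y; unfold wt; congr 1; ring
  rw [h2] at h1
  rw [h1.fderiv, inner_smul_left]
  have h3 : Real.exp (c - α / 2 * ‖x - p‖ ^ 2) = wt α c p x := congrFun h2 x
  rw [h3]
  simp [inner_sub_left]
  ring

section Conjugate

variable {U : Set (Eu d)} {u v : Eu d → ℝ} {G : Eu d → Eu d} {ν α c : ℝ} {p : Eu d}

/-- Gradient of `wt • u`. -/
noncomputable def conjGrad (α c : ℝ) (p : Eu d) (u : Eu d → ℝ) (G : Eu d → Eu d) (x : Eu d) :
    Eu d := wt α c p x • (G x - (α * u x) • (x - p))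

theorem H10.conj (hU : Bornology.IsBounded U) (hu : H10 U u G) :
    H10 U (fun x => wt α c p x * u x) (conjGrad α c p u G) := by
  have h := hu.mul_smooth hU (contDiff_wt α c p)
  have e : (fun x => wt α c p x • G x + u x • gradient (wt α c p) x) = conjGrad α c p u G := by
    ext1 x
    rw [gradient_wt]; unfold conjGrad
    module
  rwa [e] at h

/-- The antisymmetric part of the conjugated operator. -/
noncomputable def asym (α : ℝ) (p : Eu d) (f : Eu d → ℝ) (F : Eu d → Eu d) (x : Eu d) : ℝ :=
  2 * α * inner ℝ (F x) (x - p) + d * α * f x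

theorem memLp_asym (hU : Bornology.IsBounded U) (hu : H10 U u G) :
    MemLp (asym α p u G) 2 volume := by
  have hz : Continuous fun x : Eu d => x - p := by fun_prop
  exact ((memLp_inner_vec hU hu.memF hu.zeroF hz).const_mul _).add (hu.memf.const_mul _)

theorem ip_inner_sub (hU : Bornology.IsBounded U) {f k : Eu d → ℝ} {F K : Eu d → Eu d}
    (hf : H10 U f F) (hk : H10 U k K) :
    ip f (asym α p k K) = -ip k (asym α p f F) := by
  have hz : Continuous fun x : Eu d => x - p := by fun_prop
  have m1 := memLp_inner_vec hU hf.memF hf.zeroF hz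
  have m2 := memLp_inner_vec hU hk.memF hk.zeroF hz
  have h := hf.euler hU hk p
  have e1 : ip f (asym α p k K) = 2 * α * (∫ x, f x * inner ℝ (K x) (x - p)) + d * α * ip f k := by
    unfold asym
    rw [ip_add_right (m2.const_mul (2 * α)) (hk.memf.const_mul (d * α)) hf.memf,
      ip_const_mul_right, ip_const_mul_right]
    rfl
  have e2 : ip k (asym α p f F) = 2 * α * (∫ x, k x * inner ℝ (F x) (x - p)) + d * α * ip f k := by
    unfold asym
    rw [ip_add_right (m1.const_mul (2 * α)) (hf.memf.const_mul (d * α)) hk.memf,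
      ip_const_mul_right, ip_const_mul_right, ip_comm k f]
    rfl
  have e3 : ∫ x, f x * k x = ip f k := rfl
  rw [e3] at h
  rw [e1, e2]
  linear_combination 2 * α * h

theorem ip_weight_asym (hU : Bornology.IsBounded U) {f : Eu d → ℝ} {F : Eu d → Eu d}
    (hf : H10 U f F) {m : Eu d → ℝ} (hm : ContDiff ℝ (⊤ : ℕ∞) m) :
    ip (fun x => m x * f x) (asym α p f F) =
      -(α * ∫ x, (inner ℝ (gradient m x) (x - p) : ℝ) * f x ^ 2) := by
  have hz : Continuous fun x : Eu d => x - p := by fun_prop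
  have m1 := memLp_inner_vec hU hf.memF hf.zeroF hz
  have m2 := memLp_mul_cont hU hf.memf hf.zerof hm.continuous
  have h := hf.euler_weight hU p hm
  unfold asym
  rw [ip_add_right (m1.const_mul (2 * α)) (hf.memf.const_mul (d * α)) m2,
      ip_const_mul_right, ip_const_mul_right]
  have e1 : ip (fun x => m x * f x) (fun x => (inner ℝ (F x) (x - p) : ℝ)) =
    ∫ x, m x * f x * inner ℝ (F x) (x - p) := rfl
  have e2 : ip (fun x => m x * f x) f = ∫ x, m x * f x ^ 2 := by
    unfold ip; congr 1; ext x; ring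
  rw [e1, e2]
  linear_combination α * h

theorem WeakEq.conj (hU : Bornology.IsBounded U) (hu : H10 U u G) (h : WeakEq U ν u G v)
    {w : Eu d → ℝ} {W : Eu d → Eu d} (hw : H10 U w W) :
    ip (fun x => wt α c p x * v x) w = -(∫ x, (inner ℝ (conjGrad α c p u G x) (W x) : ℝ))
      + ip (asym α p (fun x => wt α c p x * u x) (conjGrad α c p u G)) w
      - ip (fun x => (ν * ‖x‖ ^ 2 - α ^ 2 * ‖x - p‖ ^ 2) * (wt α c p x * u x)) w := by
  have hz : Continuous fun x : Eu d => x - p := by fun_prop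
  have hf : H10 U (fun x => wt α c p x * u x) (conjGrad α c p u G) := hu.conj hU
  have h1 := h _ _ (hw.conj (α := α) (c := c) (p := p) hU)
  set f := fun x => wt α c p x * u x with hfdef
  set F := conjGrad α c p u G with hF
  have n1 : ip (fun x => wt α c p x * v x) w = ∫ x, v x * (wt α c p x * w x) := by
    unfold ip; congr 1; ext x; ring
  have m1 := memLp_inner_vec hU hf.memF hf.zeroF hz
  have m2 := memLp_inner_vec hU hw.memF hw.zeroF hz
  have m3 := memLp_mul_cont hU hf.memf hf.zerof
    (show Continuous fun x : Eu d => ‖x - p‖ ^ 2 by fun_prop)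
  have m4 := memLp_mul_cont hU hf.memf hf.zerof (show Continuous fun x : Eu d => ‖x‖ ^ 2 by fun_prop)
  have i0 := integrable_inner_of_memLp hf.memF hw.memF
  have i1 : Integrable fun x => α * (w x * inner ℝ (F x) (x - p)) :=
    (integrable_mul_of_memLp hw.memf m1).const_mul α
  have i2 : Integrable fun x => α * (f x * inner ℝ (W x) (x - p)) :=
    (integrable_mul_of_memLp hf.memf m2).const_mul α
  have i3 : Integrable fun x => α ^ 2 * ((‖x - p‖ ^ 2 * f x) * w x) :=
    (integrable_mul_of_memLp m3 hw.memf).const_mul _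
  have n2 : ∫ x, (inner ℝ (G x) (conjGrad α c p w W x) : ℝ) =
      (∫ x, (inner ℝ (F x) (W x) : ℝ)) - α * (∫ x, w x * inner ℝ (F x) (x - p))
      + α * (∫ x, f x * inner ℝ (W x) (x - p)) - α ^ 2 * ip (fun x => ‖x - p‖ ^ 2 * f x) w := by
    unfold ip
    have i01 : Integrable fun x => (inner ℝ (F x) (W x) : ℝ) - α * (w x * inner ℝ (F x) (x - p)) :=
      i0.sub i1
    have i012 : Integrable fun x => (inner ℝ (F x) (W x) : ℝ) - α * (w x * inner ℝ (F x) (x - p)) +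
      α * (f x * inner ℝ (W x) (x - p)) := i01.add i2
    rw [← integral_const_mul, ← integral_const_mul, ← integral_const_mul, ← integral_sub i0 i1,
      ← integral_add i01 i2, ← integral_sub i012 i3]
    congr 1; ext x
    have e1 : wt α c p x • G x = F x + (α * f x) • (x - p) := by
      rw [hF, hfdef]; unfold conjGrad; module
    have e2 : (inner ℝ (G x) (conjGrad α c p w W x) : ℝ) =
        inner ℝ (wt α c p x • G x) (W x - (α * w x) • (x - p)) := by
      unfold conjGrad
      rw [inner_smul_right, inner_smul_left]; simp
    rw [e2, e1]
    generalize x - p = z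
    simp only [inner_add_left, inner_sub_right, inner_smul_left, inner_smul_right,
      real_inner_self_eq_norm_sq]
    simp only [conj_trivial]
    rw [real_inner_comm (W x) z]
    ring
  have n3 : ∫ x, ‖x‖ ^ 2 * u x * (wt α c p x * w x) = ip (fun x => ‖x‖ ^ 2 * f x) w := by
    unfold ip; congr 1; ext x; rw [hfdef]; ring
  have n4 : ip (fun x => (ν * ‖x‖ ^ 2 - α ^ 2 * ‖x - p‖ ^ 2) * f x) w =
      ν * ip (fun x => ‖x‖ ^ 2 * f x) w - α ^ 2 * ip (fun x => ‖x - p‖ ^ 2 * f x) w := by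
    rw [← ip_const_mul_left, ← ip_const_mul_left,
      ← ip_sub_left (m4.const_mul _) (m3.const_mul _) hw.memf]
    congr 1; ext x; ring
  have n5 : ip (asym α p f F) w =
      2 * α * (∫ x, w x * inner ℝ (F x) (x - p)) + d * α * (∫ x, f x * w x) := by
    unfold asym
    rw [ip_add_left (m1.const_mul (2 * α)) (hf.memf.const_mul (d * α)) hw.memf,
      ip_const_mul_left, ip_const_mul_left, ip_comm _ w]
    rfl
  have heul := hf.euler hU hw p
  rw [n1, h1, n2, n3, n4, n5]
  linear_combination (-α) * heul

end Conjugate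

end Grushin

namespace Grushin

variable {d : ℕ}

/-- `k` is the conjugated operator applied to `f`, weakly in `U`. -/
def ConjEq (U : Set (Eu d)) (ν α : ℝ) (p : Eu d) (f : Eu d → ℝ) (F : Eu d → Eu d)
    (k : Eu d → ℝ) : Prop :=
  ∀ w W, H10 U w W → ip k w = -(∫ x, (inner ℝ (F x) (W x) : ℝ)) + ip (asym α p f F) w
      - ip (fun x => (ν * ‖x‖ ^ 2 - α ^ 2 * ‖x - p‖ ^ 2) * f x) w

/-- The effective potential of the conjugated flow. -/
noncomputable def effPot (ν α a₁ s₁ : ℝ) (p x : Eu d) : ℝ :=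
  ν * ‖x‖ ^ 2 - α ^ 2 * ‖x - p‖ ^ 2 - (s₁ - a₁ / 2 * ‖x - p‖ ^ 2)

theorem contDiff_norm_sub_sq (p : Eu d) : ContDiff ℝ (⊤ : ℕ∞) fun x : Eu d => ‖x - p‖ ^ 2 :=
  (contDiff_id.sub contDiff_const).norm_sq ℝ

theorem contDiff_effPot (ν α a₁ s₁ : ℝ) (p : Eu d) :
    ContDiff ℝ (⊤ : ℕ∞) (effPot ν α a₁ s₁ p) := by
  have h := contDiff_norm_sub_sq p
  have h0 := contDiff_norm_sq ℝ (E := Eu d) (n := (⊤ : ℕ∞))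
  unfold effPot
  fun_prop

theorem gradient_quadratic (a b c : ℝ) (p x : Eu d) :
    gradient (fun x : Eu d => a * ‖x‖ ^ 2 + b * ‖x - p‖ ^ 2 + c) x =
      (2 * a) • x + (2 * b) • (x - p) := by
  refine gradient_eq_of_inner fun v => ?_
  have h1 := (hasFDerivAt_norm_sub_sq 0 x).const_mul a
  have h2 := (hasFDerivAt_norm_sub_sq p x).const_mul b
  have h := (h1.add h2).add_const c
  simp only [sub_zero] at h
  have e : fderiv ℝ (fun x : Eu d => a * ‖x‖ ^ 2 + b * ‖x - p‖ ^ 2 + c) x = _ := h.fderiv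
  rw [e]
  simp [inner_add_left, inner_smul_left, inner_sub_left]
  ring

theorem inner_gradient_effPot (ν α a₁ s₁ : ℝ) (p x : Eu d) :
    inner ℝ (gradient (effPot ν α a₁ s₁ p) x) (x - p) =
      2 * ν * inner ℝ x (x - p) + (a₁ - 2 * α ^ 2) * ‖x - p‖ ^ 2 := by
  have e : effPot ν α a₁ s₁ p =
      fun x : Eu d => ν * ‖x‖ ^ 2 + (a₁ / 2 - α ^ 2) * ‖x - p‖ ^ 2 + (-s₁) := by
    ext x; unfold effPot; ring
  rw [e, gradient_quadratic, inner_add_left, inner_smul_left, inner_smul_left,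
    real_inner_self_eq_norm_sq]
  simp only [conj_trivial]
  ring

section Static

variable {R ν α a₁ s₁ : ℝ} {p : Eu d} {f k k₂ : Eu d → ℝ} {F K : Eu d → Eu d}

theorem integrable_cont_mul_sq {U : Set (Eu d)} (hU : Bornology.IsBounded U) (hf : H10 U f F)
    {m : Eu d → ℝ} (hm : Continuous m) : Integrable fun x => m x * f x ^ 2 := by
  have := integrable_mul_of_memLp (memLp_mul_cont hU hf.memf hf.zerof hm) hf.memf
  refine this.congr (Eventually.of_forall fun x => ?_)
  simp only; ring

theorem ip_mul_self (m f : Eu d → ℝ) : ip (fun x => m x * f x) f = ∫ x, m x * f x ^ 2 := by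
  unfold ip; congr 1; ext x; ring

/-- First derivative of the weighted energy. -/
theorem ConjEq.first {U : Set (Eu d)} (hU : Bornology.IsBounded U) (hf : H10 U f F)
    (hk : MemLp k 2 volume) (hfk : ConjEq U ν α p f F k) :
    ip f (fun x => k x + (s₁ - a₁ / 2 * ‖x - p‖ ^ 2) * f x) =
      -(∫ x, ‖F x‖ ^ 2) - ∫ x, effPot ν α a₁ s₁ p x * f x ^ 2 := by
  have h1 := hfk f F hf
  have h2 : ip f (asym α p f F) = 0 := by
    have := ip_inner_sub (α := α) (p := p) hU hf hf
    linarith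
  have cm : Continuous fun x : Eu d => s₁ - a₁ / 2 * ‖x - p‖ ^ 2 := by fun_prop
  have cq : Continuous fun x : Eu d => ν * ‖x‖ ^ 2 - α ^ 2 * ‖x - p‖ ^ 2 := by fun_prop
  have mm := memLp_mul_cont hU hf.memf hf.zerof cm
  rw [ip_add_right hk mm hf.memf, ip_comm f k, h1, ip_comm _ f, h2, ip_comm f, ip_mul_self,
    ip_mul_self]
  have e : ∫ x, effPot ν α a₁ s₁ p x * f x ^ 2 =
      (∫ x, (ν * ‖x‖ ^ 2 - α ^ 2 * ‖x - p‖ ^ 2) * f x ^ 2) -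
        ∫ x, (s₁ - a₁ / 2 * ‖x - p‖ ^ 2) * f x ^ 2 := by
    rw [← integral_sub (integrable_cont_mul_sq hU hf cq) (integrable_cont_mul_sq hU hf cm)]
    congr 1; ext x; unfold effPot; ring
  rw [e]
  simp only [real_inner_self_eq_norm_sq]
  ring

/-- Second-order differential inequality for the weighted energy. -/
theorem ConjEq.second (hd : 2 ≤ d) (hp : ‖p‖ ≤ R) (hα : 0 ≤ α) {a₂ s₂ e : ℝ}
    (hf : H10 (ball 0 R) f F) (hk : H10 (ball 0 R) k K) (hk₂ : MemLp k₂ 2 volume)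
    (hfk : ConjEq (ball 0 R) ν α p f F k) (hkk : ConjEq (ball 0 R) ν α p k K k₂)
    (he : ∀ x ∈ ball (0 : Eu d) R, (a₂ / 2 - 2 * α * a₁) * ‖x - p‖ ^ 2 - s₂
      - 2 * α * (2 * ν * inner ℝ x (x - p) + (a₁ - 2 * α ^ 2) * ‖x - p‖ ^ 2)
      ≤ 4 * α * effPot ν α a₁ s₁ p x + e)
    {f₁ : Eu d → ℝ} (hf₁ : f₁ = fun x => k x + (s₁ - a₁ / 2 * ‖x - p‖ ^ 2) * f x)
    {f₂ : Eu d → ℝ} (hf₂ : f₂ = fun x => k₂ x + 2 * ((s₁ - a₁ / 2 * ‖x - p‖ ^ 2) * k x) +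
      ((s₂ - a₂ / 2 * ‖x - p‖ ^ 2) + (s₁ - a₁ / 2 * ‖x - p‖ ^ 2) ^ 2) * f x) :
    (2 * ip f f₁) ^ 2 + 4 * α * ip f f * (2 * ip f f₁) - 2 * e * ip f f ^ 2 ≤
      ip f f * (2 * ip f₁ f₁ + 2 * ip f f₂) := by
  have hU : Bornology.IsBounded (ball (0 : Eu d) R) := isBounded_ball
  set m : Eu d → ℝ := fun x => s₁ - a₁ / 2 * ‖x - p‖ ^ 2 with hm
  set n : Eu d → ℝ := fun x => s₂ - a₂ / 2 * ‖x - p‖ ^ 2 with hn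
  set q := effPot ν α a₁ s₁ p with hq
  set q₀ : Eu d → ℝ := fun x => ν * ‖x‖ ^ 2 - α ^ 2 * ‖x - p‖ ^ 2 with hq₀
  set Y := asym α p f F with hY
  have cm : Continuous m := by fun_prop
  have cn : Continuous n := by fun_prop
  have cq₀ : Continuous q₀ := by fun_prop
  have cq : Continuous q := (contDiff_effPot ν α a₁ s₁ p).continuous
  have mY : MemLp Y 2 volume := memLp_asym hU hf
  have mm := memLp_mul_cont hU hf.memf hf.zerof cm
  have mmk := memLp_mul_cont hU hk.memf hk.zerof cm
  have mnn := memLp_mul_cont hU hf.memf hf.zerof (show Continuous fun x => n x + m x ^ 2 by fun_prop)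
  have mq₀ := memLp_mul_cont hU hf.memf hf.zerof cq₀
  have mq := memLp_mul_cont hU hf.memf hf.zerof cq
  have mf₁ : MemLp f₁ 2 volume := by rw [hf₁]; exact hk.memf.add mm
  -- the commutator identity
  have X1 : ip f k₂ = ip k k - 2 * ip k Y := by
    have b := hkk f F hf
    have a := hfk k K hk
    have anti := ip_inner_sub (α := α) (p := p) hU hf hk
    have c1 : (∫ x, (inner ℝ (K x) (F x) : ℝ)) = ∫ x, (inner ℝ (F x) (K x) : ℝ) := by
      congr 1; ext x; exact real_inner_comm _ _
    have c2 : ip (fun x => q₀ x * k x) f = ip (fun x => q₀ x * f x) k := by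
      unfold ip; congr 1; ext x; ring
    rw [ip_comm f k₂, b, a, c1]
    rw [ip_comm (asym α p k K) f, anti, ip_comm Y k, c2]
    ring
  have X2 : ip (fun x => m x * f x) Y = α * a₁ * ∫ x, ‖x - p‖ ^ 2 * f x ^ 2 := by
    rw [ip_weight_asym hU hf (by rw [hm]; have := contDiff_norm_sub_sq p; fun_prop)]
    rw [← integral_const_mul, ← integral_const_mul, ← integral_neg]
    congr 1; ext x
    have e1 : m = fun x : Eu d => 0 * ‖x‖ ^ 2 + (-(a₁ / 2)) * ‖x - p‖ ^ 2 + s₁ := by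
      ext x; rw [hm]; ring
    rw [e1, gradient_quadratic, inner_add_left, inner_smul_left, inner_smul_left,
      real_inner_self_eq_norm_sq]
    simp only [conj_trivial]
    ring
  have X3 : ip f₁ f₁ = ip k k + 2 * ip k (fun x => m x * f x) +
      ip (fun x => m x * f x) (fun x => m x * f x) := by
    have e1 : f₁ = fun x => k x + (fun x => m x * f x) x := hf₁
    have mk : MemLp (fun x => k x + (fun x => m x * f x) x) 2 volume := hk.memf.add mm
    rw [e1, ip_add_left hk.memf mm mk, ip_add_right hk.memf mm hk.memf,
      ip_add_right hk.memf mm mm, ip_comm (fun x => m x * f x) k]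
    ring
  have X4 : ip f f₂ = ip f k₂ + 2 * ip k (fun x => m x * f x) +
      ((∫ x, n x * f x ^ 2) + ip (fun x => m x * f x) (fun x => m x * f x)) := by
    have m2 : MemLp (fun x => k₂ x + 2 * (m x * k x)) 2 volume := hk₂.add (mmk.const_mul 2)
    have e0 : f₂ = fun x => (k₂ x + 2 * (m x * k x)) + (n x + m x ^ 2) * f x := hf₂
    rw [e0, ip_add_right m2 mnn hf.memf,
      ip_add_right hk₂ (mmk.const_mul 2) hf.memf, ip_const_mul_right]
    have e1 : ip f (fun x => m x * k x) = ip k (fun x => m x * f x) := by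
      unfold ip; congr 1; ext x; ring
    have e2 : ip f (fun x => (n x + m x ^ 2) * f x) =
        (∫ x, n x * f x ^ 2) + ip (fun x => m x * f x) (fun x => m x * f x) := by
      unfold ip
      rw [← integral_add (integrable_cont_mul_sq hU hf cn) (integrable_mul_of_memLp mm mm)]
      congr 1; ext x; ring
    rw [e1, e2]
  have X5 : ip f₁ Y = ip k Y + ip (fun x => m x * f x) Y := by
    rw [hf₁, ip_add_left hk.memf mm mY]
  -- the square completed with `g = f₁ - Y`
  set g : Eu d → ℝ := fun x => f₁ x - Y x with hg
  have mg : MemLp g 2 volume := mf₁.sub mY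
  have X6 : ip f₁ f₁ - ip f₁ Y = ip g g + ip g Y := by
    have e1 : f₁ = fun x => g x + Y x := by ext x; rw [hg]; ring
    have e2 : ip f₁ f₁ - ip f₁ Y = ip f₁ g := by
      rw [hg, ip_sub_right mf₁ mY mf₁]
    rw [e2]
    conv_lhs => rw [e1]
    rw [ip_add_left mg mY mg, ip_comm Y g]
  set h : Eu d → ℝ := fun x => k x - Y x + q₀ x * f x with hh
  have mh : MemLp h 2 volume := (hk.memf.sub mY).add mq₀
  have hw : ∀ w W, H10 (ball 0 R) w W → ∫ x, h x * w x = -∫ x, (inner ℝ (F x) (W x) : ℝ) := by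
    intro w W hw
    have a := hfk w W hw
    have e1 : ip h w = ip k w - ip Y w + ip (fun x => q₀ x * f x) w := by
      have m2 : MemLp (fun x => k x - Y x) 2 volume := hk.memf.sub mY
      rw [hh, ip_add_left m2 mq₀ hw.memf, ip_sub_left hk.memf mY hw.memf]
    change ip h w = _
    rw [e1, a]; ring
  have poh := pohozaev hd hp hf mh hw
  have hhf := hw f F hf
  have X7 : -(2 * α * ∫ x, ‖F x‖ ^ 2) ≤ ip h Y := by
    have hz : Continuous fun x : Eu d => x - p := by fun_prop
    have m1 := memLp_inner_vec hU hf.memF hf.zeroF hz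
    have e1 : ip h Y = 2 * α * (∫ x, h x * inner ℝ (F x) (x - p)) + d * α * (∫ x, h x * f x) := by
      rw [hY]; unfold asym
      rw [ip_add_right (m1.const_mul (2 * α)) (hf.memf.const_mul (d * α)) mh,
        ip_const_mul_right, ip_const_mul_right]
      rfl
    rw [e1, hhf]
    simp only [real_inner_self_eq_norm_sq]
    nlinarith [mul_le_mul_of_nonneg_left poh hα]
  have X8 : ip g Y = ip h Y - ip (fun x => q x * f x) Y := by
    rw [← ip_sub_left mh mq mY]
    congr 1; ext x
    simp only [hg, hf₁, hh, hq, effPot, hq₀]; ring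
  have X9 : ip (fun x => q x * f x) Y = -(α * ∫ x, (2 * ν * inner ℝ x (x - p) +
      (a₁ - 2 * α ^ 2) * ‖x - p‖ ^ 2) * f x ^ 2) := by
    rw [ip_weight_asym hU hf (contDiff_effPot ν α a₁ s₁ p)]
    congr 3; ext x
    rw [inner_gradient_effPot]
  have X10 : ip f f₁ = -(∫ x, ‖F x‖ ^ 2) - ∫ x, q x * f x ^ 2 := by
    rw [hf₁]; exact hfk.first hU hf hk.memf
  have X11 : ip f f₁ = ip f g := by
    have : ip f Y = 0 := by
      have := ip_inner_sub (α := α) (p := p) hU hf hf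
      linarith
    rw [hg, ip_sub_right mf₁ mY hf.memf, this, sub_zero]
  have X12 : ip f g ^ 2 ≤ ip f f * ip g g := ip_sq_le hf.memf mg
  have X13 : 2 * α * a₁ * (∫ x, ‖x - p‖ ^ 2 * f x ^ 2) + (∫ x, n x * f x ^ 2) +
      2 * α * (∫ x, (2 * ν * inner ℝ x (x - p) +
      (a₁ - 2 * α ^ 2) * ‖x - p‖ ^ 2) * f x ^ 2) ≥
      -(4 * α * (∫ x, q x * f x ^ 2) + e * ip f f) := by
    have i1 : Integrable fun x => ‖x - p‖ ^ 2 * f x ^ 2 :=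
      integrable_cont_mul_sq hU hf (by fun_prop)
    have i2 := integrable_cont_mul_sq hU hf cn
    have i3 : Integrable fun x => (2 * ν * inner ℝ x (x - p) +
      (a₁ - 2 * α ^ 2) * ‖x - p‖ ^ 2) * f x ^ 2 := integrable_cont_mul_sq hU hf (by fun_prop)
    have i4 := integrable_cont_mul_sq hU hf cq
    have i5 : Integrable fun x => f x * f x := integrable_mul_of_memLp hf.memf hf.memf
    have j1 : Integrable fun x => 2 * α * a₁ * (‖x - p‖ ^ 2 * f x ^ 2) + n x * f x ^ 2 :=
      (i1.const_mul _).add i2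
    have j2 : Integrable fun x => 2 * α * a₁ * (‖x - p‖ ^ 2 * f x ^ 2) + n x * f x ^ 2 +
      2 * α * ((2 * ν * inner ℝ x (x - p) + (a₁ - 2 * α ^ 2) * ‖x - p‖ ^ 2) * f x ^ 2) :=
      j1.add (i3.const_mul _)
    have j3 : Integrable fun x => 4 * α * (q x * f x ^ 2) + e * (f x * f x) :=
      (i4.const_mul _).add (i5.const_mul _)
    unfold ip
    rw [← integral_const_mul, ← integral_const_mul, ← integral_const_mul, ← integral_const_mul,
      ← integral_add (i1.const_mul _) i2, ← integral_add j1 (i3.const_mul _),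
      ← integral_add (i4.const_mul _) (i5.const_mul _), ← integral_neg]
    refine integral_mono j3.neg j2 fun x => ?_
    by_cases hx : x ∈ ball (0 : Eu d) R
    · have := mul_le_mul_of_nonneg_right (he x hx) (sq_nonneg (f x))
      simp only [hn]
      nlinarith [this]
    · simp [hf.zerof x hx]
  have hI := ip_self_nonneg f
  have key : 4 * ip g g + 4 * α * (2 * ip f f₁) - 2 * e * ip f f ≤
      2 * ip f₁ f₁ + 2 * ip f f₂ := by
    have : ip f₁ f₁ + ip f f₂ = 2 * (ip g g + ip g Y) + (2 * α * a₁ *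
        (∫ x, ‖x - p‖ ^ 2 * f x ^ 2) + ∫ x, n x * f x ^ 2) := by
      rw [← X6]
      linear_combination X4 + X1 - X3 + 2 * X5 + 2 * X2
    rw [X8, X9] at this
    rw [X10]
    linarith
  have := mul_le_mul_of_nonneg_left key hI
  rw [X11] at *
  nlinarith [this, X12]

end Static

end Grushin

namespace Grushin

variable {d : ℕ}

theorem hasDerivAt_ip_sum {ι : Type*} (J : Finset ι) {ψ : ι → Eu d → ℝ} {U : Set (Eu d)}
    (hU : Bornology.IsBounded U) (hψ : ∀ i ∈ J, MemLp (ψ i) 2 volume)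
    (h0 : ∀ i ∈ J, ∀ x ∉ U, ψ i x = 0) {S : Set ℝ} (hS : IsOpen S)
    {a a' b b' : ι → ℝ → Eu d → ℝ}
    (ha : ∀ i ∈ J, ∀ t ∈ S, ∀ x, HasDerivAt (fun t => a i t x) (a' i t x) t)
    (hb : ∀ i ∈ J, ∀ t ∈ S, ∀ x, HasDerivAt (fun t => b i t x) (b' i t x) t)
    (ca : ∀ i ∈ J, ContinuousOn (fun q : ℝ × Eu d => a i q.1 q.2) (S ×ˢ univ))
    (ca' : ∀ i ∈ J, ContinuousOn (fun q : ℝ × Eu d => a' i q.1 q.2) (S ×ˢ univ))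
    (cb : ∀ i ∈ J, ContinuousOn (fun q : ℝ × Eu d => b i q.1 q.2) (S ×ˢ univ))
    (cb' : ∀ i ∈ J, ContinuousOn (fun q : ℝ × Eu d => b' i q.1 q.2) (S ×ˢ univ))
    {t₀ : ℝ} (ht₀ : t₀ ∈ S) :
    HasDerivAt (fun t => ip (fun x => ∑ i ∈ J, a i t x * ψ i x) (fun x => ∑ i ∈ J, b i t x * ψ i x))
      (ip (fun x => ∑ i ∈ J, a' i t₀ x * ψ i x) (fun x => ∑ i ∈ J, b i t₀ x * ψ i x) +
        ip (fun x => ∑ i ∈ J, a i t₀ x * ψ i x) (fun x => ∑ i ∈ J, b' i t₀ x * ψ i x)) t₀ := by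
  obtain ⟨ε, hε, hεS⟩ := Metric.nhds_basis_closedBall.mem_iff.1 (hS.mem_nhds ht₀)
  set Q : Set (ℝ × Eu d) := closedBall t₀ ε ×ˢ closure U with hQ
  have hQc : IsCompact Q := (isCompact_closedBall t₀ ε).prod hU.isCompact_closure
  have hQS : Q ⊆ S ×ˢ univ := prod_mono hεS (subset_univ _)
  have bd : ∀ (g : ι → ℝ → Eu d → ℝ),
      (∀ i ∈ J, ContinuousOn (fun q : ℝ × Eu d => g i q.1 q.2) (S ×ˢ univ)) →
      ∃ C : ℝ, 0 ≤ C ∧ ∀ i ∈ J, ∀ q ∈ Q, |g i q.1 q.2| ≤ C := by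
    intro g hg
    have : ∀ i, ∃ C : ℝ, 0 ≤ C ∧ (i ∈ J → ∀ q ∈ Q, |g i q.1 q.2| ≤ C) := fun i => by
      by_cases hi : i ∈ J
      · obtain ⟨C, hC⟩ := hQc.exists_bound_of_continuousOn ((hg i hi).mono hQS)
        exact ⟨max C 0, le_max_right _ _, fun _ q hq => (hC q hq).trans (le_max_left _ _)⟩
      · exact ⟨0, le_rfl, fun h => absurd h hi⟩
    choose C hC0 hC using this
    refine ⟨∑ i ∈ J, C i, Finset.sum_nonneg fun i _ => hC0 i, fun i hi q hq => ?_⟩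
    exact (hC i hi q hq).trans (Finset.single_le_sum (f := C) (fun i _ => hC0 i) hi)
  obtain ⟨A, hA0, hA⟩ := bd a ca
  obtain ⟨A', hA'0, hA'⟩ := bd a' ca'
  obtain ⟨B, hB0, hB⟩ := bd b cb
  obtain ⟨B', hB'0, hB'⟩ := bd b' cb'
  set Ψ : Eu d → ℝ := fun x => ∑ i ∈ J, |ψ i x| with hΨ
  have mΨ : MemLp Ψ 2 volume := by
    have := memLp_finsetSum J (f := fun i x => |ψ i x|) fun i hi => (hψ i hi).abs
    exact this
  have sumle : ∀ (g : ι → ℝ → Eu d → ℝ) (C : ℝ), (∀ i ∈ J, ∀ q ∈ Q, |g i q.1 q.2| ≤ C) →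
      ∀ t ∈ closedBall t₀ ε, ∀ x, |∑ i ∈ J, g i t x * ψ i x| ≤ C * Ψ x := by
    intro g C hC t ht x
    rw [hΨ, Finset.mul_sum]
    refine (Finset.abs_sum_le_sum_abs _ _).trans (Finset.sum_le_sum fun i hi => ?_)
    rw [abs_mul]
    by_cases hx : x ∈ U
    · exact mul_le_mul_of_nonneg_right (hC i hi (t, x) ⟨ht, subset_closure hx⟩) (abs_nonneg _)
    · simp [h0 i hi x hx]
  have meas : ∀ (g : ι → ℝ → Eu d → ℝ),
      (∀ i ∈ J, ContinuousOn (fun q : ℝ × Eu d => g i q.1 q.2) (S ×ˢ univ)) → ∀ t ∈ S,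
      AEStronglyMeasurable (fun x => ∑ i ∈ J, g i t x * ψ i x) volume := by
    intro g hg t ht
    refine Finset.aestronglyMeasurable_fun_sum J fun i hi => ?_
    have : Continuous fun x => g i t x := by
      rw [← continuousOn_univ]
      exact (hg i hi).comp (f := fun x : Eu d => (t, x)) (by fun_prop) fun x _ => ⟨ht, mem_univ _⟩
    exact this.aestronglyMeasurable.mul (hψ i hi).1
  have hΨ2 : Integrable fun x => Ψ x * Ψ x := integrable_mul_of_memLp mΨ mΨ
  have hball : ball t₀ ε ∈ nhds t₀ := ball_mem_nhds _ hε
  have hbS : ∀ t ∈ ball t₀ ε, t ∈ S := fun t ht => hεS (ball_subset_closedBall ht)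
  have key := hasDerivAt_integral_of_dominated_loc_of_deriv_le (μ := (volume : Measure (Eu d)))
    (F := fun t x => (∑ i ∈ J, a i t x * ψ i x) * (∑ i ∈ J, b i t x * ψ i x))
    (F' := fun t x => (∑ i ∈ J, a' i t x * ψ i x) * (∑ i ∈ J, b i t x * ψ i x) +
      (∑ i ∈ J, a i t x * ψ i x) * (∑ i ∈ J, b' i t x * ψ i x))
    (x₀ := t₀) (bound := fun x => (A' * B + A * B') * (Ψ x * Ψ x)) hball ?_ ?_ ?_ ?_ ?_ ?_
  · have h2 := key.2
    rw [integral_add] at h2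
    · exact h2
    · exact (hΨ2.const_mul (A' * B)).mono' ((meas a' ca' t₀ ht₀).mul (meas b cb t₀ ht₀))
        (Eventually.of_forall fun x => by
          rw [Real.norm_eq_abs, abs_mul]
          have h1 := sumle a' A' hA' t₀ (mem_closedBall_self hε.le) x
          have h2 := sumle b B hB t₀ (mem_closedBall_self hε.le) x
          calc _ ≤ (A' * Ψ x) * (B * Ψ x) := mul_le_mul h1 h2 (abs_nonneg _)
                ((abs_nonneg _).trans h1)
            _ = _ := by ring)
    · exact (hΨ2.const_mul (A * B')).mono' ((meas a ca t₀ ht₀).mul (meas b' cb' t₀ ht₀))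
        (Eventually.of_forall fun x => by
          rw [Real.norm_eq_abs, abs_mul]
          have h1 := sumle a A hA t₀ (mem_closedBall_self hε.le) x
          have h2 := sumle b' B' hB' t₀ (mem_closedBall_self hε.le) x
          calc _ ≤ (A * Ψ x) * (B' * Ψ x) := mul_le_mul h1 h2 (abs_nonneg _)
                ((abs_nonneg _).trans h1)
            _ = _ := by ring)
  · filter_upwards [hball] with t ht
    exact (meas a ca t (hbS t ht)).mul (meas b cb t (hbS t ht))
  · exact (hΨ2.const_mul (A * B)).mono' ((meas a ca t₀ ht₀).mul (meas b cb t₀ ht₀))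
        (Eventually.of_forall fun x => by
          rw [Real.norm_eq_abs, abs_mul]
          have h1 := sumle a A hA t₀ (mem_closedBall_self hε.le) x
          have h2 := sumle b B hB t₀ (mem_closedBall_self hε.le) x
          calc _ ≤ (A * Ψ x) * (B * Ψ x) := mul_le_mul h1 h2 (abs_nonneg _)
                ((abs_nonneg _).trans h1)
            _ = _ := by ring)
  · exact ((meas a' ca' t₀ ht₀).mul (meas b cb t₀ ht₀)).add
      ((meas a ca t₀ ht₀).mul (meas b' cb' t₀ ht₀))
  · refine Eventually.of_forall fun x t ht => ?_
    have ht' := ball_subset_closedBall ht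
    have h1 := sumle a A hA t ht' x
    have h2 := sumle b B hB t ht' x
    have h3 := sumle a' A' hA' t ht' x
    have h4 := sumle b' B' hB' t ht' x
    rw [Real.norm_eq_abs]
    refine (abs_add_le _ _).trans ?_
    rw [abs_mul, abs_mul]
    calc _ ≤ (A' * Ψ x) * (B * Ψ x) + (A * Ψ x) * (B' * Ψ x) :=
          add_le_add (mul_le_mul h3 h2 (abs_nonneg _) ((abs_nonneg _).trans h3))
            (mul_le_mul h1 h4 (abs_nonneg _) ((abs_nonneg _).trans h1))
      _ = _ := by ring
  · exact hΨ2.const_mul _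
  · refine Eventually.of_forall fun x t ht => ?_
    have ht' := hbS t ht
    refine HasDerivAt.mul ?_ ?_
    · exact HasDerivAt.fun_sum fun i hi => (ha i hi t ht' x).mul_const _
    · exact HasDerivAt.fun_sum fun i hi => (hb i hi t ht' x).mul_const _

section Sums

variable {U : Set (Eu d)} {ν : ℝ}

theorem WeakEq.zero : WeakEq U ν (fun _ => 0) (fun _ => 0) (fun _ => 0) := by
  intro w W _; simp

theorem WeakEq.add_smul (hU : Bornology.IsBounded U) {u u' v v' : Eu d → ℝ} {G G' : Eu d → Eu d}
    (hu : H10 U u G) (hu' : H10 U u' G') (hv : MemLp v 2 volume) (hv' : MemLp v' 2 volume)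
    (h : WeakEq U ν u G v) (h' : WeakEq U ν u' G' v') (c : ℝ) :
    WeakEq U ν (fun x => c * u x + u' x) (fun x => c • G x + G' x) (fun x => c * v x + v' x) := by
  intro w W hw
  have e := h w W hw
  have e' := h' w W hw
  have cx : Continuous fun x : Eu d => ‖x‖ ^ 2 := by fun_prop
  have i1 := integrable_mul_of_memLp hv hw.memf
  have i2 := integrable_mul_of_memLp hv' hw.memf
  have i3 := integrable_inner_of_memLp hu.memF hw.memF
  have i4 := integrable_inner_of_memLp hu'.memF hw.memF
  have i5 := integrable_mul_of_memLp (memLp_mul_cont hU hu.memf hu.zerof cx) hw.memf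
  have i6 := integrable_mul_of_memLp (memLp_mul_cont hU hu'.memf hu'.zerof cx) hw.memf
  have n1 : ∫ x, (c * v x + v' x) * w x = c * (∫ x, v x * w x) + ∫ x, v' x * w x := by
    rw [← integral_const_mul, ← integral_add (i1.const_mul c) i2]
    congr 1; ext x; ring
  have n2 : ∫ x, (inner ℝ (c • G x + G' x) (W x) : ℝ) =
      c * (∫ x, (inner ℝ (G x) (W x) : ℝ)) + ∫ x, (inner ℝ (G' x) (W x) : ℝ) := by
    rw [← integral_const_mul, ← integral_add (i3.const_mul c) i4]
    congr 1; ext x; rw [inner_add_left, inner_smul_left]; simp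
  have n3 : ∫ x, ‖x‖ ^ 2 * (c * u x + u' x) * w x =
      c * (∫ x, ‖x‖ ^ 2 * u x * w x) + ∫ x, ‖x‖ ^ 2 * u' x * w x := by
    rw [← integral_const_mul, ← integral_add (i5.const_mul c) i6]
    congr 1; ext x; ring
  rw [n1, n2, n3, e, e']
  ring

theorem WeakEq.sum (hU : Bornology.IsBounded U) {ι : Type*} (s : Finset ι)
    {u v : ι → Eu d → ℝ} {G : ι → Eu d → Eu d} (hu : ∀ i ∈ s, H10 U (u i) (G i))
    (hv : ∀ i ∈ s, MemLp (v i) 2 volume) (h : ∀ i ∈ s, WeakEq U ν (u i) (G i) (v i)) (c : ι → ℝ) :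
    WeakEq U ν (fun x => ∑ i ∈ s, c i * u i x) (fun x => ∑ i ∈ s, c i • G i x)
      (fun x => ∑ i ∈ s, c i * v i x) := by
  classical
  induction s using Finset.induction_on with
  | empty => simpa using WeakEq.zero
  | insert a s ha ih =>
    simp only [Finset.sum_insert ha]
    have hs : ∀ i ∈ s, i ∈ insert a s := fun i hi => Finset.mem_insert_of_mem hi
    have ha' := Finset.mem_insert_self a s
    refine WeakEq.add_smul hU (hu a ha') (H10.sum s c fun i hi => hu i (hs i hi)) (hv a ha') ?_
      (h a ha') (ih (fun i hi => hu i (hs i hi)) (fun i hi => hv i (hs i hi))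
        fun i hi => h i (hs i hi)) _
    exact memLp_finsetSum s fun i hi => (hv i (hs i hi)).const_mul (c i)

end Sums

end Grushin

namespace Grushin

variable {d : ℕ}

/-- A finite orthonormal family of Dirichlet eigenfunctions of `-Δ + ν‖x‖²` on `B_R`. -/
structure Modes (R ν : ℝ) {ι : Type*} (J : Finset ι) (ψ : ι → Eu d → ℝ) (G : ι → Eu d → Eu d)
    (lam : ι → ℝ) : Prop where
  h10 : ∀ i ∈ J, H10 (ball 0 R) (ψ i) (G i)
  weak : ∀ i ∈ J, WeakEq (ball 0 R) ν (ψ i) (G i) (fun x => -lam i * ψ i x)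
  unit : ∀ i ∈ J, ip (ψ i) (ψ i) = 1
  orth : ∀ i ∈ J, ∀ j ∈ J, i ≠ j → ip (ψ i) (ψ j) = 0

/-- The `k`-th time derivative of the flow `∑ cᵢ exp(-λᵢ t) ψᵢ`. -/
noncomputable def flow {ι : Type*} (J : Finset ι) (ψ : ι → Eu d → ℝ) (lam c : ι → ℝ) (k : ℕ)
    (t : ℝ) (x : Eu d) : ℝ :=
  ∑ i ∈ J, (c i * (-lam i) ^ k * Real.exp (-lam i * t)) * ψ i x

/-- The gradient of `flow`. -/
noncomputable def gflow {ι : Type*} (J : Finset ι) (G : ι → Eu d → Eu d) (lam c : ι → ℝ) (k : ℕ)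
    (t : ℝ) (x : Eu d) : Eu d :=
  ∑ i ∈ J, (c i * (-lam i) ^ k * Real.exp (-lam i * t)) • G i x

/-- A Gaussian weight profile: the functions `α`, `s` together with two derivatives on `S`. -/
structure Profile (S : Set ℝ) (α α₁ α₂ s s₁ s₂ : ℝ → ℝ) : Prop where
  isOpen : IsOpen S
  dα : ∀ t ∈ S, HasDerivAt α (α₁ t) t
  dα₁ : ∀ t ∈ S, HasDerivAt α₁ (α₂ t) t
  cα₂ : ContinuousOn α₂ S
  ds : ∀ t ∈ S, HasDerivAt s (s₁ t) t
  ds₁ : ∀ t ∈ S, HasDerivAt s₁ (s₂ t) t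
  cs₂ : ContinuousOn s₂ S

/-- The weighted flow. -/
noncomputable def wflow {ι : Type*} (J : Finset ι) (ψ : ι → Eu d → ℝ) (lam c : ι → ℝ)
    (α s : ℝ → ℝ) (p : Eu d) (t : ℝ) (x : Eu d) : ℝ :=
  wt (α t) (s t) p x * flow J ψ lam c 0 t x

/-- The time derivative of the weighted flow. -/
noncomputable def wflow₁ {ι : Type*} (J : Finset ι) (ψ : ι → Eu d → ℝ) (lam c : ι → ℝ)
    (α α₁ s s₁ : ℝ → ℝ) (p : Eu d) (t : ℝ) (x : Eu d) : ℝ :=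
  wt (α t) (s t) p x * flow J ψ lam c 1 t x +
    (s₁ t - α₁ t / 2 * ‖x - p‖ ^ 2) * (wt (α t) (s t) p x * flow J ψ lam c 0 t x)

/-- The second time derivative of the weighted flow. -/
noncomputable def wflow₂ {ι : Type*} (J : Finset ι) (ψ : ι → Eu d → ℝ) (lam c : ι → ℝ)
    (α α₁ α₂ s s₁ s₂ : ℝ → ℝ) (p : Eu d) (t : ℝ) (x : Eu d) : ℝ :=
  wt (α t) (s t) p x * flow J ψ lam c 2 t x +
    2 * ((s₁ t - α₁ t / 2 * ‖x - p‖ ^ 2) * (wt (α t) (s t) p x * flow J ψ lam c 1 t x)) +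
    ((s₂ t - α₂ t / 2 * ‖x - p‖ ^ 2) + (s₁ t - α₁ t / 2 * ‖x - p‖ ^ 2) ^ 2) *
      (wt (α t) (s t) p x * flow J ψ lam c 0 t x)

/-- The weighted energy. -/
noncomputable def wE {ι : Type*} (J : Finset ι) (ψ : ι → Eu d → ℝ) (lam c : ι → ℝ)
    (α s : ℝ → ℝ) (p : Eu d) (t : ℝ) : ℝ :=
  ip (wflow J ψ lam c α s p t) (wflow J ψ lam c α s p t)

/-- The frequency function, `-1/2` of the logarithmic derivative of the weighted energy. -/
noncomputable def wN {ι : Type*} (J : Finset ι) (ψ : ι → Eu d → ℝ) (lam c : ι → ℝ)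
    (α α₁ s s₁ : ℝ → ℝ) (p : Eu d) (t : ℝ) : ℝ :=
  -ip (wflow J ψ lam c α s p t) (wflow₁ J ψ lam c α α₁ s s₁ p t) / wE J ψ lam c α s p t

namespace Modes

variable {R ν : ℝ} {ι : Type*} {J : Finset ι} {ψ : ι → Eu d → ℝ} {G : ι → Eu d → Eu d}
  {lam c : ι → ℝ} {S : Set ℝ} {α α₁ α₂ s s₁ s₂ : ℝ → ℝ} {p : Eu d}

theorem h10_flow (H : Modes R ν J ψ G lam) (c : ι → ℝ) (k : ℕ) (t : ℝ) :
    H10 (ball 0 R) (flow J ψ lam c k t) (gflow J G lam c k t) :=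
  H10.sum J _ H.h10

theorem weak_flow (H : Modes R ν J ψ G lam) (c : ι → ℝ) (k : ℕ) (t : ℝ) :
    WeakEq (ball 0 R) ν (flow J ψ lam c k t) (gflow J G lam c k t) (flow J ψ lam c (k + 1) t) := by
  have := WeakEq.sum isBounded_ball J H.h10 (fun i hi => (H.h10 i hi).memf.const_mul _) H.weak
    (fun i => c i * (-lam i) ^ k * Real.exp (-lam i * t))
  have e : flow J ψ lam c (k + 1) t = fun x =>
      ∑ i ∈ J, c i * (-lam i) ^ k * Real.exp (-lam i * t) * (-lam i * ψ i x) := by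
    ext x
    unfold flow
    refine Finset.sum_congr rfl fun i _ => ?_
    ring
  rw [e]
  exact this

theorem ip_flow (H : Modes R ν J ψ G lam) (c : ι → ℝ) (t : ℝ) :
    ip (flow J ψ lam c 0 t) (flow J ψ lam c 0 t) =
      ∑ i ∈ J, (c i * Real.exp (-lam i * t)) ^ 2 := by
  have hI : ∀ i ∈ J, ∀ j ∈ J, Integrable fun x => (c i * Real.exp (-lam i * t)) *
      (c j * Real.exp (-lam j * t)) * (ψ i x * ψ j x) := fun i hi j hj =>
    (integrable_mul_of_memLp (H.h10 i hi).memf (H.h10 j hj).memf).const_mul _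
  have e : ∀ x, flow J ψ lam c 0 t x * flow J ψ lam c 0 t x = ∑ i ∈ J, ∑ j ∈ J,
      (c i * Real.exp (-lam i * t)) * (c j * Real.exp (-lam j * t)) * (ψ i x * ψ j x) := by
    intro x
    unfold flow
    rw [Finset.sum_mul_sum]
    refine Finset.sum_congr rfl fun i _ => Finset.sum_congr rfl fun j _ => ?_
    ring
  unfold ip
  simp_rw [e]
  rw [integral_finsetSum _ fun i hi => integrable_finsetSum _ fun j hj => hI i hi j hj]
  refine Finset.sum_congr rfl fun i hi => ?_
  rw [integral_finsetSum _ fun j hj => hI i hi j hj]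
  rw [Finset.sum_eq_single_of_mem i hi]
  · rw [integral_const_mul]
    have : ∫ x, ψ i x * ψ i x = 1 := H.unit i hi
    rw [this]; ring
  · intro j hj hji
    rw [integral_const_mul]
    have : ∫ x, ψ i x * ψ j x = 0 := H.orth i hi j hj hji.symm
    rw [this, mul_zero]

theorem h10_wflow (H : Modes R ν J ψ G lam) (c : ι → ℝ) (α s : ℝ → ℝ) (p : Eu d) (t : ℝ) :
    H10 (ball 0 R) (wflow J ψ lam c α s p t)
      (conjGrad (α t) (s t) p (flow J ψ lam c 0 t) (gflow J G lam c 0 t)) :=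
  (H.h10_flow c 0 t).conj isBounded_ball

theorem wE_pos (H : Modes R ν J ψ G lam) (hc : ∑ i ∈ J, c i ^ 2 ≠ 0) (α s : ℝ → ℝ) (p : Eu d)
    (t : ℝ) : 0 < wE J ψ lam c α s p t := by
  have hm := (H.h10_wflow c α s p t).memf
  have hu := (H.h10_flow c 0 t).memf
  refine lt_of_le_of_ne (ip_self_nonneg _) fun h => hc ?_
  have h0 : (fun x => wflow J ψ lam c α s p t x * wflow J ψ lam c α s p t x) =ᵐ[volume] 0 :=
    (integral_eq_zero_iff_of_nonneg (fun x => mul_self_nonneg _)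
      (integrable_mul_of_memLp hm hm)).1 h.symm
  have h1 : ip (flow J ψ lam c 0 t) (flow J ψ lam c 0 t) = 0 := by
    unfold ip
    rw [integral_eq_zero_of_ae]
    filter_upwards [h0] with x hx
    have : wflow J ψ lam c α s p t x = 0 := mul_self_eq_zero.1 hx
    unfold wflow at this
    have := (mul_eq_zero.1 this).resolve_left (wt_pos _ _ _ _).ne'
    simp [this]
  rw [H.ip_flow, Finset.sum_eq_zero_iff_of_nonneg fun i _ => sq_nonneg _] at h1
  refine Finset.sum_eq_zero fun i hi => ?_
  have := h1 i hi
  rw [sq_eq_zero_iff, mul_eq_zero] at this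
  rw [this.resolve_right (Real.exp_pos _).ne']
  simp

/-- The coefficients of the weighted flow and of its time derivatives. -/
theorem hasDerivAt_coef (P : Profile S α α₁ α₂ s s₁ s₂) (l : ℝ) (p x : Eu d) {t : ℝ} (ht : t ∈ S) :
    HasDerivAt (fun t => wt (α t) (s t) p x * Real.exp (-l * t))
      ((-l + (s₁ t - α₁ t / 2 * ‖x - p‖ ^ 2)) * (wt (α t) (s t) p x * Real.exp (-l * t))) t := by
  unfold wt
  have h1 := (((P.ds t ht).sub (((P.dα t ht).mul_const (‖x - p‖ ^ 2)).div_const 2)).exp).mul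
    (((hasDerivAt_id t).const_mul (-l)).exp)
  refine h1.congr_deriv ?_
  simp only [id, Pi.sub_apply]
  ring

theorem wE_deriv (P : Profile S α α₁ α₂ s s₁ s₂) (H : Modes R ν J ψ G lam) {t : ℝ} (ht : t ∈ S) :
    HasDerivAt (wE J ψ lam c α s p) (2 * ip (wflow J ψ lam c α s p t)
        (wflow₁ J ψ lam c α α₁ s s₁ p t)) t ∧
    HasDerivAt (fun t => ip (wflow J ψ lam c α s p t) (wflow₁ J ψ lam c α α₁ s s₁ p t))
      (ip (wflow₁ J ψ lam c α α₁ s s₁ p t) (wflow₁ J ψ lam c α α₁ s s₁ p t) +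
        ip (wflow J ψ lam c α s p t) (wflow₂ J ψ lam c α α₁ α₂ s s₁ s₂ p t)) t := by
  set E : ι → ℝ → Eu d → ℝ := fun i t x => wt (α t) (s t) p x * Real.exp (-lam i * t) with hE
  set m : ι → ℝ → Eu d → ℝ := fun i t x => -lam i + (s₁ t - α₁ t / 2 * ‖x - p‖ ^ 2) with hm
  set n : ℝ → Eu d → ℝ := fun t x => s₂ t - α₂ t / 2 * ‖x - p‖ ^ 2 with hn
  have dE : ∀ i, ∀ t ∈ S, ∀ x, HasDerivAt (fun t => E i t x) (m i t x * E i t x) t :=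
    fun i t ht x => hasDerivAt_coef P (lam i) p x ht
  have dm : ∀ i, ∀ t ∈ S, ∀ x, HasDerivAt (fun t => m i t x) (n t x) t := fun i t ht x => by
    have := ((P.ds₁ t ht).sub (((P.dα₁ t ht).div_const 2).mul_const (‖x - p‖ ^ 2))).const_add
      (-lam i)
    exact this
  have e0 : ∀ t, wflow J ψ lam c α s p t = fun x => ∑ i ∈ J, (c i * E i t x) * ψ i x := fun t => by
    ext x
    unfold wflow flow
    rw [Finset.mul_sum]
    refine Finset.sum_congr rfl fun i _ => ?_
    simp only [hE]; ring
  have e1 : ∀ t, wflow₁ J ψ lam c α α₁ s s₁ p t =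
      fun x => ∑ i ∈ J, (c i * (m i t x * E i t x)) * ψ i x := fun t => by
    ext x
    unfold wflow₁ flow
    rw [Finset.mul_sum, Finset.mul_sum, Finset.mul_sum, ← Finset.sum_add_distrib]
    refine Finset.sum_congr rfl fun i _ => ?_
    simp only [hE, hm]; ring
  have e2 : ∀ t, wflow₂ J ψ lam c α α₁ α₂ s s₁ s₂ p t =
      fun x => ∑ i ∈ J, (c i * (n t x * E i t x + m i t x * (m i t x * E i t x))) * ψ i x :=
    fun t => by
    ext x
    unfold wflow₂ flow
    simp only [Finset.mul_sum]
    rw [← Finset.sum_add_distrib, ← Finset.sum_add_distrib]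
    refine Finset.sum_congr rfl fun i _ => ?_
    simp only [hE, hm, hn]; ring
  have cα : ContinuousOn α S := fun t ht => (P.dα t ht).continuousAt.continuousWithinAt
  have cα₁ : ContinuousOn α₁ S := fun t ht => (P.dα₁ t ht).continuousAt.continuousWithinAt
  have cs : ContinuousOn s S := fun t ht => (P.ds t ht).continuousAt.continuousWithinAt
  have cs₁ : ContinuousOn s₁ S := fun t ht => (P.ds₁ t ht).continuousAt.continuousWithinAt
  have lift : ∀ {g : ℝ → ℝ}, ContinuousOn g S →
      ContinuousOn (fun q : ℝ × Eu d => g q.1) (S ×ˢ univ) := fun hg =>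
    hg.comp continuousOn_fst fun q hq => hq.1
  have kα := lift cα
  have kα₁ := lift cα₁
  have kα₂ := lift P.cα₂
  have ks := lift cs
  have ks₁ := lift cs₁
  have ks₂ := lift P.cs₂
  have cz : ContinuousOn (fun q : ℝ × Eu d => ‖q.2 - p‖ ^ 2) (S ×ˢ univ) := by fun_prop
  have cE : ∀ i, ContinuousOn (fun q : ℝ × Eu d => E i q.1 q.2) (S ×ˢ univ) := fun i => by
    have h1 : ContinuousOn (fun q : ℝ × Eu d => Real.exp (-lam i * q.1)) (S ×ˢ univ) := by fun_prop
    exact (ks.sub ((kα.mul cz).div_const 2)).rexp.mul h1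
  have cm : ∀ i, ContinuousOn (fun q : ℝ × Eu d => m i q.1 q.2) (S ×ˢ univ) := fun i => by
    exact continuousOn_const.add (ks₁.sub ((kα₁.div_const 2).mul cz))
  have cn : ContinuousOn (fun q : ℝ × Eu d => n q.1 q.2) (S ×ˢ univ) := by
    exact ks₂.sub ((kα₂.div_const 2).mul cz)
  have c0 : ∀ i ∈ J, ContinuousOn (fun q : ℝ × Eu d => c i * E i q.1 q.2) (S ×ˢ univ) :=
    fun i _ => continuousOn_const.mul (cE i)
  have c1 : ∀ i ∈ J, ContinuousOn (fun q : ℝ × Eu d => c i * (m i q.1 q.2 * E i q.1 q.2))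
      (S ×ˢ univ) := fun i _ => continuousOn_const.mul ((cm i).mul (cE i))
  have c2 : ∀ i ∈ J, ContinuousOn (fun q : ℝ × Eu d => c i * (n q.1 q.2 * E i q.1 q.2 +
      m i q.1 q.2 * (m i q.1 q.2 * E i q.1 q.2)))
      (S ×ˢ univ) := fun i _ => continuousOn_const.mul ((cn.mul (cE i)).add
        ((cm i).mul ((cm i).mul (cE i))))
  have d0 : ∀ i ∈ J, ∀ t ∈ S, ∀ x, HasDerivAt (fun t => c i * E i t x)
      (c i * (m i t x * E i t x)) t := fun i _ t ht x => (dE i t ht x).const_mul _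
  have d1 : ∀ i ∈ J, ∀ t ∈ S, ∀ x, HasDerivAt (fun t => c i * (m i t x * E i t x))
      (c i * (n t x * E i t x + m i t x * (m i t x * E i t x))) t :=
    fun i _ t ht x => ((dm i t ht x).mul (dE i t ht x)).const_mul _
  have hψ : ∀ i ∈ J, MemLp (ψ i) 2 volume := fun i hi => (H.h10 i hi).memf
  have h0 : ∀ i ∈ J, ∀ x ∉ ball (0 : Eu d) R, ψ i x = 0 := fun i hi => (H.h10 i hi).zerof
  constructor
  · have key := hasDerivAt_ip_sum J isBounded_ball hψ h0 P.isOpen (a := fun i t x => c i * E i t x)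
      (b := fun i t x => c i * E i t x) d0 d0 c0 c1 c0 c1 ht
    simp only [← e0, ← e1] at key
    refine key.congr_deriv ?_
    rw [ip_comm (wflow₁ _ _ _ _ _ _ _ _ _ _)]; ring
  · have key := hasDerivAt_ip_sum J isBounded_ball hψ h0 P.isOpen (a := fun i t x => c i * E i t x)
      (b := fun i t x => c i * (m i t x * E i t x)) d0 d1 c0 c1 c1 c2 ht
    simp only [← e0, ← e1, ← e2] at key
    exact key

theorem conjEq (H : Modes R ν J ψ G lam) (c : ι → ℝ) (a b : ℝ) (p : Eu d) (k : ℕ) (t : ℝ) :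
    ConjEq (ball 0 R) ν a p (fun x => wt a b p x * flow J ψ lam c k t x)
      (conjGrad a b p (flow J ψ lam c k t) (gflow J G lam c k t))
      (fun x => wt a b p x * flow J ψ lam c (k + 1) t x) := fun _ _ hw =>
  (H.weak_flow c k t).conj isBounded_ball (H.h10_flow c k t) hw

theorem wN_mul (H : Modes R ν J ψ G lam) (hc : ∑ i ∈ J, c i ^ 2 ≠ 0) (t : ℝ) :
    wN J ψ lam c α α₁ s s₁ p t * wE J ψ lam c α s p t =
      (∫ x, ‖conjGrad (α t) (s t) p (flow J ψ lam c 0 t) (gflow J G lam c 0 t) x‖ ^ 2) +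
      ∫ x, effPot ν (α t) (α₁ t) (s₁ t) p x * wflow J ψ lam c α s p t x ^ 2 := by
  unfold wN
  rw [div_mul_cancel₀ _ (H.wE_pos hc α s p t).ne']
  have key : ip (wflow J ψ lam c α s p t) (wflow₁ J ψ lam c α α₁ s s₁ p t) =
      -(∫ x, ‖conjGrad (α t) (s t) p (flow J ψ lam c 0 t) (gflow J G lam c 0 t) x‖ ^ 2) -
      ∫ x, effPot ν (α t) (α₁ t) (s₁ t) p x * wflow J ψ lam c α s p t x ^ 2 :=
    (H.conjEq c (α t) (s t) p 0 t).first (a₁ := α₁ t) (s₁ := s₁ t) isBounded_ball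
    (H.h10_wflow c α s p t) ((H.h10_flow c 1 t).conj isBounded_ball).memf
  rw [key]
  ring

theorem log_wE_deriv (P : Profile S α α₁ α₂ s s₁ s₂) (H : Modes R ν J ψ G lam)
    (hc : ∑ i ∈ J, c i ^ 2 ≠ 0) {t : ℝ} (ht : t ∈ S) :
    HasDerivAt (fun t => Real.log (wE J ψ lam c α s p t)) (-2 * wN J ψ lam c α α₁ s s₁ p t) t := by
  refine ((wE_deriv P H ht).1.log (H.wE_pos hc α s p t).ne').congr_deriv ?_
  unfold wN; ring

theorem wN_deriv (hd : 2 ≤ d) (hp : ‖p‖ ≤ R) (P : Profile S α α₁ α₂ s s₁ s₂)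
    (H : Modes R ν J ψ G lam) (hc : ∑ i ∈ J, c i ^ 2 ≠ 0) {t : ℝ} (ht : t ∈ S) (hα : 0 ≤ α t)
    {e : ℝ} (he : ∀ x ∈ ball (0 : Eu d) R, (α₂ t / 2 - 2 * α t * α₁ t) * ‖x - p‖ ^ 2 - s₂ t
      - 2 * α t * (2 * ν * inner ℝ x (x - p) + (α₁ t - 2 * α t ^ 2) * ‖x - p‖ ^ 2)
      ≤ 4 * α t * effPot ν (α t) (α₁ t) (s₁ t) p x + e) :
    ∃ N', HasDerivAt (wN J ψ lam c α α₁ s s₁ p) N' t ∧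
      N' ≤ 4 * α t * wN J ψ lam c α α₁ s s₁ p t + e := by
  have hE := H.wE_pos hc α s p t
  obtain ⟨D1, D2⟩ := wE_deriv (c := c) (p := p) P H ht
  have key := ConjEq.second hd hp hα (H.h10_wflow c α s p t)
    ((H.h10_flow c 1 t).conj isBounded_ball) ((H.h10_flow c 2 t).conj isBounded_ball).memf
    (H.conjEq c (α t) (s t) p 0 t) (H.conjEq c (α t) (s t) p 1 t) he
    (f₁ := wflow₁ J ψ lam c α α₁ s s₁ p t) rfl (f₂ := wflow₂ J ψ lam c α α₁ α₂ s s₁ s₂ p t) rfl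
  refine ⟨_, (D2.neg.div D1 hE.ne'), ?_⟩
  unfold wN
  have hI : wE J ψ lam c α s p t = ip (wflow J ψ lam c α s p t) (wflow J ψ lam c α s p t) := rfl
  simp only [← hI, Pi.neg_apply] at key ⊢
  set I := wE J ψ lam c α s p t
  set A := ip (wflow J ψ lam c α s p t) (wflow₁ J ψ lam c α α₁ s s₁ p t)
  have e1 : 4 * α t * (-A / I) + e = (4 * α t * (-A) * I + e * I ^ 2) / I ^ 2 := by
    field_simp
  rw [e1, div_le_div_iff_of_pos_right (by positivity)]
  nlinarith [key]

end Modes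

end Grushin

namespace Grushin

variable {d : ℕ}

theorem integrable_sq {f : Eu d → ℝ} (hf : MemLp f 2 volume) : Integrable fun x => f x ^ 2 := by
  refine (integrable_mul_of_memLp hf hf).congr (Eventually.of_forall fun x => ?_)
  simp only; ring

theorem ip_self_eq (f : Eu d → ℝ) : ip f f = ∫ x, f x ^ 2 := by
  unfold ip; congr 1; ext x; ring

/-- A function with small second moment about `x₀` is concentrated near `x₀`. -/
theorem concentration {U : Set (Eu d)} (hU : Bornology.IsBounded U) {f : Eu d → ℝ}
    {F : Eu d → Eu d} (hf : H10 U f F) {x₀ : Eu d} {r : ℝ} (hr : 0 < r)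
    (h : ∫ x, ‖x - x₀‖ ^ 2 * f x ^ 2 ≤ r ^ 2 / 2 * ip f f) :
    ip f f ≤ 2 * ∫ x in ball x₀ r, f x ^ 2 := by
  have i1 := integrable_sq hf.memf
  have i2 : Integrable fun x => ‖x - x₀‖ ^ 2 * f x ^ 2 :=
    integrable_cont_mul_sq hU hf (by fun_prop)
  have hs := integral_add_compl (measurableSet_ball (x := x₀) (ε := r)) i1
  have h1 : r ^ 2 * ∫ x in (ball x₀ r)ᶜ, f x ^ 2 ≤ ∫ x, ‖x - x₀‖ ^ 2 * f x ^ 2 := by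
    rw [← integral_const_mul]
    refine le_trans ?_ (setIntegral_le_integral (s := (ball x₀ r)ᶜ) i2
      (Eventually.of_forall fun x => by positivity))
    refine setIntegral_mono_on (i1.const_mul _).integrableOn i2.integrableOn
      measurableSet_ball.compl fun x hx => ?_
    have : r ≤ ‖x - x₀‖ := by simpa [dist_eq_norm] using hx
    gcongr
  rw [ip_self_eq] at h ⊢
  have hr2 : 0 < r ^ 2 := by positivity
  rw [← hs] at h ⊢
  nlinarith

theorem wt_sq (α c : ℝ) (p x : Eu d) : wt α c p x ^ 2 = Real.exp (2 * c - α * ‖x - p‖ ^ 2) := by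
  unfold wt
  rw [← Real.exp_nat_mul]
  congr 1
  push_cast; ring

theorem wt_zero (p x : Eu d) : wt 0 0 p x = 1 := by simp [wt]

namespace Modes

variable {R ν : ℝ} {ι : Type*} {J : Finset ι} {ψ : ι → Eu d → ℝ} {G : ι → Eu d → Eu d}
  {lam c : ι → ℝ} {S : Set ℝ} {α α₁ α₂ s s₁ s₂ : ℝ → ℝ} {p : Eu d}

/-- The unweighted energy. -/
noncomputable def nE {ι : Type*} (J : Finset ι) (ψ : ι → Eu d → ℝ) (lam c : ι → ℝ) (t : ℝ) : ℝ :=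
  ip (flow J ψ lam c 0 t) (flow J ψ lam c 0 t)

theorem wE_zero (p : Eu d) :
    wE J ψ lam c (fun _ => 0) (fun _ => 0) p = nE J ψ lam c := by
  ext t
  unfold wE nE
  have : wflow J ψ lam c (fun _ => 0) (fun _ => 0) p t = flow J ψ lam c 0 t := by
    ext x; simp [wflow, wt_zero]
  rw [this]

theorem profile_zero : Profile univ (fun _ => 0) (fun _ => 0) (fun _ => 0) (fun _ => 0)
    (fun _ => 0) (fun _ => 0) :=
  ⟨isOpen_univ, fun _ _ => hasDerivAt_const _ _, fun _ _ => hasDerivAt_const _ _,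
    continuousOn_const, fun _ _ => hasDerivAt_const _ _, fun _ _ => hasDerivAt_const _ _,
    continuousOn_const⟩

/-- The unweighted frequency. -/
noncomputable def nN {ι : Type*} (J : Finset ι) (ψ : ι → Eu d → ℝ) (lam c : ι → ℝ) : ℝ → ℝ :=
  wN J ψ lam c (fun _ => 0) (fun _ => 0) (fun _ => 0) (fun _ => 0) 0

theorem nE_pos (H : Modes R ν J ψ G lam) (hc : ∑ i ∈ J, c i ^ 2 ≠ 0) (t : ℝ) :
    0 < nE J ψ lam c t := by
  rw [← wE_zero 0]; exact H.wE_pos hc _ _ _ _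

theorem log_nE_deriv (H : Modes R ν J ψ G lam) (hc : ∑ i ∈ J, c i ^ 2 ≠ 0) (t : ℝ) :
    HasDerivAt (fun t => Real.log (nE J ψ lam c t)) (-2 * nN J ψ lam c t) t := by
  rw [← wE_zero 0]
  exact log_wE_deriv profile_zero H hc (mem_univ t)

theorem nN_antitone (hd : 2 ≤ d) (hR : 0 ≤ R) (H : Modes R ν J ψ G lam)
    (hc : ∑ i ∈ J, c i ^ 2 ≠ 0) : Antitone (nN J ψ lam c) := by
  have key : ∀ t, ∃ N', HasDerivAt (nN J ψ lam c) N' t ∧ N' ≤ 0 := fun t => by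
    obtain ⟨N', h1, h2⟩ := wN_deriv (p := 0) (e := 0) hd (by simpa using hR) profile_zero H hc
      (mem_univ t) le_rfl (fun x _ => by simp)
    exact ⟨N', h1, by simpa using h2⟩
  choose N' h1 h2 using key
  exact antitone_of_hasDerivAt_nonpos h1 h2

/-- The harmonic-oscillator lower bound for the frequency. -/
theorem nN_ge {n : ℝ} (H : Modes R (n ^ 2) J ψ G lam) (hc : ∑ i ∈ J, c i ^ 2 ≠ 0) (t : ℝ) :
    n * d ≤ nN J ψ lam c t := by
  have hU : Bornology.IsBounded (ball (0 : Eu d) R) := isBounded_ball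
  have hE := H.nE_pos hc t
  have h := H.wN_mul (α := fun _ => 0) (α₁ := fun _ => 0) (s := fun _ => 0) (s₁ := fun _ => 0)
    (p := 0) hc t
  have hf := H.h10_wflow c (fun _ => 0) (fun _ => 0) 0 t
  change nN J ψ lam c t * _ = _ at h
  rw [← mul_le_mul_iff_left₀ hE]
  rw [wE_zero] at h
  rw [h]
  have e : nE J ψ lam c t = wE J ψ lam c (fun _ => 0) (fun _ => 0) 0 t := by rw [wE_zero]
  rw [e]
  unfold wE
  set f := wflow J ψ lam c (fun _ => 0) (fun _ => 0) 0 t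
  set F := conjGrad ((fun _ => 0) t : ℝ) ((fun _ => 0) t : ℝ) (0 : Eu d) (flow J ψ lam c 0 t)
    (gflow J G lam c 0 t)
  have heul := hf.euler hU hf 0
  have hz : Continuous fun x : Eu d => x - (0 : Eu d) := by fun_prop
  have m1 := memLp_inner_vec hU hf.memF hf.zeroF hz
  have j1 : Integrable fun x => ‖F x‖ ^ 2 := by
    simpa only [real_inner_self_eq_norm_sq] using integrable_inner_of_memLp hf.memF hf.memF
  have j2 : Integrable fun x => 2 * n * (f x * inner ℝ (F x) (x - (0 : Eu d))) :=
    (integrable_mul_of_memLp hf.memf m1).const_mul _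
  have j3 := integrable_cont_mul_sq hU hf (contDiff_effPot (n ^ 2) 0 0 0 0).continuous
  have j12 : Integrable fun x => ‖F x‖ ^ 2 + 2 * n * (f x * inner ℝ (F x) (x - (0 : Eu d))) :=
    j1.add j2
  have hnn : 0 ≤ (∫ x, ‖F x‖ ^ 2) + 2 * n * (∫ x, f x * inner ℝ (F x) (x - (0 : Eu d))) +
      ∫ x, effPot (n ^ 2) 0 0 0 0 x * f x ^ 2 := by
    rw [← integral_const_mul, ← integral_add j1 j2, ← integral_add j12 j3]
    refine integral_nonneg fun x => ?_
    have e1 : ‖F x + (n * f x) • x‖ ^ 2 = ‖F x‖ ^ 2 + 2 * (n * f x * inner ℝ (F x) x) +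
        (n * f x) ^ 2 * ‖x‖ ^ 2 := by
      rw [norm_add_sq_real, inner_smul_right, norm_smul, mul_pow, Real.norm_eq_abs, sq_abs]
    have e2 : effPot (n ^ 2) 0 0 0 0 x = n ^ 2 * ‖x‖ ^ 2 := by simp [effPot]
    simp only [Pi.zero_apply, sub_zero, e2]
    have : 0 ≤ ‖F x + (n * f x) • x‖ ^ 2 := by positivity
    rw [e1] at this
    nlinarith [this]
  have e3 : ∫ x, f x * f x = ip f f := rfl
  rw [e3] at heul
  have : n * d * ip f f = -(2 * n * (∫ x, f x * inner ℝ (F x) (x - (0 : Eu d)))) := by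
    linear_combination n * heul
  rw [this]
  linarith

theorem log_wE_le (H : Modes R ν J ψ G lam) (hc : ∑ i ∈ J, c i ^ 2 ≠ 0) {t b : ℝ}
    (hb : ∀ x ∈ ball (0 : Eu d) R, 2 * s t - α t * ‖x - p‖ ^ 2 ≤ b) :
    Real.log (wE J ψ lam c α s p t) ≤ b + Real.log (nE J ψ lam c t) := by
  have h1 := H.wE_pos hc α s p t
  have h2 := H.nE_pos hc t
  rw [Real.log_le_iff_le_exp h1, Real.exp_add, Real.exp_log h2]
  unfold wE nE
  rw [ip_self_eq, ip_self_eq, ← integral_const_mul]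
  refine integral_mono (integrable_sq (H.h10_wflow c α s p t).memf)
    ((integrable_sq (H.h10_flow c 0 t).memf).const_mul _) fun x => ?_
  by_cases hx : x ∈ ball (0 : Eu d) R
  · simp only [wflow, mul_pow, wt_sq]
    gcongr
    exact hb x hx
  · simp [wflow, (H.h10_flow c 0 t).zerof x hx]

theorem le_log_wE (H : Modes R ν J ψ G lam) (hc : ∑ i ∈ J, c i ^ 2 ≠ 0) {t b : ℝ}
    (hb : ∀ x ∈ ball (0 : Eu d) R, b ≤ 2 * s t - α t * ‖x - p‖ ^ 2) :
    b + Real.log (nE J ψ lam c t) ≤ Real.log (wE J ψ lam c α s p t) := by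
  have h1 := H.wE_pos hc α s p t
  have h2 := H.nE_pos hc t
  rw [Real.le_log_iff_exp_le h1, Real.exp_add, Real.exp_log h2]
  unfold wE nE
  rw [ip_self_eq, ip_self_eq, ← integral_const_mul]
  refine integral_mono 
    ((integrable_sq (H.h10_flow c 0 t).memf).const_mul _)
    (integrable_sq (H.h10_wflow c α s p t).memf) fun x => ?_
  by_cases hx : x ∈ ball (0 : Eu d) R
  · simp only [wflow, mul_pow, wt_sq]
    gcongr
    exact hb x hx
  · simp [wflow, (H.h10_flow c 0 t).zerof x hx]

/-- If the effective potential dominates `b‖x-x₀‖²`, the frequency controls the second moment. -/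
theorem moment_le (H : Modes R ν J ψ G lam) (hc : ∑ i ∈ J, c i ^ 2 ≠ 0) {t b : ℝ} {x₀ : Eu d}
    (hq : ∀ x, b * ‖x - x₀‖ ^ 2 ≤ effPot ν (α t) (α₁ t) (s₁ t) p x) :
    b * ∫ x, ‖x - x₀‖ ^ 2 * wflow J ψ lam c α s p t x ^ 2 ≤
      wN J ψ lam c α α₁ s s₁ p t * wE J ψ lam c α s p t := by
  have hU : Bornology.IsBounded (ball (0 : Eu d) R) := isBounded_ball
  have hf := H.h10_wflow c α s p t
  rw [H.wN_mul hc t, ← integral_const_mul]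
  have h0 : (0 : ℝ) ≤ ∫ x, ‖conjGrad (α t) (s t) p (flow J ψ lam c 0 t)
    (gflow J G lam c 0 t) x‖ ^ 2 := integral_nonneg fun x => by positivity
  have h1 : ∫ x, b * (‖x - x₀‖ ^ 2 * wflow J ψ lam c α s p t x ^ 2) ≤
      ∫ x, effPot ν (α t) (α₁ t) (s₁ t) p x * wflow J ψ lam c α s p t x ^ 2 := by
    refine integral_mono ((integrable_cont_mul_sq hU hf (by fun_prop)).const_mul _)
      (integrable_cont_mul_sq hU hf (contDiff_effPot _ _ _ _ _).continuous) fun x => ?_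
    have := mul_le_mul_of_nonneg_right (hq x) (sq_nonneg (wflow J ψ lam c α s p t x))
    simp only
    linarith
  linarith

theorem wN_nonneg (H : Modes R ν J ψ G lam) (hc : ∑ i ∈ J, c i ^ 2 ≠ 0) {t : ℝ}
    (hq : ∀ x, 0 ≤ effPot ν (α t) (α₁ t) (s₁ t) p x) : 0 ≤ wN J ψ lam c α α₁ s s₁ p t := by
  have := H.moment_le (s := s) (b := 0) (x₀ := 0) hc (by simpa using hq)
  rw [zero_mul] at this
  exact nonneg_of_mul_nonneg_left this (H.wE_pos hc α s p t)

end Modes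

end Grushin

namespace Grushin

variable {d : ℕ}

theorem exists_slope_eq {L N : ℝ → ℝ} {a b : ℝ} (hab : a < b)
    (h : ∀ t ∈ Icc a b, HasDerivAt L (-2 * N t) t) :
    ∃ t ∈ Ioo a b, L a - L b = 2 * (b - a) * N t := by
  obtain ⟨t, ht, e⟩ := exists_hasDerivAt_eq_slope L (fun t => -2 * N t) hab
    (fun t ht => (h t ht).continuousAt.continuousWithinAt) fun t ht => h t (Ioo_subset_Icc_self ht)
  refine ⟨t, ht, ?_⟩
  rw [eq_div_iff (sub_pos.2 hab).ne'] at e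
  linarith

theorem weighted_antitone {N w α e : ℝ → ℝ} {a b E : ℝ}
    (hN : ∀ t ∈ Icc a b, ∃ N', HasDerivAt N N' t ∧ N' ≤ 4 * α t * N t + e t)
    (hw : ∀ t ∈ Icc a b, HasDerivAt w (-4 * α t * w t) t) (hw0 : ∀ t ∈ Icc a b, 0 ≤ w t)
    (he : ∀ t ∈ Icc a b, w t * e t ≤ E) {t t' : ℝ} (ht : t ∈ Icc a b) (ht' : t' ∈ Icc a b)
    (htt' : t ≤ t') : w t' * N t' ≤ w t * N t + E * (t' - t) := by
  choose! N' h1 h2 using hN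
  have hM : ∀ t ∈ Icc a b, HasDerivAt (fun t => w t * N t - E * t)
      (-4 * α t * w t * N t + w t * N' t - E) t := fun t ht => by
    have := ((hw t ht).mul (h1 t ht)).sub ((hasDerivAt_id t).const_mul E)
    exact this.congr_deriv (by ring)
  have anti : AntitoneOn (fun t => w t * N t - E * t) (Icc a b) := by
    refine antitoneOn_of_deriv_nonpos (convex_Icc a b)
      (fun t ht => (hM t ht).continuousAt.continuousWithinAt)
      (fun t ht => (hM t (interior_subset ht)).differentiableAt.differentiableWithinAt)
      fun t ht => ?_
    have ht := interior_subset ht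
    rw [(hM t ht).deriv]
    have := mul_le_mul_of_nonneg_left (h2 t ht) (hw0 t ht)
    nlinarith [he t ht]
  have := anti ht ht' htt'
  simp only at this
  linarith

namespace Modes

variable {R ν : ℝ} {ι : Type*} {J : Finset ι} {ψ : ι → Eu d → ℝ} {G : ι → Eu d → Eu d}
  {lam c : ι → ℝ}

theorem log_nE_sub_ge {n : ℝ} (H : Modes R (n ^ 2) J ψ G lam) (hc : ∑ i ∈ J, c i ^ 2 ≠ 0)
    {a b : ℝ} (hab : a ≤ b) : 2 * (n * d) * (b - a) ≤
      Real.log (nE J ψ lam c a) - Real.log (nE J ψ lam c b) := by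
  rcases hab.eq_or_lt with rfl | hab
  · simp
  obtain ⟨t, _, e⟩ := exists_slope_eq hab (fun t _ => H.log_nE_deriv hc t)
  rw [e]
  have := H.nN_ge hc t
  nlinarith [mul_le_mul_of_nonneg_left this (sub_pos.2 hab).le]

/-- The energy in a ball. -/
noncomputable def obs {ι : Type*} (J : Finset ι) (ψ : ι → Eu d → ℝ) (lam c : ι → ℝ) (x₀ : Eu d)
    (r t : ℝ) : ℝ := ∫ x in ball x₀ r, flow J ψ lam c 0 t x ^ 2

theorem obs_nonneg (x₀ : Eu d) (r t : ℝ) : 0 ≤ obs J ψ lam c x₀ r t :=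
  integral_nonneg fun x => by positivity

/-- Weighted energies in a ball are controlled by unweighted ones. -/
theorem wflow_obs_le (H : Modes R ν J ψ G lam) {α s : ℝ → ℝ} {p x₀ : Eu d} {r t b : ℝ}
    (hb : ∀ x ∈ ball x₀ r, 2 * s t - α t * ‖x - p‖ ^ 2 ≤ b) :
    ∫ x in ball x₀ r, wflow J ψ lam c α s p t x ^ 2 ≤ Real.exp b * obs J ψ lam c x₀ r t := by
  unfold obs
  rw [← integral_const_mul]
  refine setIntegral_mono_on (integrable_sq (H.h10_wflow c α s p t).memf).integrableOn
    ((integrable_sq (H.h10_flow c 0 t).memf).const_mul _).integrableOn measurableSet_ball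
    fun x hx => ?_
  simp only [wflow, mul_pow, wt_sq]
  gcongr
  exact hb x hx

theorem profile_rough (T : ℝ) : Profile (Iio T) (fun t => 1 / (4 * (T - t)))
    (fun t => 1 / (4 * (T - t) ^ 2)) (fun t => 1 / (2 * (T - t) ^ 3)) (fun _ => 0)
    (fun _ => 0) (fun _ => 0) := by
  have hd : ∀ t : ℝ, HasDerivAt (fun t => T - t) (-1) t := fun t =>
    (hasDerivAt_id t).const_sub T
  refine ⟨isOpen_Iio, fun t ht => ?_, fun t ht => ?_, fun t ht => ?_,
    fun _ _ => hasDerivAt_const _ _, fun _ _ => hasDerivAt_const _ _, continuousOn_const⟩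
  all_goals have hT : T - t ≠ 0 := (sub_pos.2 ht).ne'
  · have := (hasDerivAt_const t (1 : ℝ)).div ((hd t).const_mul 4) (by positivity)
    refine this.congr_deriv ?_
    field_simp; ring
  · have := (hasDerivAt_const t (1 : ℝ)).div (((hd t).pow 2).const_mul 4)
      (mul_ne_zero four_ne_zero (pow_ne_zero _ hT))
    refine this.congr_deriv ?_
    field_simp; simp; ring
  · have h1 : ContinuousAt (fun t => 2 * (T - t) ^ 3) t := by fun_prop
    exact (continuousAt_const.div h1
      (mul_ne_zero two_ne_zero (pow_ne_zero _ hT))).continuousWithinAt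

set_option maxHeartbeats 2000000 in
/-- One step of the observability estimate with a backward Gaussian weight. -/
theorem rough_step (hd : 2 ≤ d) {n : ℝ} (hn : 0 ≤ n) (H : Modes R (n ^ 2) J ψ G lam)
    (hc : ∑ i ∈ J, c i ^ 2 ≠ 0) {x₀ : Eu d} (hx₀ : ‖x₀‖ ≤ R) {r : ℝ} (hr : 0 < r) {t₁ δ : ℝ}
    (hδ : 0 < δ) (hnδ : n ^ 2 * δ ≤ 1 / δ) :
    nE J ψ lam c t₁ ≤ 2 * Real.exp ((48 * R ^ 2 / r ^ 2) *
      (Real.log (nE J ψ lam c (t₁ - 2 * δ)) - Real.log (nE J ψ lam c t₁)) +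
      (56 * R ^ 4 / r ^ 2 + R ^ 2) / δ) * obs J ψ lam c x₀ r t₁ := by
  have hR : 0 ≤ R := (norm_nonneg _).trans hx₀
  have hp : ∀ x ∈ ball (0 : Eu d) R, ‖x - x₀‖ ^ 2 ≤ 4 * R ^ 2 := fun x hx => by
    have : ‖x - x₀‖ ≤ 2 * R := by
      have := norm_sub_le x x₀
      have := mem_ball_zero_iff.1 hx
      linarith
    nlinarith [norm_nonneg (x - x₀)]
  set Gg : ℝ → ℝ := fun t => Real.log (nE J ψ lam c t) with hGg
  have hGmono : ∀ a b, a ≤ b → Gg b ≤ Gg a := fun a b hab => by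
    have := H.log_nE_sub_ge hc hab
    have h0 : 0 ≤ 2 * (n * d) * (b - a) := by
      have := sub_nonneg.2 hab
      positivity
    simp only [hGg]; linarith
  set F := Gg (t₁ - 2 * δ) - Gg t₁ with hF
  have hF0 : 0 ≤ F := sub_nonneg.2 (hGmono _ _ (by linarith))
  set X := 3 / 2 * (F + R ^ 2 / δ) + n ^ 2 * R ^ 2 * δ / 4 with hX
  have hX0 : 0 ≤ X := by positivity
  set h := r ^ 2 / (32 * X + r ^ 2 / δ) with hh
  have hden : 0 < 32 * X + r ^ 2 / δ := by positivity
  have hh0 : 0 < h := by positivity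
  have hhδ : h ≤ δ := by
    rw [hh, div_le_iff₀ hden]
    have : δ * (r ^ 2 / δ) = r ^ 2 := by field_simp
    nlinarith
  have hhX : 16 * h * X ≤ r ^ 2 / 2 := by
    have e : h * (32 * X + r ^ 2 / δ) = r ^ 2 := by rw [hh]; field_simp
    have : 0 ≤ h * (r ^ 2 / δ) := by positivity
    nlinarith
  set T := t₁ + h with hT
  have P := profile_rough T
  set α : ℝ → ℝ := fun t => 1 / (4 * (T - t)) with hα
  set α₁ : ℝ → ℝ := fun t => 1 / (4 * (T - t) ^ 2) with hα₁
  set L : ℝ → ℝ := fun t => Real.log (wE J ψ lam c α (fun _ => 0) x₀ t) with hL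
  set N : ℝ → ℝ := wN J ψ lam c α α₁ (fun _ => 0) (fun _ => 0) x₀ with hN
  have hI : ∀ t ∈ Icc (t₁ - 2 * δ) t₁, 0 < T - t := fun t ht => by
    have := ht.2; rw [hT]; linarith
  have hq : ∀ t ∈ Icc (t₁ - 2 * δ) t₁, ∀ x, effPot (n ^ 2) (α t) (α₁ t) 0 x₀ x =
      n ^ 2 * ‖x‖ ^ 2 + α t ^ 2 * ‖x - x₀‖ ^ 2 := fun t ht x => by
    have := hI t ht
    unfold effPot
    simp only [hα, hα₁]
    field_simp; ring
  have hNd : ∀ t ∈ Icc (t₁ - 2 * δ) t₁, ∃ N', HasDerivAt N N' t ∧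
      N' ≤ 4 * α t * N t + α t * n ^ 2 * R ^ 2 / 2 := fun t ht => by
    have hTt := hI t ht
    have hα0 : 0 < α t := by simp only [hα]; positivity
    refine wN_deriv hd hx₀ P H hc (by rw [mem_Iio]; linarith) hα0.le fun x hx => ?_
    rw [hq t ht x]
    have e1 : α₁ t = 4 * α t ^ 2 := by simp only [hα, hα₁]; field_simp
    have e2 : 1 / (2 * (T - t) ^ 3) = 32 * α t ^ 3 := by simp only [hα]; field_simp; norm_num
    rw [e1, e2]
    have e3 : (inner ℝ x (x - x₀) : ℝ) = ‖x‖ ^ 2 - inner ℝ x x₀ := by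
      rw [inner_sub_right, real_inner_self_eq_norm_sq]
    have e4 := real_inner_le_norm x x₀
    have e5 : 0 ≤ (inner ℝ x (x - x₀) : ℝ) + ‖x‖ ^ 2 + R ^ 2 / 8 := by
      rw [e3]
      have : (inner ℝ x x₀ : ℝ) ≤ ‖x‖ * R :=
        e4.trans (mul_le_mul_of_nonneg_left hx₀ (norm_nonneg x))
      nlinarith [sq_nonneg (‖x‖ - R / 4)]
    have e6 : 0 ≤ 4 * α t * n ^ 2 * ((inner ℝ x (x - x₀) : ℝ) + ‖x‖ ^ 2 + R ^ 2 / 8) := by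
      positivity
    nlinarith
  have hstep : ∀ t ∈ Icc (t₁ - 2 * δ) t₁, h * N t₁ ≤ (T - t) * N t +
      n ^ 2 * R ^ 2 / 8 * (t₁ - t) := fun t ht => by
    have := weighted_antitone (w := fun t => T - t) (E := n ^ 2 * R ^ 2 / 8) hNd
      (fun t ht => by
        have hTt := hI t ht
        refine ((hasDerivAt_id t).const_sub T).congr_deriv ?_
        simp only [hα]; field_simp)
      (fun t ht => (hI t ht).le) (fun t ht => by
        have hTt := hI t ht
        simp only [hα]
        apply le_of_eq; field_simp; ring) ht (right_mem_Icc.2 (by linarith)) ht.2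
    have e : T - t₁ = h := by rw [hT]; ring
    simpa only [e] using this
  have hNn : ∀ t ∈ Icc (t₁ - 2 * δ) t₁, 0 ≤ N t := fun t ht =>
    H.wN_nonneg hc fun x => by rw [hq t ht x]; positivity
  obtain ⟨t, ht, hslope⟩ := exists_slope_eq (L := L) (N := N) (a := t₁ - 2 * δ) (b := t₁ - δ)
    (by linarith) fun t ht => log_wE_deriv P H hc (by rw [mem_Iio, hT]; linarith [ht.2])
  have htI : t ∈ Icc (t₁ - 2 * δ) t₁ := ⟨ht.1.le, by linarith [ht.2]⟩
  have hLa : L (t₁ - 2 * δ) ≤ Gg (t₁ - 2 * δ) := by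
    have := H.log_wE_le (s := fun _ => 0) (α := α) (p := x₀) (t := t₁ - 2 * δ) (b := 0) hc
      fun x hx => by
        have h1 := hI (t₁ - 2 * δ) ⟨le_rfl, by linarith⟩
        have : 0 ≤ α (t₁ - 2 * δ) * ‖x - x₀‖ ^ 2 := by simp only [hα]; positivity
        linarith
    simpa using this
  have hLm : -(R ^ 2 / δ) + Gg (t₁ - δ) ≤ L (t₁ - δ) := by
    refine H.le_log_wE hc fun x hx => ?_
    have h1 : α (t₁ - δ) ≤ 1 / (4 * δ) := by
      simp only [hα]
      apply one_div_le_one_div_of_le (by positivity)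
      rw [hT]; linarith
    have h2 : α (t₁ - δ) * ‖x - x₀‖ ^ 2 ≤ 1 / (4 * δ) * (4 * R ^ 2) :=
      mul_le_mul h1 (hp x hx) (by positivity) (by positivity)
    have h3 : 1 / (4 * δ) * (4 * R ^ 2) = R ^ 2 / δ := by field_simp
    linarith
  have hhN : h * N t₁ ≤ X := by
    have h1 := hstep t htI
    have h2 : (T - t) * N t ≤ 3 * δ * N t :=
      mul_le_mul_of_nonneg_right (by rw [hT]; linarith [ht.1]) (hNn t htI)
    have h3 : n ^ 2 * R ^ 2 / 8 * (t₁ - t) ≤ n ^ 2 * R ^ 2 / 8 * (2 * δ) :=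
      mul_le_mul_of_nonneg_left (by linarith [ht.1]) (by positivity)
    have h4 := hGmono (t₁ - δ) t₁ (by linarith)
    have h5 : t₁ - δ - (t₁ - 2 * δ) = δ := by ring
    rw [h5] at hslope
    rw [hX, hF]
    linarith
  have hE := H.wE_pos hc α (fun _ => 0) x₀ t₁
  have ht₁I : t₁ ∈ Icc (t₁ - 2 * δ) t₁ := ⟨by linarith, le_rfl⟩
  have hmom := H.moment_le (s := fun _ => 0) (α := α) (α₁ := α₁) (s₁ := fun _ => 0) (p := x₀)
    (b := 1 / (16 * h ^ 2)) (x₀ := x₀) (t := t₁) hc fun x => by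
      rw [hq t₁ ht₁I x]
      have : α t₁ ^ 2 = 1 / (16 * h ^ 2) := by
        have : T - t₁ = h := by rw [hT]; ring
        simp only [hα, this]; field_simp; norm_num
      rw [this]
      have : 0 ≤ n ^ 2 * ‖x‖ ^ 2 := by positivity
      linarith
  have hconc := concentration isBounded_ball (H.h10_wflow c α (fun _ => 0) x₀ t₁) (x₀ := x₀) hr (by
    change _ ≤ r ^ 2 / 2 * wE J ψ lam c α (fun _ => 0) x₀ t₁
    rw [one_div, inv_mul_le_iff₀ (by positivity)] at hmom
    refine hmom.trans ?_
    calc 16 * h ^ 2 * (N t₁ * wE J ψ lam c α (fun _ => 0) x₀ t₁)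
        = 16 * h * (h * N t₁) * wE J ψ lam c α (fun _ => 0) x₀ t₁ := by ring
      _ ≤ 16 * h * X * wE J ψ lam c α (fun _ => 0) x₀ t₁ := by gcongr
      _ ≤ _ := by gcongr)
  have hconc' : wE J ψ lam c α (fun _ => 0) x₀ t₁ ≤ 2 * obs J ψ lam c x₀ r t₁ := by
    refine hconc.trans ?_
    gcongr
    have := H.wflow_obs_le (c := c) (α := α) (s := fun _ => 0) (p := x₀) (x₀ := x₀) (r := r)
      (t := t₁) (b := 0) fun x hx => by
        have h1 := hI t₁ ht₁I
        have : 0 ≤ α t₁ * ‖x - x₀‖ ^ 2 := by simp only [hα]; positivity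
        linarith
    simpa using this
  have hlow : -(R ^ 2 / h) + Gg t₁ ≤ L t₁ := by
    refine H.le_log_wE hc fun x hx => ?_
    have h1 : α t₁ = 1 / (4 * h) := by
      have : T - t₁ = h := by rw [hT]; ring
      simp only [hα, this]
    have h2 : α t₁ * ‖x - x₀‖ ^ 2 ≤ 1 / (4 * h) * (4 * R ^ 2) := by
      rw [h1]
      exact mul_le_mul_of_nonneg_left (hp x hx) (by positivity)
    have h3 : 1 / (4 * h) * (4 * R ^ 2) = R ^ 2 / h := by field_simp
    linarith
  have hO : 0 ≤ obs J ψ lam c x₀ r t₁ := obs_nonneg _ _ _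
  have hbound : R ^ 2 / h ≤ 48 * R ^ 2 / r ^ 2 * F + (56 * R ^ 4 / r ^ 2 + R ^ 2) / δ := by
    have e : R ^ 2 / h = R ^ 2 / r ^ 2 * (32 * X) + R ^ 2 / δ := by
      rw [hh]; field_simp
    have e' : 32 * X ≤ 48 * F + 56 * R ^ 2 / δ := by
      have h1 : n ^ 2 * δ * R ^ 2 ≤ 1 / δ * R ^ 2 := by gcongr
      have h2 : R ^ 2 / δ = 1 / δ * R ^ 2 := by ring
      have h3 : 56 * R ^ 2 / δ = 56 * (1 / δ * R ^ 2) := by ring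
      rw [hX, h2, h3]
      nlinarith
    rw [e]
    calc R ^ 2 / r ^ 2 * (32 * X) + R ^ 2 / δ
        ≤ R ^ 2 / r ^ 2 * (48 * F + 56 * R ^ 2 / δ) + R ^ 2 / δ := by gcongr
      _ = _ := by ring
  have hnE := H.nE_pos hc t₁
  have h1 : nE J ψ lam c t₁ ≤ Real.exp (R ^ 2 / h) * wE J ψ lam c α (fun _ => 0) x₀ t₁ := by
    have : Gg t₁ ≤ R ^ 2 / h + L t₁ := by linarith
    rwa [hGg, hL, Real.log_le_iff_le_exp hnE, Real.exp_add, Real.exp_log hE] at this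
  calc nE J ψ lam c t₁ ≤ Real.exp (R ^ 2 / h) * wE J ψ lam c α (fun _ => 0) x₀ t₁ := h1
    _ ≤ Real.exp (48 * R ^ 2 / r ^ 2 * F + (56 * R ^ 4 / r ^ 2 + R ^ 2) / δ) *
      (2 * obs J ψ lam c x₀ r t₁) := by gcongr
    _ = _ := by ring

end Modes

end Grushin

namespace Grushin

variable {d : ℕ}

theorem exists_mul_le_integral {f : ℝ → ℝ} (hf : Continuous f) {a b : ℝ} (hab : a < b) :
    ∃ t ∈ Icc a b, (b - a) * f t ≤ ∫ t in a..b, f t := by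
  obtain ⟨t, ht, h⟩ := isCompact_Icc.exists_isMinOn (nonempty_Icc.2 hab.le) hf.continuousOn
  refine ⟨t, ht, ?_⟩
  have := intervalIntegral.integral_mono_on (μ := volume) (f := fun _ => f t) (g := f) hab.le
    intervalIntegrable_const (hf.intervalIntegrable _ _) fun x hx => h hx
  simpa using this

theorem integral_le_integral_of_subinterval {f : ℝ → ℝ} (hf : Continuous f) (h0 : ∀ t, 0 ≤ f t)
    {a b A B : ℝ} (h1 : A ≤ a) (h2 : a ≤ b) (h3 : b ≤ B) :
    ∫ t in a..b, f t ≤ ∫ t in A..B, f t :=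
  intervalIntegral.integral_mono_interval h1 h2 h3 (Eventually.of_forall h0)
    (hf.intervalIntegrable _ _)

/-- From an interpolation estimate at each time to observability in time. -/
theorem telescope {Gf o : ℝ → ℝ} {A B τ : ℝ} (hA : 1 ≤ A) (hB : 0 ≤ B) (hτ : 0 < τ)
    (hG : Antitone Gf) (ho : Continuous o) (ho0 : ∀ t, 0 ≤ o t)
    (hstep : ∀ t δ, 0 < δ → δ ≤ τ →
      Real.exp (Gf t) ≤ 2 * Real.exp (A * (Gf (t - 2 * δ) - Gf t) + B / δ) * o t) :
    Real.exp (Gf τ) ≤ Real.exp (8 * (B + 1) * (2 * A + 1) / τ) * ∫ t in (0:ℝ)..τ, o t := by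
  set O := ∫ t in (0:ℝ)..τ, o t with hO
  set ϑ := 1 + 1 / (2 * A) with hϑ
  have hA0 : 0 < A := by linarith
  have hϑ1 : 1 < ϑ := by
    have : 0 < 1 / (2 * A) := by positivity
    linarith
  have hϑ0 : 0 < ϑ := by linarith
  set l : ℕ → ℝ := fun k => τ / ϑ ^ k with hl
  set δ : ℕ → ℝ := fun k => τ / ((4 * (2 * A + 1)) * ϑ ^ k) with hδ
  have hl0 : ∀ k, 0 < l k := fun k => by simp only [hl]; positivity
  have hδ0 : ∀ k, 0 < δ k := fun k => by simp only [hδ]; positivity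
  have hp1 : ∀ k, 1 ≤ ϑ ^ k := fun k => one_le_pow₀ hϑ1.le
  have hlτ : ∀ k, l k ≤ τ := fun k => div_le_self hτ.le (hp1 k)
  have hδτ : ∀ k, δ k ≤ τ := fun k => div_le_self hτ.le (by nlinarith [hp1 k])
  have hls : ∀ k, l k - l (k + 1) = 4 * δ k := fun k => by
    have := hp1 k
    have : ϑ ^ k ≠ 0 := by positivity
    have e : ϑ = (2 * A + 1) / (2 * A) := by rw [hϑ]; field_simp
    simp only [hl, hδ, pow_succ]
    generalize ϑ ^ k = q at *
    rw [e]
    field_simp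
    ring
  have hex : ∀ k, ∃ t ∈ Icc (l k - 2 * δ k) (l k), 2 * δ k * o t ≤ O := fun k => by
    have := hδ0 k
    obtain ⟨t, ht, h⟩ := exists_mul_le_integral ho (a := l k - 2 * δ k) (b := l k) (by linarith)
    refine ⟨t, ht, ?_⟩
    have h2 := integral_le_integral_of_subinterval ho ho0 (a := l k - 2 * δ k) (b := l k)
      (A := 0) (B := τ) (by linarith [hls k, hl0 (k + 1)]) (by linarith) (hlτ k)
    have e : l k - (l k - 2 * δ k) = 2 * δ k := by ring
    rw [e] at h
    linarith
  choose t ht hto using hex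
  have hopos : ∀ s, 0 < o s := fun s => by
    refine (ho0 s).lt_of_ne fun h => ?_
    have := hstep s τ hτ le_rfl
    rw [← h, mul_zero] at this
    linarith [Real.exp_pos (Gf s)]
  have hOpos : 0 < O := lt_of_lt_of_le (by have := hδ0 0; have := hopos (t 0); positivity) (hto 0)
  have hrec : ∀ k, (1 + A) * (Gf (t k) - Real.log O) ≤
      A * (Gf (t (k + 1)) - Real.log O) + (B + 1) / δ k := fun k => by
    have hδk := hδ0 k
    have h1 := hstep (t k) (δ k) hδk (hδτ k)
    have h2 : 2 * Real.exp (A * (Gf (t k - 2 * δ k) - Gf (t k)) + B / δ k) * o (t k) ≤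
        Real.exp (A * (Gf (t k - 2 * δ k) - Gf (t k)) + B / δ k) * (O * (1 / δ k)) := by
      have : 2 * o (t k) ≤ O * (1 / δ k) := by
        rw [mul_one_div, le_div_iff₀ hδk]; linarith [hto k]
      calc _ = Real.exp (A * (Gf (t k - 2 * δ k) - Gf (t k)) + B / δ k) * (2 * o (t k)) := by ring
        _ ≤ _ := by gcongr
    have h3 : 1 / δ k ≤ Real.exp (1 / δ k) := by
      linarith [Real.add_one_le_exp (1 / δ k)]
    have h4 : Real.exp (Gf (t k)) ≤ Real.exp (A * (Gf (t k - 2 * δ k) - Gf (t k)) + B / δ k +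
        (Real.log O + 1 / δ k)) := by
      rw [Real.exp_add _ (Real.log O + 1 / δ k), Real.exp_add (Real.log O), Real.exp_log hOpos]
      refine (h1.trans h2).trans ?_
      gcongr
    rw [Real.exp_le_exp] at h4
    have h5 : Gf (t k - 2 * δ k) ≤ Gf (t (k + 1)) := hG (by
      linarith [(ht k).1, (ht (k + 1)).2, hls k])
    have h6 : (B + 1) / δ k = B / δ k + 1 / δ k := by ring
    rw [h6]
    nlinarith
  set E := 2 * (B + 1) / δ 0 with hE
  set m : ℕ → ℝ := fun k => Gf (t k) - Real.log O - E * ϑ ^ k with hm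
  have hmrec : ∀ k, (1 + 1 / A) * m k ≤ m (k + 1) := fun k => by
    have h1 := hrec k
    have e : (B + 1) / δ k = E / 2 * ϑ ^ k := by
      simp only [hE, hδ]; field_simp
    rw [e] at h1
    have h2 : A * ((1 + 1 / A) * m k) ≤ A * m (k + 1) := by
      have e1 : A * ((1 + 1 / A) * m k) = (1 + A) * m k := by field_simp; ring
      have e2 : A * (E * ϑ ^ (k + 1)) = A * (E * ϑ ^ k) + E / 2 * ϑ ^ k := by
        rw [pow_succ]
        nth_rewrite 2 [hϑ]
        field_simp
      rw [e1]
      simp only [hm]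
      linarith
    exact le_of_mul_le_mul_left h2 hA0
  have hmk : ∀ k, (1 + 1 / A) ^ k * m 0 ≤ m k := fun k => by
    induction k with
    | zero => simp
    | succ k ih =>
      refine le_trans ?_ (hmrec k)
      rw [pow_succ]
      have : 0 ≤ 1 + 1 / A := by positivity
      nlinarith [mul_le_mul_of_nonneg_left ih this]
  have hE0 : 0 ≤ E := by have := hδ0 0; positivity
  have hm0 : m 0 ≤ 0 := by
    by_contra! hpos
    have h1 : Tendsto (fun k : ℕ => (1 + 1 / A) ^ k * m 0) atTop atTop :=
      (tendsto_pow_atTop_atTop_of_one_lt (by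
        have : 0 < 1 / A := by positivity
        linarith)).atTop_mul_const hpos
    obtain ⟨k, hk⟩ := (h1.eventually_gt_atTop (Gf 0 - Real.log O)).exists
    have h2 : Gf (t k) ≤ Gf 0 := hG (by linarith [(ht k).1, hls k, hl0 (k + 1), hδ0 k])
    have h3 := hmk k
    have h4 : m k ≤ Gf (t k) - Real.log O := by
      have : 0 ≤ E * ϑ ^ k := by positivity
      simp only [hm]; linarith
    linarith
  have h1 : Gf τ ≤ 8 * (B + 1) * (2 * A + 1) / τ + Real.log O := by
    have h2 : Gf τ ≤ Gf (t 0) := hG ((ht 0).2.trans (hlτ 0))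
    have h3 : E = 8 * (B + 1) * (2 * A + 1) / τ := by
      simp only [hE, hδ]; field_simp; ring
    simp only [hm, pow_zero, mul_one] at hm0
    linarith
  calc Real.exp (Gf τ) ≤ Real.exp (8 * (B + 1) * (2 * A + 1) / τ + Real.log O) :=
        Real.exp_le_exp.2 h1
    _ = _ := by rw [Real.exp_add, Real.exp_log hOpos]

namespace Modes

variable {R ν : ℝ} {ι : Type*} {J : Finset ι} {ψ : ι → Eu d → ℝ} {G : ι → Eu d → Eu d}
  {lam c : ι → ℝ}

theorem continuous_obs (H : Modes R ν J ψ G lam) (x₀ : Eu d) (r : ℝ) :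
    Continuous (obs J ψ lam c x₀ r) := by
  have e : obs J ψ lam c x₀ r = fun t => ∑ i ∈ J, ∑ j ∈ J, (c i * Real.exp (-lam i * t)) *
      (c j * Real.exp (-lam j * t)) * ∫ x in ball x₀ r, ψ i x * ψ j x := by
    ext t
    have hI : ∀ i ∈ J, ∀ j ∈ J, Integrable (fun x => (c i * Real.exp (-lam i * t)) *
        (c j * Real.exp (-lam j * t)) * (ψ i x * ψ j x)) (volume.restrict (ball x₀ r)) :=
      fun i hi j hj =>
        ((integrable_mul_of_memLp (H.h10 i hi).memf (H.h10 j hj).memf).const_mul _).integrableOn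
    have e : ∀ x, flow J ψ lam c 0 t x ^ 2 = ∑ i ∈ J, ∑ j ∈ J,
        (c i * Real.exp (-lam i * t)) * (c j * Real.exp (-lam j * t)) * (ψ i x * ψ j x) := by
      intro x
      unfold flow
      rw [sq, Finset.sum_mul_sum]
      refine Finset.sum_congr rfl fun i _ => Finset.sum_congr rfl fun j _ => ?_
      ring
    unfold obs
    simp_rw [e]
    rw [integral_finsetSum _ fun i hi => integrable_finsetSum _ fun j hj => hI i hi j hj]
    refine Finset.sum_congr rfl fun i hi => ?_
    rw [integral_finsetSum _ fun j hj => hI i hi j hj]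
    refine Finset.sum_congr rfl fun j _ => ?_
    rw [integral_const_mul]
  rw [e]
  fun_prop

theorem antitone_log_nE {n : ℝ} (hn : 0 ≤ n) (H : Modes R (n ^ 2) J ψ G lam)
    (hc : ∑ i ∈ J, c i ^ 2 ≠ 0) : Antitone fun t => Real.log (nE J ψ lam c t) := fun a b hab => by
  have := H.log_nE_sub_ge hc hab
  have h0 : 0 ≤ 2 * (n * d) * (b - a) := by
    have := sub_nonneg.2 hab
    positivity
  simp only; linarith

/-- Observability in every positive time with a cost growing exponentially in the frequency. -/
theorem rough_observability (hd : 2 ≤ d) {x₀ : Eu d} (hx₀ : ‖x₀‖ ≤ R) {r : ℝ} (hr : 0 < r) :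
    ∃ C : ℝ, 0 < C ∧ ∀ {ι : Type*} {J : Finset ι} {ψ : ι → Eu d → ℝ} {G : ι → Eu d → Eu d}
      {lam c : ι → ℝ} {n : ℝ}, 0 ≤ n → Modes R (n ^ 2) J ψ G lam → ∑ i ∈ J, c i ^ 2 ≠ 0 →
      ∀ τ, 0 < τ → nE J ψ lam c τ ≤
        Real.exp (C * (n + 1 + 1 / τ)) * ∫ t in (0:ℝ)..τ, obs J ψ lam c x₀ r t := by
  have hR : 0 ≤ R := (norm_nonneg _).trans hx₀
  set A := 48 * R ^ 2 / r ^ 2 + 1 with hA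
  set B := 56 * R ^ 4 / r ^ 2 + R ^ 2 with hB
  have hA1 : 1 ≤ A := by
    have : 0 ≤ 48 * R ^ 2 / r ^ 2 := by positivity
    linarith
  have hB0 : 0 ≤ B := by positivity
  refine ⟨8 * (B + 1) * (2 * A + 1), by positivity, ?_⟩
  intro ι J ψ G lam c n hn H hc τ hτ
  have hanti := H.antitone_log_nE hn hc
  have hO := H.continuous_obs (c := c) x₀ r
  have hO0 : ∀ t, 0 ≤ obs J ψ lam c x₀ r t := fun t => obs_nonneg x₀ r t
  set τ' := min τ (1 / (n + 1)) with hτ'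
  have hn1 : 0 < n + 1 := by linarith
  have hτ'0 : 0 < τ' := lt_min hτ (by positivity)
  have key := telescope hA1 hB0 hτ'0 hanti hO hO0 fun t δ hδ hδτ => by
    have h1 : n * δ ≤ 1 := by
      have : δ ≤ 1 / (n + 1) := hδτ.trans (min_le_right _ _)
      rw [le_div_iff₀ hn1] at this
      nlinarith
    have h2 := H.rough_step hd hn hc hx₀ hr (t₁ := t) hδ (by
      rw [le_div_iff₀ hδ]
      have : 0 ≤ n * δ := by positivity
      nlinarith)
    rw [Real.exp_log (H.nE_pos hc t)]
    refine h2.trans ?_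
    have h3 : 0 ≤ Real.log (nE J ψ lam c (t - 2 * δ)) - Real.log (nE J ψ lam c t) :=
      sub_nonneg.2 (hanti (by linarith))
    have := hO0 t
    rw [← hB]
    gcongr
    rw [hA]; linarith
  have h1 : nE J ψ lam c τ ≤ nE J ψ lam c τ' := by
    have := hanti (min_le_left τ (1 / (n + 1)))
    exact (Real.log_le_log_iff (H.nE_pos hc _) (H.nE_pos hc _)).1 this
  rw [Real.exp_log (H.nE_pos hc _)] at key
  have h2 := integral_le_integral_of_subinterval hO hO0 (le_refl (0:ℝ)) hτ'0.le (min_le_left _ _)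
  have h3 : 1 / τ' ≤ n + 1 + 1 / τ := by
    rcases min_choice τ (1 / (n + 1)) with h | h
    · rw [hτ', h]; linarith
    · rw [hτ', h, one_div_one_div]
      have : 0 < 1 / τ := by positivity
      linarith
  have h4 : 0 ≤ ∫ t in (0:ℝ)..τ', obs J ψ lam c x₀ r t :=
    intervalIntegral.integral_nonneg hτ'0.le fun t _ => hO0 t
  calc nE J ψ lam c τ ≤ _ := h1.trans key
    _ ≤ _ := by
      rw [← mul_one_div]
      gcongr

end Modes

end Grushin

namespace Grushin

variable {d : ℕ}

/-- The contraction factor of the Mehler-type weight. -/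
noncomputable def rho (n ρ₁ t₁ t : ℝ) : ℝ := ρ₁ * Real.exp (-(2 * n) * (t₁ - t))

theorem rho_self (n ρ₁ t₁ : ℝ) : rho n ρ₁ t₁ t₁ = ρ₁ := by simp [rho]

theorem rho_pos {n ρ₁ t₁ : ℝ} (h : 0 < ρ₁) (t : ℝ) : 0 < rho n ρ₁ t₁ t := by
  unfold rho; positivity

theorem rho_le {n ρ₁ t₁ t : ℝ} (hn : 0 ≤ n) (h : 0 ≤ ρ₁) (ht : t ≤ t₁) : rho n ρ₁ t₁ t ≤ ρ₁ := by
  have : Real.exp (-(2 * n) * (t₁ - t)) ≤ 1 := Real.exp_le_one_iff.2 (by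
    have := sub_nonneg.2 ht
    nlinarith [mul_nonneg hn this])
  exact mul_le_of_le_one_right h this

theorem mul_rho_le {n ρ₁ t₁ t δ : ℝ} (hδ : 0 < δ) (hn : 0 ≤ n) (h : 0 ≤ ρ₁) (h1 : ρ₁ ≤ 1)
    (ht : t ≤ t₁ - δ) : n * rho n ρ₁ t₁ t ≤ 1 / (2 * δ) := by
  have h2 : rho n ρ₁ t₁ t ≤ Real.exp (-(2 * n * δ)) := by
    unfold rho
    calc _ ≤ 1 * Real.exp (-(2 * n) * (t₁ - t)) := by gcongr
      _ ≤ _ := by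
        rw [one_mul, Real.exp_le_exp]
        nlinarith
  rw [le_div_iff₀ (by positivity)]
  have h3 := Real.add_one_le_exp (2 * n * δ)
  have h4 : Real.exp (-(2 * n * δ)) * Real.exp (2 * n * δ) = 1 := by
    rw [← Real.exp_add]; simp
  calc n * rho n ρ₁ t₁ t * (2 * δ) = (2 * n * δ) * rho n ρ₁ t₁ t := by ring
    _ ≤ Real.exp (2 * n * δ) * Real.exp (-(2 * n * δ)) := by
      gcongr
      · unfold rho; positivity
      · linarith
    _ = 1 := by rw [mul_comm, h4]

theorem hasDerivAt_rho (n ρ₁ t₁ t : ℝ) : HasDerivAt (rho n ρ₁ t₁) (2 * n * rho n ρ₁ t₁ t) t := by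
  unfold rho
  have h1 : HasDerivAt (fun t => -(2 * n) * (t₁ - t)) (2 * n) t :=
    (((hasDerivAt_id t).const_sub t₁).const_mul (-(2 * n))).congr_deriv (by ring)
  exact (h1.exp.const_mul ρ₁).congr_deriv (by ring)

theorem continuous_rho (n ρ₁ t₁ : ℝ) : Continuous (rho n ρ₁ t₁) := by
  unfold rho; fun_prop

theorem profile_sharp (n ρ₁ t₁ R : ℝ) : Profile {t | rho n ρ₁ t₁ t < 1}
    (fun t => n * rho n ρ₁ t₁ t / (1 - rho n ρ₁ t₁ t))
    (fun t => 2 * n ^ 2 * rho n ρ₁ t₁ t / (1 - rho n ρ₁ t₁ t) ^ 2)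
    (fun t => 4 * n ^ 3 * rho n ρ₁ t₁ t * (1 + rho n ρ₁ t₁ t) / (1 - rho n ρ₁ t₁ t) ^ 3)
    (fun t => n * rho n ρ₁ t₁ t * R ^ 2 / 2)
    (fun t => n ^ 2 * rho n ρ₁ t₁ t * R ^ 2)
    (fun t => 2 * n ^ 3 * rho n ρ₁ t₁ t * R ^ 2) := by
  have hd := hasDerivAt_rho n ρ₁ t₁
  have hcont := continuous_rho n ρ₁ t₁
  generalize rho n ρ₁ t₁ = ρ at *
  refine ⟨isOpen_lt hcont continuous_const, fun t ht => ?_, fun t ht => ?_, ?_,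
    fun t _ => ?_, fun t _ => ?_, by fun_prop⟩
  · have hT : 1 - ρ t ≠ 0 := (sub_pos.2 ht).ne'
    refine (((hd t).const_mul n).div ((hd t).const_sub 1) hT).congr_deriv ?_
    field_simp; ring
  · have hT : 1 - ρ t ≠ 0 := (sub_pos.2 ht).ne'
    refine (((hd t).const_mul (2 * n ^ 2)).div (((hd t).const_sub 1).pow 2)
      (pow_ne_zero _ hT)).congr_deriv ?_
    simp only [Pi.pow_apply]
    field_simp; simp; ring
  · refine ContinuousOn.div (by fun_prop) (by fun_prop) fun t ht => ?_
    exact pow_ne_zero _ (sub_pos.2 ht).ne'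
  · exact ((((hd t).const_mul n).mul_const (R ^ 2)).div_const 2).congr_deriv (by ring)
  · exact (((hd t).const_mul (n ^ 2)).mul_const (R ^ 2)).congr_deriv (by ring)

theorem effPot_sharp {n ρ R : ℝ} {p : Eu d} (hp : ‖p‖ = R) (hρ : ρ < 1) (x : Eu d) :
    effPot (n ^ 2) (n * ρ / (1 - ρ)) (2 * n ^ 2 * ρ / (1 - ρ) ^ 2) (n ^ 2 * ρ * R ^ 2) p x =
      n ^ 2 * ‖x - ρ • p‖ ^ 2 / (1 - ρ) := by
  have hT : 1 - ρ ≠ 0 := (sub_pos.2 hρ).ne'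
  unfold effPot
  rw [norm_sub_sq_real, norm_sub_sq_real, norm_smul, real_inner_smul_right, hp, mul_pow,
    Real.norm_eq_abs, sq_abs]
  field_simp
  ring

theorem sharp_ineq {n ρ R : ℝ} {p : Eu d} (hn : 0 ≤ n) (hp : ‖p‖ = R) (hρ0 : 0 ≤ ρ) (hρ : ρ < 1)
    (x : Eu d) :
    (4 * n ^ 3 * ρ * (1 + ρ) / (1 - ρ) ^ 3 / 2 -
      2 * (n * ρ / (1 - ρ)) * (2 * n ^ 2 * ρ / (1 - ρ) ^ 2)) * ‖x - p‖ ^ 2 - 2 * n ^ 3 * ρ * R ^ 2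
      - 2 * (n * ρ / (1 - ρ)) * (2 * n ^ 2 * inner ℝ x (x - p) +
        (2 * n ^ 2 * ρ / (1 - ρ) ^ 2 - 2 * (n * ρ / (1 - ρ)) ^ 2) * ‖x - p‖ ^ 2)
      ≤ 4 * (n * ρ / (1 - ρ)) * effPot (n ^ 2) (n * ρ / (1 - ρ)) (2 * n ^ 2 * ρ / (1 - ρ) ^ 2)
        (n ^ 2 * ρ * R ^ 2) p x + 0 := by
  have hT : 1 - ρ ≠ 0 := (sub_pos.2 hρ).ne'
  rw [effPot_sharp hp hρ, ← sub_nonneg]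
  have h0 : 0 ≤ ρ * n ^ 3 / (1 - ρ) ^ 2 * (6 * ‖x - ρ • p‖ ^ 2) := by positivity
  convert h0 using 1
  rw [inner_sub_right, real_inner_self_eq_norm_sq, norm_sub_sq_real, norm_sub_sq_real, norm_smul,
    real_inner_smul_right, hp, mul_pow, Real.norm_eq_abs, sq_abs]
  field_simp
  ring

namespace Modes

variable {R ν : ℝ} {ι : Type*} {J : Finset ι} {ψ : ι → Eu d → ℝ} {G : ι → Eu d → Eu d}
  {lam c : ι → ℝ}

set_option maxHeartbeats 2000000 in
/-- One step of the observability estimate with the weight adapted to the frequency. -/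
theorem sharp_step (hd : 2 ≤ d) {n : ℝ} (hn : 0 < n) (H : Modes R (n ^ 2) J ψ G lam)
    (hc : ∑ i ∈ J, c i ^ 2 ≠ 0) {x₀ : Eu d} {ρ₁ r t₁ δ F C₀ κ : ℝ} (hρ0 : 0 < ρ₁) (hρ1 : ρ₁ < 1)
    (hx₀ : ‖x₀‖ = ρ₁ * R) (hR : 0 < R) (hr : 0 < r) (hδ : 0 < δ)
    (hC₀ : C₀ = R ^ 2 / 2 + 2 * R ^ 2 / (1 - ρ₁)) (hκ : κ = 1 / (1 - ρ₁) ^ 2)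
    (hF : F = Real.log (nE J ψ lam c (t₁ - 2 * δ)) - Real.log (nE J ψ lam c (t₁ - δ)))
    (hsmall : κ * ((F + 2 * (C₀ / δ)) / (2 * δ)) ≤ r ^ 2 / 2 * n ^ 2) :
    nE J ψ lam c (t₁ - δ) ≤ 2 * Real.exp (C₀ / δ + κ * (F + 2 * (C₀ / δ)) +
      n * (‖x₀‖ ^ 2 + 2 * r * ‖x₀‖)) * obs J ψ lam c x₀ r t₁ := by
  obtain ⟨p, hp, hpx⟩ : ∃ p : Eu d, ‖p‖ = R ∧ ρ₁ • p = x₀ := by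
    refine ⟨ρ₁⁻¹ • x₀, ?_, ?_⟩
    · rw [norm_smul, hx₀, Real.norm_eq_abs, abs_of_pos (by positivity)]; field_simp
    · rw [smul_smul, mul_inv_cancel₀ hρ0.ne', one_smul]
  have P := profile_sharp n ρ₁ t₁ R
  have hρt : ∀ t, t ≤ t₁ → rho n ρ₁ t₁ t ≤ ρ₁ := fun t ht => rho_le hn.le hρ0.le ht
  have hρp : ∀ t, 0 < rho n ρ₁ t₁ t := fun t => rho_pos hρ0 t
  have hq : ∀ t ≤ t₁, ∀ x, effPot (n ^ 2) (n * rho n ρ₁ t₁ t / (1 - rho n ρ₁ t₁ t))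
      (2 * n ^ 2 * rho n ρ₁ t₁ t / (1 - rho n ρ₁ t₁ t) ^ 2) (n ^ 2 * rho n ρ₁ t₁ t * R ^ 2) p x =
      n ^ 2 * ‖x - rho n ρ₁ t₁ t • p‖ ^ 2 / (1 - rho n ρ₁ t₁ t) := fun t ht x =>
    effPot_sharp hp ((hρt t ht).trans_lt hρ1) x
  have hNd : ∀ t ≤ t₁, ∃ N', HasDerivAt (wN J ψ lam c
      (fun t => n * rho n ρ₁ t₁ t / (1 - rho n ρ₁ t₁ t))
      (fun t => 2 * n ^ 2 * rho n ρ₁ t₁ t / (1 - rho n ρ₁ t₁ t) ^ 2)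
      (fun t => n * rho n ρ₁ t₁ t * R ^ 2 / 2)
      (fun t => n ^ 2 * rho n ρ₁ t₁ t * R ^ 2) p) N' t ∧
      N' ≤ 4 * (n * rho n ρ₁ t₁ t / (1 - rho n ρ₁ t₁ t)) * wN J ψ lam c
      (fun t => n * rho n ρ₁ t₁ t / (1 - rho n ρ₁ t₁ t))
      (fun t => 2 * n ^ 2 * rho n ρ₁ t₁ t / (1 - rho n ρ₁ t₁ t) ^ 2)
      (fun t => n * rho n ρ₁ t₁ t * R ^ 2 / 2)
      (fun t => n ^ 2 * rho n ρ₁ t₁ t * R ^ 2) p t + 0 := fun t ht => by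
    have h1 : rho n ρ₁ t₁ t < 1 := (hρt t ht).trans_lt hρ1
    have h2 := sub_pos.2 h1
    have h3 := hρp t
    exact wN_deriv hd hp.le P H hc h1 (by positivity) fun x _ =>
      sharp_ineq hn.le hp h3.le h1 x
  have hLd := fun t (ht : t ≤ t₁) => log_wE_deriv (p := p) P H hc ((hρt t ht).trans_lt hρ1)
  have hNn := fun t (ht : t ≤ t₁) => H.wN_nonneg (p := p)
    (α := fun t => n * rho n ρ₁ t₁ t / (1 - rho n ρ₁ t₁ t))
    (α₁ := fun t => 2 * n ^ 2 * rho n ρ₁ t₁ t / (1 - rho n ρ₁ t₁ t) ^ 2)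
    (s := fun t => n * rho n ρ₁ t₁ t * R ^ 2 / 2)
    (s₁ := fun t => n ^ 2 * rho n ρ₁ t₁ t * R ^ 2) (t := t) hc fun x => by
      rw [hq t ht x]
      have h2 := sub_pos.2 ((hρt t ht).trans_lt hρ1)
      positivity
  have hmom := H.moment_le (p := p) (b := n ^ 2) (x₀ := x₀)
    (α := fun t => n * rho n ρ₁ t₁ t / (1 - rho n ρ₁ t₁ t))
    (α₁ := fun t => 2 * n ^ 2 * rho n ρ₁ t₁ t / (1 - rho n ρ₁ t₁ t) ^ 2)
    (s := fun t => n * rho n ρ₁ t₁ t * R ^ 2 / 2)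
    (s₁ := fun t => n ^ 2 * rho n ρ₁ t₁ t * R ^ 2) (t := t₁) hc fun x => by
      rw [hq t₁ le_rfl x, rho_self, hpx]
      rw [le_div_iff₀ (by linarith)]
      have : 0 ≤ n ^ 2 * ‖x - x₀‖ ^ 2 := by positivity
      nlinarith
  have hobs := H.wflow_obs_le (c := c) (p := p) (x₀ := x₀) (r := r)
    (b := n * (‖x₀‖ ^ 2 + 2 * r * ‖x₀‖))
    (α := fun t => n * rho n ρ₁ t₁ t / (1 - rho n ρ₁ t₁ t))
    (s := fun t => n * rho n ρ₁ t₁ t * R ^ 2 / 2) (t := t₁) fun x hx => by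
      simp only [rho_self]
      have h1 : 0 < 1 - ρ₁ := by linarith
      have h2 : (1 - ρ₁) * R - r ≤ ‖x - p‖ := by
        have e : (1 - ρ₁) • p = (x - ρ₁ • p) - (x - p) := by rw [sub_smul, one_smul]; abel
        have h3 : ‖(1 - ρ₁) • p‖ = (1 - ρ₁) * R := by
          rw [norm_smul, hp, Real.norm_eq_abs, abs_of_pos h1]
        have h4 := norm_sub_le (x - ρ₁ • p) (x - p)
        rw [← e, h3, hpx] at h4
        have h5 : ‖x - x₀‖ < r := by rwa [mem_ball, dist_eq_norm] at hx
        linarith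
      have h3 : ((1 - ρ₁) * R) ^ 2 - 2 * ((1 - ρ₁) * R) * r ≤ ‖x - p‖ ^ 2 := by
        have h5 : 0 ≤ (1 - ρ₁) * R := by positivity
        rcases le_total r ((1 - ρ₁) * R) with h | h
        · nlinarith [sub_nonneg.2 h]
        · nlinarith [sq_nonneg ‖x - p‖]
      have h4 : n * ρ₁ / (1 - ρ₁) * (((1 - ρ₁) * R) ^ 2 - 2 * ((1 - ρ₁) * R) * r) ≤
          n * ρ₁ / (1 - ρ₁) * ‖x - p‖ ^ 2 := by gcongr
      have h5 : n * ρ₁ / (1 - ρ₁) * (((1 - ρ₁) * R) ^ 2 - 2 * ((1 - ρ₁) * R) * r) =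
          n * ρ₁ * ((1 - ρ₁) * R ^ 2 - 2 * R * r) := by field_simp
      rw [hx₀]
      nlinarith
  have hup := H.log_wE_le (c := c) (p := p) (b := C₀ / δ)
    (α := fun t => n * rho n ρ₁ t₁ t / (1 - rho n ρ₁ t₁ t))
    (s := fun t => n * rho n ρ₁ t₁ t * R ^ 2 / 2) (t := t₁ - 2 * δ) hc fun x _ => by
      have h1 := mul_rho_le (t := t₁ - 2 * δ) (t₁ := t₁) hδ hn.le hρ0.le hρ1.le (by linarith)
      have h2 := sub_pos.2 ((hρt (t₁ - 2 * δ) (by linarith)).trans_lt hρ1)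
      have h3 := hρp (t₁ - 2 * δ)
      generalize rho n ρ₁ t₁ (t₁ - 2 * δ) = ρ at *
      have h4 : 0 ≤ n * ρ / (1 - ρ) * ‖x - p‖ ^ 2 := by positivity
      have h5 : n * ρ * R ^ 2 ≤ 1 / (2 * δ) * R ^ 2 := by gcongr
      have h6 : C₀ / δ = 1 / (2 * δ) * R ^ 2 + 2 * R ^ 2 / (1 - ρ₁) / δ := by
        rw [hC₀]; field_simp
      have h7 : 0 ≤ 2 * R ^ 2 / (1 - ρ₁) / δ := by
        have : 0 < 1 - ρ₁ := by linarith
        positivity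
      linarith
  have hlow := H.le_log_wE (c := c) (p := p) (b := -(C₀ / δ))
    (α := fun t => n * rho n ρ₁ t₁ t / (1 - rho n ρ₁ t₁ t))
    (s := fun t => n * rho n ρ₁ t₁ t * R ^ 2 / 2) (t := t₁ - δ) hc fun x hx => by
      have h1 := mul_rho_le (t := t₁ - δ) (t₁ := t₁) hδ hn.le hρ0.le hρ1.le (by linarith)
      have h2 := hρt (t₁ - δ) (by linarith)
      have h3 := hρp (t₁ - δ)
      generalize rho n ρ₁ t₁ (t₁ - δ) = ρ at *
      have h8 : 0 < 1 - ρ₁ := by linarith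
      have h9 : ‖x - p‖ ^ 2 ≤ 4 * R ^ 2 := by
        have := norm_sub_le x p
        have := mem_ball_zero_iff.1 hx
        nlinarith [norm_nonneg (x - p)]
      have h4 : n * ρ / (1 - ρ) * ‖x - p‖ ^ 2 ≤ 1 / (2 * δ) / (1 - ρ₁) * (4 * R ^ 2) := by
        gcongr
      have h5 : 0 ≤ n * ρ * R ^ 2 := by positivity
      have h6 : C₀ / δ = R ^ 2 / 2 / δ + 1 / (2 * δ) / (1 - ρ₁) * (4 * R ^ 2) := by
        rw [hC₀]; field_simp; ring
      have h7 : 0 ≤ R ^ 2 / 2 / δ := by positivity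
      linarith
  have hconc := concentration (x₀ := x₀) (r := r) isBounded_ball (H.h10_wflow c
    (fun t => n * rho n ρ₁ t₁ t / (1 - rho n ρ₁ t₁ t))
    (fun t => n * rho n ρ₁ t₁ t * R ^ 2 / 2) p t₁) hr
  have hE₁ := H.wE_pos hc (fun t => n * rho n ρ₁ t₁ t / (1 - rho n ρ₁ t₁ t))
    (fun t => n * rho n ρ₁ t₁ t * R ^ 2 / 2) p t₁
  have hwE : ∀ (α s : ℝ → ℝ), ip (wflow J ψ lam c α s p t₁) (wflow J ψ lam c α s p t₁) =
    wE J ψ lam c α s p t₁ := fun _ _ => rfl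
  rw [hwE] at hconc
  generalize (fun t => n * rho n ρ₁ t₁ t * R ^ 2 / 2) = s at *
  generalize (fun t => n ^ 2 * rho n ρ₁ t₁ t * R ^ 2) = s₁ at *
  generalize (fun t => 2 * n ^ 2 * rho n ρ₁ t₁ t / (1 - rho n ρ₁ t₁ t) ^ 2) = α₁ at *
  have hw : ∀ t ≤ t₁, HasDerivAt (fun t => (1 - rho n ρ₁ t₁ t) ^ 2)
      (-4 * (n * rho n ρ₁ t₁ t / (1 - rho n ρ₁ t₁ t)) * (1 - rho n ρ₁ t₁ t) ^ 2) t := fun t ht => by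
    have h2 := sub_pos.2 ((hρt t ht).trans_lt hρ1)
    refine (((hasDerivAt_rho n ρ₁ t₁ t).const_sub 1).pow 2).congr_deriv ?_
    field_simp
    simp
    ring
  have hstep : ∀ t t', t ≤ t' → t' ≤ t₁ →
      wN J ψ lam c (fun t => n * rho n ρ₁ t₁ t / (1 - rho n ρ₁ t₁ t)) α₁ s s₁ p t' ≤
      κ * wN J ψ lam c (fun t => n * rho n ρ₁ t₁ t / (1 - rho n ρ₁ t₁ t)) α₁ s s₁ p t :=
    fun t t' htt' ht' => by
    have := weighted_antitone (N := wN J ψ lam c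
      (fun t => n * rho n ρ₁ t₁ t / (1 - rho n ρ₁ t₁ t)) α₁ s s₁ p)
      (w := fun t => (1 - rho n ρ₁ t₁ t) ^ 2) (a := t) (b := t') (E := 0) (e := fun _ => 0)
      (α := fun t => n * rho n ρ₁ t₁ t / (1 - rho n ρ₁ t₁ t))
      (fun t ht => hNd t (ht.2.trans ht')) (fun t ht => hw t (ht.2.trans ht'))
      (fun t _ => sq_nonneg _)
      (fun t _ => by simp) (left_mem_Icc.2 htt') (right_mem_Icc.2 htt') htt'
    have h0 : 0 < 1 - ρ₁ := by linarith
    have h1 : 0 < (1 - ρ₁) ^ 2 := by positivity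
    rw [hκ, one_div, ← div_eq_inv_mul, le_div_iff₀ h1]
    have h2 : (1 - rho n ρ₁ t₁ t) ^ 2 ≤ 1 := by
      have := hρp t
      have := hρt t (htt'.trans ht')
      nlinarith
    have h3 : (1 - ρ₁) ^ 2 ≤ (1 - rho n ρ₁ t₁ t') ^ 2 := by
      have := hρt t' ht'
      gcongr
    have h4 := mul_le_mul_of_nonneg_right h2 (hNn t (htt'.trans ht'))
    have h5 := mul_le_mul_of_nonneg_right h3 (hNn t' ht')
    linarith
  generalize (fun t => n * rho n ρ₁ t₁ t / (1 - rho n ρ₁ t₁ t)) = α at *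
  obtain ⟨t, ht, hsl⟩ := exists_slope_eq (by linarith : t₁ - 2 * δ < t₁ - δ)
    fun t ht => hLd t (by linarith [ht.2])
  obtain ⟨t', ht', hsl'⟩ := exists_slope_eq (by linarith : t₁ - δ < t₁)
    fun t ht => hLd t ht.2
  have hN1 := hstep t t₁ (by linarith [ht.2]) le_rfl
  have hN2 := hstep t t' (by linarith [ht.2, ht'.1]) ht'.2.le
  have hD : wN J ψ lam c α α₁ s s₁ p t ≤ (F + 2 * (C₀ / δ)) / (2 * δ) := by
    rw [le_div_iff₀ (by positivity)]
    have e : t₁ - δ - (t₁ - 2 * δ) = δ := by ring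
    rw [e] at hsl
    linarith
  have hκ0 : 0 ≤ κ := by rw [hκ]; positivity
  have hD' := mul_le_mul_of_nonneg_left hD hκ0
  have h1 : ∫ x, ‖x - x₀‖ ^ 2 * wflow J ψ lam c α s p t₁ x ^ 2 ≤
      r ^ 2 / 2 * wE J ψ lam c α s p t₁ := by
    have h2 : wN J ψ lam c α α₁ s s₁ p t₁ ≤ r ^ 2 / 2 * n ^ 2 := by linarith
    have h3 := mul_le_mul_of_nonneg_right h2 hE₁.le
    have h4 : 0 < n ^ 2 := by positivity
    refine le_of_mul_le_mul_left ?_ h4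
    linarith
  have h2 := (hconc h1).trans (mul_le_mul_of_nonneg_left hobs zero_le_two)
  have h3 : Real.log (nE J ψ lam c (t₁ - δ)) ≤ C₀ / δ + κ * (F + 2 * (C₀ / δ)) +
      Real.log (wE J ψ lam c α s p t₁) := by
    have e : t₁ - (t₁ - δ) = δ := by ring
    rw [e] at hsl'
    have h4 : 2 * δ * wN J ψ lam c α α₁ s s₁ p t' ≤
        2 * δ * (κ * ((F + 2 * (C₀ / δ)) / (2 * δ))) :=
      mul_le_mul_of_nonneg_left (hN2.trans hD') (by positivity)
    have h5 : 2 * δ * (κ * ((F + 2 * (C₀ / δ)) / (2 * δ))) = κ * (F + 2 * (C₀ / δ)) := by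
      field_simp
    linarith
  rw [Real.log_le_iff_le_exp (H.nE_pos hc _), Real.exp_add _ (Real.log _), Real.exp_log hE₁] at h3
  calc nE J ψ lam c (t₁ - δ) ≤ _ := h3
    _ ≤ Real.exp (C₀ / δ + κ * (F + 2 * (C₀ / δ))) * (2 * (Real.exp
      (n * (‖x₀‖ ^ 2 + 2 * r * ‖x₀‖)) * obs J ψ lam c x₀ r t₁)) := by gcongr
    _ = _ := by rw [Real.exp_add _ (n * _)]; ring

end Modes

end Grushin

namespace Grushin

variable {d : ℕ}

namespace Modes

variable {R ν : ℝ} {ι : Type*} {J : Finset ι} {ψ : ι → Eu d → ℝ} {G : ι → Eu d → Eu d}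
  {lam c : ι → ℝ}

theorem obs_mono (H : Modes R ν J ψ G lam) (x₀ : Eu d) {r r' : ℝ} (h : r' ≤ r) (t : ℝ) :
    obs J ψ lam c x₀ r' t ≤ obs J ψ lam c x₀ r t :=
  setIntegral_mono_set (integrable_sq (H.h10_flow c 0 t).memf).integrableOn
    (Eventually.of_forall fun _ => sq_nonneg _) (ball_subset_ball h).eventuallyLE

/-- For large frequencies, either the energy decays fast initially, or the observability inequality
follows from the sharp weight. -/
theorem high_frequency (hd : 2 ≤ d) {n : ℝ} (H : Modes R (n ^ 2) J ψ G lam)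
    (hc : ∑ i ∈ J, c i ^ 2 ≠ 0) {x₀ : Eu d} {ρ₁ r T τ δ ε C₀ κ Ct Δ : ℝ} (hn : 1 ≤ n)
    (hρ0 : 0 < ρ₁) (hρ1 : ρ₁ < 1)
    (hx₀ : ‖x₀‖ = ρ₁ * R) (hR : 0 < R) (hr : 0 < r) (hδ : 0 < δ) (hτ : 0 < τ) (hδτ : δ ≤ τ)
    (hC₀ : C₀ = R ^ 2 / 2 + 2 * R ^ 2 / (1 - ρ₁)) (hκ : κ = 1 / (1 - ρ₁) ^ 2)
    (hε : δ * Ct = ε * τ) (hε1 : ε ≤ 1) (hτT : 5 * τ ≤ T)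
    (hΔ : Δ = 2 * d * T - ‖x₀‖ ^ 2) (hΔ0 : 0 ≤ Δ)
    (h1 : 2 * r * ‖x₀‖ ≤ Δ / 8) (h2 : 8 * d * τ ≤ Δ / 8) (h3 : κ * ε ≤ Δ / 8)
    (hbig : κ * (1 + 2 * (C₀ / δ)) ≤ δ * r ^ 2 * n)
    (hrough : nE J ψ lam c τ ≤ Real.exp (Ct * n) * ∫ t in (0:ℝ)..τ, obs J ψ lam c x₀ r t) :
    nE J ψ lam c T ≤ (1 + 2 * Real.exp (C₀ / δ + κ * (2 * (C₀ / δ))) / δ) *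
      ∫ t in (0:ℝ)..T, obs J ψ lam c x₀ r t := by
  have hanti := H.antitone_log_nE (by linarith) hc
  have hO := H.continuous_obs (c := c) x₀ r
  have hO0 : ∀ t, 0 ≤ obs J ψ lam c x₀ r t := fun t => obs_nonneg x₀ r t
  have hκ0 : 0 ≤ κ := by rw [hκ]; positivity
  have hC₀0 : 0 ≤ C₀ := by
    have : 0 < 1 - ρ₁ := by linarith
    rw [hC₀]; positivity
  have h_int : 0 ≤ ∫ t in (0:ℝ)..T, obs J ψ lam c x₀ r t :=
    intervalIntegral.integral_nonneg (by linarith) fun t _ => hO0 t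
  have hle : ∀ a b, a ≤ b → nE J ψ lam c b ≤ nE J ψ lam c a := fun a b hab =>
    (Real.log_le_log_iff (H.nE_pos hc _) (H.nE_pos hc _)).1 (hanti hab)
  rcases le_or_gt (Ct * n) (Real.log (nE J ψ lam c τ) - Real.log (nE J ψ lam c (2 * τ)))
    with hcase | hcase
  · have e1 : Real.exp (Ct * n) * nE J ψ lam c (2 * τ) ≤ nE J ψ lam c τ := by
      rw [← Real.exp_log (H.nE_pos hc (2 * τ)), ← Real.exp_add, ← Real.le_log_iff_exp_le
        (H.nE_pos hc _)]
      linarith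
    have e2 := le_of_mul_le_mul_left (e1.trans hrough) (Real.exp_pos _)
    have e3 := integral_le_integral_of_subinterval hO hO0 (le_refl (0:ℝ)) hτ.le
      (by linarith : τ ≤ T)
    have e4 := hle (2 * τ) T (by linarith)
    have e5 : 0 ≤ 2 * Real.exp (C₀ / δ + κ * (2 * (C₀ / δ))) / δ *
      ∫ t in (0:ℝ)..T, obs J ψ lam c x₀ r t := by positivity
    linarith
  · obtain ⟨t₁, ht₁, hobs⟩ := exists_mul_le_integral hO
      (by linarith : 2 * τ + 2 * δ < 2 * τ + 3 * δ)
    have hN := H.nN_antitone hd hR.le hc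
    have hF : Real.log (nE J ψ lam c (t₁ - 2 * δ)) - Real.log (nE J ψ lam c (t₁ - δ)) ≤ ε * n := by
      obtain ⟨t, ht, e⟩ := exists_slope_eq (by linarith : t₁ - 2 * δ < t₁ - δ)
        fun t _ => H.log_nE_deriv hc t
      obtain ⟨t', ht', e'⟩ := exists_slope_eq (by linarith : τ < 2 * τ)
        fun t _ => H.log_nE_deriv hc t
      have h4 : nN J ψ lam c t ≤ nN J ψ lam c t' := hN (by linarith [ht.1, ht'.2, ht₁.1])
      have e1 : t₁ - δ - (t₁ - 2 * δ) = δ := by ring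
      have e2 : 2 * τ - τ = τ := by ring
      rw [e1] at e
      rw [e2] at e'
      rw [e]
      have h5 : τ * (2 * nN J ψ lam c t) ≤ Ct * n := by
        have := mul_le_mul_of_nonneg_left h4 hτ.le
        linarith
      refine le_of_mul_le_mul_left ?_ hτ
      calc τ * (2 * δ * nN J ψ lam c t) = δ * (τ * (2 * nN J ψ lam c t)) := by ring
        _ ≤ δ * (Ct * n) := by gcongr
        _ = τ * (ε * n) := by rw [← mul_assoc, hε]; ring
    have hsharp := H.sharp_step hd (by linarith : 0 < n) hc hρ0 hρ1 hx₀ hR hr (t₁ := t₁) hδ hC₀ hκ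
      rfl (by
        have h6 : 0 ≤ 2 * (C₀ / δ) := by positivity
        have h7 : (Real.log (nE J ψ lam c (t₁ - 2 * δ)) - Real.log (nE J ψ lam c (t₁ - δ)) +
          2 * (C₀ / δ)) ≤ (1 + 2 * (C₀ / δ)) * n := by
          have : ε * n ≤ 1 * n := by gcongr
          nlinarith
        rw [← mul_div_assoc, div_le_iff₀ (by positivity)]
        calc _ ≤ κ * ((1 + 2 * (C₀ / δ)) * n) := by gcongr
          _ = κ * (1 + 2 * (C₀ / δ)) * n := by ring
          _ ≤ δ * r ^ 2 * n * n := by gcongr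
          _ = _ := by ring)
    have hdiss := H.log_nE_sub_ge hc (a := t₁ - δ) (b := T) (by linarith [ht₁.2])
    have h4 : Real.exp (2 * (n * d) * (T - (t₁ - δ))) * nE J ψ lam c T ≤
        nE J ψ lam c (t₁ - δ) := by
      rw [← Real.exp_log (H.nE_pos hc T), ← Real.exp_add, ← Real.le_log_iff_exp_le (H.nE_pos hc _)]
      linarith
    have h5 : nE J ψ lam c T ≤ 2 * Real.exp (C₀ / δ + κ * (2 * (C₀ / δ))) *
        obs J ψ lam c x₀ r t₁ := by
      refine le_of_mul_le_mul_left (h4.trans (hsharp.trans ?_)) (Real.exp_pos _)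
      have h6 : C₀ / δ + κ * (Real.log (nE J ψ lam c (t₁ - 2 * δ)) -
          Real.log (nE J ψ lam c (t₁ - δ)) + 2 * (C₀ / δ)) + n * (‖x₀‖ ^ 2 + 2 * r * ‖x₀‖) ≤
          2 * (n * d) * (T - (t₁ - δ)) + (C₀ / δ + κ * (2 * (C₀ / δ))) := by
        have h7 := mul_le_mul_of_nonneg_left hF hκ0
        have h8 : 2 * (n * d) * (T - 4 * τ) ≤ 2 * (n * d) * (T - (t₁ - δ)) := by
          have : T - 4 * τ ≤ T - (t₁ - δ) := by linarith [ht₁.2]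
          have : 0 ≤ 2 * (n * (d:ℝ)) := by positivity
          gcongr
        have h9 : n * (κ * ε + (‖x₀‖ ^ 2 + 2 * r * ‖x₀‖)) ≤ n * (2 * d * (T - 4 * τ)) := by
          have : κ * ε + (‖x₀‖ ^ 2 + 2 * r * ‖x₀‖) ≤ 2 * d * (T - 4 * τ) := by linarith
          gcongr
        linarith
      calc _ ≤ 2 * Real.exp (2 * (n * d) * (T - (t₁ - δ)) + (C₀ / δ + κ * (2 * (C₀ / δ)))) *
            obs J ψ lam c x₀ r t₁ := by
            have := hO0 t₁
            gcongr
        _ = _ := by rw [Real.exp_add]; ring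
    have h6 := integral_le_integral_of_subinterval hO hO0 (A := 0) (B := T)
      (by positivity : 0 ≤ 2 * τ + 2 * δ) (by linarith : 2 * τ + 2 * δ ≤ 2 * τ + 3 * δ)
      (by linarith)
    have h7 : obs J ψ lam c x₀ r t₁ ≤ (∫ t in (0:ℝ)..T, obs J ψ lam c x₀ r t) / δ := by
      rw [le_div_iff₀ hδ]
      have e : 2 * τ + 3 * δ - (2 * τ + 2 * δ) = δ := by ring
      rw [e] at hobs
      linarith
    calc nE J ψ lam c T ≤ _ := h5
      _ ≤ 2 * Real.exp (C₀ / δ + κ * (2 * (C₀ / δ))) *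
        ((∫ t in (0:ℝ)..T, obs J ψ lam c x₀ r t) / δ) := by gcongr
      _ ≤ _ := by
        rw [add_mul, one_mul]
        have : ∀ a b : ℝ, a * (b / δ) = a / δ * b := fun a b => by ring
        rw [this]
        linarith

/-- Observability from a ball, uniformly in the frequency. -/
theorem observability (hd : 2 ≤ d) {x₀ : Eu d} (h0 : 0 < ‖x₀‖) (hxR : ‖x₀‖ < R) {r T : ℝ}
    (hr : 0 < r) (hT : ‖x₀‖ ^ 2 < 2 * d * T) :
    ∃ K : ℝ, 0 < K ∧ ∀ {ι : Type*} {J : Finset ι} {ψ : ι → Eu d → ℝ} {G : ι → Eu d → Eu d}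
      {lam c : ι → ℝ} {n : ℝ}, 0 ≤ n → Modes R (n ^ 2) J ψ G lam →
      nE J ψ lam c T ≤ K * ∫ t in (0:ℝ)..T, obs J ψ lam c x₀ r t := by
  have hR : 0 < R := h0.trans hxR
  have hd0 : (2:ℝ) ≤ d := by exact_mod_cast hd
  have hT0 : 0 < T := by
    by_contra! h
    have : 2 * (d:ℝ) * T ≤ 0 := mul_nonpos_of_nonneg_of_nonpos (by positivity) h
    nlinarith
  obtain ⟨Δ, hΔ⟩ : ∃ Δ, Δ = 2 * d * T - ‖x₀‖ ^ 2 := ⟨_, rfl⟩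
  have hΔ0 : 0 < Δ := by linarith
  obtain ⟨ρ₁, hρ⟩ : ∃ ρ₁, ρ₁ = ‖x₀‖ / R := ⟨_, rfl⟩
  have hρ0 : 0 < ρ₁ := by rw [hρ]; positivity
  have hρ1 : ρ₁ < 1 := by rw [hρ, div_lt_one hR]; exact hxR
  have hx₀ : ‖x₀‖ = ρ₁ * R := by rw [hρ]; field_simp
  have hρ2 : 0 < 1 - ρ₁ := by linarith
  obtain ⟨κ, hκ⟩ : ∃ κ, κ = 1 / (1 - ρ₁) ^ 2 := ⟨_, rfl⟩
  have hκ0 : 0 < κ := by rw [hκ]; positivity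
  obtain ⟨C₀, hC₀⟩ : ∃ C₀, C₀ = R ^ 2 / 2 + 2 * R ^ 2 / (1 - ρ₁) := ⟨_, rfl⟩
  have hC₀0 : 0 < C₀ := by rw [hC₀]; positivity
  obtain ⟨r', hr'0, hr'r, hr'⟩ : ∃ r' : ℝ, 0 < r' ∧ r' ≤ r ∧ 2 * r' * ‖x₀‖ ≤ Δ / 8 := by
    refine ⟨min r (Δ / (16 * ‖x₀‖)), lt_min hr (by positivity), min_le_left _ _, ?_⟩
    have := min_le_right r (Δ / (16 * ‖x₀‖))
    rw [le_div_iff₀ (by positivity)] at this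
    linarith
  obtain ⟨τ, hτ0, hτ1, hτ2⟩ : ∃ τ : ℝ, 0 < τ ∧ 8 * d * τ ≤ Δ / 8 ∧ 5 * τ ≤ T := by
    refine ⟨Δ / (64 * d), by positivity, ?_, ?_⟩
    · apply le_of_eq; field_simp; norm_num
    · rw [← mul_div_assoc, div_le_iff₀ (by positivity)]
      nlinarith [sq_nonneg ‖x₀‖]
  obtain ⟨ε, hε0, hε1, hε⟩ : ∃ ε : ℝ, 0 < ε ∧ ε ≤ 1 ∧ κ * ε ≤ Δ / 8 := by
    refine ⟨min 1 (Δ / (8 * κ)), lt_min one_pos (by positivity), min_le_left _ _, ?_⟩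
    have := min_le_right 1 (Δ / (8 * κ))
    rw [le_div_iff₀ (by positivity)] at this
    linarith
  obtain ⟨C, hC, hrough⟩ := rough_observability hd hxR.le hr'0
  obtain ⟨Ct, hCt⟩ : ∃ Ct, Ct = C * (2 + 1 / τ) + 1 := ⟨_, rfl⟩
  have hCt1 : 1 ≤ Ct := by
    have : 0 ≤ C * (2 + 1 / τ) := by positivity
    linarith
  obtain ⟨δ, hδ0, hδτ, hδ⟩ : ∃ δ : ℝ, 0 < δ ∧ δ ≤ τ ∧ δ * Ct = ε * τ := by
    have hCt0 : 0 < Ct := by linarith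
    refine ⟨ε * τ / Ct, by positivity, ?_, by field_simp⟩
    rw [div_le_iff₀ hCt0]
    nlinarith
  obtain ⟨n₀, hn₀⟩ : ∃ n₀, n₀ = max 1 (κ * (1 + 2 * (C₀ / δ)) / (δ * r' ^ 2)) := ⟨_, rfl⟩
  refine ⟨Real.exp (C * (n₀ + 1 + 1 / T)) +
    (1 + 2 * Real.exp (C₀ / δ + κ * (2 * (C₀ / δ))) / δ), by positivity, ?_⟩
  intro ι J ψ G lam c n hn H
  by_cases hc : ∑ i ∈ J, c i ^ 2 = 0
  · have h1 : nE J ψ lam c T = 0 := by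
      unfold nE
      rw [H.ip_flow]
      rw [Finset.sum_eq_zero_iff_of_nonneg fun i _ => sq_nonneg _] at hc
      refine Finset.sum_eq_zero fun i hi => ?_
      rw [pow_eq_zero_iff two_ne_zero |>.1 (hc i hi)]; simp
    rw [h1]
    have : 0 ≤ ∫ t in (0:ℝ)..T, obs J ψ lam c x₀ r t :=
      intervalIntegral.integral_nonneg hT0.le fun t _ => obs_nonneg x₀ r t
    positivity
  have hmono : ∫ t in (0:ℝ)..T, obs J ψ lam c x₀ r' t ≤ ∫ t in (0:ℝ)..T, obs J ψ lam c x₀ r t :=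
    intervalIntegral.integral_mono_on hT0.le ((H.continuous_obs x₀ r').intervalIntegrable _ _)
      ((H.continuous_obs x₀ r).intervalIntegrable _ _) fun t _ => H.obs_mono x₀ hr'r t
  have hI0 : 0 ≤ ∫ t in (0:ℝ)..T, obs J ψ lam c x₀ r' t :=
    intervalIntegral.integral_nonneg hT0.le fun t _ => obs_nonneg x₀ r' t
  refine le_trans ?_ (mul_le_mul_of_nonneg_left hmono (by positivity))
  rw [add_mul]
  rcases lt_or_ge n n₀ with hnn | hnn
  · have h1 := hrough hn H hc T hT0
    refine le_trans h1 (le_trans ?_ (le_add_of_nonneg_right (by positivity)))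
    gcongr
  · refine le_trans ?_ (le_add_of_nonneg_left (by positivity))
    have hn1 : 1 ≤ n := (le_max_left _ _).trans (hn₀ ▸ hnn)
    have hn2 : κ * (1 + 2 * (C₀ / δ)) / (δ * r' ^ 2) ≤ n := (le_max_right _ _).trans (hn₀ ▸ hnn)
    rw [div_le_iff₀ (by positivity)] at hn2
    refine H.high_frequency hd hc hn1 hρ0 hρ1 hx₀ hR hr'0 hδ0 hτ0 hδτ hC₀ hκ hδ hε1 hτ2 hΔ hΔ0.le
      hr' hτ1 hε (by linarith) ?_
    have h2 : 0 ≤ ∫ t in (0:ℝ)..τ, obs J ψ lam c x₀ r' t :=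
      intervalIntegral.integral_nonneg hτ0.le fun t _ => obs_nonneg x₀ r' t
    refine (hrough hn H hc τ hτ0).trans ?_
    refine mul_le_mul_of_nonneg_right (Real.exp_le_exp.2 ?_) h2
    rw [hCt]
    have h3 : 0 < 1 / τ := by positivity
    nlinarith [mul_nonneg hC.le (mul_nonneg h3.le (sub_nonneg.2 hn1)),
      mul_nonneg hC.le (sub_nonneg.2 hn1)]

end Modes

end Grushin

namespace Grushin

theorem _root_.Orthonormal.countable {ι H : Type*} [NormedAddCommGroup H] [InnerProductSpace ℝ H]
    [SecondCountableTopology H] {e : ι → H} (he : Orthonormal ℝ e) : Countable ι := by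
  rw [← Set.countable_univ_iff]
  refine PairwiseDisjoint.countable_of_isOpen (s := fun i => ball (e i) (1 / 2)) ?_
    (fun i _ => isOpen_ball) (fun i _ => ⟨e i, mem_ball_self (by norm_num)⟩)
  intro i _ k _ hik
  refine ball_disjoint_ball ?_
  have h : ‖e i - e k‖ * ‖e i - e k‖ = 2 := by
    rw [@norm_sub_mul_self_real, he.1, he.1, he.2 hik]; norm_num
  rw [dist_eq_norm]
  nlinarith [norm_nonneg (e i - e k)]

/-- Spectral decomposition associated with a compact contraction between Hilbert spaces. -/
theorem exists_eigenfamily {V H : Type} [NormedAddCommGroup V] [InnerProductSpace ℝ V]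
    [CompleteSpace V] [NormedAddCommGroup H] [InnerProductSpace ℝ H] [CompleteSpace H]
    [SecondCountableTopology H] (j : V →L[ℝ] H) (hj : IsCompactOperator j)
    (hle : ∀ v, ‖j v‖ ≤ ‖v‖) :
    ∃ (ι : Type) (v : ι → V) (lam : ι → ℝ), Countable ι ∧ (∀ i, 0 ≤ lam i) ∧
      (∀ i w, inner ℝ (v i) w = (lam i + 1) * inner ℝ (j (v i)) (j w)) ∧
      Orthonormal ℝ (fun i => j (v i)) ∧
      ∀ f, (∀ e, (∀ w, inner ℝ e (j w) = 0) → inner ℝ f e = 0) →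
        HasSum (fun i => (inner ℝ f (j (v i))) ^ 2) (‖f‖ ^ 2) := by
  let S : H →L[ℝ] H := j ∘L (ContinuousLinearMap.adjoint j)
  have hSc : IsCompactOperator S := hj.comp_clm _
  have hSs : S.IsSymmetric := fun x y => by
    simp only [S, ContinuousLinearMap.coe_comp, Function.comp_apply, ContinuousLinearMap.coe_coe]
    rw [← ContinuousLinearMap.adjoint_inner_right, ContinuousLinearMap.adjoint_inner_left]
  have hbot := ContinuousLinearMap.orthogonalComplement_iSup_eigenspaces_eq_bot hSc hSs
  have hof := hSs.orthogonalFamily_eigenspaces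
  have hcl : ∀ μ : ℝ, CompleteSpace (Module.End.eigenspace (S : Module.End ℝ H) μ) := fun μ => by
    have : IsClosed ((Module.End.eigenspace (S : Module.End ℝ H) μ : Submodule ℝ H) : Set H) := by
      have : ((Module.End.eigenspace (S : Module.End ℝ H) μ : Submodule ℝ H) : Set H)
          = {x | S x = μ • x} := by
        ext x; simp
      rw [this]
      exact isClosed_eq S.continuous (continuous_const_smul μ)
    exact this.completeSpace_coe
  choose w b hb using fun μ : ℝ =>
    exists_hilbertBasis ℝ (Module.End.eigenspace (S : Module.End ℝ H) μ)
  let e : (Σ μ, w μ) → H := fun p => (b p.1 p.2 : H)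
  have heo : Orthonormal ℝ e :=
    hof.orthonormal_sigma_orthonormal (v_family := fun μ => b μ) fun μ => (b μ).orthonormal
  have hsp : (⊤ : Submodule ℝ H) ≤ (Submodule.span ℝ (range e)).topologicalClosure := by
    rw [top_le_iff, Submodule.topologicalClosure_eq_top_iff, Submodule.eq_bot_iff]
    intro x hx
    have : x ∈ (⨆ μ, Module.End.eigenspace (S : Module.End ℝ H) μ)ᗮ := by
      rw [Submodule.mem_orthogonal] at hx ⊢
      intro u hu
      induction hu using Submodule.iSup_induction' with
      | zero => simp
      | add u v _ _ hu hv => rw [inner_add_left, hu, hv, add_zero]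
      | mem μ u hu =>
        have hs := (b μ).hasSum_repr ⟨u, hu⟩
        have hs' := (hs.mapL (Submodule.subtypeL _)).mapL (innerSL ℝ x)
        have h0 : ∀ i, inner ℝ x (e ⟨μ, i⟩) = 0 := fun i => by
          rw [real_inner_comm]
          exact hx _ (Submodule.subset_span ⟨⟨μ, i⟩, rfl⟩)
        have h1 : inner ℝ x u = 0 := by
          refine hs'.unique ?_
          convert hasSum_zero with i
          have := h0 i
          simp only [e] at this
          simp [this]
        rw [real_inner_comm]; exact h1
    rwa [hbot] at this
  let B := HilbertBasis.mk heo hsp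
  have hB : ⇑B = e := HilbertBasis.coe_mk heo hsp
  have hSe : ∀ p, S (e p) = p.1 • e p := fun p => by
    have := (b p.1 p.2).2
    rwa [Module.End.mem_eigenspace_iff] at this
  have hn : ∀ p, inner ℝ (e p) (e p) = 1 := fun p => by
    rw [real_inner_self_eq_norm_sq, heo.1 p]; norm_num
  have hadj : ∀ p w', inner ℝ (ContinuousLinearMap.adjoint j (e p)) w' = inner ℝ (e p) (j w') :=
    fun p w' => ContinuousLinearMap.adjoint_inner_left ..
  let v : {p : Σ μ, w μ // p.1 ≠ 0} → V := fun p => p.1.1⁻¹ • ContinuousLinearMap.adjoint j (e p.1)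
  have hjv : ∀ p, j (v p) = e p.1 := fun p => by
    have := hSe p.1
    simp only [S, ContinuousLinearMap.coe_comp, Function.comp_apply] at this
    simp only [v, map_smul, this, smul_smul, inv_mul_cancel₀ p.2, one_smul]
  have hvw : ∀ p w', inner ℝ (v p) w' = p.1.1⁻¹ * inner ℝ (e p.1) (j w') := fun p w' => by
    simp only [v, real_inner_smul_left, hadj]
  refine ⟨_, v, fun p => p.1.1⁻¹ - 1, ?_, ?_, ?_, ?_, ?_⟩
  · have : Orthonormal ℝ (fun p : {p : Σ μ, w μ // p.1 ≠ 0} => e p.1) :=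
      heo.comp _ Subtype.val_injective
    exact this.countable
  · intro p
    have h1 := hle (v p)
    rw [hjv, heo.1] at h1
    have h2 := hvw p (v p)
    rw [hjv, hn, real_inner_self_eq_norm_sq] at h2
    nlinarith
  · intro p w'
    rw [hvw, hjv]; ring
  · simp only [hjv]
    exact heo.comp _ Subtype.val_injective
  · intro f hf
    have h1 := B.hasSum_inner_mul_inner f f
    rw [hB, real_inner_self_eq_norm_sq] at h1
    simp only [hjv]
    have h2 : HasSum (fun p => (inner ℝ f (e p)) ^ 2) (‖f‖ ^ 2) := by
      have : (fun p => (inner ℝ f (e p)) ^ 2) = fun p => inner ℝ f (e p) * inner ℝ (e p) f := by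
        ext p
        rw [real_inner_comm f (e p), sq]
      rwa [this]
    refine (hasSum_subtype_iff_of_support_subset (s := {p | p.1 ≠ 0}) ?_).2 h2
    intro p hp
    contrapose! hp
    simp only [Set.mem_ofPred_eq, not_not] at hp
    rw [Function.notMem_support]
    have h0 : ContinuousLinearMap.adjoint j (e p) = 0 := by
      have h := hadj p (ContinuousLinearMap.adjoint j (e p))
      have h' := hSe p
      simp only [S, ContinuousLinearMap.coe_comp, Function.comp_apply, hp, zero_smul] at h'
      rw [h', inner_zero_right] at h
      exact inner_self_eq_zero.1 h
    rw [hf (e p) fun w' => by rw [← hadj, h0, inner_zero_left]]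
    norm_num

end Grushin

namespace Grushin

variable {d : ℕ}

/-- Half-open cube of side `ε` with integer index `k`. -/
def cube (ε : ℝ) (k : Fin d → ℤ) : Set (Eu d) := {x | ∀ i, ⌊x i / ε⌋ = k i}

theorem cube_eq_preimage {ε : ℝ} (hε : 0 < ε) (k : Fin d → ℤ) :
    cube ε k = (@WithLp.ofLp 2 (Fin d → ℝ)) ⁻¹'
      (univ.pi fun i => Ico (ε * k i) (ε * (k i + 1))) := by
  ext x
  simp only [cube, Set.mem_ofPred_eq, mem_preimage, Set.mem_pi, mem_univ, true_imp_iff, mem_Ico,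
    Int.floor_eq_iff, le_div_iff₀ hε, div_lt_iff₀ hε, mul_comm ε]

theorem measurableSet_cube {ε : ℝ} (hε : 0 < ε) (k : Fin d → ℤ) :
    MeasurableSet (cube ε k : Set (Eu d)) := by
  rw [cube_eq_preimage hε]
  exact (PiLp.volume_preserving_ofLp (Fin d)).measurable
    (MeasurableSet.univ_pi fun i => measurableSet_Ico)

theorem volume_cube {ε : ℝ} (hε : 0 < ε) (k : Fin d → ℤ) :
    volume (cube ε k : Set (Eu d)) = ENNReal.ofReal (ε ^ d) := by
  rw [cube_eq_preimage hε, (PiLp.volume_preserving_ofLp (Fin d)).measure_preimage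
    (MeasurableSet.univ_pi fun i => measurableSet_Ico).nullMeasurableSet, Real.volume_pi_Ico]
  have : ∀ i, ε * ((k i : ℝ) + 1) - ε * k i = ε := fun i => by ring
  simp only [this, Finset.prod_const, Finset.card_univ, Fintype.card_fin]
  rw [ENNReal.ofReal_pow hε.le]

theorem norm_sub_le_of_mem_cube {ε : ℝ} (hε : 0 < ε) {k : Fin d → ℤ} {x y : Eu d}
    (hx : x ∈ cube ε k) (hy : y ∈ cube ε k) : ‖y - x‖ ≤ √d * ε := by
  rw [EuclideanSpace.norm_eq, ← Real.sqrt_sq hε.le, ← Real.sqrt_mul (by positivity)]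
  refine Real.sqrt_le_sqrt ?_
  have : ∀ i ∈ Finset.univ, ‖(y - x) i‖ ^ 2 ≤ ε ^ 2 := fun i _ => by
    rw [cube_eq_preimage hε] at hx hy
    have h1 := hx i (mem_univ i)
    have h2 := hy i (mem_univ i)
    have h3 : |(y - x) i| ≤ ε := by
      rw [abs_le]
      simp only [PiLp.sub_apply]
      constructor <;> nlinarith [h1.1, h1.2, h2.1, h2.2]
    rw [Real.norm_eq_abs]
    gcongr
  refine (Finset.sum_le_sum this).trans ?_
  simp

theorem coeFn_sum_smul {κ : Type*} (S : Finset κ) (a : κ → ℝ)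
    (f : κ → Lp ℝ 2 (volume : Measure (Eu d))) :
    ((∑ k ∈ S, a k • f k : Lp ℝ 2 (volume : Measure (Eu d))) : Eu d → ℝ)
      =ᵐ[volume] fun x => ∑ k ∈ S, a k * f k x := by
  classical
  induction S using Finset.induction_on with
  | empty =>
    simp only [Finset.sum_empty]
    exact Lp.coeFn_zero _ _ _
  | insert k S hk ih =>
    simp only [Finset.sum_insert hk]
    filter_upwards [Lp.coeFn_add (a k • f k) (∑ k ∈ S, a k • f k), Lp.coeFn_smul (a k) (f k), ih]
      with x h1 h2 h3
    rw [h1, Pi.add_apply, h2, h3, Pi.smul_apply, smul_eq_mul]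

/-- Comparing a function with its average over a cube containing `x`. -/
theorem sq_sub_average_le {ε : ℝ} (hε : 0 < ε) {h : Eu d → ℝ} (hh : Continuous h)
    (k : Fin d → ℤ) {x : Eu d} (hx : x ∈ cube ε k) :
    (h x - (ε ^ d)⁻¹ * ∫ y in cube ε k, h y) ^ 2 ≤
      (ε ^ d)⁻¹ * ∫ v in closedBall (0 : Eu d) (√d * ε), (h (x + v) - h x) ^ 2 := by
  have hεd : 0 < ε ^ d := by positivity
  have hfin : volume (cube ε k) ≠ ⊤ := by rw [volume_cube hε]; exact ENNReal.ofReal_ne_top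
  have hsub : cube ε k ⊆ closedBall x (√d * ε) := fun y hy => by
    rw [mem_closedBall, dist_eq_norm]; exact norm_sub_le_of_mem_cube hε hx hy
  have hcI : ∀ g : Eu d → ℝ, Continuous g → IntegrableOn g (cube ε k) := fun g hg =>
    (hg.continuousOn.integrableOn_compact (isCompact_closedBall x (√d * ε))).mono_set hsub
  have hc1 : Continuous fun y => h x - h y := by fun_prop
  have hvr : (volume.restrict (cube ε k)).real univ = ε ^ d := by
    rw [measureReal_restrict_apply MeasurableSet.univ, univ_inter, Measure.real, volume_cube hε,
      ENNReal.toReal_ofReal hεd.le]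
  have : IsFiniteMeasure (volume.restrict (cube ε k)) := ⟨by simpa using hfin.lt_top⟩
  have e1 : h x - (ε ^ d)⁻¹ * ∫ y in cube ε k, h y
      = (ε ^ d)⁻¹ * ∫ y in cube ε k, (h x - h y) * 1 := by
    simp only [mul_one]
    rw [integral_sub (integrable_const _) (hcI h hh), integral_const, hvr]
    field_simp
    simp [mul_comm]
  have hm1 : MemLp (fun y => h x - h y) 2 (volume.restrict (cube ε k)) :=
    (memLp_two_iff_integrable_sq hc1.aestronglyMeasurable).2 (hcI _ (by fun_prop))
  have hcs := sq_integral_mul_le hm1 (memLp_const (1:ℝ))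
  have e2 : ∫ y in cube ε k, (h x - h y) ^ 2 ≤
      ∫ v in closedBall (0 : Eu d) (√d * ε), (h (x + v) - h x) ^ 2 := by
    rw [← integral_indicator (measurableSet_cube hε k), ← integral_indicator measurableSet_closedBall,
      ← integral_add_left_eq_self _ x]
    have hi : Integrable ((closedBall (0 : Eu d) (√d * ε)).indicator
        fun v => (h (x + v) - h x) ^ 2) := by
      rw [integrable_indicator_iff measurableSet_closedBall]
      exact ContinuousOn.integrableOn_compact (isCompact_closedBall _ _) (by fun_prop)
    refine integral_mono_of_nonneg (Eventually.of_forall fun v => ?_) hi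
      (Eventually.of_forall fun v => ?_)
    · exact indicator_nonneg (fun _ _ => sq_nonneg _) _
    · by_cases hv : x + v ∈ cube ε k
      · have : v ∈ closedBall (0 : Eu d) (√d * ε) := by
          have := norm_sub_le_of_mem_cube hε hx hv
          simpa using this
        simp only [indicator_of_mem hv, indicator_of_mem this]
        exact le_of_eq (by ring)
      · simp only [indicator_of_notMem hv]
        exact indicator_nonneg (fun _ _ => sq_nonneg _) _
  rw [e1, mul_pow]
  simp only [one_pow, integral_const, smul_eq_mul, mul_one, hvr] at hcs
  calc (ε ^ d)⁻¹ ^ 2 * (∫ y in cube ε k, (h x - h y) * 1) ^ 2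
      ≤ (ε ^ d)⁻¹ ^ 2 * ((∫ y in cube ε k, (h x - h y) ^ 2) * ε ^ d) := by
        simp only [mul_one]
        gcongr
    _ = (ε ^ d)⁻¹ * ∫ y in cube ε k, (h x - h y) ^ 2 := by field_simp
    _ ≤ _ := by gcongr

theorem IsTest.lintegral_shift_le {U : Set (Eu d)} {h : Eu d → ℝ} (hh : IsTest U h) (r : ℝ) :
    ∫⁻ x, ∫⁻ v in closedBall (0 : Eu d) r, ENNReal.ofReal ((h (x + v) - h x) ^ 2) ≤
      ENNReal.ofReal (r ^ 2 * ∫ x, ‖gradient h x‖ ^ 2) * volume (closedBall (0 : Eu d) r) := by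
  have hc : Continuous fun p : Eu d × Eu d => ENNReal.ofReal ((h (p.1 + p.2) - h p.1) ^ 2) := by
    have := hh.cont
    exact ENNReal.continuous_ofReal.comp (by fun_prop)
  rw [lintegral_lintegral_swap hc.aemeasurable, ← setLIntegral_const]
  refine setLIntegral_mono measurable_const fun v hv => ?_
  have hm : MemLp (fun x => h (x + v)) 2 volume :=
    hh.memLp.comp_measurePreserving (measurePreserving_add_right volume v)
  have hi : Integrable fun x => (h (x + v) - h x) ^ 2 := (hm.sub hh.memLp).integrable_sq
  rw [← ofReal_integral_eq_lintegral_ofReal hi (Eventually.of_forall fun _ => sq_nonneg _)]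
  refine ENNReal.ofReal_le_ofReal ?_
  have := hh.integral_sq_diff_le le_rfl v (M := r) fun x s _ _ => by simpa using hv
  simpa using this


theorem exists_cube_approx {U : Set (Eu d)} (hU : Bornology.IsBounded U) :
    ∃ C : ℝ, 0 ≤ C ∧ ∀ ε : ℝ, 0 < ε →
      ∃ P : Lp ℝ 2 (volume : Measure (Eu d)) →L[ℝ] Lp ℝ 2 (volume : Measure (Eu d)),
        IsCompactOperator P ∧ ∀ h (hh : IsTest U h),
          ‖hh.memLp.toLp h - P (hh.memLp.toLp h)‖
            ≤ C * ε * ‖hh.memLp_gradient.toLp (gradient h)‖ := by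
  obtain ⟨B, hB⟩ := hU.exists_norm_le
  set β : ℝ := (volume (ball (0 : Eu d) 1)).toReal with hβ
  have hβ0 : 0 ≤ β := ENNReal.toReal_nonneg
  refine ⟨√(√d ^ d * β * d), Real.sqrt_nonneg _, fun ε hε => ?_⟩
  have hεd : 0 < ε ^ d := by positivity
  have hfin : ∀ k : Fin d → ℤ, volume (cube ε k) ≠ ⊤ := fun k => by
    rw [volume_cube hε]; exact ENNReal.ofReal_ne_top
  let S : Finset (Fin d → ℤ) := Fintype.piFinset fun _ => Finset.Icc ⌊-B / ε⌋ ⌊B / ε⌋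
  have hS : ∀ x ∈ U, (fun i => ⌊x i / ε⌋) ∈ S := fun x hx => by
    simp only [S, Fintype.mem_piFinset, Finset.mem_Icc]
    intro i
    have h1 : |x i| ≤ B := (PiLp.norm_apply_le x i).trans (hB x hx)
    rw [abs_le] at h1
    constructor <;> apply Int.floor_le_floor <;> gcongr
    · exact h1.1
    · exact h1.2
  let e : (Fin d → ℤ) → Lp ℝ 2 (volume : Measure (Eu d)) := fun k =>
    indicatorConstLp 2 (measurableSet_cube hε k) (hfin k) 1
  let P : Lp ℝ 2 (volume : Measure (Eu d)) →L[ℝ] Lp ℝ 2 (volume : Measure (Eu d)) :=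
    ∑ k ∈ S, (ε ^ d)⁻¹ • (innerSL ℝ (e k)).smulRight (e k)
  refine ⟨P, ?_, fun h hh => ?_⟩
  · have : P ∈ compactOperator (RingHom.id ℝ) (Lp ℝ 2 (volume : Measure (Eu d)))
        (Lp ℝ 2 (volume : Measure (Eu d))) := by
      refine Submodule.sum_mem _ fun k _ => Submodule.smul_mem _ _ ?_
      change IsCompactOperator ((innerSL ℝ (e k)).smulRight (e k))
      have h1 : IsCompactOperator (innerSL ℝ (e k)) :=
        isCompactOperator_of_locallyCompactSpace_dom (innerSL ℝ (e k))
      exact h1.clm_comp (ContinuousLinearMap.toSpanSingleton ℝ (e k))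
    exact this
  set Q : Eu d → ℝ := fun x => ∑ k ∈ S, ((ε ^ d)⁻¹ * ∫ y in cube ε k, h y) *
    (cube ε k).indicator (fun _ => (1:ℝ)) x with hQ
  have hPae : (P (hh.memLp.toLp h) : Eu d → ℝ) =ᵐ[volume] Q := by
    have e1 : P (hh.memLp.toLp h) = ∑ k ∈ S, ((ε ^ d)⁻¹ * ∫ y in cube ε k, h y) • e k := by
      simp only [P, _root_.sum_apply]
      refine Finset.sum_congr rfl fun k _ => ?_
      have : inner ℝ (e k) (hh.memLp.toLp h) = ∫ y in cube ε k, h y := by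
        simp only [e]
        rw [L2.inner_indicatorConstLp_one]
        exact integral_congr_ae (ae_restrict_of_ae hh.memLp.coeFn_toLp)
      simp [this, smul_smul]
    have h2 : ∀ᵐ x : Eu d, ∀ k : Fin d → ℤ, e k x = (cube ε k).indicator (fun _ => (1:ℝ)) x :=
      ae_all_iff.2 fun k => indicatorConstLp_coeFn
    rw [e1]
    filter_upwards [coeFn_sum_smul S (fun k => (ε ^ d)⁻¹ * ∫ y in cube ε k, h y) e, h2]
      with x h3 h4
    rw [h3, hQ]
    exact Finset.sum_congr rfl fun k _ => by rw [h4]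
  have hpt : ∀ x, (h x - Q x) ^ 2 ≤
      (ε ^ d)⁻¹ * ∫ v in closedBall (0 : Eu d) (√d * ε), (h (x + v) - h x) ^ 2 := fun x => by
    have hx0 : x ∈ cube ε (fun i => ⌊x i / ε⌋) := fun i => rfl
    have hne : ∀ k, k ≠ (fun i => ⌊x i / ε⌋) → x ∉ cube ε k := fun k hk hx =>
      hk (funext fun i => (hx i).symm)
    by_cases hm : (fun i => ⌊x i / ε⌋) ∈ S
    · have : Q x = (ε ^ d)⁻¹ * ∫ y in cube ε (fun i => ⌊x i / ε⌋), h y := by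
        rw [hQ]
        simp only
        rw [Finset.sum_eq_single_of_mem _ hm fun k _ hk => by
          rw [indicator_of_notMem (hne k hk), mul_zero], indicator_of_mem hx0, mul_one]
      rw [this]
      exact sq_sub_average_le hε hh.cont _ hx0
    · have h1 : Q x = 0 := Finset.sum_eq_zero fun k hk => by
        rw [indicator_of_notMem (hne k fun h => hm (h ▸ hk)), mul_zero]
      have h2 : h x = 0 := hh.zero_of_notMem fun hx => hm (hS x hx)
      rw [h1, h2]
      have : 0 ≤ ∫ v in closedBall (0 : Eu d) (√d * ε), (h (x + v) - 0) ^ 2 :=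
        integral_nonneg fun _ => sq_nonneg _
      simp only [sub_zero, ne_eq, OfNat.ofNat_ne_zero, not_false_eq_true, zero_pow] at this ⊢
      positivity
  have hgn : ‖hh.memLp_gradient.toLp (gradient h)‖ ^ 2 = ∫ x, ‖gradient h x‖ ^ 2 := by
    rw [← real_inner_self_eq_norm_sq, inner_toLp]
    simp only [real_inner_self_eq_norm_sq]
  have hn : ‖hh.memLp.toLp h - P (hh.memLp.toLp h)‖ ^ 2 = ∫ x, (h x - Q x) ^ 2 := by
    rw [← real_inner_self_eq_norm_sq, L2.inner_def]
    refine integral_congr_ae ?_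
    filter_upwards [Lp.coeFn_sub (hh.memLp.toLp h) (P (hh.memLp.toLp h)), hh.memLp.coeFn_toLp,
      hPae] with x h1 h2 h3
    rw [h1, Pi.sub_apply, h2, h3]
    simp [sq]
  have hmain : ‖hh.memLp.toLp h - P (hh.memLp.toLp h)‖ ^ 2 ≤
      (√d ^ d * β * d) * ε ^ 2 * ∫ x, ‖gradient h x‖ ^ 2 := by
    rw [hn]
    by_cases hi : Integrable fun x => (h x - Q x) ^ 2
    swap
    · rw [integral_undef hi]; positivity
    rw [integral_eq_lintegral_of_nonneg_ae (Eventually.of_forall fun _ => sq_nonneg _) hi.1]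
    refine ENNReal.toReal_le_of_le_ofReal (by positivity) ?_
    calc ∫⁻ x, ENNReal.ofReal ((h x - Q x) ^ 2)
        ≤ ∫⁻ x, ENNReal.ofReal (ε ^ d)⁻¹ * ∫⁻ v in closedBall (0 : Eu d) (√d * ε),
            ENNReal.ofReal ((h (x + v) - h x) ^ 2) := by
          refine lintegral_mono fun x => ?_
          refine (ENNReal.ofReal_le_ofReal (hpt x)).trans (le_of_eq ?_)
          rw [ENNReal.ofReal_mul (by positivity), ofReal_integral_eq_lintegral_ofReal]
          · have := hh.cont
            exact ContinuousOn.integrableOn_compact (isCompact_closedBall _ _) (by fun_prop)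
          · exact Eventually.of_forall fun _ => sq_nonneg _
      _ ≤ ENNReal.ofReal (ε ^ d)⁻¹ * (ENNReal.ofReal ((√d * ε) ^ 2 * ∫ x, ‖gradient h x‖ ^ 2) *
            volume (closedBall (0 : Eu d) (√d * ε))) := by
          rw [lintegral_const_mul' _ _ ENNReal.ofReal_ne_top]
          gcongr
          exact hh.lintegral_shift_le _
      _ ≤ _ := by
          rw [Measure.addHaar_closedBall _ _ (by positivity),
            ← ENNReal.ofReal_toReal (measure_ball_lt_top (μ := volume) (x := (0 : Eu d))
              (r := 1)).ne, ← hβ, finrank_euclideanSpace_fin, ← ENNReal.ofReal_mul (by positivity),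
            ← ENNReal.ofReal_mul (by positivity), ← ENNReal.ofReal_mul (by positivity)]
          refine ENNReal.ofReal_le_ofReal (le_of_eq ?_)
          have hsd : (√d : ℝ) ^ 2 = d := Real.sq_sqrt (by positivity)
          rw [mul_pow, mul_pow, hsd]
          field_simp
  rw [← hgn] at hmain
  refine abs_le_of_sq_le_sq' ?_ (by positivity) |>.2
  rw [mul_pow, mul_pow, Real.sq_sqrt (by positivity)]
  exact hmain

end Grushin

namespace Grushin

variable {d : ℕ}

/-- Ambient Hilbert space for the graph of `u ↦ (u, √ν‖x‖u, ∇u)`. -/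
abbrev FormAmbient (d : ℕ) : Type :=
  WithLp 2 (Lp ℝ 2 (volume : Measure (Eu d)) ×
    WithLp 2 (Lp ℝ 2 (volume : Measure (Eu d)) × Lp (Eu d) 2 (volume : Measure (Eu d))))

theorem IsTest.memLp_weight {U : Set (Eu d)} {h : Eu d → ℝ} (hh : IsTest U h) (s : ℝ) :
    MemLp (fun x => (s * ‖x‖) * h x) 2 volume :=
  ((by fun_prop : Continuous fun x : Eu d => s * ‖x‖).mul hh.cont).memLp_of_hasCompactSupport
    hh.compact.mul_left

noncomputable def formEmb {U : Set (Eu d)} (s : ℝ) {h : Eu d → ℝ} (hh : IsTest U h) :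
    FormAmbient d :=
  WithLp.toLp 2 (hh.memLp.toLp h, WithLp.toLp 2 ((hh.memLp_weight s).toLp _,
    hh.memLp_gradient.toLp _))

theorem IsTest.const_mul {U : Set (Eu d)} {h : Eu d → ℝ} (hh : IsTest U h) (c : ℝ) :
    IsTest U (fun x => c * h x) := hh.mul_left contDiff_const

theorem gradient_const_mul {h : Eu d → ℝ} (hh : Differentiable ℝ h) (c : ℝ) (x : Eu d) :
    gradient (fun x => c * h x) x = c • gradient h x := by
  rw [gradient_mul (by fun_prop) (hh x)]
  have : gradient (fun _ : Eu d => c) x = 0 := gradient_eq_of_inner fun v => by simp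
  simp [this]

theorem formEmb_add {U : Set (Eu d)} (s : ℝ) {h k : Eu d → ℝ} (hh : IsTest U h) (hk : IsTest U k) :
    formEmb s (hh.add hk) = formEmb s hh + formEmb s hk := by
  refine congrArg (WithLp.toLp 2) (Prod.ext ?_ (congrArg (WithLp.toLp 2) (Prod.ext ?_ ?_)))
  · exact MemLp.toLp_add hh.memLp hk.memLp
  · exact MemLp.toLp_congr ((hh.add hk).memLp_weight s) ((hh.memLp_weight s).add (hk.memLp_weight s))
      (Eventually.of_forall fun x => mul_add _ _ _)
  · exact MemLp.toLp_congr (hh.add hk).memLp_gradient (hh.memLp_gradient.add hk.memLp_gradient)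
      (Eventually.of_forall fun x => gradient_fun_add (hh.diff x) (hk.diff x))

theorem formEmb_const_mul {U : Set (Eu d)} (s : ℝ) {h : Eu d → ℝ} (hh : IsTest U h) (c : ℝ) :
    formEmb s (hh.const_mul c) = c • formEmb s hh := by
  refine congrArg (WithLp.toLp 2) (Prod.ext ?_ (congrArg (WithLp.toLp 2) (Prod.ext ?_ ?_)))
  · exact MemLp.toLp_const_smul c hh.memLp
  · exact MemLp.toLp_congr ((hh.const_mul c).memLp_weight s) ((hh.memLp_weight s).const_smul c)
      (Eventually.of_forall fun x => mul_left_comm _ _ _)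
  · exact MemLp.toLp_congr (hh.const_mul c).memLp_gradient (hh.memLp_gradient.const_smul c)
      (Eventually.of_forall fun x => gradient_const_mul hh.diff c x)

/-- Images of test functions in the ambient space. -/
noncomputable def testSubmodule (U : Set (Eu d)) (s : ℝ) : Submodule ℝ (FormAmbient d) where
  carrier := {p | ∃ h, ∃ hh : IsTest U h, p = formEmb s hh}
  add_mem' := by
    rintro _ _ ⟨h, hh, rfl⟩ ⟨k, hk, rfl⟩
    exact ⟨_, hh.add hk, (formEmb_add s hh hk).symm⟩
  zero_mem' := by
    refine ⟨_, (IsTest.zero (U := U)).const_mul 0, ?_⟩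
    rw [formEmb_const_mul _ IsTest.zero, zero_smul]
  smul_mem' := by
    rintro c _ ⟨h, hh, rfl⟩
    exact ⟨_, hh.const_mul c, (formEmb_const_mul s hh c).symm⟩

theorem norm_gradient_le_formEmb {U : Set (Eu d)} (s : ℝ) {h : Eu d → ℝ} (hh : IsTest U h) :
    ‖hh.memLp_gradient.toLp (gradient h)‖ ≤ ‖formEmb s hh‖ := by
  refine abs_le_of_sq_le_sq' ?_ (norm_nonneg _) |>.2
  rw [WithLp.prod_norm_sq_eq_of_L2, WithLp.prod_norm_sq_eq_of_L2]
  change _ ≤ ‖hh.memLp.toLp h‖ ^ 2 + (‖(hh.memLp_weight s).toLp _‖ ^ 2 +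
    ‖hh.memLp_gradient.toLp (gradient h)‖ ^ 2)
  have h1 := sq_nonneg ‖hh.memLp.toLp h‖
  have h2 := sq_nonneg ‖(hh.memLp_weight s).toLp _‖
  linarith

theorem norm_fstL_le (p : FormAmbient d) : ‖WithLp.fstL 2 ℝ _ _ p‖ ≤ ‖p‖ := by
  refine abs_le_of_sq_le_sq' ?_ (norm_nonneg _) |>.2
  rw [WithLp.prod_norm_sq_eq_of_L2 p]
  change ‖p.fst‖ ^ 2 ≤ _
  nlinarith [norm_nonneg p.snd]

theorem inner_formEmb {U : Set (Eu d)} (s : ℝ) {h k : Eu d → ℝ} (hh : IsTest U h)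
    (hk : IsTest U k) :
    inner ℝ (formEmb s hh) (formEmb s hk) = (∫ x, h x * k x) +
      ((∫ x, h x * ((s ^ 2 * ‖x‖ ^ 2) * k x)) +
        ∫ x, (inner ℝ (gradient h x) (gradient k x) : ℝ)) := by
  rw [WithLp.prod_inner_apply, WithLp.prod_inner_apply]
  simp only [formEmb, inner_toLp]
  refine congrArg₂ _ ?_ (congrArg₂ _ ?_ rfl)
  · exact integral_congr_ae (Eventually.of_forall fun x => by simp [mul_comm])
  · exact integral_congr_ae (Eventually.of_forall fun x => by simp; ring)

theorem isCompactOperator_of_approx {X H : Type*} [NormedAddCommGroup X] [NormedSpace ℝ X]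
    [NormedAddCommGroup H] [NormedSpace ℝ H] [CompleteSpace H] (π : X →L[ℝ] H) (W : Submodule ℝ X)
    (hW : ∀ ε : ℝ, 0 < ε → ∃ P : H →L[ℝ] H, IsCompactOperator P ∧
      ∀ p ∈ W, ‖π p - P (π p)‖ ≤ ε * ‖p‖) :
    IsCompactOperator (π.comp W.topologicalClosure.subtypeL) := by
  choose P hPc hPe using fun n : ℕ => hW (1 / ((n:ℝ) + 1)) (by positivity)
  set j := π.comp W.topologicalClosure.subtypeL with hj
  refine isCompactOperator_of_tendsto (l := atTop) (F := fun n => (P n).comp j) ?_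
    (Eventually.of_forall fun n => (hPc n).comp_clm j)
  have hb : ∀ n (p : W.topologicalClosure), ‖j p - P n (j p)‖ ≤ (1 / ((n:ℝ) + 1)) * ‖p‖ :=
    fun n p => by
      have hcl : IsClosed {q : X | ‖π q - P n (π q)‖ ≤ (1 / ((n:ℝ) + 1)) * ‖q‖} :=
        isClosed_le (by fun_prop) (by fun_prop)
      exact closure_minimal (fun q hq => hPe n q hq) hcl p.2
  rw [tendsto_iff_norm_sub_tendsto_zero]
  refine squeeze_zero (g := fun n : ℕ => (1 / ((n:ℝ) + 1))) (fun _ => norm_nonneg _)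
    (fun n => ?_) tendsto_one_div_add_atTop_nhds_zero_nat
  refine ContinuousLinearMap.opNorm_le_bound _ (by positivity) fun p => ?_
  have := hb n p
  rw [norm_sub_rev] at this
  exact this

theorem isCompactOperator_form {U : Set (Eu d)} (hU : Bornology.IsBounded U) (s : ℝ) :
    IsCompactOperator ((WithLp.fstL 2 ℝ (Lp ℝ 2 (volume : Measure (Eu d)))
        (WithLp 2 (Lp ℝ 2 (volume : Measure (Eu d)) × Lp (Eu d) 2 (volume : Measure (Eu d))))).comp
      (testSubmodule U s).topologicalClosure.subtypeL) := by
  obtain ⟨C, hC, hP⟩ := exists_cube_approx hU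
  refine isCompactOperator_of_approx _ _ fun ε hε => ?_
  obtain ⟨P, hPc, hPe⟩ := hP (ε / (C + 1)) (by positivity)
  refine ⟨P, hPc, ?_⟩
  rintro _ ⟨h, hh, rfl⟩
  refine (hPe h hh).trans ?_
  have h1 : C * (ε / (C + 1)) ≤ ε := by
    rw [← mul_div_assoc, div_le_iff₀ (by positivity)]; nlinarith
  exact mul_le_mul h1 (norm_gradient_le_formEmb s hh) (norm_nonneg _) hε.le

theorem memLp_normSq_mul {U : Set (Eu d)} (hU : Bornology.IsBounded U) {f : Eu d → ℝ}
    (hf : MemLp f 2 volume) (h0 : ∀ x ∉ U, f x = 0) (c : ℝ) :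
    MemLp (fun x => (c * ‖x‖ ^ 2) * f x) 2 volume :=
  memLp_mul_cont hU hf h0 (by fun_prop)

theorem exists_h10_of_mem_closure {U : Set (Eu d)} (hU : Bornology.IsBounded U) (hUo : IsOpen U)
    (s : ℝ) {p : FormAmbient d} (hp : p ∈ (testSubmodule U s).topologicalClosure) :
    ∃ f F, ∃ hf : H10 U f F, WithLp.fstL 2 ℝ _ _ p = hf.memf.toLp f ∧
      ∀ w (hw : IsTest U w), inner ℝ p (formEmb s hw) = (∫ x, f x * w x) +
        ((∫ x, f x * ((s ^ 2 * ‖x‖ ^ 2) * w x)) + ∫ x, (inner ℝ (F x) (gradient w x) : ℝ)) := by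
  obtain ⟨q, hq, hlim⟩ := mem_closure_iff_seq_limit.1 hp
  choose h hh he using hq
  have l1 : Tendsto (fun n => (hh n).memLp.toLp (h n)) atTop (nhds p.fst) := by
    have := ((WithLp.fstL 2 ℝ _ _).continuous.tendsto p).comp hlim
    refine this.congr fun n => ?_
    simp only [Function.comp_apply, he]
    rfl
  have l2 : Tendsto (fun n => (hh n).memLp_gradient.toLp (gradient (h n))) atTop
      (nhds p.snd.snd) := by
    have := (((WithLp.sndL 2 ℝ (Lp ℝ 2 (volume : Measure (Eu d)))
      (Lp (Eu d) 2 (volume : Measure (Eu d)))).comp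
      (WithLp.sndL 2 ℝ _ _)).continuous.tendsto p).comp hlim
    refine this.congr fun n => ?_
    simp only [Function.comp_apply, he]
    rfl
  have m1 : MemLp (U.indicator (p.fst : Eu d → ℝ)) 2 volume :=
    (Lp.memLp p.fst).indicator hUo.measurableSet
  have m2 : MemLp (U.indicator (p.snd.snd : Eu d → Eu d)) 2 volume :=
    (Lp.memLp p.snd.snd).indicator hUo.measurableSet
  have c1 : Tendsto (fun k => eLpNorm (h k - U.indicator (p.fst : Eu d → ℝ)) 2 volume) atTop
      (nhds 0) := by
    have := (Lp.tendsto_Lp_iff_tendsto_eLpNorm'' h (fun k => (hh k).memLp) p.fst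
      (Lp.memLp p.fst)).1 (by rwa [Lp.toLp_coeFn])
    refine tendsto_of_tendsto_of_tendsto_of_le_of_le tendsto_const_nhds this (fun _ => zero_le)
      fun k => eLpNorm_mono fun x => ?_
    by_cases hx : x ∈ U
    · simp [hx]
    · simp [hx, (hh k).zero_of_notMem hx]
  have c2 : Tendsto (fun k => eLpNorm (gradient (h k) - U.indicator (p.snd.snd : Eu d → Eu d)) 2
      volume) atTop (nhds 0) := by
    have := (Lp.tendsto_Lp_iff_tendsto_eLpNorm'' (fun k => gradient (h k))
      (fun k => (hh k).memLp_gradient) p.snd.snd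
      (Lp.memLp p.snd.snd)).1 (by rwa [Lp.toLp_coeFn])
    refine tendsto_of_tendsto_of_tendsto_of_le_of_le tendsto_const_nhds this (fun _ => zero_le)
      fun k => eLpNorm_mono fun x => ?_
    by_cases hx : x ∈ U
    · simp [hx]
    · simp [hx, (hh k).gradient_zero_of_notMem hx]
  have H : H10 U (U.indicator (p.fst : Eu d → ℝ)) (U.indicator (p.snd.snd : Eu d → Eu d)) :=
    ⟨m1, m2, fun x hx => indicator_of_notMem hx _, fun x hx => indicator_of_notMem hx _,
      h, hh, c1, c2⟩
  refine ⟨_, _, H, ?_, fun w hw => ?_⟩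
  · exact tendsto_nhds_unique l1
      ((Lp.tendsto_Lp_iff_tendsto_eLpNorm'' h (fun k => (hh k).memLp) _ H.memf).2 c1)
  · have t1 := hlim.inner (𝕜 := ℝ) (tendsto_const_nhds (x := formEmb s hw))
    refine tendsto_nhds_unique t1 ?_
    simp only [he, inner_formEmb]
    have mw := memLp_normSq_mul hU hw.memLp (fun x hx => hw.zero_of_notMem hx) (s ^ 2)
    exact (tendsto_integral_mul H.memf hw.memLp (fun k => (hh k).memLp) (fun _ => hw.memLp) c1
      (tendsto_eLpNorm_const_sub _)).add
      ((tendsto_integral_mul H.memf mw (fun k => (hh k).memLp) (fun _ => mw) c1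
        (tendsto_eLpNorm_const_sub _)).add
      (tendsto_integral_inner H.memF hw.memLp_gradient (fun k => (hh k).memLp_gradient)
        (fun _ => hw.memLp_gradient) c2 (tendsto_eLpNorm_const_sub _)))

end Grushin

namespace Grushin

variable {d : ℕ}

/-- Orthonormal basis of weak Dirichlet eigenfunctions of `-Δ + ν‖x‖²`. -/
structure Eigenbasis (U : Set (Eu d)) (ν : ℝ) {ι : Type} (ψ : ι → Eu d → ℝ)
    (G : ι → Eu d → Eu d) (lam : ι → ℝ) : Prop where
  countable : Countable ι
  h10 : ∀ i, H10 U (ψ i) (G i)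
  weak : ∀ i, WeakEq U ν (ψ i) (G i) (fun x => -lam i * ψ i x)
  unit : ∀ i, ip (ψ i) (ψ i) = 1
  orth : ∀ i j, i ≠ j → ip (ψ i) (ψ j) = 0
  nonneg : ∀ i, 0 ≤ lam i
  parseval : ∀ f, MemLp f 2 volume → (∀ x ∉ U, f x = 0) →
    HasSum (fun i => (ip f (ψ i)) ^ 2) (ip f f)

theorem inner_toLp_eq_ip {f g : Eu d → ℝ} (hf : MemLp f 2 volume) (hg : MemLp g 2 volume) :
    inner ℝ (hf.toLp f) (hg.toLp g) = ip f g := by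
  rw [inner_toLp]
  exact integral_congr_ae (Eventually.of_forall fun x => by simp [mul_comm])

theorem ae_eq_zero_of_ip_test {U : Set (Eu d)} (hUo : IsOpen U) {e : Eu d → ℝ}
    (he : MemLp e 2 volume) (h : ∀ w, IsTest U w → ip e w = 0) : ∀ᵐ x, x ∈ U → e x = 0 := by
  refine hUo.ae_eq_zero_of_integral_contDiff_smul_eq_zero
    ((he.locallyIntegrable (by norm_num)).locallyIntegrableOn _) fun g hg hc hs => ?_
  have := h g ⟨hg, hc, hs⟩
  rw [ip_comm] at this
  exact this

theorem weakEq_of_test {U : Set (Eu d)} (hU : Bornology.IsBounded U) {ν : ℝ} {u : Eu d → ℝ}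
    {G : Eu d → Eu d} (hu : H10 U u G) {v : Eu d → ℝ} (hv : MemLp v 2 volume)
    (h : ∀ w, IsTest U w → (∫ x, v x * w x) =
      -(∫ x, (inner ℝ (G x) (gradient w x) : ℝ)) - ν * ∫ x, ‖x‖ ^ 2 * u x * w x) :
    WeakEq U ν u G v := by
  intro w W hw
  obtain ⟨k, hk, l1, l2⟩ := hw.approx
  have mu : MemLp (fun x => ‖x‖ ^ 2 * u x) 2 volume := by
    simpa using memLp_normSq_mul hU hu.memf hu.zerof 1
  have t1 := tendsto_integral_mul hv hw.memf (fun _ => hv) (fun n => (hk n).memLp)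
    (tendsto_eLpNorm_const_sub _) l1
  have t2 := tendsto_integral_mul mu hw.memf (fun _ => mu) (fun n => (hk n).memLp)
    (tendsto_eLpNorm_const_sub _) l1
  have t3 := tendsto_integral_inner hu.memF hw.memF (fun _ => hu.memF)
    (fun n => (hk n).memLp_gradient) (tendsto_eLpNorm_const_sub _) l2
  refine tendsto_nhds_unique t1 ((t3.neg.sub (t2.const_mul ν)).congr fun n => ?_)
  exact (h _ (hk n)).symm

theorem exists_eigenfamily_closure {X H : Type} [NormedAddCommGroup X] [InnerProductSpace ℝ X]
    [CompleteSpace X] [NormedAddCommGroup H] [InnerProductSpace ℝ H] [CompleteSpace H]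
    [SecondCountableTopology H] (π : X →L[ℝ] H) (W : Submodule ℝ X)
    (hπ : IsCompactOperator (π.comp W.topologicalClosure.subtypeL)) (hle : ∀ v, ‖π v‖ ≤ ‖v‖) :
    ∃ (ι : Type) (v : ι → X) (lam : ι → ℝ), Countable ι ∧ (∀ i, 0 ≤ lam i) ∧
      (∀ i, v i ∈ W.topologicalClosure) ∧
      (∀ i, ∀ w ∈ W, inner ℝ (v i) w = (lam i + 1) * inner ℝ (π (v i)) (π w)) ∧
      Orthonormal ℝ (fun i => π (v i)) ∧
      ∀ f, (∀ e, (∀ w ∈ W, inner ℝ e (π w) = 0) → inner ℝ f e = 0) →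
        HasSum (fun i => (inner ℝ f (π (v i))) ^ 2) (‖f‖ ^ 2) := by
  obtain ⟨ι, v, lam, hc, hl, he, ho, hp⟩ := exists_eigenfamily _ hπ fun v => hle v
  exact ⟨ι, fun i => v i, lam, hc, hl, fun i => (v i).2,
    fun i w hw => he i ⟨w, subset_closure hw⟩, ho,
    fun f hf => hp f fun e he => hf e fun w hw => he ⟨w, subset_closure hw⟩⟩

theorem exists_eigenbasis {U : Set (Eu d)} (hU : Bornology.IsBounded U) (hUo : IsOpen U) (n : ℝ) :
    ∃ (ι : Type) (ψ : ι → Eu d → ℝ) (G : ι → Eu d → Eu d) (lam : ι → ℝ),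
      Eigenbasis U (n ^ 2) ψ G lam := by
  have : Fact ((2 : ENNReal) ≠ ⊤) := ⟨by simp⟩
  obtain ⟨ι, v, lam, hc, hl, hv, he, ho, hp⟩ := exists_eigenfamily_closure _ _
    (isCompactOperator_form hU n) norm_fstL_le
  choose f F hf hj hfi using fun i => exists_h10_of_mem_closure hU hUo n (hv i)
  simp only [hj] at he ho hp
  classical
  have hip := orthonormal_iff_ite.1 ho
  simp only [inner_toLp_eq_ip] at hip
  refine ⟨ι, f, F, lam, hc, hf, fun i => ?_, fun i => by simp [hip i i],
    fun i j hij => by simp [hip i j, hij], hl, fun g hg hg0 => ?_⟩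
  · refine weakEq_of_test hU (hf i) ((hf i).memf.const_mul _) fun w hw => ?_
    have h1 := he i (formEmb n hw) ⟨w, hw, rfl⟩
    have h2 := hfi i w hw
    have h3 : inner ℝ ((hf i).memf.toLp (f i)) (hw.memLp.toLp w) = ∫ x, f i x * w x :=
      inner_toLp_eq_ip _ _
    have h4 : inner ℝ (v i) (formEmb n hw)
        = (lam i + 1) * inner ℝ ((hf i).memf.toLp (f i)) (hw.memLp.toLp w) := h1
    rw [h3, h2] at h4
    have h5 : (∫ x, -lam i * f i x * w x) = -lam i * ∫ x, f i x * w x := by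
      rw [← integral_const_mul]; simp only [mul_assoc]
    have h6 : (∫ x, f i x * ((n ^ 2 * ‖x‖ ^ 2) * w x)) = n ^ 2 * ∫ x, ‖x‖ ^ 2 * f i x * w x := by
      rw [← integral_const_mul]
      exact integral_congr_ae (Eventually.of_forall fun x => by ring)
    rw [h5]
    linarith
  · have := hp (hg.toLp g) fun e hez => ?_
    · simp only [inner_toLp_eq_ip] at this
      rwa [← real_inner_self_eq_norm_sq, inner_toLp_eq_ip] at this
    · have h0 : ∀ᵐ x, x ∈ U → e x = 0 := ae_eq_zero_of_ip_test hUo (Lp.memLp e) fun w hw => by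
        have h1 := hez (formEmb n hw) ⟨w, hw, rfl⟩
        have h2 : inner ℝ e (hw.memLp.toLp w) = 0 := h1
        rw [← Lp.toLp_coeFn e (Lp.memLp e), inner_toLp_eq_ip] at h2
        exact h2
      rw [← Lp.toLp_coeFn e (Lp.memLp e), inner_toLp_eq_ip]
      refine integral_eq_zero_of_ae ?_
      filter_upwards [h0] with x hx
      by_cases hxU : x ∈ U
      · simp [hx hxU]
      · simp [hg0 x hxU]

end Grushin

namespace Grushin

section Parametric

variable {Z X Y : Type} [NormedAddCommGroup Z] [NormedSpace ℝ Z] [NormedAddCommGroup X] [NormedSpace ℝ X]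
  [NormedAddCommGroup Y] [NormedSpace ℝ Y]

theorem contDiffOn_partial_fderiv {O : Set Z} {W : Set X} (hO : IsOpen O) (hW : IsOpen W)
    {F : Z × X → Y} (hF : ContDiffOn ℝ (⊤ : ℕ∞) F (O ×ˢ W)) :
    ContDiffOn ℝ (⊤ : ℕ∞) (fun q => (fderiv ℝ F q).comp (ContinuousLinearMap.inr ℝ Z X))
      (O ×ˢ W) :=
  (hF.fderiv_of_isOpen (hO.prod hW) (m := (⊤ : ℕ∞)) (by simp)).clm_comp contDiffOn_const

theorem hasFDerivAt_partial {O : Set Z} {W : Set X} (hO : IsOpen O) (hW : IsOpen W)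
    {F : Z × X → Y} (hF : ContDiffOn ℝ (⊤ : ℕ∞) F (O ×ˢ W)) {τ : Z} {p : X} (hτ : τ ∈ O)
    (hp : p ∈ W) :
    HasFDerivAt (fun p => F (τ, p)) ((fderiv ℝ F (τ, p)).comp (ContinuousLinearMap.inr ℝ Z X)) p :=
  (((hF.contDiffAt ((hO.prod hW).mem_nhds ⟨hτ, hp⟩)).differentiableAt (by simp)).hasFDerivAt).comp
    p (hasFDerivAt_prodMk_right τ p)

theorem continuousOn_apply_partial {O : Set ℝ} {W : Set X} (hO : IsOpen O) (hW : IsOpen W)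
    {s t : ℝ} (hst : uIcc s t ⊆ O) {F : ℝ × X → Y} (hF : ContDiffOn ℝ (⊤ : ℕ∞) F (O ×ˢ W)) {p : X}
    (hp : p ∈ W) :
    ContinuousOn (fun τ => (fderiv ℝ F (τ, p)).comp (ContinuousLinearMap.inr ℝ ℝ X))
      (uIcc s t) :=
  ContinuousOn.comp (g := fun q => (fderiv ℝ F q).comp (ContinuousLinearMap.inr ℝ ℝ X))
    (contDiffOn_partial_fderiv hO hW hF).continuousOn
    (f := fun τ => (τ, p)) (by fun_prop) fun _ hτ => ⟨hst hτ, hp⟩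

theorem contDiffOn_fderiv_apply {O : Set Z} {W : Set X} (hO : IsOpen O) (hW : IsOpen W)
    {F : Z × X → Y} (hF : ContDiffOn ℝ (⊤ : ℕ∞) F (O ×ˢ W)) (e : X) :
    ContDiffOn ℝ (⊤ : ℕ∞) (fun q => fderiv ℝ F q (0, e)) (O ×ˢ W) :=
  (hF.fderiv_of_isOpen (hO.prod hW) (m := (⊤ : ℕ∞)) (by simp)).clm_apply contDiffOn_const

variable [ProperSpace X]

theorem hasFDerivAt_parametric {O : Set ℝ} {W : Set X} (hO : IsOpen O) (hW : IsOpen W)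
    {F : ℝ × X → Y} (hF : ContDiffOn ℝ (⊤ : ℕ∞) F (O ×ˢ W)) {s t : ℝ} (hst : uIcc s t ⊆ O)
    {p : X} (hp : p ∈ W) :
    HasFDerivAt (fun p => ∫ τ in s..t, F (τ, p))
      (∫ τ in s..t, (fderiv ℝ F (τ, p)).comp (ContinuousLinearMap.inr ℝ ℝ X)) p := by
  obtain ⟨r, hr, hrW⟩ := nhds_basis_closedBall.mem_iff.1 (hW.mem_nhds hp)
  have hsub : uIcc s t ×ˢ closedBall p r ⊆ O ×ˢ W := prod_mono hst hrW
  have hF' := (contDiffOn_partial_fderiv hO hW hF).continuousOn.mono hsub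
  obtain ⟨C, hC⟩ := (isCompact_uIcc.prod (isCompact_closedBall p r)).exists_bound_of_continuousOn hF'
  have cF : ∀ q ∈ closedBall p r, ContinuousOn (fun τ => F (τ, q)) (uIcc s t) := fun q hq =>
    hF.continuousOn.comp (by fun_prop) fun τ hτ => hsub ⟨hτ, hq⟩
  have cF' : ContinuousOn (fun τ => (fderiv ℝ F (τ, p)).comp (ContinuousLinearMap.inr ℝ ℝ X))
      (uIcc s t) :=
    ContinuousOn.comp (g := fun q => (fderiv ℝ F q).comp (ContinuousLinearMap.inr ℝ ℝ X)) hF'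
      (f := fun τ => (τ, p)) (by fun_prop) fun τ hτ => ⟨hτ, mem_closedBall_self hr.le⟩
  refine intervalIntegral.hasFDerivAt_integral_of_dominated_of_fderiv_le (bound := fun _ => C)
    (F' := fun q τ => (fderiv ℝ F (τ, q)).comp (ContinuousLinearMap.inr ℝ ℝ X))
    (closedBall_mem_nhds p hr) ?_ ?_ ?_ ?_ intervalIntegrable_const ?_
  · filter_upwards [closedBall_mem_nhds p hr] with q hq
    exact (cF q hq).intervalIntegrable.def'.aestronglyMeasurable
  · exact (cF p (mem_closedBall_self hr.le)).intervalIntegrable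
  · exact cF'.intervalIntegrable.def'.aestronglyMeasurable
  · exact Eventually.of_forall fun τ hτ q hq => hC (τ, q) ⟨uIoc_subset_uIcc hτ, hq⟩
  · exact Eventually.of_forall fun τ hτ q hq =>
      hasFDerivAt_partial hO hW hF (hst (uIoc_subset_uIcc hτ)) (hrW hq)

theorem contDiffOn_parametric_nat {O : Set ℝ} {W : Set X} (hO : IsOpen O) (hW : IsOpen W)
    {s t : ℝ} (hst : uIcc s t ⊆ O) (n : ℕ) :
    ∀ {Y : Type} [NormedAddCommGroup Y] [NormedSpace ℝ Y] {F : ℝ × X → Y},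
      ContDiffOn ℝ (⊤ : ℕ∞) F (O ×ˢ W) →
      ContDiffOn ℝ n (fun p => ∫ τ in s..t, F (τ, p)) W := by
  induction n with
  | zero =>
    intro Y _ _ F hF
    exact contDiffOn_zero.2 fun p hp =>
      (hasFDerivAt_parametric hO hW hF hst hp).continuousAt.continuousWithinAt
  | succ n ih =>
    intro Y _ _ F hF
    rw [Nat.cast_succ, contDiffOn_succ_iff_fderiv_of_isOpen hW]
    refine ⟨fun p hp => (hasFDerivAt_parametric hO hW hF hst
      hp).differentiableAt.differentiableWithinAt, by simp, ?_⟩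
    exact (ih (contDiffOn_partial_fderiv hO hW hF)).congr fun p hp =>
      (hasFDerivAt_parametric hO hW hF hst hp).fderiv

theorem contDiffOn_parametric {O : Set ℝ} {W : Set X} (hO : IsOpen O) (hW : IsOpen W)
    {s t : ℝ} (hst : uIcc s t ⊆ O) {F : ℝ × X → Y} (hF : ContDiffOn ℝ (⊤ : ℕ∞) F (O ×ˢ W)) :
    ContDiffOn ℝ (⊤ : ℕ∞) (fun p => ∫ τ in s..t, F (τ, p)) W :=
  contDiffOn_infty.2 fun n => contDiffOn_parametric_nat hO hW hst n hF

theorem fderiv_parametric_apply [CompleteSpace Y] {O : Set ℝ} {W : Set X} (hO : IsOpen O)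
    (hW : IsOpen W)
    {s t : ℝ} (hst : uIcc s t ⊆ O) {F : ℝ × X → Y} (hF : ContDiffOn ℝ (⊤ : ℕ∞) F (O ×ˢ W)) {p : X}
    (hp : p ∈ W) (e : X) :
    fderiv ℝ (fun p => ∫ τ in s..t, F (τ, p)) p e = ∫ τ in s..t, fderiv ℝ F (τ, p) (0, e) := by
  rw [(hasFDerivAt_parametric hO hW hF hst hp).fderiv,
    ContinuousLinearMap.intervalIntegral_apply
      (continuousOn_apply_partial hO hW hst hF hp).intervalIntegrable]
  simp

end Parametric

variable {d : ℕ}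

theorem lapl_slice {Z : Type} [NormedAddCommGroup Z] [NormedSpace ℝ Z]
    {O : Set Z} {W : Set (Eu d)} (hO : IsOpen O) (hW : IsOpen W)
    {F : Z × Eu d → ℝ} (hF : ContDiffOn ℝ (⊤ : ℕ∞) F (O ×ˢ W)) {τ : Z} (hτ : τ ∈ O) {p : Eu d}
    (hp : p ∈ W) : lapl (fun x => F (τ, x)) p =
      ∑ i, fderiv ℝ (fun q => fderiv ℝ F q (0, EuclideanSpace.single i 1)) (τ, p)
        (0, EuclideanSpace.single i 1) := by
  refine Finset.sum_congr rfl fun i _ => ?_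
  have h1 : (fun z => fderiv ℝ (fun x => F (τ, x)) z (EuclideanSpace.single i 1)) =ᶠ[nhds p]
      fun z => fderiv ℝ F (τ, z) (0, EuclideanSpace.single i 1) := by
    filter_upwards [hW.mem_nhds hp] with z hz
    rw [(hasFDerivAt_partial hO hW hF hτ hz).fderiv]
    simp
  rw [h1.fderiv_eq, (hasFDerivAt_partial hO hW (contDiffOn_fderiv_apply hO hW hF
    (EuclideanSpace.single i 1)) hτ hp).fderiv]
  simp

theorem continuousOn_lapl_slice {Z : Type} [NormedAddCommGroup Z] [NormedSpace ℝ Z]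
    {O : Set Z} {W : Set (Eu d)} (hO : IsOpen O) (hW : IsOpen W)
    {F : Z × Eu d → ℝ} (hF : ContDiffOn ℝ (⊤ : ℕ∞) F (O ×ˢ W)) :
    ContinuousOn (fun q : Z × Eu d => lapl (fun x => F (q.1, x)) q.2) (O ×ˢ W) := by
  refine ContinuousOn.congr (continuousOn_finsetSum (f := fun i q =>
    fderiv ℝ (fun q => fderiv ℝ F q (0, EuclideanSpace.single i 1)) q
        (0, EuclideanSpace.single i 1)) Finset.univ fun i _ => ?_)
    fun q hq => lapl_slice hO hW hF hq.1 hq.2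
  exact (contDiffOn_fderiv_apply hO hW (contDiffOn_fderiv_apply hO hW hF _) _).continuousOn

theorem lapl_parametric {O : Set ℝ} {W : Set (Eu d)} (hO : IsOpen O) (hW : IsOpen W)
    {s t : ℝ} (hst : uIcc s t ⊆ O) {F : ℝ × Eu d → ℝ} (hF : ContDiffOn ℝ (⊤ : ℕ∞) F (O ×ˢ W))
    {p : Eu d} (hp : p ∈ W) :
    lapl (fun x => ∫ τ in s..t, F (τ, x)) p = ∫ τ in s..t, lapl (fun x => F (τ, x)) p := by
  rw [intervalIntegral.integral_congr fun τ hτ => lapl_slice hO hW hF (hst hτ) hp,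
    intervalIntegral.integral_finsetSum]
  · refine Finset.sum_congr rfl fun i _ => ?_
    have h1 : (fun z => fderiv ℝ (fun x => ∫ τ in s..t, F (τ, x)) z (EuclideanSpace.single i 1))
        =ᶠ[nhds p] fun z => ∫ τ in s..t, fderiv ℝ F (τ, z) (0, EuclideanSpace.single i 1) := by
      filter_upwards [hW.mem_nhds hp] with z hz
      exact fderiv_parametric_apply hO hW hst hF hz _
    rw [h1.fderiv_eq, fderiv_parametric_apply hO hW hst (contDiffOn_fderiv_apply hO hW hF
      (EuclideanSpace.single i 1)) hp]
  · intro i _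
    refine ContinuousOn.intervalIntegrable (ContinuousOn.comp (g := fun q =>
      fderiv ℝ (fun q => fderiv ℝ F q (0, EuclideanSpace.single i 1)) q
        (0, EuclideanSpace.single i 1)) (t := O ×ˢ W)
      (contDiffOn_fderiv_apply hO hW (contDiffOn_fderiv_apply hO hW hF _) _).continuousOn
      (f := fun τ => (τ, p)) (by fun_prop) fun _ hτ => ⟨hst hτ, hp⟩)

end Grushin

namespace Grushin

variable {d e : ℕ}

/-- `v` solves `Δₓ v + ‖x‖² Δ_z v = f` in `U × V` with zero boundary values. -/
structure StationarySolution (U : Set (Eu d)) (V : Set (Eu e)) (v f : Eu d × Eu e → ℝ) : Prop where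
  cont : ContinuousOn v (closure (U ×ˢ V))
  smooth : ContDiffOn ℝ (⊤ : ℕ∞) v (U ×ˢ V)
  eqn : ∀ x ∈ U, ∀ z ∈ V, lapl (fun x => v (x, z)) x + ‖x‖ ^ 2 * lapl (fun z => v (x, z)) z
    = f (x, z)
  boundary : ∀ p ∈ frontier (U ×ˢ V), v p = 0
  cont_rhs : ContinuousOn f (closure (U ×ˢ V))

theorem continuousOn_parametric {X : Type} [TopologicalSpace X] [FirstCountableTopology X]
    {K : Set X} (hK : IsCompact K)
    {s t : ℝ} {F : ℝ × X → ℝ} (hF : ContinuousOn F (uIcc s t ×ˢ K)) :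
    ContinuousOn (fun p => ∫ τ in s..t, F (τ, p)) K := by
  obtain ⟨C, hC⟩ := (isCompact_uIcc.prod hK).exists_bound_of_continuousOn hF
  intro p hp
  have h1 : ∀ q ∈ K, ContinuousOn (fun τ => F (τ, q)) (uIcc s t) := fun q hq =>
    hF.comp (by fun_prop) fun τ hτ => ⟨hτ, hq⟩
  refine intervalIntegral.continuousWithinAt_of_dominated_interval (bound := fun _ => C) ?_ ?_
    intervalIntegrable_const ?_
  · filter_upwards [self_mem_nhdsWithin] with q hq
    exact (h1 q hq).intervalIntegrable.def'.aestronglyMeasurable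
  · filter_upwards [self_mem_nhdsWithin] with q hq
    exact Eventually.of_forall fun τ hτ => hC (τ, q) ⟨uIoc_subset_uIcc hτ, hq⟩
  · refine Eventually.of_forall fun τ hτ => ?_
    exact (hF.comp (f := fun q => (τ, q)) (by fun_prop) fun q hq => ⟨uIoc_subset_uIcc hτ, hq⟩) p hp

theorem _root_.IsGrushinSolution.stationary {R T : ℝ} {V : Set (Eu e)} (hV : IsOpen V)
    (hVb : Bornology.IsBounded V) {y : ℝ → Eu d → Eu e → ℝ} (hy : IsGrushinSolution d e R T V y)
    {s t : ℝ} (hs : 0 < s) (hst : s ≤ t) (htT : t < T) :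
    StationarySolution (ball 0 R) V (fun p => ∫ τ in s..t, y τ p.1 p.2)
      (fun p => y t p.1 p.2 - y s p.1 p.2) := by
  have hsub : uIcc s t ⊆ Ioo 0 T := by
    rw [uIcc_of_le hst]; exact fun τ hτ => ⟨hs.trans_le hτ.1, hτ.2.trans_lt htT⟩
  have hsub' : uIcc s t ⊆ Icc 0 T := hsub.trans Ioo_subset_Icc_self
  have hK : IsCompact (closure (ball (0 : Eu d) R ×ˢ V)) :=
    (isBounded_ball.prod hVb).isCompact_closure
  have hWo := (isOpen_ball (x := (0 : Eu d)) (ε := R)).prod hV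
  have hc : ∀ τ ∈ Icc 0 T, ContinuousOn (fun p : Eu d × Eu e => y τ p.1 p.2)
      (closure (ball (0 : Eu d) R ×ˢ V)) := fun τ hτ =>
    hy.continuousOn.comp (f := fun p : Eu d × Eu e => (τ, p)) (by fun_prop) fun p hp => ⟨hτ, hp⟩
  refine ⟨?_, ?_, fun x hx z hz => ?_, fun p hp => ?_, ?_⟩
  · exact continuousOn_parametric hK (F := fun q : ℝ × (Eu d × Eu e) => y q.1 q.2.1 q.2.2)
      (hy.continuousOn.mono (prod_mono hsub' subset_rfl))
  · exact contDiffOn_parametric isOpen_Ioo hWo hsub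
      (F := fun q : ℝ × (Eu d × Eu e) => y q.1 q.2.1 q.2.2) hy.smoothOn
  · have sx : ContDiffOn ℝ (⊤ : ℕ∞) (fun q : ℝ × Eu d => y q.1 q.2 z) (Ioo 0 T ×ˢ ball 0 R) :=
      hy.smoothOn.comp (f := fun q : ℝ × Eu d => (q.1, (q.2, z)))
        (ContDiff.contDiffOn (by fun_prop)) fun q hq => ⟨hq.1, hq.2, hz⟩
    have sz : ContDiffOn ℝ (⊤ : ℕ∞) (fun q : ℝ × Eu e => y q.1 x q.2) (Ioo 0 T ×ˢ V) :=
      hy.smoothOn.comp (f := fun q : ℝ × Eu e => (q.1, (x, q.2)))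
        (ContDiff.contDiffOn (by fun_prop)) fun q hq => ⟨hq.1, hx, hq.2⟩
    have st : ContDiffOn ℝ (⊤ : ℕ∞) (fun τ : ℝ => y τ x z) (Ioo 0 T) :=
      hy.smoothOn.comp (f := fun τ : ℝ => (τ, (x, z)))
        (ContDiff.contDiffOn (by fun_prop)) fun q hq => ⟨hq, hx, hz⟩
    have e1 := lapl_parametric isOpen_Ioo isOpen_ball hsub sx hx
    have e2 := lapl_parametric isOpen_Ioo hV hsub sz hz
    have i1 : IntervalIntegrable (fun τ => lapl (fun x => y τ x z) x) volume s t :=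
      ContinuousOn.intervalIntegrable ((continuousOn_lapl_slice isOpen_Ioo isOpen_ball sx).comp
        (f := fun τ => (τ, x)) (by fun_prop) fun τ hτ => ⟨hsub hτ, hx⟩)
    have i2 : IntervalIntegrable (fun τ => lapl (fun z => y τ x z) z) volume s t :=
      ContinuousOn.intervalIntegrable ((continuousOn_lapl_slice isOpen_Ioo hV sz).comp
        (f := fun τ => (τ, z)) (by fun_prop) fun τ hτ => ⟨hsub hτ, hz⟩)
    have e3 : ∫ τ in s..t, (lapl (fun x => y τ x z) x + ‖x‖ ^ 2 * lapl (fun z => y τ x z) z)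
        = y t x z - y s x z := by
      refine intervalIntegral.integral_eq_sub_of_hasDerivAt (f := fun τ => y τ x z)
        (fun τ hτ => ?_) (i1.add (i2.const_mul _))
      have h1 := ((st.contDiffAt (isOpen_Ioo.mem_nhds (hsub hτ))).differentiableAt
        (by simp)).hasDerivAt
      have h2 := hy.eqn τ (hsub hτ) x hx z hz
      rwa [show deriv (fun τ => y τ x z) τ = lapl (fun x => y τ x z) x +
        ‖x‖ ^ 2 * lapl (fun z => y τ x z) z by linarith] at h1
    rw [← e3, intervalIntegral.integral_add i1 (i2.const_mul _),
      intervalIntegral.integral_const_mul]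
    exact congrArg₂ (fun a b => a + ‖x‖ ^ 2 * b) e1 e2
  · refine (intervalIntegral.integral_congr fun τ hτ => ?_).trans intervalIntegral.integral_zero
    exact hy.boundary τ (hsub hτ) p hp
  · exact (hc t (hsub' right_mem_uIcc)).sub (hc s (hsub' left_mem_uIcc))

end Grushin

namespace Grushin

/-- `β = B'` is a smooth truncation of the identity vanishing on `[-ε, ε]`, and `κ = β'`. -/
structure Truncation (ε : ℝ) (κ β B : ℝ → ℝ) : Prop where
  smooth_κ : ContDiff ℝ (⊤ : ℕ∞) κ
  deriv_β : ∀ r, HasDerivAt β (κ r) r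
  deriv_B : ∀ r, HasDerivAt B (β r) r
  nonneg : ∀ r, 0 ≤ κ r
  le_one : ∀ r, κ r ≤ 1
  zero_β : ∀ r, |r| ≤ ε → β r = 0
  zero_B : ∀ r, |r| ≤ ε → B r = 0
  abs_β_le : ∀ r, |β r| ≤ |r|
  abs_sub_le : ∀ r, |r - β r| ≤ 4 * ε

theorem Truncation.smooth_β {ε : ℝ} {κ β B : ℝ → ℝ} (h : Truncation ε κ β B) :
    ContDiff ℝ (⊤ : ℕ∞) β := by
  rw [contDiff_infty_iff_deriv]
  refine ⟨fun r => (h.deriv_β r).differentiableAt, ?_⟩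
  rw [show deriv β = κ from funext fun r => (h.deriv_β r).deriv]
  exact h.smooth_κ

theorem Truncation.smooth_B {ε : ℝ} {κ β B : ℝ → ℝ} (h : Truncation ε κ β B) :
    ContDiff ℝ (⊤ : ℕ∞) B := by
  rw [contDiff_infty_iff_deriv]
  refine ⟨fun r => (h.deriv_B r).differentiableAt, ?_⟩
  rw [show deriv B = β from funext fun r => (h.deriv_B r).deriv]
  exact h.smooth_β

theorem integral_zero_of_abs_le {ε : ℝ} {g : ℝ → ℝ} (h : ∀ r, |r| ≤ ε → g r = 0) {r : ℝ}
    (hr : |r| ≤ ε) : ∫ u in (0:ℝ)..r, g u = 0 := by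
  refine (intervalIntegral.integral_congr fun u hu => h u ?_).trans intervalIntegral.integral_zero
  rw [mem_uIcc] at hu
  rcases hu with ⟨h1, h2⟩ | ⟨h1, h2⟩
  · rw [abs_of_nonneg h1]; exact h2.trans ((le_abs_self r).trans hr)
  · rw [abs_of_nonpos h2]; exact (neg_le_neg h1).trans ((neg_le_abs r).trans hr)

theorem exists_truncation {ε : ℝ} (hε : 0 < ε) : ∃ κ β B, Truncation ε κ β B := by
  set κ : ℝ → ℝ := fun r => Real.smoothTransition ((r / ε) ^ 2 - 1) with hκ
  have sκ : ContDiff ℝ (⊤ : ℕ∞) κ := Real.smoothTransition.contDiff.comp (by fun_prop)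
  have zκ : ∀ r, |r| ≤ ε → κ r = 0 := fun r hr => by
    refine Real.smoothTransition.zero_of_nonpos ?_
    have : |r / ε| ≤ 1 := by rw [abs_div, abs_of_pos hε, div_le_one hε]; exact hr
    have := (sq_le_one_iff_abs_le_one _).2 this
    linarith
  have oκ : ∀ r, 2 * ε < |r| → κ r = 1 := fun r hr => by
    refine Real.smoothTransition.one_of_one_le ?_
    have : 2 < |r / ε| := by rw [abs_div, abs_of_pos hε, lt_div_iff₀ hε]; exact hr
    have h2 := sq_abs (r / ε)
    nlinarith
  have n0 : ∀ r, 0 ≤ κ r := fun r => Real.smoothTransition.nonneg _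
  have n1 : ∀ r, κ r ≤ 1 := fun r => Real.smoothTransition.le_one _
  have dβ : ∀ r, HasDerivAt (fun r => ∫ u in (0:ℝ)..r, κ u) (κ r) r := fun r =>
    sκ.continuous.integral_hasStrictDerivAt 0 r |>.hasDerivAt
  have cβ : Continuous (fun r => ∫ u in (0:ℝ)..r, κ u) :=
    continuous_iff_continuousAt.2 fun r => (dβ r).continuousAt
  have zβ : ∀ r, |r| ≤ ε → (∫ u in (0:ℝ)..r, κ u) = 0 := fun r hr => integral_zero_of_abs_le zκ hr
  refine ⟨κ, fun r => ∫ u in (0:ℝ)..r, κ u, fun r => ∫ w in (0:ℝ)..r, ∫ u in (0:ℝ)..w, κ u, sκ, dβ,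
    fun r => (cβ.integral_hasStrictDerivAt 0 r).hasDerivAt, n0, n1, zβ,
    fun r hr => integral_zero_of_abs_le zβ hr, fun r => ?_, fun r => ?_⟩
  · have := intervalIntegral.norm_integral_le_of_norm_le_const (a := 0) (b := r) (f := κ) (C := 1)
      fun u _ => by rw [Real.norm_eq_abs, abs_of_nonneg (n0 u)]; exact n1 u
    simpa using this
  · have e : r - ∫ u in (0:ℝ)..r, κ u = ∫ u in (0:ℝ)..r, (1 - κ u) := by
      rw [intervalIntegral.integral_sub intervalIntegrable_const
        (sκ.continuous.intervalIntegrable _ _)]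
      simp
    have hle : ∀ u, ‖1 - κ u‖ ≤ (Icc (-(2 * ε)) (2 * ε)).indicator (fun _ => (1:ℝ)) u := fun u => by
      rw [Real.norm_eq_abs, abs_of_nonneg (sub_nonneg.2 (n1 u))]
      by_cases hu : |u| ≤ 2 * ε
      · rw [indicator_of_mem (by exact abs_le.1 hu)]; linarith [n0 u]
      · rw [oκ u (not_le.1 hu)]; simpa using indicator_nonneg (fun _ _ => zero_le_one) u
    have hi : Integrable ((Icc (-(2 * ε)) (2 * ε)).indicator (fun _ => (1:ℝ))) volume :=
      (integrable_indicator_iff measurableSet_Icc).2 (by simp)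
    have hm : Integrable (fun u => ‖1 - κ u‖) volume :=
      hi.mono' (by have := sκ.continuous; fun_prop) (Eventually.of_forall fun u => by
        rw [norm_norm]; exact hle u)
    rw [e, ← Real.norm_eq_abs]
    refine (intervalIntegral.norm_integral_le_integral_norm_uIoc).trans ?_
    refine (setIntegral_le_integral hm (Eventually.of_forall fun _ => norm_nonneg _)).trans ?_
    refine (integral_mono hm hi hle).trans ?_
    rw [integral_indicator measurableSet_Icc]
    rw [setIntegral_const, Measure.real, Real.volume_Icc, ENNReal.toReal_ofReal (by linarith)]
    simp
    linarith

end Grushin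

namespace Grushin

variable {d : ℕ} {U : Set (Eu d)} {h : Eu d → ℝ}

theorem lapl_congr {f g : Eu d → ℝ} {x : Eu d} (hfg : f =ᶠ[nhds x] g) : lapl f x = lapl g x := by
  refine Finset.sum_congr rfl fun i _ => ?_
  have : (fun z => fderiv ℝ f z (EuclideanSpace.single i 1)) =ᶠ[nhds x]
      fun z => fderiv ℝ g z (EuclideanSpace.single i 1) :=
    (hfg.fderiv (𝕜 := ℝ)).mono fun z hz => by simp only [hz]
  rw [this.fderiv_eq]

theorem lapl_zero (x : Eu d) : lapl (fun _ : Eu d => (0:ℝ)) x = 0 := by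
  simp [lapl]

theorem inner_gradient_eq_sum (f g : Eu d → ℝ) (x : Eu d) :
    (inner ℝ (gradient f x) (gradient g x) : ℝ) =
      ∑ i, fderiv ℝ f x (EuclideanSpace.single i 1) * fderiv ℝ g x (EuclideanSpace.single i 1) := by
  rw [PiLp.inner_apply]
  refine Finset.sum_congr rfl fun i _ => ?_
  have h : ∀ f : Eu d → ℝ, fderiv ℝ f x (EuclideanSpace.single i 1) = gradient f x i := fun f => by
    rw [← gradient_apply_inner, EuclideanSpace.inner_single_right]
    simp
  rw [h, h]
  exact mul_comm _ _

theorem IsTest.of_support {k : Eu d → ℝ} (hh : IsTest U h) (hk : ContDiff ℝ (⊤ : ℕ∞) k)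
    (hs : ∀ x ∉ tsupport h, k x = 0) : IsTest U k := by
  have : tsupport k ⊆ tsupport h :=
    closure_minimal (fun x hx => by_contra fun hx' => hx (hs x hx')) (isClosed_tsupport h)
  exact ⟨hk, hh.compact.of_isClosed_subset (isClosed_tsupport k) this, this.trans hh.supp⟩

theorem IsTest.dir (hh : IsTest U h) (v : Eu d) : IsTest U (fun x => fderiv ℝ h x v) :=
  hh.of_support ((hh.smooth.fderiv_right (m := (⊤ : ℕ∞)) (by simp)).clm_apply contDiff_const)
    fun x hx => by
      rw [(notMem_tsupport_iff_eventuallyEq.1 hx).fderiv_eq]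
      simp

theorem IsTest.lapl (hh : IsTest U h) : IsTest U (lapl h) :=
  hh.of_support (ContDiff.sum fun i _ => ((hh.dir _).dir (EuclideanSpace.single i 1)).smooth)
    fun x hx => by
      rw [lapl_congr (notMem_tsupport_iff_eventuallyEq.1 hx)]
      exact lapl_zero x

theorem continuous_mul_of_tsupport {X : Type*} [TopologicalSpace X] {W : Set X} (hW : IsOpen W)
    {v g : X → ℝ}
    (hv : ContinuousOn v W) (hg : Continuous g) (hs : tsupport g ⊆ W) :
    Continuous (fun x => v x * g x) :=
  continuous_of_tsupport fun x hx => by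
    have hx' : x ∈ W := hs (closure_mono (Function.support_mul_subset_right v g) hx)
    exact (hv.continuousAt (hW.mem_nhds hx')).mul hg.continuousAt

theorem IsTest.integrable_mul (hU : IsOpen U) {v : Eu d → ℝ} (hv : ContinuousOn v U)
    (hh : IsTest U h) : Integrable (fun x => v x * h x) volume :=
  (continuous_mul_of_tsupport hU hv hh.cont hh.supp).integrable_of_hasCompactSupport
    hh.compact.mul_left

theorem contDiffOn_fderiv_dir (hU : IsOpen U) {v : Eu d → ℝ} (hv : ContDiffOn ℝ (⊤ : ℕ∞) v U)
    (e : Eu d) : ContDiffOn ℝ (⊤ : ℕ∞) (fun x => fderiv ℝ v x e) U :=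
  (hv.fderiv_of_isOpen hU (m := (⊤ : ℕ∞)) (by simp)).clm_apply contDiffOn_const

theorem integral_mul_fderiv_test (hU : IsOpen U) {v : Eu d → ℝ} (hv : ContDiffOn ℝ (⊤ : ℕ∞) v U)
    (hh : IsTest U h) (e : Eu d) :
    ∫ x, v x * fderiv ℝ h x e = -∫ x, fderiv ℝ v x e * h x :=
  integral_mul_fderiv_eq_neg_fderiv_mul_of_integrable
    (hh.integrable_mul hU (contDiffOn_fderiv_dir hU hv e).continuousOn)
    ((hh.dir e).integrable_mul hU hv.continuousOn) (hh.integrable_mul hU hv.continuousOn)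
    (fun x hx => (hv.contDiffAt (hU.mem_nhds (hh.supp hx))).differentiableAt (by simp))
    fun x _ => hh.diff x

theorem integral_mul_lapl (hU : IsOpen U) {v : Eu d → ℝ} (hv : ContDiffOn ℝ (⊤ : ℕ∞) v U)
    (hh : IsTest U h) :
    ∫ x, v x * lapl h x = -∫ x, (inner ℝ (gradient v x) (gradient h x) : ℝ) := by
  simp only [inner_gradient_eq_sum, _root_.lapl, Finset.mul_sum]
  rw [integral_finsetSum _ fun i _ => ((hh.dir _).dir _).integrable_mul hU hv.continuousOn,
    integral_finsetSum _ fun i _ => (hh.dir _).integrable_mul hU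
      (contDiffOn_fderiv_dir hU hv _).continuousOn, ← Finset.sum_neg_distrib]
  exact Finset.sum_congr rfl fun i _ => integral_mul_fderiv_test hU hv (hh.dir _) _

theorem integral_lapl_mul (hU : IsOpen U) {v : Eu d → ℝ} (hv : ContDiffOn ℝ (⊤ : ℕ∞) v U)
    (hh : IsTest U h) :
    ∫ x, lapl v x * h x = ∫ x, v x * lapl h x := by
  rw [integral_mul_lapl hU hv hh]
  simp only [inner_gradient_eq_sum, _root_.lapl, Finset.sum_mul]
  rw [integral_finsetSum _ fun i _ => hh.integrable_mul hU
      (contDiffOn_fderiv_dir hU (contDiffOn_fderiv_dir hU hv _) _).continuousOn,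
    integral_finsetSum _ fun i _ => (hh.dir _).integrable_mul hU
      (contDiffOn_fderiv_dir hU hv _).continuousOn, ← Finset.sum_neg_distrib]
  refine Finset.sum_congr rfl fun i _ => ?_
  rw [integral_mul_fderiv_test hU (contDiffOn_fderiv_dir hU hv _) hh, neg_neg]

theorem integral_lapl_eq_zero (hh : IsTest U h) : ∫ x, lapl h x = 0 := by
  have := integral_mul_lapl (U := univ) isOpen_univ (v := fun _ => 1) contDiffOn_const
    ⟨hh.smooth, hh.compact, subset_univ _⟩
  simpa [gradient_fun_const] using this

theorem lapl_comp (hU : IsOpen U) {v : Eu d → ℝ} (hv : ContDiffOn ℝ (⊤ : ℕ∞) v U)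
    {κ β B : ℝ → ℝ} (hβ : ∀ r, HasDerivAt β (κ r) r) (hB : ∀ r, HasDerivAt B (β r) r)
    {x : Eu d} (hx : x ∈ U) :
    lapl (fun x => B (v x)) x = κ (v x) * ‖gradient v x‖ ^ 2 + β (v x) * lapl v x := by
  have hdv : ∀ z ∈ U, HasFDerivAt v (fderiv ℝ v z) z := fun z hz =>
    ((hv.contDiffAt (hU.mem_nhds hz)).differentiableAt (by simp)).hasFDerivAt
  rw [← real_inner_self_eq_norm_sq, inner_gradient_eq_sum, _root_.lapl, _root_.lapl,
    Finset.mul_sum, Finset.mul_sum, ← Finset.sum_add_distrib]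
  refine Finset.sum_congr rfl fun i _ => ?_
  set e : Eu d := EuclideanSpace.single i 1
  have h1 : (fun z => fderiv ℝ (fun x => B (v x)) z e) =ᶠ[nhds x]
      fun z => β (v z) * fderiv ℝ v z e := by
    filter_upwards [hU.mem_nhds hx] with z hz
    have h0 : HasFDerivAt (fun x => B (v x)) (β (v z) • fderiv ℝ v z) z :=
      (hB (v z)).comp_hasFDerivAt z (hdv z hz)
    rw [h0.fderiv]
    simp
  have h2 : HasFDerivAt (fun x => β (v x)) (κ (v x) • fderiv ℝ v x) x :=
    (hβ (v x)).comp_hasFDerivAt x (hdv x hx)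
  have h3 : HasFDerivAt (fun z => fderiv ℝ v z e) (fderiv ℝ (fun z => fderiv ℝ v z e) x) x :=
    (((contDiffOn_fderiv_dir hU hv e).contDiffAt (hU.mem_nhds hx)).differentiableAt
      (by simp)).hasFDerivAt
  rw [h1.fderiv_eq, (h2.fun_mul h3).fderiv]
  simp
  ring

theorem gradient_comp (hU : IsOpen U) {v : Eu d → ℝ} (hv : ContDiffOn ℝ (⊤ : ℕ∞) v U)
    {κ β : ℝ → ℝ} (hβ : ∀ r, HasDerivAt β (κ r) r) {x : Eu d} (hx : x ∈ U) :
    gradient (fun x => β (v x)) x = κ (v x) • gradient v x := by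
  have hdv : HasFDerivAt v (fderiv ℝ v x) x :=
    ((hv.contDiffAt (hU.mem_nhds hx)).differentiableAt (by simp)).hasFDerivAt
  refine gradient_eq_of_inner fun w => ?_
  have h0 : HasFDerivAt (fun x => β (v x)) (κ (v x) • fderiv ℝ v x) x :=
    (hβ (v x)).comp_hasFDerivAt x hdv
  rw [h0.fderiv, inner_smul_left, gradient_apply_inner]
  simp

end Grushin

namespace Grushin

variable {d e : ℕ} {U : Set (Eu d)} {V : Set (Eu e)} {Θ : Eu d × Eu e → ℝ}

/-- A smooth function on the product with compact support in `U ×ˢ V`. -/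
structure PairTest (U : Set (Eu d)) (V : Set (Eu e)) (Θ : Eu d × Eu e → ℝ) : Prop where
  smooth : ContDiff ℝ (⊤ : ℕ∞) Θ
  compact : HasCompactSupport Θ
  supp : tsupport Θ ⊆ U ×ˢ V

/-- The gradient with respect to the first variable. -/
noncomputable def gradFst (Θ : Eu d × Eu e → ℝ) (p : Eu d × Eu e) : Eu d :=
  gradient (fun x => Θ (x, p.2)) p.1

/-- The gradient with respect to the second variable. -/
noncomputable def gradSnd (Θ : Eu d × Eu e → ℝ) (p : Eu d × Eu e) : Eu e :=
  gradient (fun z => Θ (p.1, z)) p.2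

/-- The Laplacian with respect to the first variable. -/
noncomputable def laplFst (Θ : Eu d × Eu e → ℝ) (p : Eu d × Eu e) : ℝ :=
  lapl (fun x => Θ (x, p.2)) p.1

/-- The Laplacian with respect to the second variable. -/
noncomputable def laplSnd (Θ : Eu d × Eu e → ℝ) (p : Eu d × Eu e) : ℝ :=
  lapl (fun z => Θ (p.1, z)) p.2

theorem PairTest.swap (h : PairTest U V Θ) : PairTest V U (Θ ∘ Prod.swap) := by
  have e1 : tsupport (Θ ∘ Prod.swap) = Prod.swap ⁻¹' tsupport Θ :=
    tsupport_comp_eq_preimage Θ (Homeomorph.prodComm (Eu e) (Eu d))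
  refine ⟨h.smooth.comp (contDiff_snd.prodMk contDiff_fst), h.compact.comp_homeomorph (Homeomorph.prodComm _ _), ?_⟩
  rw [e1]
  exact fun p hp => ⟨(h.supp hp).2, (h.supp hp).1⟩

theorem PairTest.slice_fst (h : PairTest U V Θ) (z : Eu e) : IsTest U (fun x => Θ (x, z)) := by
  have hc : IsCompact (Prod.fst '' tsupport Θ) := IsCompact.image h.compact continuous_fst
  have hs : tsupport (fun x => Θ (x, z)) ⊆ Prod.fst '' tsupport Θ :=
    closure_minimal (fun x hx => ⟨(x, z), subset_tsupport Θ hx, rfl⟩) hc.isClosed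
  refine ⟨h.smooth.comp (by fun_prop), hc.of_isClosed_subset (isClosed_tsupport _) hs,
    hs.trans ?_⟩
  rintro _ ⟨p, hp, rfl⟩
  exact (h.supp hp).1

theorem PairTest.slice_snd (h : PairTest U V Θ) (x : Eu d) : IsTest V (fun z => Θ (x, z)) :=
  h.swap.slice_fst x

theorem gradFst_eq_zero {p : Eu d × Eu e} (hp : p ∉ tsupport Θ) : gradFst Θ p = 0 := by
  have h1 := notMem_tsupport_iff_eventuallyEq.1 hp
  have h2 : (fun x => Θ (x, p.2)) =ᶠ[nhds p.1] fun _ => 0 :=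
    (Continuous.tendsto (f := fun x : Eu d => (x, p.2)) (by fun_prop) p.1).eventually h1
  refine gradient_eq_of_inner fun w => ?_
  rw [h2.fderiv_eq]
  simp

theorem laplFst_eq_zero {p : Eu d × Eu e} (hp : p ∉ tsupport Θ) : laplFst Θ p = 0 := by
  have h1 := notMem_tsupport_iff_eventuallyEq.1 hp
  have h2 : (fun x => Θ (x, p.2)) =ᶠ[nhds p.1] fun _ => 0 :=
    (Continuous.tendsto (f := fun x : Eu d => (x, p.2)) (by fun_prop) p.1).eventually h1
  exact (lapl_congr h2).trans (lapl_zero _)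

theorem PairTest.continuous_gradFst (h : PairTest U V Θ) : Continuous (gradFst Θ) := by
  have e1 : gradFst Θ = fun p => (InnerProductSpace.toDual ℝ (Eu d)).symm
      ((fderiv ℝ Θ p).comp (ContinuousLinearMap.inl ℝ (Eu d) (Eu e))) := by
    funext p
    refine gradient_eq_of_inner fun w => ?_
    have h0 : HasFDerivAt (fun x => Θ (x, p.2))
        ((fderiv ℝ Θ p).comp (ContinuousLinearMap.inl ℝ (Eu d) (Eu e))) p.1 :=
      (h.smooth.differentiable (by simp) p).hasFDerivAt.comp (p.1) (hasFDerivAt_prodMk_left p.1 p.2)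
    rw [h0.fderiv, InnerProductSpace.toDual_symm_apply]
  rw [e1]
  exact (LinearIsometryEquiv.continuous _).comp
    ((h.smooth.continuous_fderiv (by simp)).clm_comp continuous_const)

theorem PairTest.continuous_laplSnd (h : PairTest U V Θ) : Continuous (laplSnd Θ) := by
  have := continuousOn_lapl_slice (Z := Eu d) isOpen_univ isOpen_univ
    (F := Θ) h.smooth.contDiffOn
  rwa [univ_prod_univ, continuousOn_univ] at this

theorem PairTest.continuous_laplFst (h : PairTest U V Θ) : Continuous (laplFst Θ) :=
  h.swap.continuous_laplSnd.comp continuous_swap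

theorem PairTest.continuous_gradSnd (h : PairTest U V Θ) : Continuous (gradSnd Θ) :=
  h.swap.continuous_gradFst.comp continuous_swap

theorem PairTest.hasCompactSupport_gradFst (h : PairTest U V Θ) : HasCompactSupport (gradFst Θ) :=
  HasCompactSupport.intro h.compact fun _ hp => gradFst_eq_zero hp

theorem PairTest.hasCompactSupport_laplFst (h : PairTest U V Θ) : HasCompactSupport (laplFst Θ) :=
  HasCompactSupport.intro h.compact fun _ hp => laplFst_eq_zero hp

theorem PairTest.hasCompactSupport_gradSnd (h : PairTest U V Θ) : HasCompactSupport (gradSnd Θ) :=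
  h.swap.hasCompactSupport_gradFst.comp_homeomorph (Homeomorph.prodComm _ _)

theorem PairTest.hasCompactSupport_laplSnd (h : PairTest U V Θ) : HasCompactSupport (laplSnd Θ) :=
  h.swap.hasCompactSupport_laplFst.comp_homeomorph (Homeomorph.prodComm _ _)

theorem PairTest.integral_laplFst (h : PairTest U V Θ) : ∫ p, laplFst Θ p = 0 := by
  have hi : Integrable (laplFst Θ) volume :=
    h.continuous_laplFst.integrable_of_hasCompactSupport h.hasCompactSupport_laplFst
  rw [Measure.volume_eq_prod, integral_prod_symm _ hi]
  exact (integral_congr_ae (ae_of_all _ fun z => integral_lapl_eq_zero (h.slice_fst z))).trans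
    (integral_zero _ _)

theorem PairTest.integral_laplSnd (h : PairTest U V Θ) :
    ∫ p : Eu d × Eu e, ‖p.1‖ ^ 2 * laplSnd Θ p = 0 := by
  have hi : Integrable (fun p : Eu d × Eu e => ‖p.1‖ ^ 2 * laplSnd Θ p) volume :=
    ((continuous_fst.norm.pow 2).mul h.continuous_laplSnd).integrable_of_hasCompactSupport
      h.hasCompactSupport_laplSnd.mul_left
  rw [Measure.volume_eq_prod, integral_prod _ hi]
  refine (integral_congr_ae (ae_of_all _ fun x => ?_)).trans (integral_zero _ _)
  exact (integral_const_mul (‖x‖ ^ 2) (lapl fun z => Θ (x, z))).trans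
    ((congrArg _ (integral_lapl_eq_zero (h.slice_snd x))).trans (mul_zero _))

section tensor

variable {α β E : Type*} [MeasurableSpace α] [MeasurableSpace β] [NormedAddCommGroup E]
  [NormedSpace ℝ E] {μ : Measure α} {ν : Measure β} [SFinite ν]

theorem eLpNorm_tensor {f : α → ℝ} {g : β → E} (hf : AEStronglyMeasurable f μ)
    (hg : AEStronglyMeasurable g ν) :
    eLpNorm (fun p : α × β => f p.1 • g p.2) 2 (μ.prod ν) = eLpNorm f 2 μ * eLpNorm g 2 ν := by
  simp only [eLpNorm_eq_lintegral_rpow_enorm_toReal (two_ne_zero) (ENNReal.ofNat_ne_top (n := 2)),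
    enorm_smul]
  rw [← ENNReal.mul_rpow_of_nonneg _ _ (by positivity), ← lintegral_prod_mul]
  · simp only [ENNReal.toReal_ofNat, ENNReal.mul_rpow_of_nonneg _ _ (zero_le_two (α := ℝ))]
  · exact hf.enorm.pow_const _
  · exact hg.enorm.pow_const _

theorem memLp_tensor {f : α → ℝ} {g : β → E} (hf : MemLp f 2 μ) (hg : MemLp g 2 ν) :
    MemLp (fun p : α × β => f p.1 • g p.2) 2 (μ.prod ν) := by
  refine ⟨hf.1.comp_fst.smul hg.1.comp_snd, ?_⟩
  rw [eLpNorm_tensor hf.1 hg.1]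
  exact ENNReal.mul_lt_top hf.2 hg.2

theorem tendsto_eLpNorm_tensor {f : α → ℝ} {g : β → E} {fs : ℕ → α → ℝ} {gs : ℕ → β → E}
    (hf : MemLp f 2 μ) (hg : MemLp g 2 ν) (hfs : ∀ k, MemLp (fs k) 2 μ)
    (hgs : ∀ k, MemLp (gs k) 2 ν)
    (h1 : Tendsto (fun k => eLpNorm (fs k - f) 2 μ) atTop (nhds 0))
    (h2 : Tendsto (fun k => eLpNorm (gs k - g) 2 ν) atTop (nhds 0)) :
    Tendsto (fun k => eLpNorm ((fun p : α × β => fs k p.1 • gs k p.2) -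
      fun p : α × β => f p.1 • g p.2) 2 (μ.prod ν)) atTop (nhds 0) := by
  have e1 : ∀ k, ((fun p : α × β => fs k p.1 • gs k p.2) - fun p : α × β => f p.1 • g p.2) =
      (fun p : α × β => (fs k - f) p.1 • (gs k - g) p.2) +
        ((fun p : α × β => (fs k - f) p.1 • g p.2) + fun p : α × β => f p.1 • (gs k - g) p.2) := by
    intro k
    funext p
    simp only [Pi.add_apply, Pi.sub_apply, smul_sub, sub_smul]
    abel
  have m1 := fun k => (hfs k).sub hf
  have m2 := fun k => (hgs k).sub hg
  have hle : ∀ k, eLpNorm ((fun p : α × β => fs k p.1 • gs k p.2) -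
      fun p : α × β => f p.1 • g p.2) 2 (μ.prod ν) ≤ eLpNorm (fs k - f) 2 μ * eLpNorm (gs k - g) 2 ν
        + (eLpNorm (fs k - f) 2 μ * eLpNorm g 2 ν + eLpNorm f 2 μ * eLpNorm (gs k - g) 2 ν) := by
    intro k
    rw [e1, ← eLpNorm_tensor (m1 k).1 (m2 k).1, ← eLpNorm_tensor (m1 k).1 hg.1,
      ← eLpNorm_tensor hf.1 (m2 k).1]
    refine (eLpNorm_add_le (memLp_tensor (m1 k) (m2 k)).1
      ((memLp_tensor (m1 k) hg).1.add (memLp_tensor hf (m2 k)).1) one_le_two).trans ?_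
    exact add_le_add le_rfl (eLpNorm_add_le (memLp_tensor (m1 k) hg).1
      (memLp_tensor hf (m2 k)).1 one_le_two)
  refine tendsto_of_tendsto_of_tendsto_of_le_of_le tendsto_const_nhds ?_ (fun _ => zero_le) hle
  have t1 := ENNReal.Tendsto.mul h1 (.inr ENNReal.zero_ne_top) h2 (.inr ENNReal.zero_ne_top)
  have t2 := ENNReal.Tendsto.mul_const (b := eLpNorm g 2 ν) h1 (.inr hg.2.ne)
  have t3 := ENNReal.Tendsto.const_mul (a := eLpNorm f 2 μ) h2 (.inr hf.2.ne)
  simpa using t1.add (t2.add t3)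

end tensor

end Grushin

namespace Grushin

section swap

variable {α β E : Type*} [MeasurableSpace α] [MeasurableSpace β] [NormedAddCommGroup E]
  [NormedSpace ℝ E] {μ : Measure α} {ν : Measure β} [SFinite μ] [SFinite ν]

theorem memLp_tensor_swap {f : β → ℝ} {g : α → E} (hf : MemLp f 2 ν) (hg : MemLp g 2 μ) :
    MemLp (fun p : α × β => f p.2 • g p.1) 2 (μ.prod ν) :=
  (memLp_tensor hf hg).comp_measurePreserving Measure.measurePreserving_swap

theorem tendsto_eLpNorm_tensor_swap {f : β → ℝ} {g : α → E} {fs : ℕ → β → ℝ} {gs : ℕ → α → E}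
    (hf : MemLp f 2 ν) (hg : MemLp g 2 μ) (hfs : ∀ k, MemLp (fs k) 2 ν)
    (hgs : ∀ k, MemLp (gs k) 2 μ)
    (h1 : Tendsto (fun k => eLpNorm (fs k - f) 2 ν) atTop (nhds 0))
    (h2 : Tendsto (fun k => eLpNorm (gs k - g) 2 μ) atTop (nhds 0)) :
    Tendsto (fun k => eLpNorm ((fun p : α × β => fs k p.2 • gs k p.1) -
      fun p : α × β => f p.2 • g p.1) 2 (μ.prod ν)) atTop (nhds 0) := by
  refine (tendsto_eLpNorm_tensor hf hg hfs hgs h1 h2).congr fun k => ?_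
  exact (eLpNorm_comp_measurePreserving
    ((memLp_tensor (hfs k) (hgs k)).sub (memLp_tensor hf hg)).1
    (Measure.measurePreserving_swap (μ := μ) (ν := ν))).symm

end swap

variable {d e : ℕ} {U : Set (Eu d)} {V : Set (Eu e)} {Θ : Eu d × Eu e → ℝ}

theorem PairTest.continuous (h : PairTest U V Θ) : Continuous Θ := h.smooth.continuous

theorem PairTest.memLp (h : PairTest U V Θ) : MemLp Θ 2 volume :=
  h.continuous.memLp_of_hasCompactSupport h.compact

theorem PairTest.memLp_gradFst (h : PairTest U V Θ) : MemLp (gradFst Θ) 2 volume :=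
  h.continuous_gradFst.memLp_of_hasCompactSupport h.hasCompactSupport_gradFst

theorem PairTest.memLp_gradSnd (h : PairTest U V Θ) :
    MemLp (fun p => ‖p.1‖ • gradSnd Θ p) 2 volume :=
  (continuous_fst.norm.smul h.continuous_gradSnd).memLp_of_hasCompactSupport
    h.hasCompactSupport_gradSnd.smul_left

theorem PairTest.integral_inner_gradFst (h : PairTest U V Θ) {H : Eu d → Eu d} {A : Eu d → ℝ}
    {m : Eu e → ℝ} (hH : MemLp H 2 volume) (hA : MemLp A 2 volume) (hm : MemLp m 2 volume)
    (hw : ∀ w, IsTest U w → ∫ x, (inner ℝ (H x) (gradient w x) : ℝ) = ∫ x, A x * w x) :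
    ∫ p, (inner ℝ (gradFst Θ p) (m p.2 • H p.1) : ℝ) = ∫ p, Θ p * (A p.1 * m p.2) := by
  have i1 : Integrable (fun p : Eu d × Eu e => (inner ℝ (gradFst Θ p) (m p.2 • H p.1) : ℝ))
      (volume.prod volume) := integrable_inner_of_memLp h.memLp_gradFst (memLp_tensor_swap hm hH)
  have i2 : Integrable (fun p : Eu d × Eu e => Θ p * (A p.1 * m p.2)) (volume.prod volume) :=
    integrable_mul_of_memLp h.memLp (memLp_tensor hA hm)
  rw [Measure.volume_eq_prod, integral_prod_symm _ i1, integral_prod_symm _ i2]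
  refine integral_congr_ae (ae_of_all _ fun z => ?_)
  have h1 := hw _ (h.slice_fst z)
  calc ∫ x, (inner ℝ (gradFst Θ (x, z)) (m z • H x) : ℝ)
      = ∫ x, m z * (inner ℝ (H x) (gradient (fun x => Θ (x, z)) x) : ℝ) := by
        refine integral_congr_ae (ae_of_all _ fun x => ?_)
        simp only [inner_smul_right]
        rw [real_inner_comm]
        rfl
    _ = ∫ x, m z * (A x * Θ (x, z)) := by rw [integral_const_mul, h1, integral_const_mul]
    _ = ∫ x, Θ (x, z) * (A x * m z) := by
        refine integral_congr_ae (ae_of_all _ fun x => ?_)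
        simp only
        ring

theorem PairTest.integral_inner_gradSnd (h : PairTest U V Θ) {H : Eu e → Eu e} {A : Eu e → ℝ}
    {m : Eu d → ℝ} (hH : MemLp H 2 volume) (hA : MemLp A 2 volume) (hm : MemLp m 2 volume)
    (hw : ∀ w, IsTest V w → ∫ x, (inner ℝ (H x) (gradient w x) : ℝ) = ∫ x, A x * w x) :
    ∫ p, (inner ℝ (gradSnd Θ p) (m p.1 • H p.2) : ℝ) = ∫ p, Θ p * (A p.2 * m p.1) := by
  have h1 := h.swap.integral_inner_gradFst hH hA hm hw
  rw [Measure.volume_eq_prod] at h1 ⊢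
  rw [← integral_prod_swap, ← integral_prod_swap (fun p : Eu d × Eu e => Θ p * (A p.2 * m p.1))]
  exact h1

theorem PairTest.energy_pairing (h : PairTest U V Θ) {ψ A : Eu d → ℝ} {G : Eu d → Eu d}
    {φ B : Eu e → ℝ} {Φ : Eu e → Eu e} (hψ : MemLp (fun x => ‖x‖ ^ 2 * ψ x) 2 volume)
    (hA : MemLp A 2 volume) (hG : MemLp G 2 volume)
    (hφ : MemLp φ 2 volume) (hB : MemLp B 2 volume) (hΦ : MemLp Φ 2 volume)
    (h1 : ∀ w, IsTest U w → ∫ x, (inner ℝ (G x) (gradient w x) : ℝ) = ∫ x, A x * w x)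
    (h2 : ∀ w, IsTest V w → ∫ x, (inner ℝ (Φ x) (gradient w x) : ℝ) = ∫ x, B x * w x) :
    (∫ p, (inner ℝ (gradFst Θ p) (φ p.2 • G p.1) : ℝ)) +
      (∫ p : Eu d × Eu e,
        (inner ℝ (‖p.1‖ • gradSnd Θ p) ((‖p.1‖ * ψ p.1) • Φ p.2) : ℝ)) =
      ∫ p : Eu d × Eu e, Θ p * (A p.1 * φ p.2 + ‖p.1‖ ^ 2 * ψ p.1 * B p.2) := by
  have e2 : ∫ p : Eu d × Eu e, (inner ℝ (‖p.1‖ • gradSnd Θ p) ((‖p.1‖ * ψ p.1) • Φ p.2) : ℝ) =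
      ∫ p : Eu d × Eu e, (inner ℝ (gradSnd Θ p) ((‖p.1‖ ^ 2 * ψ p.1) • Φ p.2) : ℝ) := by
    refine integral_congr_ae (ae_of_all _ fun p => ?_)
    simp only [inner_smul_left, inner_smul_right, RCLike.conj_to_real]
    ring
  have i1 : Integrable (fun p : Eu d × Eu e => Θ p * (A p.1 * φ p.2)) volume :=
    integrable_mul_of_memLp h.memLp (memLp_tensor hA hφ)
  have i2 : Integrable (fun p : Eu d × Eu e => Θ p * (B p.2 * (‖p.1‖ ^ 2 * ψ p.1))) volume :=
    integrable_mul_of_memLp h.memLp (memLp_tensor_swap hB hψ)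
  rw [e2, h.integral_inner_gradFst hG hA hφ h1, h.integral_inner_gradSnd hΦ hB hψ h2,
    ← integral_add i1 i2]
  refine integral_congr_ae (ae_of_all _ fun p => ?_)
  simp only
  ring

theorem gradFst_congr {Ξ : Eu d × Eu e → ℝ} {p : Eu d × Eu e} (h : Θ =ᶠ[nhds p] Ξ) :
    gradFst Θ p = gradFst Ξ p := by
  have h2 : (fun x => Θ (x, p.2)) =ᶠ[nhds p.1] fun x => Ξ (x, p.2) :=
    (Continuous.tendsto (f := fun x : Eu d => (x, p.2)) (by fun_prop) p.1).eventually h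
  refine gradient_eq_of_inner fun w => ?_
  rw [h2.fderiv_eq]
  exact (gradient_apply_inner _ _ _).symm

theorem laplFst_congr {Ξ : Eu d × Eu e → ℝ} {p : Eu d × Eu e} (h : Θ =ᶠ[nhds p] Ξ) :
    laplFst Θ p = laplFst Ξ p :=
  lapl_congr ((Continuous.tendsto (f := fun x : Eu d => (x, p.2)) (by fun_prop) p.1).eventually h)

theorem pairTest_indicator (hU : IsOpen U) (hV : IsOpen V) (hUb : Bornology.IsBounded U)
    (hVb : Bornology.IsBounded V) {v : Eu d × Eu e → ℝ} (hc : ContinuousOn v (closure (U ×ˢ V)))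
    (hs : ContDiffOn ℝ (⊤ : ℕ∞) v (U ×ˢ V)) (h0 : ∀ p ∈ frontier (U ×ˢ V), v p = 0)
    {b : ℝ → ℝ} {ε : ℝ} (hε : 0 < ε) (hb : ContDiff ℝ (⊤ : ℕ∞) b) (hb0 : ∀ r, |r| ≤ ε → b r = 0) :
    PairTest U V ((U ×ˢ V).indicator fun p => b (v p)) := by
  have hW := hU.prod hV
  set W := U ×ˢ V with hWdef
  have hK : IsCompact (closure W) := (hUb.prod hVb).isCompact_closure
  have hcl : IsClosed (closure W ∩ (fun p => |v p|) ⁻¹' Ici ε) :=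
    hc.abs.preimage_isClosed_of_isClosed isClosed_closure isClosed_Ici
  have hKW : closure W ∩ (fun p => |v p|) ⁻¹' Ici ε ⊆ W := by
    rintro p ⟨hp, hpε⟩
    by_contra hpW
    have : v p = 0 := h0 p (by rw [hW.frontier_eq]; exact ⟨hp, hpW⟩)
    simp only [mem_preimage, this, abs_zero, mem_Ici] at hpε
    linarith
  have hsub : tsupport (W.indicator fun p => b (v p)) ⊆
      closure W ∩ (fun p => |v p|) ⁻¹' Ici ε := by
    refine closure_minimal (fun p hp => ?_) hcl
    have hpW : p ∈ W := by
      by_contra hpW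
      exact hp (indicator_of_notMem hpW _)
    refine ⟨subset_closure hpW, ?_⟩
    by_contra hpε
    simp only [mem_preimage, mem_Ici, not_le] at hpε
    exact hp ((indicator_of_mem hpW _).trans (hb0 _ hpε.le))
  refine ⟨contDiff_iff_contDiffAt.2 fun p => ?_,
    (hK.inter_right isClosed_closure |>.of_isClosed_subset (isClosed_tsupport _)
      (hsub.trans (inter_subset_left.trans (subset_inter subset_rfl subset_rfl)))),
    hsub.trans hKW⟩
  by_cases hp : p ∈ W
  · have : ContDiffAt ℝ (⊤ : ℕ∞) (fun p => b (v p)) p :=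
      hb.contDiffAt.comp p (hs.contDiffAt (hW.mem_nhds hp))
    refine this.congr_of_eventuallyEq ?_
    filter_upwards [hW.mem_nhds hp] with q hq
    exact indicator_of_mem hq _
  · have := notMem_tsupport_iff_eventuallyEq.1 fun h => hp (hKW (hsub h))
    exact (contDiffAt_const (c := (0:ℝ))).congr_of_eventuallyEq this

theorem sq_norm_gradFst_le (hU : IsOpen U) (hV : IsOpen V) {v : Eu d × Eu e → ℝ}
    (hs : ContDiffOn ℝ (⊤ : ℕ∞) v (U ×ˢ V)) {ε : ℝ} {κ β B : ℝ → ℝ} (hT : Truncation ε κ β B)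
    {p : Eu d × Eu e} (hp : p ∈ U ×ˢ V) :
    ‖gradFst ((U ×ˢ V).indicator fun p => β (v p)) p‖ ^ 2 ≤
      laplFst ((U ×ˢ V).indicator fun p => B (v p)) p - β (v p) * laplFst v p := by
  have hW := hU.prod hV
  have h1 : ∀ b : ℝ → ℝ, (U ×ˢ V).indicator (fun p => b (v p)) =ᶠ[nhds p] fun p => b (v p) :=
    fun b => by
      filter_upwards [hW.mem_nhds hp] with q hq
      exact indicator_of_mem hq _
  have hs' : ContDiffOn ℝ (⊤ : ℕ∞) (fun x => v (x, p.2)) U :=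
    hs.comp (f := fun x : Eu d => (x, p.2)) (ContDiff.contDiffOn (by fun_prop))
      fun x hx => ⟨hx, hp.2⟩
  rw [gradFst_congr (h1 β), laplFst_congr (h1 B)]
  have e1 : gradFst (fun p => β (v p)) p = κ (v p) • gradFst v p :=
    gradient_comp hU hs' hT.deriv_β hp.1
  have e2 : laplFst (fun p => B (v p)) p = κ (v p) * ‖gradFst v p‖ ^ 2 + β (v p) * laplFst v p :=
    lapl_comp hU hs' hT.deriv_β hT.deriv_B hp.1
  rw [e1, e2, norm_smul, mul_pow, Real.norm_eq_abs, sq_abs]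
  have h3 := hT.nonneg (v p)
  have h4 := hT.le_one (v p)
  have h5 : κ (v p) ^ 2 ≤ κ (v p) := by nlinarith
  nlinarith [mul_le_mul_of_nonneg_right h5 (sq_nonneg ‖gradFst v p‖)]

theorem sq_norm_gradSnd_le (hU : IsOpen U) (hV : IsOpen V) {v : Eu d × Eu e → ℝ}
    (hs : ContDiffOn ℝ (⊤ : ℕ∞) v (U ×ˢ V)) {ε : ℝ} {κ β B : ℝ → ℝ} (hT : Truncation ε κ β B)
    {p : Eu d × Eu e} (hp : p ∈ U ×ˢ V) :
    ‖gradSnd ((U ×ˢ V).indicator fun p => β (v p)) p‖ ^ 2 ≤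
      laplSnd ((U ×ˢ V).indicator fun p => B (v p)) p - β (v p) * laplSnd v p := by
  have h1 : ∀ g : Eu d × Eu e → ℝ, (V ×ˢ U).indicator (g ∘ Prod.swap) =
      (U ×ˢ V).indicator g ∘ Prod.swap := fun g => by
    funext q
    classical
    simp only [Function.comp_apply, indicator_apply]
    exact if_congr and_comm rfl rfl
  have h2 := sq_norm_gradFst_le hV hU (v := v ∘ Prod.swap)
    (hs.comp (contDiff_snd.prodMk contDiff_fst).contDiffOn fun q hq => ⟨hq.2, hq.1⟩) hT
    (p := p.swap) ⟨hp.2, hp.1⟩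
  have h3 := h1 fun p => β (v p)
  have h4 := h1 fun p => B (v p)
  simp only [Function.comp_def] at h2 h3 h4
  rw [h3, h4] at h2
  exact h2

theorem StationarySolution.energy_le (hU : IsOpen U) (hV : IsOpen V) (hUb : Bornology.IsBounded U)
    (hVb : Bornology.IsBounded V) {v f : Eu d × Eu e → ℝ} (hv : StationarySolution U V v f)
    {ε : ℝ} (hε : 0 < ε) {κ β B : ℝ → ℝ} (hT : Truncation ε κ β B) :
    (∫ p, ‖gradFst ((U ×ˢ V).indicator fun p => β (v p)) p‖ ^ 2) +
      (∫ p : Eu d × Eu e, ‖‖p.1‖ • gradSnd ((U ×ˢ V).indicator fun p => β (v p)) p‖ ^ 2) ≤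
      ∫ p, (U ×ˢ V).indicator (fun p => |v p| * |f p|) p := by
  have hW := hU.prod hV
  have hK : IsCompact (closure (U ×ˢ V)) := (hUb.prod hVb).isCompact_closure
  have tβ := pairTest_indicator hU hV hUb hVb hv.cont hv.smooth hv.boundary hε hT.smooth_β
    hT.zero_β
  have tB := pairTest_indicator hU hV hUb hVb hv.cont hv.smooth hv.boundary hε hT.smooth_B
    hT.zero_B
  set W := U ×ˢ V with hWdef
  set Θβ := W.indicator fun p => β (v p) with hΘβ
  set ΘB := W.indicator fun p => B (v p) with hΘB
  have i1 := (memLp_two_iff_integrable_sq_norm tβ.memLp_gradFst.1).1 tβ.memLp_gradFst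
  have i2 := (memLp_two_iff_integrable_sq_norm tβ.memLp_gradSnd.1).1 tβ.memLp_gradSnd
  have i3 : Integrable (laplFst ΘB) volume :=
    tB.continuous_laplFst.integrable_of_hasCompactSupport tB.hasCompactSupport_laplFst
  have i4 : Integrable (fun p : Eu d × Eu e => ‖p.1‖ ^ 2 * laplSnd ΘB p) volume :=
    ((continuous_fst.norm.pow 2).mul tB.continuous_laplSnd).integrable_of_hasCompactSupport
      tB.hasCompactSupport_laplSnd.mul_left
  have hind : ∀ g : Eu d × Eu e → ℝ, ContinuousOn g (closure W) →
      Integrable (W.indicator g) volume := fun g hg =>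
    ((hg.integrableOn_compact hK).mono_set subset_closure).integrable_indicator hW.measurableSet
  have i5 : Integrable (W.indicator fun p => |v p| * |f p|) volume :=
    hind _ (hv.cont.abs.mul hv.cont_rhs.abs)
  calc _ = ∫ p : Eu d × Eu e, (‖gradFst Θβ p‖ ^ 2 + ‖‖p.1‖ • gradSnd Θβ p‖ ^ 2) :=
        (integral_add i1 i2).symm
    _ ≤ ∫ p : Eu d × Eu e, ((laplFst ΘB p + ‖p.1‖ ^ 2 * laplSnd ΘB p) +
          W.indicator (fun p => |v p| * |f p|) p) := by
        refine integral_mono (i1.add i2) ((i3.add i4).add i5) fun p => ?_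
        simp only
        by_cases hp : p ∈ W
        · have h1 := sq_norm_gradFst_le hU hV hv.smooth hT hp
          have h2 := sq_norm_gradSnd_le hU hV hv.smooth hT hp
          have h3 : laplFst v p + ‖p.1‖ ^ 2 * laplSnd v p = f p := hv.eqn p.1 hp.1 p.2 hp.2
          have h4 : -(β (v p) * f p) ≤ |v p| * |f p| := by
            refine (neg_le_abs _).trans ?_
            rw [abs_mul]
            exact mul_le_mul_of_nonneg_right (hT.abs_β_le _) (abs_nonneg _)
          rw [indicator_of_mem hp, norm_smul, norm_norm, mul_pow]
          have h5 := mul_le_mul_of_nonneg_left h2 (sq_nonneg ‖p.1‖)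
          rw [← h3] at h4
          rw [← hWdef, ← hΘβ, ← hΘB] at h1 h5
          rw [← h3]
          nlinarith
        · have z1 : gradFst Θβ p = 0 := gradFst_eq_zero fun h => hp (tβ.supp h)
          have z2 : gradSnd Θβ p = 0 :=
            gradFst_eq_zero (Θ := Θβ ∘ Prod.swap) (p := p.swap) fun h =>
              hp ⟨(tβ.swap.supp h).2, (tβ.swap.supp h).1⟩
          have z3 : laplFst ΘB p = 0 := laplFst_eq_zero fun h => hp (tB.supp h)
          have z4 : laplSnd ΘB p = 0 :=
            laplFst_eq_zero (Θ := ΘB ∘ Prod.swap) (p := p.swap) fun h =>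
              hp ⟨(tB.swap.supp h).2, (tB.swap.supp h).1⟩
          simp [z1, z2, z3, z4, hp]
    _ = _ := by
        have i34 : Integrable (fun p : Eu d × Eu e => laplFst ΘB p + ‖p.1‖ ^ 2 * laplSnd ΘB p)
          volume := i3.add i4
        rw [integral_add i34 i5, integral_add i3 i4, tB.integral_laplFst, tB.integral_laplSnd]
        simp

end Grushin

namespace Grushin

theorem abs_integral_inner_le {α E : Type*} [MeasurableSpace α] {μ : Measure α}
    [NormedAddCommGroup E] [InnerProductSpace ℝ E] {a b : α → E} (ha : MemLp a 2 μ)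
    (hb : MemLp b 2 μ) {M : ℝ} (hM : ∫ x, ‖a x‖ ^ 2 ∂μ ≤ M) :
    |∫ x, (inner ℝ (a x) (b x) : ℝ) ∂μ| ≤ √M * (eLpNorm b 2 μ).toReal := by
  have h1 : ‖ha.toLp a‖ ^ 2 ≤ M := by
    rw [← real_inner_self_eq_norm_sq, inner_toLp]
    simpa only [real_inner_self_eq_norm_sq] using hM
  rw [← inner_toLp ha hb, ← Lp.norm_toLp b hb]
  exact (abs_real_inner_le_norm _ _).trans
    (mul_le_mul_of_nonneg_right (Real.le_sqrt_of_sq_le h1) (norm_nonneg _))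

variable {d e : ℕ} {U : Set (Eu d)} {V : Set (Eu e)} {Θ : Eu d × Eu e → ℝ}

theorem IsTest.pair {h : Eu d → ℝ} {k : Eu e → ℝ} (hh : IsTest U h) (hk : IsTest V k) :
    PairTest U V (fun p => h p.1 * k p.2) := by
  have hK : IsCompact (tsupport h ×ˢ tsupport k) := IsCompact.prod hh.compact hk.compact
  have hs : tsupport (fun p : Eu d × Eu e => h p.1 * k p.2) ⊆ tsupport h ×ˢ tsupport k :=
    closure_minimal (fun p hp => ⟨subset_tsupport h (left_ne_zero_of_mul hp),
      subset_tsupport k (right_ne_zero_of_mul hp)⟩) hK.isClosed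
  exact ⟨(hh.smooth.comp contDiff_fst).mul (hk.smooth.comp contDiff_snd),
    hK.of_isClosed_subset (isClosed_tsupport _) hs, hs.trans (prod_mono hh.supp hk.supp)⟩

theorem PairTest.zero_of_notMem (h : PairTest U V Θ) {p : Eu d × Eu e} (hp : p ∉ U ×ˢ V) :
    Θ p = 0 :=
  image_eq_zero_of_notMem_tsupport fun hp' => hp (h.supp hp')

theorem PairTest.indicator_mul (h : PairTest U V Θ) (g : Eu d × Eu e → ℝ) (p : Eu d × Eu e) :
    (U ×ˢ V).indicator g p * Θ p = g p * Θ p := by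
  by_cases hp : p ∈ U ×ˢ V
  · rw [indicator_of_mem hp]
  · rw [h.zero_of_notMem hp, mul_zero, mul_zero]

theorem PairTest.integrable_mul (h : PairTest U V Θ) (hU : IsOpen U) (hV : IsOpen V)
    {g : Eu d × Eu e → ℝ} (hg : ContinuousOn g (U ×ˢ V)) :
    Integrable (fun p => (U ×ˢ V).indicator g p * Θ p) volume := by
  simp only [h.indicator_mul]
  exact (continuous_mul_of_tsupport (hU.prod hV) hg h.continuous
    h.supp).integrable_of_hasCompactSupport h.compact.mul_left

theorem continuousOn_laplSnd (hU : IsOpen U) (hV : IsOpen V) {v : Eu d × Eu e → ℝ}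
    (hv : ContDiffOn ℝ (⊤ : ℕ∞) v (U ×ˢ V)) : ContinuousOn (laplSnd v) (U ×ˢ V) :=
  continuousOn_lapl_slice hU hV hv

theorem continuousOn_laplFst (hU : IsOpen U) (hV : IsOpen V) {v : Eu d × Eu e → ℝ}
    (hv : ContDiffOn ℝ (⊤ : ℕ∞) v (U ×ˢ V)) : ContinuousOn (laplFst v) (U ×ˢ V) := by
  have hm : MapsTo (Prod.swap : Eu e × Eu d → Eu d × Eu e) (V ×ˢ U) (U ×ˢ V) :=
    fun q hq => ⟨hq.2, hq.1⟩
  have hm' : MapsTo (Prod.swap : Eu d × Eu e → Eu e × Eu d) (U ×ˢ V) (V ×ˢ U) :=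
    fun q hq => ⟨hq.2, hq.1⟩
  have h0 : ContDiff ℝ (⊤ : ℕ∞) (Prod.swap : Eu e × Eu d → Eu d × Eu e) :=
    contDiff_snd.prodMk contDiff_fst
  have h1 : ContDiffOn ℝ (⊤ : ℕ∞) (fun q : Eu e × Eu d => v q.swap) (V ×ˢ U) :=
    hv.comp h0.contDiffOn hm
  have h2 := continuousOn_laplSnd hV hU h1
  have h3 : ContinuousOn (fun p : Eu d × Eu e => laplSnd (fun q : Eu e × Eu d => v q.swap) p.swap)
    (U ×ˢ V) := h2.comp continuous_swap.continuousOn hm'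
  have h4 : (fun p : Eu d × Eu e => laplSnd (fun q : Eu e × Eu d => v q.swap) p.swap) =
    laplFst v := rfl
  rw [← h4]
  exact h3

theorem integral_laplFst_mul (hU : IsOpen U) (hV : IsOpen V) {v : Eu d × Eu e → ℝ}
    (hv : ContDiffOn ℝ (⊤ : ℕ∞) v (U ×ˢ V)) {h : Eu d → ℝ} {k : Eu e → ℝ} (hh : IsTest U h)
    (hk : IsTest V k) :
    ∫ p, (U ×ˢ V).indicator v p * (lapl h p.1 * k p.2) =
      ∫ p, (U ×ˢ V).indicator (laplFst v) p * (h p.1 * k p.2) := by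
  have t1 := hh.lapl.pair hk
  have t2 := hh.pair hk
  have i1 := t1.integrable_mul hU hV hv.continuousOn
  have i2 := t2.integrable_mul hU hV (continuousOn_laplFst hU hV hv)
  simp only [t1.indicator_mul, t2.indicator_mul] at i1 i2 ⊢
  rw [Measure.volume_eq_prod] at i1 i2 ⊢
  rw [integral_prod_symm _ i1, integral_prod_symm _ i2]
  refine integral_congr_ae (ae_of_all _ fun z => ?_)
  simp only [← mul_assoc, integral_mul_const]
  by_cases hz : z ∈ V
  · have hs' : ContDiffOn ℝ (⊤ : ℕ∞) (fun x => v (x, z)) U :=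
      hv.comp (f := fun x : Eu d => (x, z)) (ContDiff.contDiffOn (by fun_prop))
        fun x hx => ⟨hx, hz⟩
    exact congrArg (· * k z) (integral_lapl_mul hU hs' hh).symm
  · rw [hk.zero_of_notMem hz, mul_zero, mul_zero]

theorem integral_laplSnd_mul (hU : IsOpen U) (hV : IsOpen V) {v : Eu d × Eu e → ℝ}
    (hv : ContDiffOn ℝ (⊤ : ℕ∞) v (U ×ˢ V)) {h : Eu d → ℝ} {k : Eu e → ℝ} (hh : IsTest U h)
    (hk : IsTest V k) :
    ∫ p, (U ×ˢ V).indicator v p * (h p.1 * lapl k p.2) =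
      ∫ p, (U ×ˢ V).indicator (laplSnd v) p * (h p.1 * k p.2) := by
  have h1 := integral_laplFst_mul hV hU (v := v ∘ Prod.swap)
    (hv.comp (contDiff_snd.prodMk contDiff_fst).contDiffOn fun q hq => ⟨hq.2, hq.1⟩) hk hh
  have t1 := hh.pair hk.lapl
  have t2 := hh.pair hk
  have t1' := hk.lapl.pair hh
  have t2' := hk.pair hh
  simp only [t1.indicator_mul, t2.indicator_mul, t1'.indicator_mul, t2'.indicator_mul] at h1 ⊢
  rw [Measure.volume_eq_prod] at h1 ⊢
  rw [← integral_prod_swap, ← integral_prod_swap (fun p : Eu d × Eu e =>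
    laplSnd v p * (h p.1 * k p.2))]
  refine Eq.trans (integral_congr_ae (ae_of_all _ fun q => ?_))
    (h1.trans (integral_congr_ae (ae_of_all _ fun q => ?_)))
  · simp only [Function.comp_apply, Prod.swap, mul_comm]
  · simp only [Prod.swap, mul_comm (k _)]
    rfl

theorem StationarySolution.integral_mul_test (hU : IsOpen U) (hV : IsOpen V)
    {v f : Eu d × Eu e → ℝ} (hv : StationarySolution U V v f)
    {h : Eu d → ℝ} {k : Eu e → ℝ} (hh : IsTest U h) (hk : IsTest V k) :
    ∫ p, (U ×ˢ V).indicator v p * (lapl h p.1 * k p.2 + ‖p.1‖ ^ 2 * h p.1 * lapl k p.2) =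
      ∫ p, (U ×ˢ V).indicator f p * (h p.1 * k p.2) := by
  have hh' : IsTest U (fun x => ‖x‖ ^ 2 * h x) := hh.mul_left (contDiff_norm_sq ℝ)
  have j1 := (hh.lapl.pair hk).integrable_mul hU hV hv.smooth.continuousOn
  have j2 := (hh'.pair hk.lapl).integrable_mul hU hV hv.smooth.continuousOn
  have j3 := (hh.pair hk).integrable_mul hU hV (continuousOn_laplFst hU hV hv.smooth)
  have j4 := (hh'.pair hk).integrable_mul hU hV (continuousOn_laplSnd hU hV hv.smooth)
  simp only [mul_add]
  rw [integral_add j1 j2, integral_laplFst_mul hU hV hv.smooth hh hk,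
    integral_laplSnd_mul hU hV hv.smooth hh' hk, ← integral_add j3 j4]
  refine integral_congr_ae (ae_of_all _ fun p => ?_)
  simp only
  by_cases hp : p ∈ U ×ˢ V
  · simp only [indicator_of_mem hp]
    rw [← hv.eqn p.1 hp.1 p.2 hp.2]
    change laplFst v p * _ + laplSnd v p * _ = (laplFst v p + ‖p.1‖ ^ 2 * laplSnd v p) * _
    ring
  · simp only [indicator_of_notMem hp]
    ring

theorem IsTest.integral_inner_gradient_eq_lapl {h w : Eu d → ℝ} (hh : IsTest U h) (hw : IsTest U w) :
    ∫ x, (inner ℝ (gradient h x) (gradient w x) : ℝ) = ∫ x, -_root_.lapl h x * w x := by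
  have h1 := integral_mul_lapl isOpen_univ hw.smooth.contDiffOn
    (⟨hh.smooth, hh.compact, subset_univ _⟩ : IsTest univ h)
  simp only [neg_mul, integral_neg, mul_comm (_root_.lapl h _), h1, neg_neg]
  simp only [real_inner_comm]

theorem WeakEq.integral_inner_gradient (hUb : Bornology.IsBounded U) {ψ : Eu d → ℝ}
    {G : Eu d → Eu d} {μ lam : ℝ}
    (hψ : H10 U ψ G) (hw : WeakEq U μ ψ G (fun x => -lam * ψ x)) {w : Eu d → ℝ}
    (hw' : IsTest U w) :
    ∫ x, (inner ℝ (G x) (gradient w x) : ℝ) =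
      ∫ x, (lam * ψ x - (μ * ‖x‖ ^ 2) * ψ x) * w x := by
  have h1 := hw w _ hw'.h10
  have i1 : Integrable (fun x => lam * ψ x * w x) volume :=
    integrable_mul_of_memLp (hψ.memf.const_mul lam) hw'.memLp
  have i2 : Integrable (fun x => (μ * ‖x‖ ^ 2) * ψ x * w x) volume :=
    integrable_mul_of_memLp (memLp_normSq_mul hUb hψ.memf hψ.zerof μ) hw'.memLp
  simp only [sub_mul]
  rw [integral_sub i1 i2]
  simp only [mul_assoc, integral_const_mul, neg_mul, integral_neg] at h1 ⊢
  linarith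

end Grushin

namespace Grushin

variable {d e : ℕ} {U : Set (Eu d)} {V : Set (Eu e)}

theorem memLp_indicator_of_continuousOn {W : Set (Eu d × Eu e)} (hW : IsOpen W)
    (hWb : Bornology.IsBounded W) {g : Eu d × Eu e → ℝ} (hg : ContinuousOn g (closure W)) :
    MemLp (W.indicator g) 2 volume := by
  have hK : IsCompact (closure W) := hWb.isCompact_closure
  obtain ⟨C, hC⟩ := hK.exists_bound_of_continuousOn hg
  rw [memLp_indicator_iff_restrict hW.measurableSet]
  have : IsFiniteMeasure ((volume : Measure (Eu d × Eu e)).restrict W) :=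
    ⟨by rw [Measure.restrict_apply_univ]; exact hWb.measure_lt_top⟩
  refine MemLp.of_bound ((hg.mono subset_closure).aestronglyMeasurable hW.measurableSet) C ?_
  exact ae_restrict_of_forall_mem hW.measurableSet fun p hp => hC p (subset_closure hp)

theorem Truncation.abs_integral_sub_le {W : Set (Eu d × Eu e)} (hW : IsOpen W)
    (hWb : Bornology.IsBounded W) {v Ψ : Eu d × Eu e → ℝ} (hv : MemLp (W.indicator v) 2 volume)
    {ε : ℝ} {κ β B : ℝ → ℝ} (hT : Truncation ε κ β B)
    (hβ : MemLp (W.indicator fun p => β (v p)) 2 volume) (hΨ : MemLp Ψ 2 volume) :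
    |(∫ p, W.indicator v p * Ψ p) - ∫ p, W.indicator (fun p => β (v p)) p * Ψ p| ≤
      4 * ε * ∫ p, W.indicator (fun _ => (1:ℝ)) p * |Ψ p| := by
  have h1 : MemLp (W.indicator fun _ => (1:ℝ)) 2 volume :=
    memLp_indicator_of_continuousOn hW hWb continuousOn_const
  rw [← integral_sub (integrable_mul_of_memLp hv hΨ) (integrable_mul_of_memLp hβ hΨ),
    ← integral_const_mul]
  refine (abs_integral_le_integral_abs).trans (integral_mono ?_ ?_ fun p => ?_)
  · exact ((integrable_mul_of_memLp hv hΨ).sub (integrable_mul_of_memLp hβ hΨ)).abs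
  · exact (integrable_mul_of_memLp h1 hΨ.abs).const_mul _
  · simp only
    by_cases hp : p ∈ W
    · simp only [indicator_of_mem hp]
      rw [← sub_mul, abs_mul, one_mul]
      exact mul_le_mul_of_nonneg_right (hT.abs_sub_le _) (abs_nonneg _)
    · simp [indicator_of_notMem hp]

/-- The data `ψ`, `G`, `A` satisfy `-div G = A` weakly. -/
structure WeakDiv (U : Set (Eu d)) (ψ : Eu d → ℝ) (G : Eu d → Eu d) (A : Eu d → ℝ) : Prop where
  mem : MemLp ψ 2 volume
  memGrad : MemLp G 2 volume
  memDiv : MemLp A 2 volume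
  zero : ∀ x ∉ U, ψ x = 0
  weak : ∀ w, IsTest U w → ∫ x, (inner ℝ (G x) (gradient w x) : ℝ) = ∫ x, A x * w x

theorem IsTest.weakDiv {h : Eu d → ℝ} (hh : IsTest U h) :
    WeakDiv U h (gradient h) (fun x => -_root_.lapl h x) :=
  ⟨hh.memLp, hh.memLp_gradient, hh.lapl.memLp.neg, fun _ => hh.zero_of_notMem,
    fun _ hw => hh.integral_inner_gradient_eq_lapl hw⟩

theorem WeakEq.weakDiv (hUb : Bornology.IsBounded U) {ψ : Eu d → ℝ}
    {G : Eu d → Eu d} {μ lam : ℝ}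
    (hψ : H10 U ψ G) (hw : WeakEq U μ ψ G (fun x => -lam * ψ x)) :
    WeakDiv U ψ G (fun x => lam * ψ x - (μ * ‖x‖ ^ 2) * ψ x) :=
  ⟨hψ.memf, hψ.memF, (hψ.memf.const_mul lam).sub (memLp_normSq_mul hUb hψ.memf hψ.zerof μ),
    hψ.zerof, fun _ hw' => hw.integral_inner_gradient hUb hψ hw'⟩

theorem memLp_norm_mul (hUb : Bornology.IsBounded U) {ψ : Eu d → ℝ} (hψ : MemLp ψ 2 volume)
    (h0 : ∀ x ∉ U, ψ x = 0) : MemLp (fun x => ‖x‖ * ψ x) 2 volume :=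
  memLp_mul_cont hUb hψ h0 continuous_norm

theorem memLp_sq_norm_mul (hUb : Bornology.IsBounded U) {ψ : Eu d → ℝ} (hψ : MemLp ψ 2 volume)
    (h0 : ∀ x ∉ U, ψ x = 0) : MemLp (fun x => ‖x‖ ^ 2 * ψ x) 2 volume :=
  memLp_mul_cont hUb hψ h0 (continuous_norm.pow 2)

/-- The tested form of the operator. -/
noncomputable def pairDiv (ψ A : Eu d → ℝ) (φ B : Eu e → ℝ) (p : Eu d × Eu e) : ℝ :=
  A p.1 * φ p.2 + ‖p.1‖ ^ 2 * ψ p.1 * B p.2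

theorem memLp_pairDiv (hUb : Bornology.IsBounded U) {ψ A : Eu d → ℝ} {G : Eu d → Eu d}
    {φ B : Eu e → ℝ} {Φ : Eu e → Eu e} (h : WeakDiv U ψ G A) (k : WeakDiv V φ Φ B) :
    MemLp (pairDiv ψ A φ B) 2 volume :=
  (memLp_tensor h.memDiv k.mem : MemLp _ 2 (volume.prod volume)).add
    (memLp_tensor (memLp_sq_norm_mul hUb h.mem h.zero) k.memDiv)

variable {v f : Eu d × Eu e → ℝ} {ψ A ψ' A' : Eu d → ℝ} {G G' : Eu d → Eu d}
  {φ B φ' B' : Eu e → ℝ} {Φ Φ' : Eu e → Eu e}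

theorem PairTest.abs_integral_pairDiv_sub_le {Θ : Eu d × Eu e → ℝ} (hΘ : PairTest U V Θ)
    (hUb : Bornology.IsBounded U)
    (h : WeakDiv U ψ G A) (h' : WeakDiv U ψ' G' A') (k : WeakDiv V φ Φ B) (k' : WeakDiv V φ' Φ' B')
    {M : ℝ} (hM : (∫ p, ‖gradFst Θ p‖ ^ 2) + (∫ p : Eu d × Eu e, ‖‖p.1‖ • gradSnd Θ p‖ ^ 2) ≤ M) :
    |(∫ p, Θ p * pairDiv ψ' A' φ' B' p) - ∫ p, Θ p * pairDiv ψ A φ B p| ≤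
      √M * ((eLpNorm ((fun p : Eu d × Eu e => φ' p.2 • G' p.1) - fun p => φ p.2 • G p.1)
          2 volume).toReal +
        (eLpNorm ((fun p : Eu d × Eu e => (‖p.1‖ * ψ' p.1) • Φ' p.2) -
          fun p => (‖p.1‖ * ψ p.1) • Φ p.2) 2 volume).toReal) := by
  have n1 := memLp_norm_mul hUb h.mem h.zero
  have n1' := memLp_norm_mul hUb h'.mem h'.zero
  have a1 : MemLp (fun p : Eu d × Eu e => φ p.2 • G p.1) 2 volume :=
    memLp_tensor_swap k.mem h.memGrad
  have a1' : MemLp (fun p : Eu d × Eu e => φ' p.2 • G' p.1) 2 volume :=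
    memLp_tensor_swap k'.mem h'.memGrad
  have a2 : MemLp (fun p : Eu d × Eu e => (‖p.1‖ * ψ p.1) • Φ p.2) 2 volume :=
    memLp_tensor n1 k.memGrad
  have a2' : MemLp (fun p : Eu d × Eu e => (‖p.1‖ * ψ' p.1) • Φ' p.2) 2 volume :=
    memLp_tensor n1' k'.memGrad
  have e1 := hΘ.energy_pairing (memLp_sq_norm_mul hUb h.mem h.zero) h.memDiv h.memGrad k.mem
    k.memDiv k.memGrad h.weak k.weak
  have e1' := hΘ.energy_pairing (memLp_sq_norm_mul hUb h'.mem h'.zero) h'.memDiv h'.memGrad k'.mem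
    k'.memDiv k'.memGrad h'.weak k'.weak
  have m1 := hΘ.memLp_gradFst
  have m2 := hΘ.memLp_gradSnd
  have p1 : (0:ℝ) ≤ ∫ p, ‖gradFst Θ p‖ ^ 2 := integral_nonneg fun p => sq_nonneg _
  have p2 : (0:ℝ) ≤ ∫ p : Eu d × Eu e, ‖‖p.1‖ • gradSnd Θ p‖ ^ 2 :=
    integral_nonneg fun p => sq_nonneg _
  have b1 := abs_integral_inner_le m1 (a1'.sub a1) (M := M) (by linarith)
  have b2 := abs_integral_inner_le m2 (a2'.sub a2) (M := M) (by linarith)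
  simp only [Pi.sub_apply, inner_sub_right] at b1 b2
  rw [integral_sub (integrable_inner_of_memLp m1 a1') (integrable_inner_of_memLp m1 a1)] at b1
  rw [integral_sub (integrable_inner_of_memLp m2 a2') (integrable_inner_of_memLp m2 a2)] at b2
  change |(∫ p, Θ p * (A' p.1 * φ' p.2 + ‖p.1‖ ^ 2 * ψ' p.1 * B' p.2)) -
    ∫ p, Θ p * (A p.1 * φ p.2 + ‖p.1‖ ^ 2 * ψ p.1 * B p.2)| ≤ _
  rw [← e1, ← e1', mul_add, add_sub_add_comm]
  exact (abs_add_le _ _).trans (add_le_add b1 b2)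

theorem StationarySolution.abs_integral_pairDiv_sub_le (hU : IsOpen U) (hV : IsOpen V)
    (hUb : Bornology.IsBounded U) (hVb : Bornology.IsBounded V) (hv : StationarySolution U V v f)
    (h : WeakDiv U ψ G A) (h' : WeakDiv U ψ' G' A') (k : WeakDiv V φ Φ B)
    (k' : WeakDiv V φ' Φ' B') :
    |(∫ p, (U ×ˢ V).indicator v p * pairDiv ψ' A' φ' B' p) -
        ∫ p, (U ×ˢ V).indicator v p * pairDiv ψ A φ B p| ≤
      √(∫ p, (U ×ˢ V).indicator (fun p => |v p| * |f p|) p) *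
        ((eLpNorm ((fun p : Eu d × Eu e => φ' p.2 • G' p.1) - fun p => φ p.2 • G p.1)
          2 volume).toReal +
        (eLpNorm ((fun p : Eu d × Eu e => (‖p.1‖ * ψ' p.1) • Φ' p.2) -
          fun p => (‖p.1‖ * ψ p.1) • Φ p.2) 2 volume).toReal) := by
  have hW := hU.prod hV
  have hWb := hUb.prod hVb
  have hvm := memLp_indicator_of_continuousOn hW hWb hv.cont
  have m1 := memLp_pairDiv hUb h k
  have m2 := memLp_pairDiv hUb h' k'
  set D := √(∫ p, (U ×ˢ V).indicator (fun p => |v p| * |f p|) p) *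
        ((eLpNorm ((fun p : Eu d × Eu e => φ' p.2 • G' p.1) - fun p => φ p.2 • G p.1)
          2 volume).toReal +
        (eLpNorm ((fun p : Eu d × Eu e => (‖p.1‖ * ψ' p.1) • Φ' p.2) -
          fun p => (‖p.1‖ * ψ p.1) • Φ p.2) 2 volume).toReal) with hD
  set I1 := ∫ p, (U ×ˢ V).indicator (fun _ => (1:ℝ)) p * |pairDiv ψ A φ B p|
  set I2 := ∫ p, (U ×ˢ V).indicator (fun _ => (1:ℝ)) p * |pairDiv ψ' A' φ' B' p|
  have key : ∀ ε : ℝ, 0 < ε → |(∫ p, (U ×ˢ V).indicator v p * pairDiv ψ' A' φ' B' p) -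
        ∫ p, (U ×ˢ V).indicator v p * pairDiv ψ A φ B p| ≤ D + ε * (4 * (I1 + I2)) := by
    intro ε hε
    obtain ⟨κ, β, B₀, hT⟩ := exists_truncation hε
    have tβ := pairTest_indicator hU hV hUb hVb hv.cont hv.smooth hv.boundary hε hT.smooth_β
      hT.zero_β
    have b0 := tβ.abs_integral_pairDiv_sub_le hUb h h' k k' (hv.energy_le hU hV hUb hVb hε hT)
    have b1 := hT.abs_integral_sub_le hW hWb hvm tβ.memLp m1
    have b2 := hT.abs_integral_sub_le hW hWb hvm tβ.memLp m2
    rw [← hD, abs_le] at b0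
    rw [abs_le] at b1 b2 ⊢
    constructor <;> linarith [b0.1, b0.2, b1.1, b1.2, b2.1, b2.2]
  have lim : Tendsto (fun ε : ℝ => D + ε * (4 * (I1 + I2))) (nhdsWithin 0 (Ioi 0)) (nhds D) := by
    have : Tendsto (fun ε : ℝ => D + ε * (4 * (I1 + I2))) (nhds 0)
        (nhds (D + 0 * (4 * (I1 + I2)))) := Continuous.tendsto (by fun_prop) 0
    rw [zero_mul, add_zero] at this
    exact this.mono_left nhdsWithin_le_nhds
  refine ge_of_tendsto lim ?_
  filter_upwards [self_mem_nhdsWithin] with ε hε using key ε hε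

theorem StationarySolution.integral_mul_eigenfunctions (hU : IsOpen U) (hV : IsOpen V)
    (hUb : Bornology.IsBounded U) (hVb : Bornology.IsBounded V) (hv : StationarySolution U V v f)
    {μ lam : ℝ} (hψ : H10 U ψ G) (wψ : WeakEq U μ ψ G (fun x => -lam * ψ x))
    (hφ : H10 V φ Φ) (wφ : WeakEq V 0 φ Φ (fun x => -μ * φ x)) :
    lam * ∫ p, (U ×ˢ V).indicator v p * (ψ p.1 * φ p.2) =
      -∫ p, (U ×ˢ V).indicator f p * (ψ p.1 * φ p.2) := by
  have hW := hU.prod hV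
  have hWb := hUb.prod hVb
  have hfm := memLp_indicator_of_continuousOn hW hWb hv.cont_rhs
  have k1 := wψ.weakDiv hUb hψ
  have k2 := wφ.weakDiv hVb hφ
  obtain ⟨h, ht, h1, h2⟩ := hψ.approx
  obtain ⟨k, kt, h3, h4⟩ := hφ.approx
  have e0 : ∫ p, (U ×ˢ V).indicator v p *
      pairDiv ψ (fun x => lam * ψ x - (μ * ‖x‖ ^ 2) * ψ x) φ
        (fun x => μ * φ x - (0 * ‖x‖ ^ 2) * φ x) p =
      lam * ∫ p, (U ×ˢ V).indicator v p * (ψ p.1 * φ p.2) := by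
    rw [← integral_const_mul]
    refine integral_congr_ae (ae_of_all _ fun p => ?_)
    simp only [pairDiv]
    ring
  have e1 : ∀ n, ∫ p, (U ×ˢ V).indicator v p * pairDiv (h n) (fun x => -lapl (h n) x) (k n)
      (fun z => -lapl (k n) z) p = -∫ p, (U ×ˢ V).indicator f p * (h n p.1 * k n p.2) := by
    intro n
    rw [← hv.integral_mul_test hU hV (ht n) (kt n), ← integral_neg]
    refine integral_congr_ae (ae_of_all _ fun p => ?_)
    simp only [pairDiv]
    ring
  have b := fun n => hv.abs_integral_pairDiv_sub_le hU hV hUb hVb k1 (ht n).weakDiv k2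
    (kt n).weakDiv
  simp only [e0, e1] at b
  have l1 := tendsto_eLpNorm_tensor_swap (μ := volume) (ν := volume) hφ.memf hψ.memF
    (fun n => (kt n).memLp) (fun n => (ht n).memLp_gradient) h3 h2
  obtain ⟨C, -, hC⟩ := exists_bound_on hUb (continuous_norm (E := Eu d))
  have l2' : Tendsto (fun n => eLpNorm ((fun x => ‖x‖ * h n x) - fun x => ‖x‖ * ψ x) 2 volume)
      atTop (nhds 0) := by
    refine tendsto_eLpNorm_of_le_mul (C := C) h1 fun n => ae_of_all _ fun x => ?_
    simp only [Pi.sub_apply, ← mul_sub, norm_mul]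
    by_cases hx : x ∈ U
    · exact mul_le_mul_of_nonneg_right (hC x hx) (norm_nonneg _)
    · simp [(ht n).zero_of_notMem hx, hψ.zerof x hx]
  have l2 := tendsto_eLpNorm_tensor (μ := volume) (ν := volume)
    (memLp_norm_mul hUb hψ.memf hψ.zerof) hφ.memF
    (fun n => memLp_norm_mul hUb (ht n).memLp fun _ => (ht n).zero_of_notMem)
    (fun n => (kt n).memLp_gradient) l2' h4
  have l3 := tendsto_eLpNorm_tensor (μ := volume) (ν := volume) hψ.memf hφ.memf
    (fun n => (ht n).memLp) (fun n => (kt n).memLp) h1 h3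
  have l4 := tendsto_integral_mul hfm
    (memLp_tensor hψ.memf hφ.memf : MemLp _ 2 (volume.prod volume)) (fun _ => hfm)
    (fun n => memLp_tensor (ht n).memLp (kt n).memLp)
    (tendsto_eLpNorm_const_sub _) l3
  have r1 := ((ENNReal.tendsto_toReal ENNReal.zero_ne_top).comp l1).add
    ((ENNReal.tendsto_toReal ENNReal.zero_ne_top).comp l2)
  have r2 := r1.const_mul (√(∫ p, (U ×ˢ V).indicator (fun p => |v p| * |f p|) p))
  have r3 := (l4.neg.sub_const (lam * ∫ p, (U ×ˢ V).indicator v p * (ψ p.1 * φ p.2))).abs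
  have fin := le_of_tendsto_of_tendsto' r3 r2 b
  simp only [ENNReal.toReal_zero, add_zero, mul_zero] at fin
  have := abs_eq_zero.1 (le_antisymm fin (abs_nonneg _))
  exact (sub_eq_zero.1 this).symm

end Grushin

namespace Grushin

theorem continuousOn_setIntegral_mul {X Y : Type*} [TopologicalSpace X]
    [FirstCountableTopology X] [TopologicalSpace Y] [MeasurableSpace Y] [OpensMeasurableSpace Y]
    {μ : Measure Y} {K : Set X} (hK : IsCompact K) {V : Set Y} (hV : MeasurableSet V)
    (hVc : IsCompact (closure V)) {F : X × Y → ℝ} (hF : ContinuousOn F (K ×ˢ closure V))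
    {m : Y → ℝ} (hm : IntegrableOn m V μ) :
    ContinuousOn (fun q => ∫ z in V, F (q, z) * m z ∂μ) K := by
  obtain ⟨C, hC⟩ := (hK.prod hVc).exists_bound_of_continuousOn hF
  refine continuousOn_of_dominated (bound := fun z => C * ‖m z‖) (fun q hq => ?_) (fun q hq => ?_)
    (hm.norm.const_mul C) ?_
  · have : ContinuousOn (fun z => F (q, z)) V :=
      hF.comp (by fun_prop) fun z hz => ⟨hq, subset_closure hz⟩
    exact (this.aestronglyMeasurable hV).mul hm.1
  · refine ae_restrict_of_forall_mem hV fun z hz => ?_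
    rw [norm_mul]
    exact mul_le_mul_of_nonneg_right (hC _ ⟨hq, subset_closure hz⟩) (norm_nonneg _)
  · refine ae_restrict_of_forall_mem hV fun z hz => ?_
    exact (hF.comp (f := fun q => (q, z)) (by fun_prop) fun q hq => ⟨hq, subset_closure hz⟩).mul
      continuousOn_const

theorem continuousOn_setIntegral {X Y : Type*} [TopologicalSpace X]
    [FirstCountableTopology X] [TopologicalSpace Y] [MeasurableSpace Y] [OpensMeasurableSpace Y]
    {μ : Measure Y} [IsFiniteMeasureOnCompacts μ] {K : Set X} (hK : IsCompact K) {V : Set Y}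
    (hV : MeasurableSet V)
    (hVc : IsCompact (closure V)) {F : X × Y → ℝ} (hF : ContinuousOn F (K ×ˢ closure V)) :
    ContinuousOn (fun q => ∫ z in V, F (q, z) ∂μ) K := by
  have h1 : IntegrableOn (fun _ : Y => (1:ℝ)) V μ :=
    integrableOn_const ((measure_mono subset_closure).trans_lt hVc.measure_lt_top).ne
  simpa using continuousOn_setIntegral_mul hK hV hVc hF h1

theorem setIntegral_intervalIntegral_swap {Y : Type*} [TopologicalSpace Y] [MeasurableSpace Y]
    [OpensMeasurableSpace Y] {μ : Measure Y} [SFinite μ] {V : Set Y} (hV : MeasurableSet V)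
    [OpensMeasurableSpace (ℝ × Y)]
    (hVc : IsCompact (closure V)) {s t : ℝ} (hst : s ≤ t) {F : ℝ × Y → ℝ}
    (hF : ContinuousOn F (Icc s t ×ˢ closure V)) {m : Y → ℝ} (hm : IntegrableOn m V μ) :
    ∫ z in V, (∫ τ in s..t, F (τ, z)) * m z ∂μ = ∫ τ in s..t, ∫ z in V, F (τ, z) * m z ∂μ := by
  obtain ⟨C, hC⟩ := (isCompact_Icc.prod hVc).exists_bound_of_continuousOn hF
  have hsub : Ioc s t ×ˢ V ⊆ Icc s t ×ˢ closure V := prod_mono Ioc_subset_Icc_self subset_closure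
  have h1 : AEStronglyMeasurable F ((volume.restrict (Ioc s t)).prod (μ.restrict V)) := by
    rw [Measure.prod_restrict]
    exact (hF.mono hsub).aestronglyMeasurable (measurableSet_Ioc.prod hV)
  have h2 : Integrable (fun q : ℝ × Y => m q.2) ((volume.restrict (Ioc s t)).prod (μ.restrict V)) :=
    hm.comp_snd _
  have hi : Integrable (fun q : ℝ × Y => F q * m q.2)
      ((volume.restrict (Ioc s t)).prod (μ.restrict V)) := by
    refine h2.bdd_mul (c := C) h1 ?_
    rw [Measure.prod_restrict]
    exact ae_restrict_of_forall_mem (measurableSet_Ioc.prod hV) fun q hq => hC q (hsub hq)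
  simp only [intervalIntegral.integral_of_le hst, ← integral_mul_const]
  exact (integral_integral_swap (f := fun τ z => F (τ, z) * m z) hi).symm

theorem eq_mul_exp_of_integral_eq {c : ℝ → ℝ} {lam T : ℝ} (hc : ContinuousOn c (Icc 0 T))
    (h : ∀ s t, 0 < s → s ≤ t → t < T → lam * ∫ τ in s..t, c τ = -(c t - c s)) :
    ∀ t ∈ Icc (0:ℝ) T, c t = c 0 * Real.exp (-lam * t) := by
  have hd : ∀ t ∈ Ioo 0 T, HasDerivAt c (-lam * c t) t := by
    intro t ht
    have hs : 0 < t / 2 := by linarith [ht.1]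
    have hst : t / 2 < t := by linarith [ht.1]
    have h1 : HasDerivAt (fun u => ∫ τ in (t / 2)..u, c τ) (c t) t := by
      refine intervalIntegral.integral_hasDerivAt_right
        (ContinuousOn.intervalIntegrable_of_Icc hst.le (hc.mono fun τ hτ => ?_))
        ((hc.mono Ioo_subset_Icc_self).stronglyMeasurableAtFilter isOpen_Ioo t ht)
        (hc.continuousAt (Icc_mem_nhds ht.1 ht.2))
      exact ⟨hs.le.trans hτ.1, hτ.2.trans ht.2.le⟩
    have h2 := (h1.const_mul (-lam)).const_add (c (t / 2))
    refine h2.congr_of_eventuallyEq ?_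
    filter_upwards [Ioo_mem_nhds hst ht.2] with u hu
    have := h (t / 2) u hs hu.1.le hu.2
    linarith
  intro t ht
  rcases ht.1.eq_or_lt with rfl | ht0
  · simp
  obtain ⟨u, hu, hu'⟩ := exists_hasDerivAt_eq_slope (fun t => c t * Real.exp (lam * t))
    (fun t => (-lam * c t) * Real.exp (lam * t) + c t * (Real.exp (lam * t) * lam)) ht0
    ((hc.mono (Icc_subset_Icc_right ht.2)).mul (by fun_prop)) fun u hu => by
      have e1 : HasDerivAt (fun t => Real.exp (lam * t)) (Real.exp (lam * u) * lam) u := by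
        simpa using ((hasDerivAt_id u).const_mul lam).exp
      exact (hd u ⟨hu.1, hu.2.trans_le ht.2⟩).mul e1
  rw [show (-lam * c u) * Real.exp (lam * u) + c u * (Real.exp (lam * u) * lam) = 0 by ring,
    eq_comm, div_eq_zero_iff, or_iff_left (by linarith)] at hu'
  simp only [mul_zero, Real.exp_zero, mul_one] at hu'
  rw [← sub_eq_zero.1 hu', mul_assoc, ← Real.exp_add]
  simp

end Grushin

namespace Grushin

variable {d e : ℕ}

theorem integral_indicator_mul {α : Type*} [MeasurableSpace α] {μ : Measure α} {W : Set α}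
    (hW : MeasurableSet W) (v m : α → ℝ) :
    ∫ p, W.indicator v p * m p ∂μ = ∫ p in W, v p * m p ∂μ := by
  rw [← integral_indicator hW]
  congr 1; ext p
  by_cases hp : p ∈ W <;> simp [hp]

theorem integrableOn_of_memLp_two {α : Type*} [MeasurableSpace α] {μ : Measure α} {W : Set α}
    (hW : μ W < ⊤) {m : α → ℝ} (hm : MemLp m 2 μ) : IntegrableOn m W μ := by
  have : IsFiniteMeasure (μ.restrict W) := ⟨by rwa [Measure.restrict_apply_univ]⟩
  exact (hm.restrict W).integrable one_le_two

/-- The partial Fourier coefficient of `w` against `φ` in the second variable, cut off to the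
ball of radius `R`. -/
noncomputable def fiberCoeff (R : ℝ) (V : Set (Eu e)) (φ : Eu e → ℝ) (w : Eu d → Eu e → ℝ) :
    Eu d → ℝ :=
  (ball 0 R).indicator fun x => ∫ z in V, w x z * φ z

theorem fiberCoeff_of_notMem {R : ℝ} {V : Set (Eu e)} {φ : Eu e → ℝ} {w : Eu d → Eu e → ℝ}
    {x : Eu d} (hx : x ∉ ball 0 R) : fiberCoeff R V φ w x = 0 := indicator_of_notMem hx _

theorem fiberCoeff_of_mem {R : ℝ} {V : Set (Eu e)} {φ : Eu e → ℝ} {w : Eu d → Eu e → ℝ}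
    {x : Eu d} (hx : x ∈ ball 0 R) : fiberCoeff R V φ w x = ∫ z in V, w x z * φ z :=
  indicator_of_mem hx _

theorem continuousOn_slab {R T : ℝ} {V : Set (Eu e)} {y : ℝ → Eu d → Eu e → ℝ}
    (hy : IsGrushinSolution d e R T V y) :
    ContinuousOn (fun p : (ℝ × Eu d) × Eu e => y p.1.1 p.1.2 p.2)
      ((Icc 0 T ×ˢ closure (ball 0 R)) ×ˢ closure V) := by
  refine hy.continuousOn.comp (f := fun p : (ℝ × Eu d) × Eu e => (p.1.1, (p.1.2, p.2)))
    (by fun_prop) fun p hp => ⟨hp.1.1, ?_⟩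
  rw [closure_prod_eq]
  exact ⟨hp.1.2, hp.2⟩

theorem isCompact_slab (R T : ℝ) : IsCompact (Icc 0 T ×ˢ closure (ball (0 : Eu d) R)) :=
  isCompact_Icc.prod isBounded_ball.isCompact_closure

theorem continuousOn_fiber {R T : ℝ} {V : Set (Eu e)} (hV : IsOpen V)
    (hVb : Bornology.IsBounded V) {y : ℝ → Eu d → Eu e → ℝ} (hy : IsGrushinSolution d e R T V y)
    {φ : Eu e → ℝ} (hφ : MemLp φ 2 volume) :
    ContinuousOn (fun q : ℝ × Eu d => ∫ z in V, y q.1 q.2 z * φ z)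
      (Icc 0 T ×ˢ closure (ball 0 R)) :=
  continuousOn_setIntegral_mul (isCompact_slab R T) hV.measurableSet hVb.isCompact_closure
    (F := fun p : (ℝ × Eu d) × Eu e => y p.1.1 p.1.2 p.2) (continuousOn_slab hy)
    (integrableOn_of_memLp_two hVb.measure_lt_top hφ)

theorem continuousOn_fiber_slice {R T t : ℝ} (ht : t ∈ Icc 0 T) {V : Set (Eu e)} (hV : IsOpen V)
    (hVb : Bornology.IsBounded V) {y : ℝ → Eu d → Eu e → ℝ} (hy : IsGrushinSolution d e R T V y)
    {φ : Eu e → ℝ} (hφ : MemLp φ 2 volume) :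
    ContinuousOn (fun x : Eu d => ∫ z in V, y t x z * φ z) (closure (ball 0 R)) :=
  (continuousOn_fiber hV hVb hy hφ).comp (f := fun x : Eu d => (t, x)) (by fun_prop)
    fun _ hx => ⟨ht, hx⟩

theorem memLp_fiberCoeff {R T t : ℝ} (ht : t ∈ Icc 0 T) {V : Set (Eu e)} (hV : IsOpen V)
    (hVb : Bornology.IsBounded V) {y : ℝ → Eu d → Eu e → ℝ} (hy : IsGrushinSolution d e R T V y)
    {φ : Eu e → ℝ} (hφ : MemLp φ 2 volume) :
    MemLp (fiberCoeff R V φ (y t)) 2 volume := by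
  have h := continuousOn_fiber_slice ht hV hVb hy hφ
  obtain ⟨C, hC⟩ := isBounded_ball.isCompact_closure.exists_bound_of_continuousOn h
  unfold fiberCoeff
  rw [memLp_indicator_iff_restrict measurableSet_ball]
  have : IsFiniteMeasure ((volume : Measure (Eu d)).restrict (ball 0 R)) :=
    ⟨by rw [Measure.restrict_apply_univ]; exact measure_ball_lt_top⟩
  exact MemLp.of_bound ((h.mono subset_closure).aestronglyMeasurable measurableSet_ball) C
    (ae_restrict_of_forall_mem measurableSet_ball fun p hp => hC p (subset_closure hp))

theorem memLp_tensor_real {ψ : Eu d → ℝ} {φ : Eu e → ℝ} (hψ : MemLp ψ 2 volume)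
    (hφ : MemLp φ 2 volume) :
    MemLp (fun p : Eu d × Eu e => ψ p.1 * φ p.2) 2 volume :=
  memLp_tensor hψ hφ

theorem ip_fiberCoeff {R T t : ℝ} (ht : t ∈ Icc 0 T) {V : Set (Eu e)} (hV : IsOpen V)
    (hVb : Bornology.IsBounded V) {y : ℝ → Eu d → Eu e → ℝ} (hy : IsGrushinSolution d e R T V y)
    {ψ : Eu d → ℝ} {φ : Eu e → ℝ} (hψ : MemLp ψ 2 volume) (hφ : MemLp φ 2 volume) :
    ip (fiberCoeff R V φ (y t)) ψ =
      ∫ p in ball (0 : Eu d) R ×ˢ V, y t p.1 p.2 * (ψ p.1 * φ p.2) := by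
  have hWb : Bornology.IsBounded (ball (0 : Eu d) R ×ˢ V) := isBounded_ball.prod hVb
  have hm := integrableOn_of_memLp_two hWb.measure_lt_top (memLp_tensor_real hψ hφ)
  have hcont : ContinuousOn (fun p : Eu d × Eu e => y t p.1 p.2)
      (closure (ball (0 : Eu d) R ×ˢ V)) :=
    hy.continuousOn.comp (f := fun p : Eu d × Eu e => (t, p)) (by fun_prop) fun p hp => ⟨ht, hp⟩
  obtain ⟨C, hC⟩ := hWb.isCompact_closure.exists_bound_of_continuousOn hcont
  have hW := (isOpen_ball (x := (0 : Eu d)) (ε := R)).prod hV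
  have hi : IntegrableOn (fun p : Eu d × Eu e => y t p.1 p.2 * (ψ p.1 * φ p.2))
      (ball (0 : Eu d) R ×ˢ V) volume :=
    Integrable.bdd_mul (c := C) hm
      ((hcont.mono subset_closure).aestronglyMeasurable hW.measurableSet)
      (ae_restrict_of_forall_mem hW.measurableSet fun p hp => hC p (subset_closure hp))
  rw [Measure.volume_eq_prod] at hi ⊢
  rw [setIntegral_prod _ hi]
  unfold ip fiberCoeff
  rw [integral_indicator_mul measurableSet_ball]
  refine integral_congr_ae (Eventually.of_forall fun x => ?_)
  simp only
  rw [← integral_mul_const]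
  congr 1; ext z; ring

/-- Each Fourier coefficient of a Grushin solution decays exponentially. -/
theorem ip_fiberCoeff_eq_exp {R T : ℝ} {V : Set (Eu e)} (hV : IsOpen V)
    (hVb : Bornology.IsBounded V) {y : ℝ → Eu d → Eu e → ℝ} (hy : IsGrushinSolution d e R T V y)
    {μ lam : ℝ} {ψ : Eu d → ℝ} {G : Eu d → Eu d} {φ : Eu e → ℝ} {Φ : Eu e → Eu e}
    (hψ : H10 (ball 0 R) ψ G) (wψ : WeakEq (ball 0 R) μ ψ G (fun x => -lam * ψ x))
    (hφ : H10 V φ Φ) (wφ : WeakEq V 0 φ Φ (fun x => -μ * φ x)) {t : ℝ} (ht : t ∈ Icc 0 T) :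
    ip (fiberCoeff R V φ (y t)) ψ =
      ip (fiberCoeff R V φ (y 0)) ψ * Real.exp (-lam * t) := by
  have hWb : Bornology.IsBounded (ball (0 : Eu d) R ×ˢ V) := isBounded_ball.prod hVb
  have hW := (isOpen_ball (x := (0 : Eu d)) (ε := R)).prod hV
  have hm := integrableOn_of_memLp_two hWb.measure_lt_top (memLp_tensor_real hψ.memf hφ.memf)
  have hc := continuousOn_setIntegral_mul isCompact_Icc hW.measurableSet
    hWb.isCompact_closure (F := fun p : ℝ × (Eu d × Eu e) => y p.1 p.2.1 p.2.2)
    hy.continuousOn hm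
  have h0 : (0:ℝ) ∈ Icc 0 T := ⟨le_rfl, ht.1.trans ht.2⟩
  rw [ip_fiberCoeff ht hV hVb hy hψ.memf hφ.memf, ip_fiberCoeff h0 hV hVb hy hψ.memf hφ.memf]
  refine eq_mul_exp_of_integral_eq hc (fun s t hs hst htT => ?_) t ht
  have hS := hy.stationary hV hVb hs hst htT
  have key := hS.integral_mul_eigenfunctions isOpen_ball hV isBounded_ball hVb hψ wψ hφ wφ
  rw [integral_indicator_mul hW.measurableSet, integral_indicator_mul hW.measurableSet] at key
  have hsub : Icc s t ⊆ Icc 0 T := Icc_subset_Icc hs.le htT.le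
  have hsw := setIntegral_intervalIntegral_swap hW.measurableSet hWb.isCompact_closure hst
    (F := fun p : ℝ × (Eu d × Eu e) => y p.1 p.2.1 p.2.2)
    (hy.continuousOn.mono (prod_mono hsub le_rfl)) hm
  simp only at hsw
  rw [hsw] at key
  rw [key]
  have hi : ∀ τ ∈ Icc 0 T, IntegrableOn (fun p : Eu d × Eu e => y τ p.1 p.2 * (ψ p.1 * φ p.2))
      (ball (0 : Eu d) R ×ˢ V) volume := by
    intro τ hτ
    have hcont : ContinuousOn (fun p : Eu d × Eu e => y τ p.1 p.2)
        (closure (ball (0 : Eu d) R ×ˢ V)) :=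
      hy.continuousOn.comp (f := fun p : Eu d × Eu e => (τ, p)) (by fun_prop)
        fun p hp => ⟨hτ, hp⟩
    obtain ⟨C, hC⟩ := hWb.isCompact_closure.exists_bound_of_continuousOn hcont
    exact Integrable.bdd_mul (c := C) hm
      ((hcont.mono subset_closure).aestronglyMeasurable hW.measurableSet)
      (ae_restrict_of_forall_mem hW.measurableSet fun p hp => hC p (subset_closure hp))
  rw [← integral_sub (hi t (hsub ⟨hst, le_rfl⟩)) (hi s (hsub ⟨le_rfl, hst⟩))]
  simp only [sub_mul]

end Grushin

namespace Grushin

variable {d e : ℕ}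

theorem Eigenbasis.modes {R ν : ℝ} {ι : Type} {ψ : ι → Eu d → ℝ} {G : ι → Eu d → Eu d}
    {lam : ι → ℝ} (B : Eigenbasis (ball 0 R) ν ψ G lam) (J : Finset ι) : Modes R ν J ψ G lam :=
  ⟨fun i _ => B.h10 i, fun i _ => B.weak i, fun i _ => B.unit i, fun i _ j _ => B.orth i j⟩

/-- Pythagoras for a function whose coefficients agree with those of a flow. -/
theorem Modes.ip_sub_flow {R ν : ℝ} {ι : Type*} {J : Finset ι} {ψ : ι → Eu d → ℝ}
    {G : ι → Eu d → Eu d} {lam : ι → ℝ} (H : Modes R ν J ψ G lam) {f : Eu d → ℝ}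
    (hf : MemLp f 2 volume) {c : ι → ℝ} {t : ℝ}
    (hc : ∀ i ∈ J, ip f (ψ i) = c i * Real.exp (-lam i * t)) :
    ip (fun x => f x - flow J ψ lam c 0 t x) (fun x => f x - flow J ψ lam c 0 t x) =
      ip f f - ∑ i ∈ J, (c i * Real.exp (-lam i * t)) ^ 2 := by
  have hw := (H.h10_flow c 0 t).memf
  have hfw : ip f (flow J ψ lam c 0 t) = ∑ i ∈ J, (c i * Real.exp (-lam i * t)) ^ 2 := by
    unfold ip flow
    simp only [Finset.mul_sum, pow_zero, mul_one]
    rw [integral_finsetSum]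
    · refine Finset.sum_congr rfl fun i hi => ?_
      have := hc i hi
      unfold ip at this
      rw [sq, ← this, ← integral_const_mul, this]
      congr 1; ext x; ring
    · intro i hi
      refine ((integrable_mul_of_memLp hf (H.h10 i hi).memf).const_mul
        (c i * Real.exp (-lam i * t))).congr (Eventually.of_forall fun x => ?_)
      simp only; ring
  have hs : MemLp (fun x => f x - flow J ψ lam c 0 t x) 2 volume := hf.sub hw
  rw [ip_sub_left hf hw hs, ip_sub_right hf hw hf, ip_sub_right hf hw hw, H.ip_flow,
    ip_comm (flow J ψ lam c 0 t) f, hfw]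
  ring

theorem setIntegral_sq_le_two_mul {f g : Eu d → ℝ} (hf : MemLp f 2 volume)
    (hg : MemLp g 2 volume) (A : Set (Eu d)) :
    ∫ x in A, g x ^ 2 ≤ 2 * (∫ x in A, f x ^ 2) +
      2 * ip (fun x => f x - g x) (fun x => f x - g x) := by
  have hs : MemLp (fun x => f x - g x) 2 volume := hf.sub hg
  have h1 : ∫ x in A, (f x - g x) ^ 2 ≤ ip (fun x => f x - g x) (fun x => f x - g x) := by
    rw [ip_self_eq]
    exact setIntegral_le_integral (integrable_sq hs) (Eventually.of_forall fun x => sq_nonneg _)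
  have i1 := (integrable_sq hf).integrableOn (s := A)
  have i2 := (integrable_sq hs).integrableOn (s := A)
  have h2 : ∫ x in A, g x ^ 2 ≤ ∫ x in A, (2 * f x ^ 2 + 2 * (f x - g x) ^ 2) := by
    refine integral_mono (integrable_sq hg).integrableOn ((i1.const_mul 2).add (i2.const_mul 2))
      fun x => ?_
    simp only
    nlinarith [sq_nonneg (f x - (f x - g x) - 2 * (f x - g x)), sq_nonneg (2 * f x - g x)]
  rw [integral_add (i1.const_mul 2) (i2.const_mul 2), integral_const_mul,
    integral_const_mul] at h2
  linarith

theorem continuousOn_setIntegral_fiberCoeff_sq {R T : ℝ} {V : Set (Eu e)} (hV : IsOpen V)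
    (hVb : Bornology.IsBounded V) {y : ℝ → Eu d → Eu e → ℝ} (hy : IsGrushinSolution d e R T V y)
    {φ : Eu e → ℝ} (hφ : MemLp φ 2 volume) {A : Set (Eu d)} (hA : IsOpen A) (hAR : A ⊆ ball 0 R) :
    ContinuousOn (fun t => ∫ x in A, fiberCoeff R V φ (y t) x ^ 2) (Icc 0 T) := by
  have hAb : Bornology.IsBounded A := isBounded_ball.subset hAR
  have h := continuousOn_setIntegral (μ := volume) isCompact_Icc hA.measurableSet
    hAb.isCompact_closure (F := fun q : ℝ × Eu d => (∫ z in V, y q.1 q.2 z * φ z) ^ 2)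
    (((continuousOn_fiber hV hVb hy hφ).mono
      (prod_mono le_rfl (closure_mono hAR))).pow 2)
  refine h.congr fun t _ => setIntegral_congr_fun hA.measurableSet fun x hx => ?_
  simp only [fiberCoeff_of_mem (hAR hx)]

/-- Observability of each Fourier mode in the degenerate variable, uniformly in the mode. -/
theorem fiber_observability (hd : 2 ≤ d) {R : ℝ} {x₀ : Eu d} (h0 : 0 < ‖x₀‖) (hxR : ‖x₀‖ < R)
    {r T : ℝ} (hr : 0 < r) (hrR : ball x₀ r ⊆ ball 0 R) (hT : ‖x₀‖ ^ 2 < 2 * d * T) :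
    ∃ K : ℝ, 0 < K ∧ ∀ {V : Set (Eu e)}, IsOpen V → Bornology.IsBounded V →
      ∀ {y : ℝ → Eu d → Eu e → ℝ}, IsGrushinSolution d e R T V y →
      ∀ {μ : ℝ} {φ : Eu e → ℝ} {Φ : Eu e → Eu e}, 0 ≤ μ → H10 V φ Φ →
      WeakEq V 0 φ Φ (fun x => -μ * φ x) →
      ip (fiberCoeff R V φ (y T)) (fiberCoeff R V φ (y T)) ≤
        K * ∫ t in (0:ℝ)..T, ∫ x in ball x₀ r, fiberCoeff R V φ (y t) x ^ 2 := by
  obtain ⟨K, hK, hobs⟩ := Modes.observability hd h0 hxR hr hT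
  have hT0 : 0 < T := by
    by_contra! h
    have : 2 * (d:ℝ) * T ≤ 0 := mul_nonpos_of_nonneg_of_nonpos (by positivity) h
    nlinarith
  refine ⟨K * 2, by positivity, fun {V} hV hVb {y} hy {μ φ Φ} hμ hφ wφ => ?_⟩
  obtain ⟨ι, ψ, G, lam, B⟩ := exists_eigenbasis (isBounded_ball (x := (0 : Eu d)) (r := R))
    isOpen_ball (Real.sqrt μ)
  have hn : Real.sqrt μ ^ 2 = μ := Real.sq_sqrt hμ
  set u : ℝ → Eu d → ℝ := fun t => fiberCoeff R V φ (y t) with hu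
  have hum : ∀ t ∈ Icc 0 T, MemLp (u t) 2 volume := fun t ht =>
    memLp_fiberCoeff ht hV hVb hy hφ.memf
  have h0T : (0:ℝ) ∈ Icc 0 T := ⟨le_rfl, hT0.le⟩
  have hTT : T ∈ Icc 0 T := ⟨hT0.le, le_rfl⟩
  set c : ι → ℝ := fun i => ip (u 0) (ψ i) with hcdef
  have hc : ∀ t ∈ Icc 0 T, ∀ i, ip (u t) (ψ i) = c i * Real.exp (-lam i * t) := fun t ht i =>
    ip_fiberCoeff_eq_exp hV hVb hy (B.h10 i) (hn ▸ B.weak i) hφ wφ ht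
  have hP : ∀ t ∈ Icc 0 T, HasSum (fun i => (c i * Real.exp (-lam i * t)) ^ 2)
      (ip (u t) (u t)) := fun t ht => by
    have := B.parseval (u t) (hum t ht) fun x hx => fiberCoeff_of_notMem hx
    simpa only [hc t ht] using this
  have hP0 : HasSum (fun i => c i ^ 2) (ip (u 0) (u 0)) := by simpa using hP 0 h0T
  set δ : Finset ι → ℝ := fun J => ip (u 0) (u 0) - ∑ i ∈ J, c i ^ 2 with hδ
  have hδ0 : Tendsto δ atTop (nhds 0) := by
    have h := (tendsto_const_nhds (x := ip (u 0) (u 0))).sub hP0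
    simpa only [sub_self, SummationFilter.unconditional_filter] using h
  have hrem : ∀ J : Finset ι, ∀ t ∈ Icc 0 T,
      ip (u t) (u t) - ∑ i ∈ J, (c i * Real.exp (-lam i * t)) ^ 2 ≤ δ J := by
    intro J t ht
    have h := sum_le_hasSum J (fun i _ => ?_) (hP0.sub (hP t ht))
    · rw [Finset.sum_sub_distrib] at h
      simp only [hδ]
      linarith
    · have h1 : Real.exp (-lam i * t) ≤ 1 :=
        Real.exp_le_one_iff.2 (by nlinarith [B.nonneg i, ht.1, mul_nonneg (B.nonneg i) ht.1])
      have h2 : Real.exp (-lam i * t) ^ 2 ≤ 1 := pow_le_one₀ (Real.exp_pos _).le h1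
      rw [mul_pow]
      nlinarith [sq_nonneg (c i)]
  have hcu := continuousOn_setIntegral_fiberCoeff_sq hV hVb hy hφ.memf isOpen_ball hrR
  have hui : IntervalIntegrable (fun t => ∫ x in ball x₀ r, u t x ^ 2) volume 0 T :=
    hcu.intervalIntegrable_of_Icc hT0.le
  have main : ∀ J : Finset ι, ip (u T) (u T) ≤
      K * (2 * (∫ t in (0:ℝ)..T, ∫ x in ball x₀ r, u t x ^ 2) + 2 * δ J * T) + δ J := by
    intro J
    have H := B.modes J
    have h1 := hobs (c := c) (Real.sqrt_nonneg μ) H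
    have h2 := hrem J T hTT
    unfold Modes.nE at h1
    rw [H.ip_flow] at h1
    have h3 : ∫ t in (0:ℝ)..T, Modes.obs J ψ lam c x₀ r t ≤
        ∫ t in (0:ℝ)..T, (2 * (∫ x in ball x₀ r, u t x ^ 2) + 2 * δ J) := by
      refine intervalIntegral.integral_mono_on hT0.le
        ((H.continuous_obs x₀ r).intervalIntegrable _ _)
        ((hui.const_mul 2).add intervalIntegrable_const) fun t ht => ?_
      have h4 := setIntegral_sq_le_two_mul (hum t ht) (H.h10_flow c 0 t).memf (ball x₀ r)
      rw [H.ip_sub_flow (hum t ht) fun i _ => hc t ht i] at h4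
      have := hrem J t ht
      unfold Modes.obs
      linarith
    rw [intervalIntegral.integral_add (hui.const_mul 2) intervalIntegrable_const,
      intervalIntegral.integral_const_mul, intervalIntegral.integral_const, sub_zero,
      smul_eq_mul] at h3
    have h5 := mul_le_mul_of_nonneg_left h3 hK.le
    linarith [h5, mul_comm T (2 * δ J), congrArg (K * ·) (mul_comm T (2 * δ J))]
  have hlim : Tendsto (fun J => K * (2 * (∫ t in (0:ℝ)..T, ∫ x in ball x₀ r, u t x ^ 2)
      + 2 * δ J * T) + δ J) atTop (nhds (K * (2 * (∫ t in (0:ℝ)..T, ∫ x in ball x₀ r, u t x ^ 2)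
      + 2 * 0 * T) + 0)) :=
    ((((hδ0.const_mul 2).mul_const T).const_add _).const_mul K).add hδ0
  have := ge_of_tendsto' hlim main
  simp only [mul_zero, zero_mul, add_zero] at this
  linarith

end Grushin

namespace Grushin

variable {d e : ℕ}

theorem exists_ne_zero_mem_of_sInf_lt (hd : 2 ≤ d) {ω : Set (Eu d)} (hωo : IsOpen ω)
    (hωne : ω.Nonempty) {T : ℝ}
    (hT : sInf ((fun x : Eu d => ‖x‖ ^ 2) '' ω) / (2 * d) < T) :
    0 < T ∧ ∃ x ∈ ω, 0 < ‖x‖ ∧ ‖x‖ ^ 2 < 2 * d * T := by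
  have hd0 : (0:ℝ) < 2 * d := by
    have : (2:ℝ) ≤ d := by exact_mod_cast hd
    linarith
  have hT0 : 0 < T := lt_of_le_of_lt (div_nonneg (Real.sInf_nonneg (by
    rintro _ ⟨x, _, rfl⟩; positivity)) hd0.le) hT
  rw [div_lt_iff₀ hd0] at hT
  obtain ⟨_, ⟨x, hx, rfl⟩, hlt⟩ := exists_lt_of_csInf_lt (hωne.image _) hT
  have : Nonempty (Fin d) := ⟨⟨0, by omega⟩⟩
  have : NeBot (nhdsWithin (0 : Eu d) {0}ᶜ) := Module.punctured_nhds_neBot ℝ (Eu d) 0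
  have hO : IsOpen (ω ∩ {x : Eu d | ‖x‖ ^ 2 < 2 * d * T}) :=
    hωo.inter (isOpen_lt (by fun_prop) continuous_const)
  have hxO : x ∈ {x : Eu d | ‖x‖ ^ 2 < 2 * d * T} := by
    simp only [mem_ofPred_eq] at hlt ⊢
    linarith
  obtain ⟨z, ⟨hz, hz2⟩, hz0⟩ := (dense_compl_singleton (0 : Eu d)).inter_open_nonempty _ hO
    ⟨x, hx, hxO⟩
  exact ⟨hT0, z, hz, norm_pos_iff.2 hz0, hz2⟩

/-- Parseval in the degenerate variable. -/
theorem hasSum_fiberCoeff_sq {R T t : ℝ} (ht : t ∈ Icc 0 T) {V : Set (Eu e)} (hV : IsOpen V)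
    (hVb : Bornology.IsBounded V) {y : ℝ → Eu d → Eu e → ℝ} (hy : IsGrushinSolution d e R T V y)
    {ν : ℝ} {ι : Type} {φ : ι → Eu e → ℝ} {Φ : ι → Eu e → Eu e} {μ : ι → ℝ}
    (B : Eigenbasis V ν φ Φ μ) {x : Eu d} (hx : x ∈ ball 0 R) :
    HasSum (fun k => fiberCoeff R V (φ k) (y t) x ^ 2) (∫ z in V, y t x z ^ 2) := by
  have hcont : ContinuousOn (y t x) (closure V) :=
    (continuousOn_slab hy).comp (f := fun z : Eu e => ((t, x), z)) (by fun_prop)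
      fun z hz => ⟨⟨ht, subset_closure hx⟩, hz⟩
  obtain ⟨C, hC⟩ := hVb.isCompact_closure.exists_bound_of_continuousOn hcont
  have hm : MemLp (V.indicator (y t x)) 2 volume := by
    rw [memLp_indicator_iff_restrict hV.measurableSet]
    have : IsFiniteMeasure ((volume : Measure (Eu e)).restrict V) :=
      ⟨by rw [Measure.restrict_apply_univ]; exact hVb.measure_lt_top⟩
    exact MemLp.of_bound ((hcont.mono subset_closure).aestronglyMeasurable hV.measurableSet) C
      (ae_restrict_of_forall_mem hV.measurableSet fun p hp => hC p (subset_closure hp))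
  have h := B.parseval _ hm fun z hz => indicator_of_notMem hz _
  have e1 : ip (V.indicator (y t x)) (V.indicator (y t x)) = ∫ z in V, y t x z ^ 2 := by
    unfold ip
    rw [integral_indicator_mul hV.measurableSet]
    refine setIntegral_congr_fun hV.measurableSet fun z hz => ?_
    simp only [indicator_of_mem hz]
    ring
  have e2 : ∀ k, ip (V.indicator (y t x)) (φ k) = fiberCoeff R V (φ k) (y t) x := fun k => by
    rw [fiberCoeff_of_mem hx]
    exact integral_indicator_mul hV.measurableSet _ _
  simpa only [e1, e2] using h

theorem continuousOn_energy {R T : ℝ} {V : Set (Eu e)} (hV : IsOpen V)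
    (hVb : Bornology.IsBounded V) {y : ℝ → Eu d → Eu e → ℝ} (hy : IsGrushinSolution d e R T V y) :
    ContinuousOn (fun q : ℝ × Eu d => ∫ z in V, y q.1 q.2 z ^ 2)
      (Icc 0 T ×ˢ closure (ball 0 R)) :=
  continuousOn_setIntegral (isCompact_slab R T) hV.measurableSet hVb.isCompact_closure
    (F := fun p : (ℝ × Eu d) × Eu e => y p.1.1 p.1.2 p.2 ^ 2) ((continuousOn_slab hy).pow 2)

theorem integrableOn_energy {R T t : ℝ} (ht : t ∈ Icc 0 T) {V : Set (Eu e)} (hV : IsOpen V)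
    (hVb : Bornology.IsBounded V) {y : ℝ → Eu d → Eu e → ℝ} (hy : IsGrushinSolution d e R T V y) :
    IntegrableOn (fun x : Eu d => ∫ z in V, y t x z ^ 2) (ball 0 R) := by
  have h : ContinuousOn (fun x : Eu d => ∫ z in V, y t x z ^ 2) (closure (ball 0 R)) :=
    (continuousOn_energy hV hVb hy).comp (f := fun x : Eu d => (t, x)) (by fun_prop)
      fun _ hx => ⟨ht, hx⟩
  exact (h.integrableOn_compact isBounded_ball.isCompact_closure).mono_set subset_closure

theorem intervalIntegrable_energy {R T : ℝ} (hT : 0 ≤ T) {V : Set (Eu e)} (hV : IsOpen V)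
    (hVb : Bornology.IsBounded V) {y : ℝ → Eu d → Eu e → ℝ} (hy : IsGrushinSolution d e R T V y)
    {A : Set (Eu d)} (hA : IsOpen A) (hAR : A ⊆ ball 0 R) :
    IntervalIntegrable (fun t => ∫ x in A, ∫ z in V, y t x z ^ 2) volume 0 T := by
  have h := continuousOn_setIntegral (μ := volume) isCompact_Icc hA.measurableSet
    (isBounded_ball.subset hAR).isCompact_closure
    (F := fun q : ℝ × Eu d => ∫ z in V, y q.1 q.2 z ^ 2)
    ((continuousOn_energy hV hVb hy).mono (prod_mono le_rfl (closure_mono hAR)))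
  exact h.intervalIntegrable_of_Icc hT

theorem sum_integral_fiberCoeff_sq_le {R T t : ℝ} (ht : t ∈ Icc 0 T) {V : Set (Eu e)}
    (hV : IsOpen V) (hVb : Bornology.IsBounded V) {y : ℝ → Eu d → Eu e → ℝ}
    (hy : IsGrushinSolution d e R T V y)
    {ν : ℝ} {ι : Type} {φ : ι → Eu e → ℝ} {Φ : ι → Eu e → Eu e} {μ : ι → ℝ}
    (B : Eigenbasis V ν φ Φ μ) {A : Set (Eu d)} (hA : IsOpen A) (hAR : A ⊆ ball 0 R)
    (F : Finset ι) :
    ∑ k ∈ F, ∫ x in A, fiberCoeff R V (φ k) (y t) x ^ 2 ≤ ∫ x in A, ∫ z in V, y t x z ^ 2 := by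
  have hi : ∀ k ∈ F, IntegrableOn (fun x => fiberCoeff R V (φ k) (y t) x ^ 2) A := fun k _ =>
    (integrable_sq (memLp_fiberCoeff ht hV hVb hy (B.h10 k).memf)).integrableOn
  rw [← integral_finsetSum F hi]
  refine setIntegral_mono_on (integrable_finsetSum F hi)
    ((integrableOn_energy ht hV hVb hy).mono_set hAR) hA.measurableSet fun x hx => ?_
  exact sum_le_hasSum F (fun k _ => sq_nonneg _) (hasSum_fiberCoeff_sq ht hV hVb hy B (hAR hx))

theorem integral_energy_le_of_sum_le {R T t M : ℝ} (ht : t ∈ Icc 0 T) {V : Set (Eu e)}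
    (hV : IsOpen V) (hVb : Bornology.IsBounded V) {y : ℝ → Eu d → Eu e → ℝ}
    (hy : IsGrushinSolution d e R T V y)
    {ν : ℝ} {ι : Type} {φ : ι → Eu e → ℝ} {Φ : ι → Eu e → Eu e} {μ : ι → ℝ}
    (B : Eigenbasis V ν φ Φ μ)
    (hM : ∀ F : Finset ι, ∑ k ∈ F,
      ip (fiberCoeff R V (φ k) (y t)) (fiberCoeff R V (φ k) (y t)) ≤ M) :
    ∫ x in ball (0 : Eu d) R, ∫ z in V, y t x z ^ 2 ≤ M := by
  have : Countable ι := B.countable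
  have hi : ∀ k, Integrable (fun x => fiberCoeff R V (φ k) (y t) x ^ 2)
      (volume.restrict (ball 0 R)) := fun k =>
    (integrable_sq (memLp_fiberCoeff ht hV hVb hy (B.h10 k).memf)).integrableOn
  have hle : ∀ k, ∫ x in ball 0 R, fiberCoeff R V (φ k) (y t) x ^ 2 ≤
      ip (fiberCoeff R V (φ k) (y t)) (fiberCoeff R V (φ k) (y t)) := fun k => by
    rw [ip_self_eq]
    exact setIntegral_le_integral (integrable_sq (memLp_fiberCoeff ht hV hVb hy (B.h10 k).memf))
      (Eventually.of_forall fun x => sq_nonneg _)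
  have hM' : ∀ F : Finset ι, ∑ k ∈ F, ∫ x in ball 0 R, fiberCoeff R V (φ k) (y t) x ^ 2 ≤ M :=
    fun F => (Finset.sum_le_sum fun k _ => hle k).trans (hM F)
  have hs : Summable fun k => ∫ x in ball 0 R, ‖fiberCoeff R V (φ k) (y t) x ^ 2‖ := by
    simp only [norm_pow, Real.norm_eq_abs, sq_abs]
    exact summable_of_sum_le (fun k => integral_nonneg fun x => sq_nonneg _) hM'
  have h := hasSum_integral_of_summable_integral_norm hi hs
  have e1 : ∫ x in ball 0 R, ∑' k, fiberCoeff R V (φ k) (y t) x ^ 2 =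
      ∫ x in ball (0 : Eu d) R, ∫ z in V, y t x z ^ 2 :=
    setIntegral_congr_fun measurableSet_ball fun x hx =>
      (hasSum_fiberCoeff_sq ht hV hVb hy B hx).tsum_eq
  rw [e1] at h
  exact hasSum_le_of_sum_le h hM'

end Grushin

/-- If `ω ⊆ B_R` is nonempty and open and `T* = (inf_{x ∈ ω} ‖x‖²)/(2d)`,
then for every `T > T*` there is a constant `K > 0` such that every solution of the
Baouendi–Grushin equation on `[0,T]` satisfies the observability inequality from `ω × Ω̃`. -/
theorem statement0
    (d dt : ℕ) (hd : 2 ≤ d) (hdt : 1 ≤ dt) (R : ℝ) (hR : 0 < R)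
    (Ωt : Set (EuclideanSpace ℝ (Fin dt))) (hΩo : IsOpen Ωt)
    (hΩb : Bornology.IsBounded Ωt) (hΩne : Ωt.Nonempty)
    (ω : Set (EuclideanSpace ℝ (Fin d))) (hωo : IsOpen ω) (hωne : ω.Nonempty)
    (hωsub : ω ⊆ ball (0 : EuclideanSpace ℝ (Fin d)) R)
    (T : ℝ)
    (hT : sInf ((fun x : EuclideanSpace ℝ (Fin d) => ‖x‖ ^ 2) '' ω) / (2 * d) < T) :
    ∃ K : ℝ, 0 < K ∧
      ∀ y : ℝ → EuclideanSpace ℝ (Fin d) → EuclideanSpace ℝ (Fin dt) → ℝ,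
        IsGrushinSolution d dt R T Ωt y →
        (∫ x in ball (0 : EuclideanSpace ℝ (Fin d)) R, ∫ z in Ωt, (y T x z) ^ 2) ≤
          K ^ 2 * ∫ t in Ioc (0:ℝ) T, ∫ x in ω, ∫ z in Ωt, (y t x z) ^ 2 := by
  obtain ⟨hT0, x₀, hx₀, h0, hlt⟩ := Grushin.exists_ne_zero_mem_of_sInf_lt hd hωo hωne hT
  obtain ⟨r, hr, hrω⟩ := Metric.isOpen_iff.1 hωo x₀ hx₀
  have hxR : ‖x₀‖ < R := by simpa using hωsub hx₀
  obtain ⟨K, hK, hobs⟩ := Grushin.fiber_observability (e := dt) hd h0 hxR hr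
    (hrω.trans hωsub) hlt
  obtain ⟨ι, φ, Φ, μ, B⟩ := Grushin.exists_eigenbasis hΩb hΩo 0
  rw [zero_pow two_ne_zero] at B
  refine ⟨Real.sqrt K, Real.sqrt_pos.2 hK, fun y hy => ?_⟩
  rw [Real.sq_sqrt hK.le, ← intervalIntegral.integral_of_le hT0.le]
  refine Grushin.integral_energy_le_of_sum_le ⟨hT0.le, le_rfl⟩ hΩo hΩb hy B fun F => ?_
  refine (Finset.sum_le_sum fun k _ => hobs hΩo hΩb hy (B.nonneg k) (B.h10 k) (B.weak k)).trans ?_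
  rw [← Finset.mul_sum]
  refine mul_le_mul_of_nonneg_left ?_ hK.le
  have hc : ∀ k ∈ F, IntervalIntegrable (fun t => ∫ x in ball x₀ r,
      Grushin.fiberCoeff R Ωt (φ k) (y t) x ^ 2) volume 0 T := fun k _ =>
    (Grushin.continuousOn_setIntegral_fiberCoeff_sq hΩo hΩb hy (B.h10 k).memf isOpen_ball
      (hrω.trans hωsub)).intervalIntegrable_of_Icc hT0.le
  rw [← intervalIntegral.integral_finsetSum hc]
  refine intervalIntegral.integral_mono_on hT0.le (by
      simpa only [Finset.sum_fn] using IntervalIntegrable.sum F hc)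
    (Grushin.intervalIntegrable_energy hT0.le hΩo hΩb hy hωo hωsub) fun t ht => ?_
  refine (Grushin.sum_integral_fiberCoeff_sq_le ht hΩo hΩb hy B isOpen_ball
    (hrω.trans hωsub) F).trans ?_
  exact setIntegral_mono_set ((Grushin.integrableOn_energy ht hΩo hΩb hy).mono_set hωsub)
    (Eventually.of_forall fun x => integral_nonneg fun z => sq_nonneg _)
    (LE.le.eventuallyLE hrω)
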